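/- The boundary of the Mandelbrot set has Hausdorff dimension 2: if M = {c ∈ ℂ : the orbit of 0 under f_c(z) = z² + c is bounded}, then the topological frontier ∂M of M satisfies dim_H(∂M) = 2. (Shishikura's theorem.) -/

import Mathlib

open Complex Metric Set Filter Topology

namespace Mand

lemma simplyConn_of_star {U : Set ℂ} {x : ℂ} (h : StarConvex ℝ x U) (hx : x ∈ U) :
    IsSimplyConnected U := by
  have := h.contractibleSpace ⟨x, hx⟩
  have : SimplyConnectedSpace U := inferInstance
  exact this

lemma exists_log {U : Set ℂ} (hU : IsSimplyConnected U) (ho : IsOpen U) {g : ℂ → ℂ}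
    (hg : DifferentiableOn ℂ g U) (h0 : ∀ z ∈ U, g z ≠ 0) {z0 w0 : ℂ} (hz0 : z0 ∈ U)
    (hw0 : exp w0 = g z0) :
    ∃ f : ℂ → ℂ, DifferentiableOn ℂ f U ∧ (∀ z ∈ U, exp (f z) = g z) ∧ f z0 = w0 := by
  obtain ⟨f, hfc, hf⟩ := exists_continuousOn_eqOn_exp_comp hU ho hg.continuousOn
    (by rintro ⟨z, hz, h⟩; exact h0 z hz h)
  have hf' : ∀ z ∈ U, exp (f z) = g z := fun z hz => hf hz
  have hd : DifferentiableOn ℂ f U := by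
    intro a ha
    have hc : ContinuousAt f a := hfc.continuousAt (ho.mem_nhds ha)
    have hga : DifferentiableAt ℂ g a := hg.differentiableAt (ho.mem_nhds ha)
    have h1 : ∀ᶠ z in 𝓝 a, f z = f a + log (g z / g a) := by
      have h2 : ∀ᶠ z in 𝓝 a, ‖f z - f a‖ < 1 := by
        have := Metric.continuousAt_iff'.1 hc 1 one_pos
        simpa [dist_eq_norm] using this
      filter_upwards [h2, ho.mem_nhds ha] with z hz hzU
      rw [← hf' z hzU, ← hf' a ha, ← exp_sub, log_exp]
      · ring
      · have := (abs_le.1 ((abs_im_le_norm (f z - f a)).trans hz.le)).1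
        linarith [Real.pi_gt_three]
      · have := (abs_le.1 ((abs_im_le_norm (f z - f a)).trans hz.le)).2
        linarith [Real.pi_gt_three]
    have h3 : DifferentiableAt ℂ (fun z => f a + log (g z / g a)) a := by
      refine (DifferentiableAt.clog (hga.div_const _) ?_).const_add _
      rw [div_self (h0 a ha)]; simp
    exact (h3.congr_of_eventuallyEq h1).differentiableWithinAt
  refine ⟨fun z => f z + (w0 - f z0), hd.add_const _, fun z hz => ?_, by ring⟩
  rw [exp_add, exp_sub, hw0, hf' z hz, hf' z0 hz0, div_self (h0 z0 hz0), mul_one]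

lemma exists_sqrt {U : Set ℂ} (hU : IsSimplyConnected U) (ho : IsOpen U) {g : ℂ → ℂ}
    (hg : DifferentiableOn ℂ g U) (h0 : ∀ z ∈ U, g z ≠ 0) {z0 w0 : ℂ} (hz0 : z0 ∈ U)
    (hw0 : w0 ^ 2 = g z0) :
    ∃ f : ℂ → ℂ, DifferentiableOn ℂ f U ∧ (∀ z ∈ U, f z ^ 2 = g z) ∧ f z0 = w0 := by
  have hw : w0 ≠ 0 := by
    rintro rfl; exact h0 z0 hz0 (by rw [← hw0]; ring)
  obtain ⟨f, hf, he, hb⟩ := exists_log hU ho hg h0 hz0 (w0 := 2 * log w0) (by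
    rw [two_mul, exp_add, exp_log hw, ← hw0]; ring)
  refine ⟨fun z => exp (f z / 2), (hf.div_const _).cexp, fun z hz => ?_, ?_⟩
  · rw [← he z hz, sq, ← exp_add]; ring_nf
  · simp only [hb]; rw [mul_div_cancel_left₀ _ two_ne_zero, exp_log hw]

lemma exists_zero {H : ℂ → ℂ} {c : ℂ} {r : ℝ} (hr : 0 < r) (hH : DiffContOnCl ℂ H (ball c r))
    (h : ∀ z ∈ sphere c r, ‖H c‖ < ‖H z‖) : ∃ z ∈ ball c r, H z = 0 := by
  by_contra! hn
  have hcl : closure (ball c r) = closedBall c r := closure_ball c hr.ne'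
  have hne : ∀ z ∈ closure (ball c r), H z ≠ 0 := by
    rw [hcl]
    intro z hz
    rcases (mem_closedBall.1 hz).lt_or_eq with h1 | h1
    · exact hn z h1
    · have := h z h1
      intro h2
      rw [h2, norm_zero] at this
      exact absurd this (not_lt.2 (norm_nonneg _))
  obtain ⟨z, hz, hmax⟩ := exists_mem_frontier_isMaxOn_norm isBounded_ball ⟨c, mem_ball_self hr⟩
    (hH.inv hne)
  rw [frontier_ball c hr.ne'] at hz
  have h1 := hmax (subset_closure (mem_ball_self hr : c ∈ ball c r))
  simp only [Function.comp, Pi.inv_apply, norm_inv, mem_setOf_eq] at h1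
  have h2 : 0 < ‖H c‖ := norm_pos_iff.2 (hn c (mem_ball_self hr))
  have h3 := h z hz
  exact absurd h1 (not_le.2 (inv_strictAnti₀ h2 h3))

/-- Crude Taylor estimate from a bound on the derivative. -/
lemma taylor_of_deriv_bound {G : ℂ → ℂ} {a : ℂ} {ρ A : ℝ} (hρ : 0 < ρ)
    (hG : DifferentiableOn ℂ G (ball a ρ))
    (hb : ∀ z ∈ ball a ρ, ‖deriv G z - deriv G a‖ ≤ A) {z : ℂ} (hz : z ∈ ball a ρ) :
    ‖G z - G a - deriv G a * (z - a)‖ ≤ A / ρ * ‖z - a‖ ^ 2 := by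
  have hd : DifferentiableOn ℂ (deriv G) (ball a ρ) := hG.deriv isOpen_ball
  have hz' : ‖z - a‖ < ρ := by simpa [dist_eq_norm] using hz
  have hA : 0 ≤ A := (norm_nonneg _).trans (hb a (mem_ball_self hρ))
  have h1 : ∀ w ∈ ball a ρ, ‖deriv G w - deriv G a‖ ≤ A / ρ * ‖w - a‖ := by
    intro w hw
    have := dist_le_div_mul_dist_of_mapsTo_ball hd (R₂ := A) (fun u hu => by
      rw [mem_closedBall, dist_eq_norm]; exact hb u hu) hw
    simpa [dist_eq_norm] using this
  have hsub : closedBall a ‖z - a‖ ⊆ ball a ρ := closedBall_subset_ball hz'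
  have h2 := Convex.norm_image_sub_le_of_norm_deriv_le (𝕜 := ℂ)
    (f := fun w => G w - deriv G a * w) (s := closedBall a ‖z - a‖)
    (C := A / ρ * ‖z - a‖) (x := a) (y := z) ?_ ?_ (convex_closedBall _ _)
    (mem_closedBall_self (norm_nonneg _)) (by simp [dist_eq_norm])
  · calc ‖G z - G a - deriv G a * (z - a)‖ = ‖G z - deriv G a * z - (G a - deriv G a * a)‖ := by
          congr 1; ring
      _ ≤ _ := h2
      _ = _ := by ring
  · intro w hw
    exact (hG.differentiableAt (isOpen_ball.mem_nhds (hsub hw))).sub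
      ((differentiableAt_id).const_mul _)
  · intro w hw
    have hw' := hsub hw
    have hGw := hG.differentiableAt (isOpen_ball.mem_nhds hw')
    have : deriv (fun w => G w - deriv G a * w) w = deriv G w - deriv G a := by
      have h := (hGw.hasDerivAt.sub ((hasDerivAt_id w).const_mul (deriv G a))).deriv
      simp only [mul_one] at h
      exact h
    rw [this]
    refine (h1 w hw').trans ?_
    have : ‖w - a‖ ≤ ‖z - a‖ := by simpa [dist_eq_norm] using hw
    gcongr

/-- A quantitative open mapping lemma. -/
lemma cover_of_deriv_bound {G : ℂ → ℂ} {a : ℂ} {ρ A : ℝ} (hρ : 0 < ρ)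
    (hG : DifferentiableOn ℂ G (ball a ρ)) (hA0 : 0 < ‖deriv G a‖)
    (hA : 1 ≤ A)
    (hb : ∀ z ∈ ball a ρ, ‖deriv G z - deriv G a‖ ≤ A * ‖deriv G a‖) :
    ball (G a) (‖deriv G a‖ * ρ / (8 * A)) ⊆ G '' ball a ρ := by
  intro w hw
  set s := ρ / (2 * A) with hs
  have hs0 : 0 < s := by positivity
  have hsρ : s < ρ := by
    rw [hs, div_lt_iff₀ (by positivity)]; nlinarith
  have hsub : closedBall a s ⊆ ball a ρ := closedBall_subset_ball hsρ
  have hw' : ‖w - G a‖ < ‖deriv G a‖ * ρ / (8 * A) := by simpa [dist_eq_norm] using hw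
  have := exists_zero (H := fun z => G z - w) hs0
    (DifferentiableOn.diffContOnCl (by
      rw [closure_ball a hs0.ne']
      exact (hG.mono hsub).sub_const _)) ?_
  · obtain ⟨z, hz, hz2⟩ := this
    exact ⟨z, hsub (ball_subset_closedBall hz), sub_eq_zero.1 hz2⟩
  · intro z hz
    have hzs : ‖z - a‖ = s := by simpa [dist_eq_norm] using hz
    have hT := taylor_of_deriv_bound hρ hG hb (hsub (sphere_subset_closedBall hz))
    rw [hzs] at hT
    have h3 : ‖deriv G a * (z - a)‖ = ‖deriv G a‖ * s := by rw [norm_mul, hzs]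
    have h4 : ‖deriv G a * (z - a)‖ ≤ ‖G z - w‖ + ‖w - G a‖ + ‖G z - G a - deriv G a * (z - a)‖ := by
      have : deriv G a * (z - a) = (G z - w) + (w - G a) - (G z - G a - deriv G a * (z - a)) := by
        ring
      calc _ = ‖(G z - w) + (w - G a) - (G z - G a - deriv G a * (z - a))‖ := by rw [← this]
        _ ≤ _ := (norm_sub_le _ _).trans (by gcongr; exact norm_add_le _ _)
    have h5 : A * ‖deriv G a‖ / ρ * s ^ 2 = ‖deriv G a‖ * ρ / (4 * A) := by
      rw [hs]; field_simp; ring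
    have h6 : ‖deriv G a‖ * s = ‖deriv G a‖ * ρ / (2 * A) := by rw [hs]; ring
    have h7 : ‖deriv G a‖ * ρ / (2 * A) = 4 * (‖deriv G a‖ * ρ / (8 * A)) := by
      field_simp; ring
    have h8 : ‖deriv G a‖ * ρ / (4 * A) = 2 * (‖deriv G a‖ * ρ / (8 * A)) := by
      field_simp; ring
    rw [norm_sub_rev (G a) w]
    linarith

lemma bloch {G : ℂ → ℂ} {c : ℂ} {r R : ℝ} (hr : 0 < r) (hR : 0 < R)
    (hG : DifferentiableOn ℂ G (ball c r)) (hn : ∀ w, ¬ ball w R ⊆ G '' ball c r) :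
    ‖deriv G c‖ ≤ 100 * R / r := by
  have hr2 : 0 < r / 2 := by positivity
  have hsub : closedBall c (r / 2) ⊆ ball c r := closedBall_subset_ball (by linarith)
  have hd : DifferentiableOn ℂ (deriv G) (ball c r) := hG.deriv isOpen_ball
  obtain ⟨a, ha, hmax⟩ := (isCompact_closedBall c (r / 2)).exists_isMaxOn
    ⟨c, mem_closedBall_self hr2.le⟩ (f := fun z => (r / 2 - ‖z - c‖) * ‖deriv G z‖) (by
      refine ContinuousOn.mul (by fun_prop) ((hd.continuousOn.mono hsub).norm))
  have hmax' : ∀ z ∈ closedBall c (r / 2), (r / 2 - ‖z - c‖) * ‖deriv G z‖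
    ≤ (r / 2 - ‖a - c‖) * ‖deriv G a‖ := fun z hz => hmax hz
  have hc := hmax' c (mem_closedBall_self hr2.le)
  simp only [sub_self, norm_zero, sub_zero] at hc
  rcases (norm_nonneg (deriv G c)).eq_or_lt with h0 | h0
  · rw [← h0]; positivity
  have hpos : 0 < (r / 2 - ‖a - c‖) * ‖deriv G a‖ := lt_of_lt_of_le (by positivity) hc
  have hA : 0 < ‖deriv G a‖ := by
    rcases (norm_nonneg (deriv G a)).eq_or_lt with h | h
    · rw [← h] at hpos; simp at hpos
    · exact h
  have hρ : 0 < r / 2 - ‖a - c‖ := by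
    by_contra h; push Not at h
    nlinarith
  set ρ := (r / 2 - ‖a - c‖) / 2 with hρd
  have hρ0 : 0 < ρ := by positivity
  have hball : ball a ρ ⊆ closedBall c (r / 2) := by
    intro z hz
    rw [mem_ball, dist_eq_norm] at hz
    rw [mem_closedBall, dist_eq_norm]
    have : ‖z - c‖ ≤ ‖z - a‖ + ‖a - c‖ := norm_sub_le_norm_sub_add_norm_sub z a c
    linarith
  have hcov := cover_of_deriv_bound (A := 3) hρ0 (hG.mono (hball.trans hsub)) hA (by norm_num) (by
    intro z hz
    have h1 := hmax' z (hball hz)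
    rw [mem_ball, dist_eq_norm] at hz
    have h2 : ‖z - c‖ ≤ ‖z - a‖ + ‖a - c‖ := norm_sub_le_norm_sub_add_norm_sub z a c
    have h3 : ρ ≤ r / 2 - ‖z - c‖ := by linarith
    have h4 : ρ * ‖deriv G z‖ ≤ 2 * ρ * ‖deriv G a‖ := by
      calc ρ * ‖deriv G z‖ ≤ (r / 2 - ‖z - c‖) * ‖deriv G z‖ := by gcongr
        _ ≤ _ := h1
        _ = _ := by rw [hρd]; ring
    have h5 : ‖deriv G z‖ ≤ 2 * ‖deriv G a‖ := by
      by_contra h; push Not at h; nlinarith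
    linarith [norm_sub_le (deriv G z) (deriv G a)])
  have hlt : ‖deriv G a‖ * ρ / (8 * 3) < R := by
    by_contra h; push Not at h
    exact hn (G a) ((ball_subset_ball h).trans (hcov.trans (image_mono (hball.trans hsub))))
  rw [le_div_iff₀ hr]
  have : (r / 2 - ‖a - c‖) * ‖deriv G a‖ = 2 * (‖deriv G a‖ * ρ) := by rw [hρd]; ring
  rw [this] at hc
  nlinarith

end Mand

open Complex Metric Set Filter Topology

namespace Mand

lemma cosh_net (w : ℂ) : ∃ p ∈ ball w 2, ∃ n : ℤ, cosh p ^ 2 = n := by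
  obtain ⟨x', hx', n, hn⟩ : ∃ x' : ℝ, |w.re - x'| ≤ 1 ∧ ∃ n : ℤ, Real.cosh x' ^ 2 = n := by
    have key : ∀ x : ℝ, 0 ≤ x → ∃ y ∈ Icc x (x + 1), ∃ n : ℤ, Real.cosh y ^ 2 = n := by
      intro x hx
      have h1 : Real.cosh x ^ 2 + 1 ≤ Real.cosh (x + 1) ^ 2 := by
        have e1 : Real.cosh (x + 1) = Real.cosh x * Real.cosh 1 + Real.sinh x * Real.sinh 1 :=
          Real.cosh_add x 1
        have e2 : 1 ≤ Real.sinh 1 := by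
          simp
        have e3 := Real.cosh_sq 1
        have e4 : 0 ≤ Real.sinh x := Real.sinh_nonneg_iff.2 hx
        have e5 := Real.one_le_cosh x
        have e6 := Real.one_le_cosh 1
        rw [e1]
        have h7 : 0 ≤ Real.cosh x * Real.cosh 1 * (Real.sinh x * Real.sinh 1) := by positivity
        have h8 : 2 ≤ Real.cosh 1 ^ 2 := by nlinarith
        nlinarith [sq_nonneg (Real.sinh x * Real.sinh 1), mul_le_mul_of_nonneg_left h8 (sq_nonneg (Real.cosh x))]
      have hc : ContinuousOn (fun y => Real.cosh y ^ 2) (Icc x (x + 1)) := by fun_prop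
      obtain ⟨y, hy, hy2⟩ := intermediate_value_Icc (by linarith) hc
        (show (⌈Real.cosh x ^ 2⌉ : ℝ) ∈ _ from
        ⟨Int.le_ceil _, (Int.ceil_lt_add_one _).le.trans h1⟩)
      exact ⟨y, hy, _, hy2⟩
    rcases le_total 0 w.re with h | h
    · obtain ⟨y, hy, n, hn⟩ := key _ h
      exact ⟨y, by rw [abs_le]; constructor <;> linarith [hy.1, hy.2], n, hn⟩
    · obtain ⟨y, hy, n, hn⟩ := key (-w.re) (by linarith)
      exact ⟨-y, by rw [abs_le]; constructor <;> linarith [hy.1, hy.2], n, by rwa [Real.cosh_neg]⟩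
  set m : ℤ := round (w.im / Real.pi) with hm
  have hmm : |w.im - m * Real.pi| ≤ Real.pi / 2 := by
    have h1 := abs_sub_round (w.im / Real.pi)
    rw [← hm] at h1
    have h2 : w.im - m * Real.pi = (w.im / Real.pi - m) * Real.pi := by
      field_simp
    rw [h2, abs_mul, abs_of_pos Real.pi_pos]
    nlinarith [Real.pi_pos]
  refine ⟨x' + m * Real.pi * I, ?_, n, ?_⟩
  · rw [mem_ball, dist_comm, dist_eq_norm, ← sq_lt_sq₀ (norm_nonneg _) (by norm_num),
      ← normSq_eq_norm_sq, normSq_apply]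
    simp only [sub_re, add_re, ofReal_re, mul_re, intCast_re, intCast_im, ofReal_im, I_re, I_im,
      mul_im, sub_im, add_im]
    ring_nf
    have h3 := Real.pi_lt_d2
    have h4 : (w.im - m * Real.pi) ^ 2 ≤ (Real.pi / 2) ^ 2 := sq_le_sq' (by linarith [(abs_le.1 hmm).1]) (abs_le.1 hmm).2
    have h5 : (w.re - x') ^ 2 ≤ 1 := by
      have := (sq_le_sq' (by linarith [(abs_le.1 hx').1]) (abs_le.1 hx').2); simpa using this
    have h6 : (Real.pi / 2) ^ 2 < 3 := by nlinarith [Real.pi_pos]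
    nlinarith
  · have h1 : cosh (m * Real.pi * I) = cos (m * Real.pi) := by rw [cosh_mul_I]
    have h2 : sinh (m * Real.pi * I) = 0 := by
      rw [sinh_mul_I]
      have := Complex.sin_int_mul_pi m
      rw [this, zero_mul]
    rw [cosh_add, h2, mul_zero, add_zero, h1, mul_pow]
    have h3 : cos (m * Real.pi) ^ 2 = 1 := by
      have := Complex.sin_sq_add_cos_sq (m * Real.pi)
      rw [Complex.sin_int_mul_pi m] at this; simpa using this
    rw [h3, mul_one, ← ofReal_cosh, ← ofReal_pow, hn]; simp

lemma norm_cosh_le (z : ℂ) : ‖cosh z‖ ≤ Real.exp ‖z‖ := by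
  rw [Complex.cosh]
  have h1 := norm_exp_le_exp_norm z
  have h2 := norm_exp_le_exp_norm (-z)
  rw [norm_neg] at h2
  rw [norm_div, Complex.norm_ofNat]
  have := norm_add_le (exp z) (exp (-z))
  linarith

lemma schottky (g0 : ℂ) (h0 : g0 ≠ 0) (h1 : g0 ≠ 1) : ∃ C : ℝ, 0 < C ∧ ∀ (g : ℂ → ℂ) (c : ℂ) (r : ℝ),
    0 < r → DifferentiableOn ℂ g (ball c r) → (∀ z ∈ ball c r, g z ≠ 0 ∧ g z ≠ 1) → g c = g0 →
    ∀ z ∈ ball c (r / 2), ‖g z‖ ≤ C := by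
  have h2pi : (2 * Real.pi * I : ℂ) ≠ 0 := two_pi_I_ne_zero
  set A0 : ℂ := log g0 / (2 * Real.pi * I) with hA0
  have hA0e : exp (2 * Real.pi * I * A0) = g0 := by
    rw [hA0, mul_div_cancel₀ _ h2pi, exp_log h0]
  obtain ⟨s0, hs0⟩ : ∃ s : ℂ, s ^ 2 = A0 := ⟨A0 ^ (1 / 2 : ℂ), by
    rw [← cpow_mul_nat]; simp⟩
  obtain ⟨t0, ht0⟩ : ∃ s : ℂ, s ^ 2 = A0 - 1 := ⟨(A0 - 1) ^ (1 / 2 : ℂ), by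
    rw [← cpow_mul_nat]; simp⟩
  have hu0 : (s0 - t0) * (s0 + t0) = 1 := by linear_combination hs0 - ht0
  have hu : s0 - t0 ≠ 0 := left_ne_zero_of_mul_eq_one hu0
  set G0 : ℂ := log (s0 - t0)
  refine ⟨Real.exp (2 * Real.pi * (Real.exp (‖G0‖ + 400)) ^ 2), Real.exp_pos _, ?_⟩
  intro g c r hr hg hom hgc z hz
  have hUs : IsSimplyConnected (ball c r) :=
    simplyConn_of_star ((convex_ball c r).starConvex (mem_ball_self hr)) (mem_ball_self hr)
  have hcm : c ∈ ball c r := mem_ball_self hr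
  obtain ⟨f, hf, hfe, hfc⟩ := exists_log hUs isOpen_ball hg (fun z hz => (hom z hz).1) hcm
    (w0 := log g0) (by rw [exp_log h0, hgc])
  set A : ℂ → ℂ := fun z => f z / (2 * Real.pi * I) with hA
  have hAd : DifferentiableOn ℂ A (ball c r) := hf.div_const _
  have hAe : ∀ z ∈ ball c r, exp (2 * Real.pi * I * A z) = g z := fun z hz => by
    rw [hA, mul_div_cancel₀ _ h2pi, hfe z hz]
  have hAn : ∀ z ∈ ball c r, ∀ n : ℤ, A z ≠ n := by
    intro z hz n hn
    have := hAe z hz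
    rw [hn] at this
    apply (hom z hz).2
    rw [← this, mul_comm, exp_int_mul_two_pi_mul_I]
  have hAc : A c = A0 := by simp only [hA, hA0, hfc]
  obtain ⟨s, hs, hs2, hsc⟩ := exists_sqrt hUs isOpen_ball hAd
    (fun z hz => by simpa using hAn z hz 0) hcm (w0 := s0) (by rw [hs0, hAc])
  obtain ⟨t, ht, ht2, htc⟩ := exists_sqrt hUs isOpen_ball (hAd.sub_const 1)
    (fun z hz => sub_ne_zero.2 (by simpa using hAn z hz 1)) hcm (w0 := t0) (by rw [ht0, hAc])
  have hst : ∀ z ∈ ball c r, (s z - t z) * (s z + t z) = 1 := fun z hz => by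
    linear_combination hs2 z hz - ht2 z hz
  obtain ⟨G, hG, hGe, hGc⟩ := exists_log hUs isOpen_ball (hs.sub ht)
    (fun z hz => left_ne_zero_of_mul_eq_one (hst z hz)) hcm
    (w0 := G0) (by simp only [Pi.sub_apply]; rw [hsc, htc, exp_log hu])
  have hcosh : ∀ z ∈ ball c r, cosh (G z) ^ 2 = A z := by
    intro z hz
    have e1 : exp (G z) = s z - t z := hGe z hz
    have e2 : exp (-G z) = s z + t z := by
      rw [exp_neg, e1]; exact inv_eq_of_mul_eq_one_right (hst z hz)
    rw [Complex.cosh, e1, e2, ← hs2 z hz]; ring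
  have hnb : ∀ z ∈ ball c (r / 2), ‖deriv G z‖ ≤ 800 / r := by
    intro z hz
    have hsub : ball z (r / 2) ⊆ ball c r := by
      intro y hy
      rw [mem_ball] at *
      linarith [dist_triangle y z c]
    have := bloch (G := G) (c := z) (r := r / 2) (R := 2) (by positivity) (by norm_num) (hG.mono hsub) (by
      intro w hw
      obtain ⟨p, hp, n, hn⟩ := cosh_net w
      obtain ⟨y, hy, hyp⟩ := hw hp
      apply hAn y (hsub hy) n
      rw [← hcosh y (hsub hy), hyp, hn])
    calc _ ≤ _ := this
      _ = 400 / r := by field_simp; ring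
      _ ≤ _ := by gcongr; norm_num
  have hsub2 : ball c (r / 2) ⊆ ball c r := ball_subset_ball (by linarith)
  have hGz : ‖G z‖ ≤ ‖G0‖ + 400 := by
    have := Convex.norm_image_sub_le_of_norm_deriv_le (𝕜 := ℂ) (f := G) (s := ball c (r / 2))
      (fun x hx => hG.differentiableAt (isOpen_ball.mem_nhds (hsub2 hx))) hnb (convex_ball _ _)
      (mem_ball_self (by positivity)) hz
    rw [hGc] at this
    have h3 : ‖z - c‖ ≤ r / 2 := by rw [mem_ball, dist_eq_norm] at hz; exact hz.le
    have h4 : 800 / r * ‖z - c‖ ≤ 400 := by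
      calc 800 / r * ‖z - c‖ ≤ 800 / r * (r / 2) := by gcongr
        _ = 400 := by field_simp; norm_num
    have h5 := norm_sub_norm_le (G z) G0
    linarith
  rw [← hAe z (hsub2 hz)]
  refine (norm_exp_le_exp_norm _).trans (Real.exp_le_exp.2 ?_)
  rw [norm_mul, norm_mul, norm_mul, norm_I, mul_one, Complex.norm_ofNat, norm_real, Real.norm_of_nonneg Real.pi_pos.le,
    ← hcosh z (hsub2 hz), norm_pow]
  gcongr
  exact (norm_cosh_le _).trans (Real.exp_le_exp.2 hGz)

end Mand

open Complex Metric Set Filter Topology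

namespace Mand

/-- Univalent holomorphic map with non-vanishing derivative. -/
structure Uni (H : ℂ → ℂ) (U : Set ℂ) : Prop where
  d : DifferentiableOn ℂ H U
  inj : InjOn H U
  ne : ∀ z ∈ U, deriv H z ≠ 0

lemma Uni.mono {H : ℂ → ℂ} {U V : Set ℂ} (h : Uni H U) (hV : V ⊆ U) : Uni H V :=
  ⟨h.d.mono hV, h.inj.mono hV, fun z hz => h.ne z (hV hz)⟩

lemma koebe_normalized : ∃ M : ℝ, 1 ≤ M ∧ ∀ g : ℂ → ℂ, Uni g (ball 0 1) → g 0 = 0 → deriv g 0 = 1 →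
    ∀ z ∈ ball (0 : ℂ) (1 / 4), ‖g z‖ ≤ M := by
  obtain ⟨C, hC, hS⟩ := schottky (-1) (by norm_num) (by norm_num)
  refine ⟨1 + C ^ 2, by nlinarith [sq_nonneg C], ?_⟩
  intro g hg g0 g1 z hz
  have h01 : (0 : ℂ) ∈ ball (0 : ℂ) 1 := mem_ball_self one_pos
  have hgz : ∀ z ∈ ball (0 : ℂ) 1, g z = 0 → z = 0 := fun z hz h =>
    hg.inj hz h01 (by rw [h, g0])
  set h := dslope g 0 with hh
  have hd : DifferentiableOn ℂ h (ball 0 1) :=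
    (differentiableOn_dslope (isOpen_ball.mem_nhds h01)).2 hg.d
  have hgh : ∀ z, g z = z * h z := fun z => by
    have := sub_smul_dslope g 0 z
    simp only [sub_zero, g0, smul_eq_mul] at this
    rw [hh, this]
  have h0 : h 0 = 1 := by rw [hh, dslope_same, g1]
  have hz0 : ∀ z ∈ ball (0 : ℂ) 1, h z ≠ 0 := by
    intro z hz h1
    have := hgz z hz (by rw [hgh, h1, mul_zero])
    rw [this, h0] at h1
    exact one_ne_zero h1
  have hsub : closedBall (0 : ℂ) (9 / 10) ⊆ ball 0 1 := closedBall_subset_ball (by norm_num)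
  obtain ⟨z1, hz1, hz1n⟩ : ∃ z ∈ sphere (0 : ℂ) (9 / 10), ‖h z‖ ≤ ‖h 0‖ := by
    by_contra! hcon
    obtain ⟨w, hw, hw0⟩ := exists_zero (H := h) (c := 0) (r := 9 / 10) (by norm_num)
      (DifferentiableOn.diffContOnCl (by
        rw [closure_ball _ (by norm_num)]; exact hd.mono hsub)) hcon
    exact hz0 w (hsub (ball_subset_closedBall hw)) hw0
  have hz1b := hsub (sphere_subset_closedBall hz1)
  have hz1' : ‖z1‖ = 9 / 10 := by simpa using hz1
  set a := g z1 with ha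
  have ha0 : a ≠ 0 := by
    intro h1
    have := hgz z1 hz1b h1
    rw [this] at hz1'; norm_num at hz1'
  have ha1 : ‖a‖ ≤ 1 := by
    rw [ha, hgh, norm_mul, hz1']
    rw [h0, norm_one] at hz1n; linarith
  have hbs : ball (0 : ℂ) (9 / 10) ⊆ ball 0 1 := ball_subset_ball (by norm_num)
  have h09 : (0 : ℂ) ∈ ball (0 : ℂ) (9 / 10) := mem_ball_self (by norm_num)
  obtain ⟨s, hs, hs2, hs0⟩ := exists_sqrt (U := ball 0 (9 / 10)) (g := fun z => 1 - g z / a)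
    (z0 := 0) (w0 := 1)
    (simplyConn_of_star ((convex_ball _ _).starConvex h09) h09)
    isOpen_ball (((hg.d.mono hbs).div_const a).const_sub 1) (by
      intro z hz h1
      have h2 : g z = a := by
        rw [sub_eq_zero, eq_div_iff ha0] at h1; rw [← h1, one_mul]
      have := hg.inj (hbs hz) hz1b h2
      rw [mem_ball, dist_zero_right, this, hz1'] at hz
      exact lt_irrefl _ hz) h09 (by simp [g0])
  have hb := hS (fun z => -s z) 0 (9 / 10) (by norm_num) hs.neg (by
    intro z hz
    constructor
    · intro h1
      have h2 : s z = 0 := neg_eq_zero.1 h1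
      have h3 := hs2 z hz
      rw [h2] at h3
      have h4 : g z = a := by
        have : g z / a = 1 := by linear_combination h3
        rwa [div_eq_one_iff_eq ha0] at this
      have := hg.inj (hbs hz) hz1b h4
      rw [mem_ball, dist_zero_right, this, hz1'] at hz
      exact lt_irrefl _ hz
    · intro h1
      have h2 : s z = -1 := by linear_combination -h1
      have h3 := hs2 z hz
      rw [h2] at h3
      have h4 : g z = 0 := by
        have : g z / a = 0 := by linear_combination h3
        exact (div_eq_zero_iff.1 this).resolve_right ha0
      have := hgz z (hbs hz) h4
      rw [this, hs0] at h2; norm_num at h2) (by simp [hs0]) z (ball_subset_ball (by norm_num) hz)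
  have hzb : z ∈ ball (0 : ℂ) (9 / 10) := ball_subset_ball (by norm_num) hz
  have h5 : g z = a * (1 - s z ^ 2) := by
    rw [hs2 z hzb]; field_simp; ring
  rw [norm_neg] at hb
  rw [h5, norm_mul]
  calc ‖a‖ * ‖1 - s z ^ 2‖ ≤ 1 * (1 + C ^ 2) := by
        gcongr
        refine (norm_sub_le _ _).trans ?_
        rw [norm_one, norm_pow]; gcongr
    _ = _ := one_mul _

lemma koebe_bound : ∃ M : ℝ, 1 ≤ M ∧ ∀ (H : ℂ → ℂ) (a : ℂ) (r : ℝ), 0 < r → Uni H (ball a r) →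
    ∀ z ∈ ball a (r / 4), ‖H z - H a‖ ≤ M * r * ‖deriv H a‖ := by
  obtain ⟨M, hM, hK⟩ := koebe_normalized
  refine ⟨M, hM, ?_⟩
  intro H a r hr hH z hz
  have hne := hH.ne a (mem_ball_self hr)
  have hrc : (r : ℂ) ≠ 0 := by exact_mod_cast hr.ne'
  set g : ℂ → ℂ := fun w => (H (a + r * w) - H a) / (r * deriv H a) with hg
  have hmap : ∀ w ∈ ball (0 : ℂ) 1, a + r * w ∈ ball a r := by
    intro w hw
    rw [mem_ball, dist_zero_right] at hw
    rw [mem_ball, dist_eq_norm, add_sub_cancel_left, norm_mul, norm_real, Real.norm_of_nonneg hr.le]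
    nlinarith
  have hder : ∀ w ∈ ball (0 : ℂ) 1, HasDerivAt g (deriv H (a + r * w) / deriv H a) w := by
    intro w hw
    have h1 := (hH.d.differentiableAt (isOpen_ball.mem_nhds (hmap w hw))).hasDerivAt
    have h2 : HasDerivAt (fun w : ℂ => a + r * w) r w := by
      simpa using ((hasDerivAt_id w).const_mul (r : ℂ)).const_add a
    have h3 := ((h1.comp w h2).sub_const (H a)).div_const (r * deriv H a)
    rw [mul_comm (deriv H (a + r * w)), mul_div_mul_left _ _ hrc] at h3
    exact h3
  have hU : Uni g (ball 0 1) := by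
    refine ⟨fun w hw => (hder w hw).differentiableAt.differentiableWithinAt, ?_, ?_⟩
    · intro x hx y hy hxy
      have h1 : H (a + r * x) = H (a + r * y) := by
        simp only [hg] at hxy
        rw [div_left_inj' (mul_ne_zero hrc hne)] at hxy
        exact sub_left_injective hxy
      have := hH.inj (hmap x hx) (hmap y hy) h1
      exact mul_left_cancel₀ hrc (add_left_cancel this)
    · intro w hw
      rw [(hder w hw).deriv]
      exact div_ne_zero (hH.ne _ (hmap w hw)) hne
  have := hK g hU (by simp [hg]) (by
    rw [(hder 0 (mem_ball_self one_pos)).deriv]; simp [hne]) ((z - a) / r) (by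
    rw [mem_ball, dist_zero_right, norm_div, norm_real, Real.norm_of_nonneg hr.le, div_lt_iff₀ hr]
    rw [mem_ball, dist_eq_norm] at hz; linarith)
  simp only [hg] at this
  rw [mul_div_cancel₀ _ hrc, add_sub_cancel, norm_div, norm_mul, norm_real,
    Real.norm_of_nonneg hr.le, div_le_iff₀ (mul_pos hr (norm_pos_iff.2 hne))] at this
  linarith

lemma koebe : ∃ M : ℝ, 1 ≤ M ∧ ∀ (H : ℂ → ℂ) (a : ℂ) (r : ℝ), 0 < r → Uni H (ball a r) →
    (∀ z ∈ ball a (r / 16), ‖deriv H z‖ ≤ M * ‖deriv H a‖ ∧ ‖deriv H a‖ ≤ M * ‖deriv H z‖ ∧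
      ‖H z - H a - deriv H a * (z - a)‖ ≤ M / r * ‖deriv H a‖ * ‖z - a‖ ^ 2 ∧
      ‖H z - H a‖ ≤ M * ‖deriv H a‖ * ‖z - a‖) ∧
    ball (H a) (r * ‖deriv H a‖ / M) ⊆ H '' ball a r := by
  obtain ⟨M, hM, hK⟩ := koebe_bound
  have key : ∀ (H : ℂ → ℂ) (a : ℂ) (r : ℝ), 0 < r → Uni H (ball a r) →
      ∀ z ∈ ball a (r / 8), ‖deriv H z‖ ≤ 16 * M * ‖deriv H a‖ := by
    intro H a r hr hH z hz
    have hsub : ball z (r / 8) ⊆ ball a (r / 4) := by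
      intro y hy; rw [mem_ball] at *; linarith [dist_triangle y z a]
    have hz4 : z ∈ ball a (r / 4) := hsub (mem_ball_self (by positivity))
    have := norm_deriv_le_div_of_mapsTo_ball (f := H) (c := z) (R₁ := r / 8)
      (R₂ := 2 * (M * r * ‖deriv H a‖))
      (hH.d.mono (hsub.trans (ball_subset_ball (by linarith)))) (by
        intro y hy
        rw [mem_closedBall, dist_eq_norm]
        have h1 := hK H a r hr hH y (hsub hy)
        have h2 := hK H a r hr hH z hz4
        have h3 := norm_sub_le (H y - H a) (H z - H a)
        rw [sub_sub_sub_cancel_right] at h3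
        linarith) (by positivity)
    calc _ ≤ _ := this
      _ = _ := by field_simp; ring
  refine ⟨1088 * M, by linarith, ?_⟩
  intro H a r hr hH
  have hM0 : 0 < M := by linarith
  have hder8 : ∀ z ∈ ball a (r / 8), ‖deriv H z - deriv H a‖ ≤ 17 * M * ‖deriv H a‖ := by
    intro z hz
    have := key H a r hr hH z hz
    have h1 := norm_sub_le (deriv H z) (deriv H a)
    nlinarith [norm_nonneg (deriv H a)]
  have hH8 := hH.mono (ball_subset_ball (show r / 8 ≤ r by linarith))
  refine ⟨fun z hz => ?_, ?_⟩
  · have hz8 : z ∈ ball a (r / 8) := ball_subset_ball (by linarith) hz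
    have hz' := hz
    rw [mem_ball, dist_eq_norm] at hz'
    refine ⟨?_, ?_, ?_, ?_⟩
    · refine (key H a r hr hH z hz8).trans ?_
      gcongr; norm_num
    · have hs : ball z (r / 2) ⊆ ball a r := by
        intro y hy; rw [mem_ball] at *; linarith [dist_triangle y z a]
      have := key H z (r / 2) (by positivity) (hH.mono hs) a (by
        rw [mem_ball, dist_comm]; rw [mem_ball] at hz; linarith)
      refine this.trans ?_
      gcongr; norm_num
    · have := taylor_of_deriv_bound (by positivity) hH8.d hder8 hz8
      refine this.trans ?_
      have e : 17 * M * ‖deriv H a‖ / (r / 8) = 136 * M / r * ‖deriv H a‖ := by field_simp; ring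
      rw [e]
      gcongr; norm_num
    · have := Convex.norm_image_sub_le_of_norm_deriv_le (𝕜 := ℂ) (f := H) (s := ball a (r / 8))
        (fun x hx => hH8.d.differentiableAt (isOpen_ball.mem_nhds hx)) (key H a r hr hH)
        (convex_ball _ _) (mem_ball_self (by positivity)) hz8
      refine this.trans ?_
      gcongr; norm_num
  · have := cover_of_deriv_bound (by positivity : 0 < r / 8) hH8.d
      (norm_pos_iff.2 (hH.ne a (mem_ball_self hr))) (by linarith : 1 ≤ 17 * M) hder8
    refine (ball_subset_ball (le_of_eq ?_)).trans (this.trans (image_mono (ball_subset_ball (by linarith))))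
    field_simp; ring

/-- Distortion along chains. -/
lemma chain {U : Set ℂ} (ho : IsOpen U) (hc : IsPreconnected U) {a b : ℂ} (ha : a ∈ U) (hb : b ∈ U) :
    ∃ C : ℝ, 1 ≤ C ∧ ∀ H, Uni H U → ‖deriv H b‖ ≤ C * ‖deriv H a‖ ∧ ‖deriv H a‖ ≤ C * ‖deriv H b‖ ∧
      ‖H b - H a‖ ≤ C * ‖deriv H a‖ := by
  obtain ⟨M, hM, hK⟩ := koebe
  have hM0 : 0 ≤ M := by linarith
  refine hc.induction₂' (fun a b => ∃ C : ℝ, 1 ≤ C ∧ ∀ H, Uni H U → ‖deriv H b‖ ≤ C * ‖deriv H a‖ ∧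
    ‖deriv H a‖ ≤ C * ‖deriv H b‖ ∧ ‖H b - H a‖ ≤ C * ‖deriv H a‖) ?_ ?_ ha hb
  · intro x hx
    obtain ⟨r, hr, hrU⟩ := Metric.isOpen_iff.1 ho x hx
    filter_upwards [mem_nhdsWithin_of_mem_nhds (ball_mem_nhds x (show 0 < r / 16 by positivity))]
      with y hy
    have hyr : ‖y - x‖ ≤ r := by rw [mem_ball, dist_eq_norm] at hy; linarith
    have hMr : 0 ≤ M * M * r := by positivity
    have h0 : 1 ≤ M * (1 + r) * M := by nlinarith
    constructor
    · refine ⟨M * (1 + r) * M, h0, fun H hH => ?_⟩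
      obtain ⟨h1, h2, -, h4⟩ := (hK H x r hr (hH.mono hrU)).1 y hy
      have e1 : M ≤ M * (1 + r) * M := by nlinarith
      have e2 : M * r ≤ M * (1 + r) * M := by nlinarith
      refine ⟨h1.trans (by gcongr), h2.trans (by gcongr), h4.trans ?_⟩
      calc M * ‖deriv H x‖ * ‖y - x‖ ≤ M * ‖deriv H x‖ * r := by gcongr
        _ = M * r * ‖deriv H x‖ := by ring
        _ ≤ _ := by gcongr
    · refine ⟨M * (1 + r) * M, h0, fun H hH => ?_⟩
      obtain ⟨h1, h2, -, h4⟩ := (hK H x r hr (hH.mono hrU)).1 y hy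
      have e1 : M ≤ M * (1 + r) * M := by nlinarith
      have e2 : M * r * M ≤ M * (1 + r) * M := by nlinarith
      refine ⟨h2.trans (by gcongr), h1.trans (by gcongr), ?_⟩
      rw [norm_sub_rev]
      refine h4.trans ?_
      calc M * ‖deriv H x‖ * ‖y - x‖ ≤ M * (M * ‖deriv H y‖) * r := by gcongr
        _ = M * r * M * ‖deriv H y‖ := by ring
        _ ≤ _ := by gcongr
  · rintro x y z - - - ⟨C, hC, h⟩ ⟨D, hD, h'⟩
    refine ⟨C + D * C, by nlinarith, fun H hH => ?_⟩
    obtain ⟨h1, h2, h3⟩ := h H hH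
    obtain ⟨k1, k2, k3⟩ := h' H hH
    have hC0 : 0 ≤ C := by linarith
    have hD0 : 0 ≤ D := by linarith
    refine ⟨?_, ?_, ?_⟩
    · calc _ ≤ D * ‖deriv H y‖ := k1
        _ ≤ D * (C * ‖deriv H x‖) := by gcongr
        _ ≤ _ := by nlinarith [mul_nonneg hC0 (norm_nonneg (deriv H x))]
    · calc _ ≤ C * ‖deriv H y‖ := h2
        _ ≤ C * (D * ‖deriv H z‖) := by gcongr
        _ ≤ _ := by nlinarith [mul_nonneg hC0 (norm_nonneg (deriv H z))]
    · calc _ ≤ ‖H z - H y‖ + ‖H y - H x‖ := norm_sub_le_norm_sub_add_norm_sub _ _ _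
        _ ≤ D * (C * ‖deriv H x‖) + C * ‖deriv H x‖ := add_le_add (k3.trans (by gcongr)) h3
        _ = _ := by ring

lemma uni_of_leftInv {F H : ℂ → ℂ} {U : Set ℂ} (ho : IsOpen U) (hF : Differentiable ℂ F)
    (hH : DifferentiableOn ℂ H U) (hFH : ∀ z ∈ U, F (H z) = z) : Uni H U := by
  refine ⟨hH, fun x hx y hy h => by rw [← hFH x hx, ← hFH y hy, h], fun z hz h0 => ?_⟩
  have h1 := (hF (H z)).hasDerivAt.comp z (hH.differentiableAt (ho.mem_nhds hz)).hasDerivAt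
  rw [h0, mul_zero] at h1
  have h2 : HasDerivAt (F ∘ H) 1 z := (hasDerivAt_id z).congr_of_eventuallyEq (by
    filter_upwards [ho.mem_nhds hz] with w hw
    exact hFH w hw)
  exact zero_ne_one (h1.unique h2)

/-- The quadratic family. -/
def f (μ z : ℂ) : ℂ := μ * z + z ^ 2

lemma f_diff (μ : ℂ) : Differentiable ℂ (f μ) := by unfold f; fun_prop

lemma fit_diff (μ : ℂ) (n : ℕ) : Differentiable ℂ ((f μ)^[n]) := (f_diff μ).iterate n

lemma inv_branch {μ : ℂ} {U : Set ℂ} (hU : IsSimplyConnected U) (ho : IsOpen U)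
    {z1 : ℂ} (hz1 : z1 ∈ U) (n : ℕ) (hv : ∀ i < n, (f μ)^[i] (-μ ^ 2 / 4) ∉ U) (w : ℂ)
    (hw : (f μ)^[n] w = z1) :
    ∃ H : ℂ → ℂ, DifferentiableOn ℂ H U ∧ (∀ z ∈ U, (f μ)^[n] (H z) = z) ∧ H z1 = w := by
  induction n generalizing w with
  | zero => exact ⟨id, differentiableOn_id, fun z _ => rfl, hw.symm⟩
  | succ n ih =>
    obtain ⟨H1, hd, hl, h1⟩ := ih (fun i hi => hv i (by omega)) (f μ w) (by
      rw [← hw, Function.iterate_succ_apply])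
    obtain ⟨s, hs, hs2, hs1⟩ := exists_sqrt hU ho (hd.add_const (μ ^ 2 / 4)) (by
      intro z hz h0
      apply hv n (by omega)
      have : H1 z = -μ ^ 2 / 4 := by linear_combination h0
      rw [← this, hl z hz]; exact hz) hz1 (w0 := w + μ / 2) (by rw [h1]; unfold f; ring)
    refine ⟨fun z => s z - μ / 2, hs.sub_const _, fun z hz => ?_, by simp only [hs1]; ring⟩
    rw [Function.iterate_succ_apply]
    have := hs2 z hz
    have h3 : f μ (s z - μ / 2) = H1 z := by unfold f; linear_combination this
    rw [h3, hl z hz]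

end Mand

open Complex Metric Set Filter Topology
open scoped NNReal ENNReal

namespace Mand

lemma dim_lemma {K : ℕ} (hK : 2 ≤ K) {X : (ℕ → Fin K) → ℂ} {A r' : ℝ} {s : ℝ≥0} (hs : 0 < s)
    (hA : 0 < A) (hr' : 0 < r') (hKs : 1 ≤ K * r' ^ (s : ℝ))
    (hsep : ∀ (k : ℕ) (ω ω' : ℕ → Fin K), (∀ i < k, ω i = ω' i) → ω k ≠ ω' k →
      A * r' ^ k ≤ ‖X ω - X ω'‖) : (s : ℝ≥0∞) ≤ dimH (range X) := by
  have hK0 : (0 : ℝ) < K := by positivity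
  have main : ∀ ω ω', |Real.ofDigits ω - Real.ofDigits ω'| ≤ (A⁻¹) ^ (s : ℝ) * ‖X ω - X ω'‖ ^ (s : ℝ) := by
    intro ω ω'
    by_cases h : ω = ω'
    · rw [h]; simp; positivity
    · have h1 := hsep _ ω ω' (fun i hi => PiNat.apply_eq_of_lt_firstDiff hi)
        (PiNat.apply_firstDiff_ne h)
      set k := PiNat.firstDiff ω ω'
      have h2 : |Real.ofDigits ω - Real.ofDigits ω'| ≤ ((K : ℝ) ^ k)⁻¹ :=
        Real.abs_ofDigits_sub_ofDigits_le (fun i hi => PiNat.apply_eq_of_lt_firstDiff hi)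
      refine h2.trans ?_
      rw [← Real.mul_rpow (by positivity) (norm_nonneg _)]
      have h3 : r' ^ k ≤ A⁻¹ * ‖X ω - X ω'‖ := by
        rw [inv_mul_eq_div, le_div_iff₀ hA]; linarith
      calc ((K : ℝ) ^ k)⁻¹ ≤ (r' ^ (s : ℝ)) ^ k := by
            rw [inv_le_iff_one_le_mul₀ (by positivity), ← mul_pow, mul_comm]
            exact one_le_pow₀ hKs
        _ = (r' ^ k) ^ (s : ℝ) := by
            rw [← Real.rpow_natCast, ← Real.rpow_natCast, ← Real.rpow_mul hr'.le, ← Real.rpow_mul hr'.le, mul_comm]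
        _ ≤ _ := by gcongr
  have hinj : ∀ ω ω', X ω = X ω' → Real.ofDigits ω = Real.ofDigits ω' := by
    intro ω ω' h
    have := main ω ω'
    rw [h, sub_self, norm_zero, Real.zero_rpow (by exact_mod_cast hs.ne'), mul_zero] at this
    exact sub_eq_zero.1 (abs_nonpos_iff.1 this)
  have : Nonempty (ℕ → Fin K) := ⟨fun _ => ⟨0, by omega⟩⟩
  choose! pre hpre using (fun x (hx : x ∈ range X) => hx)
  set φ : ℂ → ℝ := fun x => Real.ofDigits (pre x) with hφ
  have hφX : ∀ ω, φ (X ω) = Real.ofDigits ω := fun ω =>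
    hinj _ _ (hpre (X ω) (mem_range_self _))
  set C : ℝ≥0 := Real.toNNReal ((A⁻¹) ^ (s : ℝ)) with hC
  have hH : HolderOnWith C s φ (range X) := by
    rintro x ⟨ω, rfl⟩ y ⟨ω', rfl⟩
    rw [hφX, hφX, edist_dist, edist_dist, Real.dist_eq, dist_eq_norm,
      ENNReal.ofReal_rpow_of_nonneg (norm_nonneg _) s.coe_nonneg]
    have : (C : ℝ≥0∞) = ENNReal.ofReal ((A⁻¹) ^ (s : ℝ)) := by
      rw [ENNReal.ofReal]
    rw [this, ← ENNReal.ofReal_mul (by positivity)]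
    exact ENNReal.ofReal_le_ofReal (main ω ω')
  have h1 := hH.dimH_image_le hs
  have h2 : Icc (0 : ℝ) 1 ⊆ φ '' range X := by
    intro y hy
    obtain ⟨ω, -, hω⟩ := Real.ofDigits_SurjOn (b := K) (by omega) hy
    exact ⟨X ω, mem_range_self _, by rw [hφX, hω]⟩
  have h3 : dimH (Icc (0 : ℝ) 1) = 1 := by
    rw [Real.dimH_of_nonempty_interior (by simp)]; simp
  have h4 : (1 : ℝ≥0∞) ≤ dimH (range X) / s := by
    rw [← h3]; exact (dimH_mono h2).trans h1
  rwa [ENNReal.le_div_iff_mul_le (Or.inl (by exact_mod_cast hs.ne')) (Or.inl ENNReal.coe_ne_top), one_mul] at h4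

/-- The Mandelbrot set. -/
def MM : Set ℂ := {c : ℂ | Bornology.IsBounded (Set.range fun n : ℕ => (fun z : ℂ => z ^ 2 + c)^[n] 0)}

/-- The parameter change. -/
noncomputable def cc (μ : ℂ) : ℂ := μ / 2 - μ ^ 2 / 4

lemma conj_iter (μ : ℂ) (n : ℕ) (z : ℂ) :
    (fun z : ℂ => z ^ 2 + cc μ)^[n] (z + μ / 2) = (f μ)^[n] z + μ / 2 := by
  induction n with
  | zero => rfl
  | succ n ih =>
    rw [Function.iterate_succ_apply', Function.iterate_succ_apply', ih]
    simp only [f, cc]; ring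

lemma escape {μ z : ℂ} (hμ : ‖μ + 1‖ < 1 / 20) (hz : 4 < ‖z‖) : 2 * ‖z‖ ≤ ‖f μ z‖ := by
  have h1 : f μ z = z * (z + ((μ + 1) - 1)) := by unfold f; ring
  rw [h1, norm_mul]
  have h2 : ‖z‖ - ‖(μ + 1) - 1‖ ≤ ‖z + ((μ + 1) - 1)‖ := by
    have := norm_sub_norm_le z (-((μ + 1) - 1)); rwa [norm_neg, sub_neg_eq_add] at this
  have h3 : ‖(μ + 1) - 1‖ ≤ 1 / 20 + 1 := (norm_sub_le _ _).trans (by rw [norm_one]; linarith)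
  nlinarith

lemma escape_iter {μ z : ℂ} (hμ : ‖μ + 1‖ < 1 / 20) (hz : 4 < ‖z‖) (n : ℕ) :
    2 ^ n * ‖z‖ ≤ ‖(f μ)^[n] z‖ := by
  induction n with
  | zero => simp
  | succ n ih =>
    rw [Function.iterate_succ_apply']
    have : 4 < ‖(f μ)^[n] z‖ := by
      have : (1 : ℝ) ≤ 2 ^ n := one_le_pow₀ (by norm_num)
      nlinarith
    have h2 := escape hμ this
    rw [pow_succ]; nlinarith

lemma mem_MM {μ : ℂ} (hμ : ‖μ + 1‖ < 1 / 20) :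
    cc μ ∈ MM ↔ ∀ n, ‖(f μ)^[n] (-μ / 2)‖ ≤ 4 := by
  have h0 : ∀ n, (fun z : ℂ => z ^ 2 + cc μ)^[n] 0 = (f μ)^[n] (-μ / 2) + μ / 2 := by
    intro n
    rw [← conj_iter]; congr 1; ring
  have e : MM = {c : ℂ | Bornology.IsBounded (Set.range fun n : ℕ => (fun z : ℂ => z ^ 2 + c)^[n] 0)} := rfl
  rw [e, mem_ofPred_eq]
  simp only [h0]
  rw [isBounded_iff_forall_norm_le]
  constructor
  · rintro ⟨C, hC⟩ n
    by_contra! h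
    obtain ⟨k, hk⟩ := pow_unbounded_of_one_lt (C + ‖μ / 2‖) (one_lt_two)
    have h1 := escape_iter hμ h k
    have h2 := hC _ ⟨k + n, rfl⟩
    simp only [Function.iterate_add_apply] at h2
    have h3 := norm_sub_le ((f μ)^[k] ((f μ)^[n] (-μ / 2)) + μ / 2) (μ / 2)
    rw [add_sub_cancel_right] at h3
    have : (0 : ℝ) < 2 ^ k := by positivity
    nlinarith
  · intro h
    refine ⟨4 + ‖μ / 2‖, ?_⟩
    rintro _ ⟨n, rfl⟩
    exact (norm_add_le _ _).trans (by linarith [h n])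

lemma cc_sub (μ μ' : ℂ) : cc μ - cc μ' = (μ - μ') * (2 - μ - μ') / 4 := by unfold cc; ring

lemma cc_sep {μ μ' : ℂ} (h : ‖μ + 1‖ < 1 / 20) (h' : ‖μ' + 1‖ < 1 / 20) :
    ‖μ - μ'‖ / 2 ≤ ‖cc μ - cc μ'‖ := by
  rw [cc_sub, norm_div, norm_mul, Complex.norm_ofNat]
  have : (2 : ℝ) ≤ ‖2 - μ - μ'‖ := by
    have e : (2 : ℂ) - μ - μ' = 4 - ((μ + 1) + (μ' + 1)) := by ring
    rw [e]
    have h1 := norm_sub_norm_le (4 : ℂ) ((μ + 1) + (μ' + 1))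
    have h2 := norm_add_le (μ + 1) (μ' + 1)
    rw [Complex.norm_ofNat] at h1
    linarith
  nlinarith [norm_nonneg (μ - μ')]

lemma norm_sqrt_sub_one_le (w : ℂ) : ‖w ^ (1 / 2 : ℂ) - 1‖ ≤ ‖w - 1‖ := by
  have h2 : (w ^ (1 / 2 : ℂ)) ^ 2 = w := by rw [← cpow_mul_nat]; simp
  have hre : 0 ≤ (w ^ (1 / 2 : ℂ)).re := by
    by_cases hw : w = 0
    · subst hw; simp
    · rw [cpow_def_of_ne_zero hw, exp_re]
      refine mul_nonneg (Real.exp_pos _).le (Real.cos_nonneg_of_mem_Icc ?_)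
      have e : (log w * (1 / 2 : ℂ)).im = w.arg / 2 := by
        rw [show (1 / 2 : ℂ) = ((1 / 2 : ℝ) : ℂ) by norm_num, im_mul_ofReal, log_im]; ring
      rw [e]
      have h1 := Complex.neg_pi_lt_arg w
      have h3 := Complex.arg_le_pi w
      constructor <;> linarith
  have h3 : 1 ≤ ‖w ^ (1 / 2 : ℂ) + 1‖ := by
    refine le_trans ?_ (re_le_norm _)
    simp only [add_re, one_re]; linarith
  have h4 : w - 1 = (w ^ (1 / 2 : ℂ) - 1) * (w ^ (1 / 2 : ℂ) + 1) := by linear_combination -h2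
  calc ‖w ^ (1 / 2 : ℂ) - 1‖ ≤ ‖w ^ (1 / 2 : ℂ) - 1‖ * ‖w ^ (1 / 2 : ℂ) + 1‖ :=
        le_mul_of_one_le_right (norm_nonneg _) h3
    _ = _ := by rw [h4, norm_mul]

/-- Lifting inverse branches to nearby parameters. -/
lemma lift_branch (μs a : ℂ) (n : ℕ) : ∀ (ρ1 ρ : ℝ), ρ1 < ρ → ∀ (G : ℂ → ℂ),
    DifferentiableOn ℂ G (ball a ρ) → (∀ z ∈ ball a ρ, (f μs)^[n] (G z) = z) → ∀ ε > 0,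
    ∃ η > 0, ∃ GG : ℂ → ℂ → ℂ,
      DifferentiableOn ℂ (fun p : ℂ × ℂ => GG p.1 p.2) (ball μs η ×ˢ ball a ρ1) ∧
      (∀ μ ∈ ball μs η, ∀ z ∈ ball a ρ1, (f μ)^[n] (GG μ z) = z ∧ ‖GG μ z - G z‖ ≤ ε) := by
  induction n with
  | zero =>
    intro ρ1 ρ hρ G hG hGi ε hε
    refine ⟨1, one_pos, fun _ z => z, differentiableOn_snd, fun μ hμ z hz => ⟨rfl, ?_⟩⟩
    have := hGi z (ball_subset_ball hρ.le hz)
    simp only [Function.iterate_zero, id] at this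
    rw [this, sub_self, norm_zero]; exact hε.le
  | succ n ih =>
    intro ρ1 ρ hρ G hG hGi ε hε
    rcases le_or_gt ρ1 0 with hneg | hpos
    · refine ⟨1, one_pos, fun _ z => z, differentiableOn_snd, fun μ hμ z hz => ?_⟩
      rw [ball_eq_empty.2 hneg] at hz; exact absurd hz (notMem_empty _)
    have hsubc : closedBall a ρ1 ⊆ ball a ρ := closedBall_subset_ball hρ
    have hG1d : DifferentiableOn ℂ (fun z => f μs (G z)) (ball a ρ) := (f_diff μs).comp_differentiableOn hG
    have hU := uni_of_leftInv isOpen_ball (fit_diff μs (n + 1)) hG hGi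
    have hne : ∀ z ∈ ball a ρ, G z + μs / 2 ≠ 0 := by
      intro z hz h0
      have h1 : deriv (fun z => f μs (G z)) z = 0 := by
        have hGz := (hG.differentiableAt (isOpen_ball.mem_nhds hz)).hasDerivAt
        have h2 := (hGz.const_mul μs).add (hGz.pow 2)
        have h3 : HasDerivAt (fun z => f μs (G z)) _ z := h2
        rw [h3.deriv]
        have : G z = - μs / 2 := by linear_combination h0
        rw [this]; simp; ring
      have hU1 := uni_of_leftInv isOpen_ball (fit_diff μs n) hG1d (fun z hz => by
        have := hGi z hz; rwa [Function.iterate_succ_apply] at this)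
      exact hU1.ne z hz h1
    have hcont : ContinuousOn (fun z => ‖G z + μs / 2‖) (closedBall a ρ1) :=
      ((hG.continuousOn.mono hsubc).add continuousOn_const).norm
    obtain ⟨zm, hzm, hmin⟩ := (isCompact_closedBall a ρ1).exists_isMinOn
      ⟨a, mem_closedBall_self hpos.le⟩ hcont
    obtain ⟨zM, hzM, hmax⟩ := (isCompact_closedBall a ρ1).exists_isMaxOn
      ⟨a, mem_closedBall_self hpos.le⟩ hcont
    set m := ‖G zm + μs / 2‖ with hm
    set Mx := ‖G zM + μs / 2‖ with hMx
    have hm0 : 0 < m := norm_pos_iff.2 (hne zm (hsubc hzm))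
    have hml : ∀ z ∈ ball a ρ1, m ≤ ‖G z + μs / 2‖ := fun z hz => hmin (ball_subset_closedBall hz)
    have hMl : ∀ z ∈ ball a ρ1, ‖G z + μs / 2‖ ≤ Mx := fun z hz => hmax (ball_subset_closedBall hz)
    have hMx0 : 0 ≤ Mx := norm_nonneg _
    -- small quantities
    set δ := min (1 / 2) (ε / (2 * (Mx + 1))) with hδ
    have hδ0 : 0 < δ := by positivity
    have hδM : Mx * δ ≤ ε / 2 := by
      calc Mx * δ ≤ (Mx + 1) * (ε / (2 * (Mx + 1))) := by
            gcongr; linarith; exact min_le_right _ _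
        _ = ε / 2 := by field_simp
    obtain ⟨η1, hη1, GG1, hd1, h1⟩ := ih ρ1 ρ hρ _ hG1d (fun z hz => by
        have := hGi z hz; rwa [Function.iterate_succ_apply] at this) (δ * m ^ 2 / 2) (by positivity)
    have hct : ContinuousAt (fun μ : ℂ => μ ^ 2 / 4) μs := by fun_prop
    obtain ⟨η2, hη2, h2⟩ := Metric.continuousAt_iff.1 hct (δ * m ^ 2 / 2) (by positivity)
    set η := min (min η1 η2) ε with hη
    have hη0 : 0 < η := by positivity
    set W : ℂ → ℂ → ℂ := fun μ z => (GG1 μ z + μ ^ 2 / 4) / (G z + μs / 2) ^ 2 with hW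
    have hW1 : ∀ μ ∈ ball μs η, ∀ z ∈ ball a ρ1, ‖W μ z - 1‖ ≤ δ := by
      intro μ hμ z hz
      have hz' := hne z (hsubc (ball_subset_closedBall hz))
      have e1 := (h1 μ (ball_subset_ball ((min_le_left _ _).trans (min_le_left _ _)) hμ) z hz).2
      have e2 := h2 (show dist μ μs < η2 from lt_of_lt_of_le hμ ((min_le_left _ _).trans (min_le_right _ _)))
      rw [dist_eq_norm] at e2
      have e3 : W μ z - 1 = ((GG1 μ z - f μs (G z)) + (μ ^ 2 / 4 - μs ^ 2 / 4)) / (G z + μs / 2) ^ 2 := by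
        have h9 := pow_ne_zero 2 hz'
        show (GG1 μ z + μ ^ 2 / 4) / (G z + μs / 2) ^ 2 - 1 = _
        rw [eq_div_iff h9, sub_mul, div_mul_cancel₀ _ h9]; simp only [f]; ring
      rw [e3, norm_div, norm_pow, div_le_iff₀ (by positivity)]
      have e4 := hml z hz
      calc _ ≤ δ * m ^ 2 / 2 + δ * m ^ 2 / 2 := (norm_add_le _ _).trans (add_le_add e1 e2.le)
        _ = δ * m ^ 2 := by ring
        _ ≤ _ := by gcongr
    refine ⟨η, hη0, fun μ z => -μ / 2 + (G z + μs / 2) * (W μ z) ^ (1 / 2 : ℂ), ?_, ?_⟩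
    · have hGs : DifferentiableOn ℂ (fun p : ℂ × ℂ => G p.2) (ball μs η ×ˢ ball a ρ1) :=
        hG.comp differentiableOn_snd (fun p hp => ball_subset_ball hρ.le hp.2)
      have hd1' : DifferentiableOn ℂ (fun p : ℂ × ℂ => GG1 p.1 p.2) (ball μs η ×ˢ ball a ρ1) :=
        hd1.mono (prod_mono (ball_subset_ball ((min_le_left _ _).trans (min_le_left _ _))) subset_rfl)
      have hWd : DifferentiableOn ℂ (fun p : ℂ × ℂ => W p.1 p.2) (ball μs η ×ˢ ball a ρ1) := by
        have hn : DifferentiableOn ℂ (fun p : ℂ × ℂ => GG1 p.1 p.2 + p.1 ^ 2 / 4) (ball μs η ×ˢ ball a ρ1) :=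
          hd1'.add (by fun_prop)
        have hdn : DifferentiableOn ℂ (fun p : ℂ × ℂ => (G p.2 + μs / 2) ^ 2) (ball μs η ×ˢ ball a ρ1) :=
          (show DifferentiableOn ℂ (fun p : ℂ × ℂ => G p.2 + μs / 2) _ from hGs.add_const _).pow 2
        have hh := hn.mul (hdn.inv (fun p hp => pow_ne_zero 2 (hne _ (ball_subset_ball hρ.le hp.2))))
        refine hh.congr (fun p hp => ?_)
        exact div_eq_mul_inv _ _
      refine DifferentiableOn.add (by fun_prop) ((hGs.add_const _).mul ?_)
      refine hWd.cpow (differentiableOn_const _) ?_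
      intro p hp
      have := hW1 p.1 hp.1 p.2 hp.2
      left
      have h3 := abs_re_le_norm (W p.1 p.2 - 1)
      have h4 := (abs_le.1 (h3.trans this)).1
      simp only [sub_re, one_re] at h4
      have : δ ≤ 1 / 2 := min_le_left _ _
      linarith
    · intro μ hμ z hz
      have hz' := hne z (hsubc (ball_subset_closedBall hz))
      have e0 := h1 μ (ball_subset_ball ((min_le_left _ _).trans (min_le_left _ _)) hμ) z hz
      have h2 : ((W μ z) ^ (1 / 2 : ℂ)) ^ 2 = W μ z := by rw [← cpow_mul_nat]; simp
      constructor
      · rw [Function.iterate_succ_apply]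
        have : f μ (-μ / 2 + (G z + μs / 2) * (W μ z) ^ (1 / 2 : ℂ)) = GG1 μ z := by
          have e5 : (G z + μs / 2) ^ 2 * W μ z = GG1 μ z + μ ^ 2 / 4 := by
            exact mul_div_cancel₀ _ (pow_ne_zero 2 hz')
          unfold f
          linear_combination (G z + μs / 2) ^ 2 * h2 + e5
        rw [this]; exact e0.1
      · have e6 : -μ / 2 + (G z + μs / 2) * (W μ z) ^ (1 / 2 : ℂ) - G z =
          (G z + μs / 2) * ((W μ z) ^ (1 / 2 : ℂ) - 1) - (μ - μs) / 2 := by ring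
        rw [e6]
        have e7 : ‖μ - μs‖ ≤ ε := by
          rw [mem_ball, dist_eq_norm] at hμ
          exact hμ.le.trans (min_le_right _ _)
        refine (norm_sub_le _ _).trans ?_
        rw [norm_mul, norm_div, Complex.norm_ofNat]
        have e8 : ‖G z + μs / 2‖ * ‖(W μ z) ^ (1 / 2 : ℂ) - 1‖ ≤ Mx * δ := by
          gcongr
          · exact hMl z hz
          · exact (norm_sqrt_sub_one_le _).trans (hW1 μ hμ z hz)
        linarith

end Mand

open Complex Metric Set Filter Topology
open scoped NNReal ENNReal

namespace Mand

lemma lip_of_bound {h : ℂ → ℂ} {R R1 ε : ℝ} (hR : R < R1) (hd : DifferentiableOn ℂ h (ball 0 R1))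
    (hb : ∀ z ∈ ball (0 : ℂ) R1, ‖h z‖ ≤ ε) {z w : ℂ} (hz : z ∈ closedBall (0 : ℂ) R)
    (hw : w ∈ closedBall (0 : ℂ) R) : ‖h z - h w‖ ≤ ε / ((R1 - R) / 2) * ‖z - w‖ := by
  have hsub : closedBall (0 : ℂ) R ⊆ ball 0 R1 := closedBall_subset_ball hR
  refine (convex_closedBall (0 : ℂ) R).norm_image_sub_le_of_norm_deriv_le
    (fun x hx => hd.differentiableAt (isOpen_ball.mem_nhds (hsub hx))) (fun x hx => ?_) hw hz
  have hx0 : ‖x‖ ≤ R := by simpa using hx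
  have hs : closedBall x ((R1 - R) / 2) ⊆ ball 0 R1 := by
    intro y hy
    rw [mem_closedBall, dist_eq_norm] at hy
    rw [mem_ball_zero_iff]
    have := norm_add_le (y - x) x
    rw [sub_add_cancel] at this
    linarith
  refine norm_deriv_le_of_forall_mem_sphere_norm_le (by linarith) ?_ ?_
  · exact ((hd.mono hs).diffContOnCl_ball subset_rfl)
  · intro y hy; exact hb y (hs (sphere_subset_closedBall hy))

/-- A persistent iterated function system made of inverse branches. -/
structure Sys (μs : ℂ) (K : ℕ) (n : Fin K → ℕ) (R R0 r d η : ℝ) (GG : Fin K → ℂ → ℂ → ℂ) : Prop where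
  η_pos : 0 < η
  R_pos : 0 < R
  R0_lt : R0 < R
  r_pos : 0 < r
  d_pos : 0 < d
  near : ∀ μ ∈ ball μs η, ‖μ + 1‖ < 1 / 20
  diff : ∀ i, ∃ R1 > R, DifferentiableOn ℂ (fun p : ℂ × ℂ => GG i p.1 p.2) (ball μs η ×ˢ ball 0 R1)
  inv : ∀ i, ∀ μ ∈ ball μs η, ∀ z ∈ closedBall (0 : ℂ) R, (f μ)^[n i] (GG i μ z) = z
  maps : ∀ i, ∀ μ ∈ ball μs η, ∀ z ∈ closedBall (0 : ℂ) R, GG i μ z ∈ closedBall (0 : ℂ) R0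
  low : ∀ i, ∀ μ ∈ ball μs η, ∀ z ∈ closedBall (0 : ℂ) R, ∀ w ∈ closedBall (0 : ℂ) R,
    r * ‖z - w‖ ≤ ‖GG i μ z - GG i μ w‖
  upp : ∀ i, ∀ μ ∈ ball μs η, ∀ z ∈ closedBall (0 : ℂ) R, ∀ w ∈ closedBall (0 : ℂ) R,
    ‖GG i μ z - GG i μ w‖ ≤ ‖z - w‖ / 2
  sep : ∀ i j, i ≠ j → ∀ μ ∈ ball μs η, ∀ z ∈ closedBall (0 : ℂ) R, ∀ w ∈ closedBall (0 : ℂ) R,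
    d ≤ ‖GG i μ z - GG j μ w‖

lemma exists_sys {μs : ℂ} {K : ℕ} {n : Fin K → ℕ} {ρ R R0 r d : ℝ} {G : Fin K → ℂ → ℂ}
    (hμ : ‖μs + 1‖ < 1 / 20) (hR : 0 < R) (hRρ : R < ρ) (hR0 : R0 < R) (hr : 0 < r) (hd : 0 < d)
    (hG : ∀ i, DifferentiableOn ℂ (G i) (ball 0 ρ))
    (hinv : ∀ i, ∀ z ∈ ball (0 : ℂ) ρ, (f μs)^[n i] (G i z) = z)
    (hmaps : ∀ i, ∀ z ∈ closedBall (0 : ℂ) R, G i z ∈ closedBall (0 : ℂ) R0)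
    (hlow : ∀ i, ∀ z ∈ closedBall (0 : ℂ) R, ∀ w ∈ closedBall (0 : ℂ) R,
      r * ‖z - w‖ ≤ ‖G i z - G i w‖)
    (hupp : ∀ i, ∀ z ∈ closedBall (0 : ℂ) R, ∀ w ∈ closedBall (0 : ℂ) R,
      ‖G i z - G i w‖ ≤ ‖z - w‖ / 4)
    (hsep : ∀ i j, i ≠ j → ∀ z ∈ closedBall (0 : ℂ) R, ∀ w ∈ closedBall (0 : ℂ) R,
      d ≤ ‖G i z - G j w‖) :
    ∃ η GG, Sys μs K n R ((R0 + R) / 2) (r / 2) (d / 2) η GG := by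
  set R1 := (R + ρ) / 2 with hR1
  have hRR1 : R < R1 := by linarith
  have hR1ρ : R1 < ρ := by linarith
  set L := (R1 - R) / 2 with hL
  have hL0 : 0 < L := by linarith
  set ε := min (min ((R - R0) / 2) (d / 4)) (min (r / 2 * L) (L / 4)) with hε
  have hε0 : 0 < ε := by
    have : 0 < R - R0 := by linarith
    positivity
  have e1 : ε ≤ (R - R0) / 2 := (min_le_left _ _).trans (min_le_left _ _)
  have e2 : ε ≤ d / 4 := (min_le_left _ _).trans (min_le_right _ _)
  have e3 : ε / L ≤ r / 2 := by rw [div_le_iff₀ hL0]; exact (min_le_right _ _).trans (min_le_left _ _)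
  have e4 : ε / L ≤ 1 / 4 := by
    rw [div_le_iff₀ hL0]
    have : ε ≤ L / 4 := (min_le_right _ _).trans (min_le_right _ _)
    linarith
  choose η hη GG hGd hGG using fun i => lift_branch μs 0 (n i) R1 ρ hR1ρ (G i) (hG i) (hinv i) ε hε0
  obtain ⟨η0, hη0, hη0le⟩ : ∃ η0 > 0, ∀ i, η0 ≤ η i := by
    rcases isEmpty_or_nonempty (Fin K) with h | h
    · exact ⟨1, one_pos, fun i => h.elim i⟩
    · obtain ⟨i0, hi0⟩ := Finite.exists_min η
      exact ⟨η i0, hη i0, hi0⟩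
  set η1 := min η0 (1 / 20 - ‖μs + 1‖) with hη1
  have hη1p : 0 < η1 := lt_min hη0 (by linarith)
  have hsub : ∀ i, ball μs η1 ⊆ ball μs (η i) := fun i =>
    ball_subset_ball ((min_le_left _ _).trans (hη0le i))
  have hcb : closedBall (0 : ℂ) R ⊆ ball 0 R1 := closedBall_subset_ball hRR1
  have hlip : ∀ i, ∀ μ ∈ ball μs η1, ∀ z ∈ closedBall (0 : ℂ) R, ∀ w ∈ closedBall (0 : ℂ) R,
      ‖(GG i μ z - G i z) - (GG i μ w - G i w)‖ ≤ ε / L * ‖z - w‖ := by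
    intro i μ hμ z hz w hw
    have hdz : DifferentiableOn ℂ (fun z => GG i μ z - G i z) (ball 0 R1) := by
      refine DifferentiableOn.sub ?_ ((hG i).mono (ball_subset_ball hR1ρ.le))
      have : DifferentiableOn ℂ (fun z : ℂ => (μ, z)) (ball 0 R1) := by fun_prop
      exact (hGd i).comp this (fun z hz => ⟨hsub i hμ, hz⟩)
    exact lip_of_bound hRR1 hdz (fun z hz => (hGG i μ (hsub i hμ) z hz).2) hz hw
  refine ⟨η1, GG, ⟨hη1p, hR, by linarith, by linarith, by linarith, ?_, ?_, ?_, ?_, ?_, ?_, ?_⟩⟩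
  · intro μ h
    rw [mem_ball, dist_eq_norm] at h
    have h2 := lt_of_lt_of_le h (min_le_right _ _)
    have : μ + 1 = (μ - μs) + (μs + 1) := by ring
    rw [this]
    exact (norm_add_le _ _).trans_lt (by linarith)
  · intro i
    exact ⟨R1, hRR1, (hGd i).mono (prod_mono (hsub i) subset_rfl)⟩
  · intro i μ h z hz
    exact (hGG i μ (hsub i h) z (hcb hz)).1
  · intro i μ h z hz
    have h1 := (hGG i μ (hsub i h) z (hcb hz)).2
    have h2 := hmaps i z hz
    rw [mem_closedBall_zero_iff] at h2 ⊢
    have := norm_add_le (GG i μ z - G i z) (G i z)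
    rw [sub_add_cancel] at this
    linarith
  · intro i μ h z hz w hw
    have h1 := hlip i μ h z hz w hw
    have h2 := hlow i z hz w hw
    have h3 : ε / L * ‖z - w‖ ≤ r / 2 * ‖z - w‖ := by gcongr
    have h4 := norm_sub_le (GG i μ z - GG i μ w) ((GG i μ z - G i z) - (GG i μ w - G i w))
    have : GG i μ z - GG i μ w - ((GG i μ z - G i z) - (GG i μ w - G i w)) = G i z - G i w := by ring
    rw [this] at h4
    linarith
  · intro i μ h z hz w hw
    have h1 := hlip i μ h z hz w hw
    have h2 := hupp i z hz w hw
    have h3 : ε / L * ‖z - w‖ ≤ 1 / 4 * ‖z - w‖ := by gcongr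
    have h4 := norm_add_le (G i z - G i w) ((GG i μ z - G i z) - (GG i μ w - G i w))
    have : G i z - G i w + ((GG i μ z - G i z) - (GG i μ w - G i w)) = GG i μ z - GG i μ w := by ring
    rw [this] at h4
    linarith
  · intro i j hij μ h z hz w hw
    have h1 := (hGG i μ (hsub i h) z (hcb hz)).2
    have h1' := (hGG j μ (hsub j h) w (hcb hw)).2
    have h2 := hsep i j hij z hz w hw
    have h4 := norm_sub_le (GG i μ z - GG j μ w) ((GG i μ z - G i z) - (GG j μ w - G j w))
    have h5 := norm_sub_le (GG i μ z - G i z) (GG j μ w - G j w)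
    have : GG i μ z - GG j μ w - ((GG i μ z - G i z) - (GG j μ w - G j w)) = G i z - G j w := by ring
    rw [this] at h4
    linarith

end Mand

open Complex Metric Set Filter Topology
open scoped NNReal ENNReal

namespace Mand

/-- shift -/
def sh {K : ℕ} (j : ℕ) (ω : ℕ → Fin K) : ℕ → Fin K := fun i => ω (i + j)

/-- approximate coding -/
def Xk {K : ℕ} (GG : Fin K → ℂ → ℂ → ℂ) : ℕ → (ℕ → Fin K) → ℂ → ℂ
  | 0, _, _ => 0
  | k + 1, ω, μ => GG (ω 0) μ (Xk GG k (sh 1 ω) μ)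

/-- coding -/
noncomputable def XX {K : ℕ} (GG : Fin K → ℂ → ℂ → ℂ) (ω : ℕ → Fin K) (μ : ℂ) : ℂ :=
  limUnder atTop (fun k => Xk GG k ω μ)

section
variable {μs : ℂ} {K : ℕ} {n : Fin K → ℕ} {R R0 r d η : ℝ} {GG : Fin K → ℂ → ℂ → ℂ}

lemma Xk_mem (S : Sys μs K n R R0 r d η GG) {μ : ℂ} (hμ : μ ∈ ball μs η) (k : ℕ) (ω : ℕ → Fin K) :
    Xk GG k ω μ ∈ closedBall (0 : ℂ) R := by
  induction k generalizing ω with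
  | zero => simp [Xk, S.R_pos.le]
  | succ k ih => exact closedBall_subset_closedBall S.R0_lt.le (S.maps _ _ hμ _ (ih _))

lemma Sys.diffX (S : Sys μs K n R R0 r d η GG) (i : Fin K) {φ : ℂ → ℂ} {U : Set ℂ} (hU : U ⊆ ball μs η)
    (hφ : DifferentiableOn ℂ φ U) (hm : ∀ μ ∈ U, φ μ ∈ closedBall (0 : ℂ) R) :
    DifferentiableOn ℂ (fun μ => GG i μ (φ μ)) U := by
  obtain ⟨R1, hR1, hd⟩ := S.diff i
  have : DifferentiableOn ℂ (fun μ : ℂ => (μ, φ μ)) U := differentiableOn_id.prodMk hφ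
  exact hd.comp this (fun μ hμ => ⟨hU hμ, closedBall_subset_ball hR1 (hm μ hμ)⟩)

lemma Xk_diff (S : Sys μs K n R R0 r d η GG) (k : ℕ) (ω : ℕ → Fin K) :
    DifferentiableOn ℂ (Xk GG k ω) (ball μs η) := by
  induction k generalizing ω with
  | zero => exact differentiableOn_const (c := (0 : ℂ))
  | succ k ih => exact S.diffX (ω 0) subset_rfl (ih _) (fun μ hμ => Xk_mem S hμ k _)

lemma Xk_step (S : Sys μs K n R R0 r d η GG) {μ : ℂ} (hμ : μ ∈ ball μs η) (k : ℕ) (ω : ℕ → Fin K) :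
    dist (Xk GG k ω μ) (Xk GG (k + 1) ω μ) ≤ (2 * R) / 2 / 2 ^ k := by
  induction k generalizing ω with
  | zero =>
    have := Xk_mem S hμ 1 ω
    rw [mem_closedBall] at this
    rw [dist_comm]; simpa [Xk] using this
  | succ k ih =>
    have h1 := S.upp (ω 0) μ hμ _ (Xk_mem S hμ k (sh 1 ω)) _ (Xk_mem S hμ (k + 1) (sh 1 ω))
    have h2 := ih (sh 1 ω)
    rw [dist_eq_norm] at h2 ⊢
    calc _ ≤ _ := h1
      _ ≤ (2 * R / 2 / 2 ^ k) / 2 := by gcongr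
      _ = _ := by rw [pow_succ]; field_simp

lemma Xk_tendsto (S : Sys μs K n R R0 r d η GG) {μ : ℂ} (hμ : μ ∈ ball μs η) (ω : ℕ → Fin K) :
    Tendsto (fun k => Xk GG k ω μ) atTop (𝓝 (XX GG ω μ)) :=
  (cauchySeq_of_le_geometric_two (fun k => Xk_step S hμ k ω)).tendsto_limUnder

lemma Xk_dist (S : Sys μs K n R R0 r d η GG) {μ : ℂ} (hμ : μ ∈ ball μs η) (k : ℕ) (ω : ℕ → Fin K) :
    dist (Xk GG k ω μ) (XX GG ω μ) ≤ 2 * R / 2 ^ k :=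
  dist_le_of_le_geometric_two_of_tendsto (fun k => Xk_step S hμ k ω) (Xk_tendsto S hμ ω) k

lemma XX_mem' (S : Sys μs K n R R0 r d η GG) {μ : ℂ} (hμ : μ ∈ ball μs η) (ω : ℕ → Fin K) :
    XX GG ω μ ∈ closedBall (0 : ℂ) R :=
  isClosed_closedBall.mem_of_tendsto (Xk_tendsto S hμ ω) (Eventually.of_forall fun k => Xk_mem S hμ k ω)

lemma XX_diff (S : Sys μs K n R R0 r d η GG) (ω : ℕ → Fin K) :
    DifferentiableOn ℂ (XX GG ω) (ball μs η) := by
  have h : TendstoUniformlyOn (fun k => Xk GG k ω) (XX GG ω) atTop (ball μs η) := by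
    rw [Metric.tendstoUniformlyOn_iff]
    intro ε hε
    have h1 : Tendsto (fun k : ℕ => 2 * R * (1 / 2) ^ k) atTop (𝓝 (2 * R * 0)) :=
      (tendsto_pow_atTop_nhds_zero_of_lt_one (by norm_num) (by norm_num)).const_mul _
    rw [mul_zero] at h1
    filter_upwards [h1.eventually_lt_const hε] with k hk μ hμ
    rw [dist_comm]
    refine (Xk_dist S hμ k ω).trans_lt (lt_of_eq_of_lt ?_ hk)
    rw [one_div, inv_pow, div_eq_mul_inv]
  exact h.tendstoLocallyUniformlyOn.differentiableOn (Eventually.of_forall fun k => Xk_diff S k ω) isOpen_ball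

lemma XX_eq (S : Sys μs K n R R0 r d η GG) {μ : ℂ} (hμ : μ ∈ ball μs η) (ω : ℕ → Fin K) :
    XX GG ω μ = GG (ω 0) μ (XX GG (sh 1 ω) μ) := by
  have h1 := (tendsto_add_atTop_iff_nat 1).2 (Xk_tendsto S hμ ω)
  refine tendsto_nhds_unique h1 ?_
  have h2 : Tendsto (fun k => ‖Xk GG k (sh 1 ω) μ - XX GG (sh 1 ω) μ‖ / 2) atTop (𝓝 0) := by
    have := (tendsto_iff_norm_sub_tendsto_zero.1 (Xk_tendsto S hμ (sh 1 ω))).div_const 2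
    simpa using this
  rw [tendsto_iff_norm_sub_tendsto_zero]
  refine squeeze_zero (fun _ => norm_nonneg _) (fun k => ?_) h2
  exact S.upp (ω 0) μ hμ _ (Xk_mem S hμ k (sh 1 ω)) _ (XX_mem' S hμ _)

lemma XX_mem (S : Sys μs K n R R0 r d η GG) {μ : ℂ} (hμ : μ ∈ ball μs η) (ω : ℕ → Fin K) :
    XX GG ω μ ∈ closedBall (0 : ℂ) R0 := by
  rw [XX_eq S hμ]; exact S.maps _ _ hμ _ (XX_mem' S hμ _)

lemma XX_sep (S : Sys μs K n R R0 r d η GG) {μ : ℂ} (hμ : μ ∈ ball μs η) (k : ℕ) (ω ω' : ℕ → Fin K)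
    (h : ∀ i < k, ω i = ω' i) (hk : ω k ≠ ω' k) : d * r ^ k ≤ ‖XX GG ω μ - XX GG ω' μ‖ := by
  induction k generalizing ω ω' with
  | zero =>
    rw [XX_eq S hμ, XX_eq S hμ ω', pow_zero, mul_one]
    exact S.sep _ _ hk _ hμ _ (XX_mem' S hμ _) _ (XX_mem' S hμ _)
  | succ k ih =>
    rw [XX_eq S hμ, XX_eq S hμ ω', ← h 0 (by omega)]
    have h1 := S.low (ω 0) _ hμ _ (XX_mem' S hμ (sh 1 ω)) _ (XX_mem' S hμ (sh 1 ω'))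
    have h2 := ih (sh 1 ω) (sh 1 ω') (fun i hi => h (i + 1) (by omega)) hk
    refine le_trans ?_ h1
    rw [pow_succ]
    have := mul_le_mul_of_nonneg_left h2 S.r_pos.le
    linarith

/-- return times -/
def NN (n : Fin K → ℕ) : ℕ → (ℕ → Fin K) → ℕ
  | 0, _ => 0
  | j + 1, ω => NN n j ω + n (ω j)

lemma sh_sh (j : ℕ) (ω : ℕ → Fin K) : sh 1 (sh j ω) = sh (j + 1) ω := by
  funext i; simp only [sh]; congr 1; omega

lemma XX_iter (S : Sys μs K n R R0 r d η GG) {μ : ℂ} (hμ : μ ∈ ball μs η) (j : ℕ) (ω : ℕ → Fin K) :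
    (f μ)^[NN n j ω] (XX GG ω μ) = XX GG (sh j ω) μ := by
  induction j with
  | zero => rfl
  | succ j ih =>
    simp only [NN]
    rw [add_comm, Function.iterate_add_apply, ih, XX_eq S hμ (sh j ω), sh_sh]
    have : sh j ω 0 = ω j := by simp [sh]
    rw [this]
    exact S.inv _ _ hμ _ (XX_mem' S hμ _)

end
end Mand

open Complex Metric Set Filter Topology
open scoped NNReal ENNReal

namespace Mand

lemma sqrt_sq (w : ℂ) : (w ^ (1 / 2 : ℂ)) ^ 2 = w := by rw [← cpow_mul_nat]; simp

lemma sqrt_re_nonneg (w : ℂ) : 0 ≤ (w ^ (1 / 2 : ℂ)).re := by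
  by_cases hw : w = 0
  · subst hw; simp
  · rw [cpow_def_of_ne_zero hw, exp_re]
    refine mul_nonneg (Real.exp_pos _).le (Real.cos_nonneg_of_mem_Icc ?_)
    have e : (log w * (1 / 2 : ℂ)).im = w.arg / 2 := by
      rw [show (1 / 2 : ℂ) = ((1 / 2 : ℝ) : ℂ) by norm_num, im_mul_ofReal, log_im]; ring
    rw [e]
    have h1 := Complex.neg_pi_lt_arg w
    have h3 := Complex.arg_le_pi w
    constructor <;> linarith

lemma sqrt_re_ge_one {w : ℂ} (hw : 1 ≤ w.re) : 1 ≤ (w ^ (1 / 2 : ℂ)).re := by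
  have h0 := sqrt_re_nonneg w
  have h1 := congrArg re (sqrt_sq w)
  rw [pow_two, mul_re] at h1
  nlinarith [mul_self_nonneg (w ^ (1 / 2 : ℂ)).im]

lemma mu_bounds {μ : ℂ} (hμ : ‖μ + 1‖ < 1 / 20) : |μ.re + 1| < 1 / 20 ∧ |μ.im| < 1 / 20 ∧ 19 / 20 ≤ ‖μ‖ ∧ ‖μ‖ ≤ 21 / 20 := by
  have h1 := abs_re_le_norm (μ + 1)
  have h2 := abs_im_le_norm (μ + 1)
  simp only [add_re, one_re, add_im, one_im, add_zero] at h1 h2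
  refine ⟨by linarith, by linarith, ?_, ?_⟩
  · have := norm_sub_norm_le (1 : ℂ) (μ + 1)
    have e : (1 : ℂ) - (μ + 1) = - μ := by ring
    rw [e, norm_neg, norm_one] at this; linarith
  · have := norm_sub_le (μ + 1) 1
    rw [add_sub_cancel_right, norm_one] at this; linarith

/-- preimages of points near `0` approaching the fixed point `1 - μ`. -/
lemma pre_beta (k : ℕ) : ∃ T : ℂ → ℂ → ℂ,
    DifferentiableOn ℂ (fun p : ℂ × ℂ => T p.1 p.2) (ball (-1) (1 / 20) ×ˢ ball 0 (1 / 50)) ∧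
    ∀ μ ∈ ball (-1 : ℂ) (1 / 20), ∀ y ∈ ball (0 : ℂ) (1 / 50), (f μ)^[k + 1] (T μ y) = y ∧
      ‖T μ y - (1 - μ)‖ ≤ 2 / 2 ^ k ∧ 4 / 5 ≤ (T μ y).re := by
  have hb : ∀ μ ∈ ball (-1 : ℂ) (1 / 20), ‖μ + 1‖ < 1 / 20 := by
    intro μ h; rwa [mem_ball, dist_eq_norm, sub_neg_eq_add] at h
  induction k with
  | zero =>
    have hw : ∀ μ ∈ ball (-1 : ℂ) (1 / 20), ∀ y ∈ ball (0 : ℂ) (1 / 50), ‖4 * y / μ ^ 2‖ ≤ 1 / 10 := by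
      intro μ hμ y hy
      have h1 := (mu_bounds (hb μ hμ)).2.2
      rw [mem_ball_zero_iff] at hy
      rw [norm_div, norm_mul, norm_pow, Complex.norm_ofNat, div_le_iff₀ (by nlinarith)]
      nlinarith
    refine ⟨fun μ y => -μ / 2 - μ / 2 * (1 + 4 * y / μ ^ 2) ^ (1 / 2 : ℂ), ?_, ?_⟩
    · have h1 : DifferentiableOn ℂ (fun p : ℂ × ℂ => 1 + 4 * p.2 / p.1 ^ 2) (ball (-1) (1 / 20) ×ˢ ball 0 (1 / 50)) := by
        have hn : DifferentiableOn ℂ (fun p : ℂ × ℂ => 4 * p.2) (ball (-1 : ℂ) (1 / 20) ×ˢ ball (0 : ℂ) (1 / 50)) := by fun_prop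
        have hdn : DifferentiableOn ℂ (fun p : ℂ × ℂ => p.1 ^ 2) (ball (-1 : ℂ) (1 / 20) ×ˢ ball (0 : ℂ) (1 / 50)) := by fun_prop
        have hne : ∀ p ∈ (ball (-1 : ℂ) (1 / 20) ×ˢ ball (0 : ℂ) (1 / 50)), p.1 ^ 2 ≠ 0 := by
          intro p hp
          have h1 := (mu_bounds (hb _ hp.1)).2.2.1
          exact pow_ne_zero 2 (norm_pos_iff.1 (by linarith))
        have hh := (hn.mul (hdn.inv hne)).const_add 1
        refine hh.congr (fun p hp => ?_)
        simp only [div_eq_mul_inv, Pi.mul_apply, Pi.inv_apply]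
      refine DifferentiableOn.sub (by fun_prop) (DifferentiableOn.mul (by fun_prop) ?_)
      refine h1.cpow (differentiableOn_const _) ?_
      intro p hp
      left
      have h2 := hw _ hp.1 _ hp.2
      have h3 := (abs_le.1 ((abs_re_le_norm _).trans h2)).1
      simp only [add_re, one_re]; linarith
    · intro μ hμ y hy
      have h1 := mu_bounds (hb μ hμ)
      have hμ0 : μ ≠ 0 := norm_pos_iff.1 (by linarith)
      set w := 1 + 4 * y / μ ^ 2 with hwdef
      have h2 := sqrt_sq w
      have h3 : ‖w ^ (1 / 2 : ℂ) - 1‖ ≤ 1 / 10 := by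
        refine (norm_sqrt_sub_one_le w).trans ?_
        rw [hwdef, add_sub_cancel_left]; exact hw μ hμ y hy
      have h4 : ‖(-μ / 2 - μ / 2 * w ^ (1 / 2 : ℂ)) + μ‖ ≤ 1 / 10 := by
        have : (-μ / 2 - μ / 2 * w ^ (1 / 2 : ℂ)) + μ = - (μ / 2 * (w ^ (1 / 2 : ℂ) - 1)) := by ring
        rw [this, norm_neg, norm_mul, norm_div, Complex.norm_ofNat]
        nlinarith [norm_nonneg (w ^ (1 / 2 : ℂ) - 1)]
      refine ⟨?_, ?_, ?_⟩
      · simp only [zero_add, Function.iterate_one, f]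
        have h5 : μ ^ 2 * w = μ ^ 2 + 4 * y := by
          rw [hwdef, mul_add, mul_div_cancel₀ _ (pow_ne_zero 2 hμ0), mul_one]
        linear_combination μ ^ 2 / 4 * h2 + h5 / 4
      · have : (-μ / 2 - μ / 2 * w ^ (1 / 2 : ℂ)) - (1 - μ) = ((-μ / 2 - μ / 2 * w ^ (1 / 2 : ℂ)) + μ) - 1 := by ring
        rw [this]
        refine (norm_sub_le _ _).trans ?_
        rw [norm_one]; norm_num; linarith
      · have h5 := (abs_le.1 ((abs_re_le_norm _).trans h4)).1
        rw [add_re] at h5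
        have := (abs_lt.1 h1.1).2
        linarith
  | succ k ih =>
    obtain ⟨T, hTd, hT⟩ := ih
    have hre : ∀ μ ∈ ball (-1 : ℂ) (1 / 20), ∀ y : ℂ, 4 / 5 ≤ y.re → 1 ≤ (y + μ ^ 2 / 4).re := by
      intro μ hμ y hy
      have h1 := mu_bounds (hb μ hμ)
      have e : (y + μ ^ 2 / 4).re = y.re + (μ.re * μ.re - μ.im * μ.im) / 4 := by
        rw [add_re, show μ ^ 2 / 4 = μ ^ 2 / ((4 : ℝ) : ℂ) by norm_num, div_ofReal_re, pow_two, mul_re]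
      rw [e]
      have a1 := abs_lt.1 h1.1
      have a2 := abs_lt.1 h1.2.1
      nlinarith
    refine ⟨fun μ y => -μ / 2 + (T μ y + μ ^ 2 / 4) ^ (1 / 2 : ℂ), ?_, ?_⟩
    · refine DifferentiableOn.add (by fun_prop) ?_
      refine DifferentiableOn.cpow (hTd.add (by fun_prop)) (differentiableOn_const _) ?_
      intro p hp
      left
      have := hre _ hp.1 _ (hT _ hp.1 _ hp.2).2.2
      exact lt_of_lt_of_le one_pos this
    · intro μ hμ y hy
      obtain ⟨t1, t2, t3⟩ := hT μ hμ y hy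
      have h1 := mu_bounds (hb μ hμ)
      have a1 := abs_lt.1 h1.1
      set w := T μ y + μ ^ 2 / 4 with hwdef
      have h2 := sqrt_sq w
      have h3 := sqrt_re_ge_one (hre μ hμ _ t3)
      have hmr : (-μ / 2).re = - μ.re / 2 := by
        rw [show -μ / 2 = -μ / ((2 : ℝ) : ℂ) by norm_num, div_ofReal_re, neg_re]
      refine ⟨?_, ?_, ?_⟩
      · rw [Function.iterate_succ_apply]
        have : f μ (-μ / 2 + w ^ (1 / 2 : ℂ)) = T μ y := by
          simp only [f]; linear_combination h2 + hwdef
        rw [this]; exact t1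
      · have h5 : (-μ / 2 + w ^ (1 / 2 : ℂ) - (1 - μ)) * (w ^ (1 / 2 : ℂ) + (1 - μ / 2)) = T μ y - (1 - μ) := by
          linear_combination h2 + hwdef
        have h6 : 2 ≤ ‖w ^ (1 / 2 : ℂ) + (1 - μ / 2)‖ := by
          refine le_trans ?_ (re_le_norm _)
          have : (1 - μ / 2).re = 1 - μ.re / 2 := by
            rw [show 1 - μ / 2 = 1 + (-μ / 2) by ring, add_re, hmr, one_re]; ring
          rw [add_re, this]; linarith
        have h7 := congrArg norm h5
        rw [norm_mul] at h7
        have h8 : 2 / 2 ^ (k + 1) = (2 / 2 ^ k : ℝ) / 2 := by rw [pow_succ]; field_simp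
        rw [h8]
        nlinarith [norm_nonneg (-μ / 2 + w ^ (1 / 2 : ℂ) - (1 - μ))]
      · rw [add_re, hmr]; linarith

lemma diff_param (n : ℕ) : Differentiable ℂ (fun μ : ℂ => (f μ)^[n] (-μ / 2)) := by
  induction n with
  | zero => simp only [Function.iterate_zero, id]; fun_prop
  | succ n ih =>
    simp only [Function.iterate_succ_apply', f]
    exact (differentiable_id.mul ih).add (ih.pow 2)

/-- the isolated zero -/
lemma isolated_E {μs : ℂ} {J : ℕ} {η : ℝ} (hη : 0 < η) :
    ∃ δ, 0 < δ ∧ δ < η ∧ ∀ μ ∈ sphere μs δ, (f μ)^[J] (-μ / 2) - (1 - μ) ≠ 0 := by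
  set E : ℂ → ℂ := fun μ => (f μ)^[J] (-μ / 2) - (1 - μ) with hE
  have hd : Differentiable ℂ E := (diff_param J).sub (by fun_prop)
  have ha : AnalyticOnNhd ℂ E univ := hd.differentiableOn.analyticOnNhd isOpen_univ
  have h0 : E 0 ≠ 0 := by
    have : ∀ n, (f 0)^[n] 0 = 0 := by
      intro n
      induction n with
      | zero => rfl
      | succ n ih => rw [Function.iterate_succ_apply', ih]; simp [f]
    simp [hE, this]
  rcases (ha μs (mem_univ _)).eventually_eq_zero_or_eventually_ne_zero with h | h
  · exact absurd (ha.eqOn_zero_of_preconnected_of_eventuallyEq_zero isPreconnected_univ (mem_univ _) h (mem_univ 0)) h0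
  · rw [eventually_nhdsWithin_iff, Metric.eventually_nhds_iff] at h
    obtain ⟨ε, hε, h⟩ := h
    refine ⟨min ε η / 2, by positivity, ?_, fun μ hμ => ?_⟩
    · have := min_le_right ε η; linarith
    · rw [mem_sphere] at hμ
      refine h ?_ ?_
      · rw [hμ]; have := min_le_left ε η; have : 0 < min ε η := by positivity
        linarith
      · intro hh
        have : 0 < min ε η := by positivity
        rw [mem_singleton_iff] at hh
        rw [hh, dist_self] at hμ; linarith

lemma exists_param {μs : ℂ} {K : ℕ} {n : Fin K → ℕ} {R R0 r d η : ℝ} {GG : Fin K → ℂ → ℂ → ℂ}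
    (S : Sys μs K n R R0 r d η GG) (hR : R ≤ 1 / 100) {J : ℕ} (hJ : (f μs)^[J] (-μs / 2) = 1 - μs) :
    ∃ δ, 0 < δ ∧ δ < η ∧ ∃ J2, (f μs)^[J2] (-μs / 2) = 1 - μs ∧ ∀ ω, ∃ μ ∈ ball μs δ,
      (f μ)^[J2] (-μ / 2) = XX GG ω μ := by
  obtain ⟨δ, hδ, hδη, hE⟩ := isolated_E (μs := μs) (J := J) S.η_pos
  have hEd : Differentiable ℂ (fun μ => (f μ)^[J] (-μ / 2) - (1 - μ)) := (diff_param J).sub (by fun_prop)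
  obtain ⟨μm, hμm, hmin⟩ := (isCompact_sphere μs δ).exists_isMinOn (NormedSpace.sphere_nonempty.2 hδ.le)
    hEd.continuous.norm.continuousOn
  set m := ‖(f μm)^[J] (-μm / 2) - (1 - μm)‖ with hm
  have hm0 : 0 < m := norm_pos_iff.2 (hE _ hμm)
  obtain ⟨k, hk⟩ := pow_unbounded_of_one_lt (4 / m) (one_lt_two (α := ℝ))
  have hk' : 2 / 2 ^ k < m / 2 := by
    rw [div_lt_iff₀ (by positivity)] at hk ⊢
    linarith
  obtain ⟨T, hTd, hT⟩ := pre_beta k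
  have hb : ∀ μ ∈ ball μs η, μ ∈ ball (-1 : ℂ) (1 / 20) := by
    intro μ h; rw [mem_ball, dist_eq_norm, sub_neg_eq_add]; exact S.near μ h
  have hXm : ∀ ω, ∀ μ ∈ ball μs η, XX GG ω μ ∈ ball (0 : ℂ) (1 / 50) := fun ω μ h =>
    closedBall_subset_ball (by linarith) (XX_mem' S h ω)
  refine ⟨δ, hδ, hδη, k + 1 + J, ?_, fun ω => ?_⟩
  · rw [Function.iterate_add_apply, hJ]
    refine Function.iterate_fixed ?_ _
    simp only [f]; ring
  set H : ℂ → ℂ := fun μ => (f μ)^[J] (-μ / 2) - T μ (XX GG ω μ) with hH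
  have hHd : DifferentiableOn ℂ H (ball μs η) := by
    refine (diff_param J).differentiableOn.sub ?_
    have : DifferentiableOn ℂ (fun μ : ℂ => (μ, XX GG ω μ)) (ball μs η) := differentiableOn_id.prodMk (XX_diff S ω)
    exact hTd.comp this (fun μ h => ⟨hb μ h, hXm ω μ h⟩)
  have hHe : ∀ μ ∈ ball μs η, ‖H μ - ((f μ)^[J] (-μ / 2) - (1 - μ))‖ < m / 2 := by
    intro μ h
    have := (hT μ (hb μ h) _ (hXm ω μ h)).2.1
    have e : H μ - ((f μ)^[J] (-μ / 2) - (1 - μ)) = - (T μ (XX GG ω μ) - (1 - μ)) := by rw [hH]; ring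
    rw [e, norm_neg]; linarith
  have hcs : closedBall μs δ ⊆ ball μs η := closedBall_subset_ball hδη
  have hc : DiffContOnCl ℂ H (ball μs δ) := (hHd.mono hcs).diffContOnCl_ball subset_rfl
  obtain ⟨μ, hμ, h0⟩ := exists_zero hδ hc (fun z hz => by
    have h1 := hHe μs (mem_ball_self S.η_pos)
    rw [hJ, sub_self, sub_zero] at h1
    have h2 := hHe z (hcs (sphere_subset_closedBall hz))
    have h3 : m ≤ ‖(f z)^[J] (-z / 2) - (1 - z)‖ := hmin hz
    have h4 := norm_sub_norm_le ((f z)^[J] (-z / 2) - (1 - z)) (H z)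
    rw [norm_sub_rev _ (H z)] at h4
    linarith)
  refine ⟨μ, hμ, ?_⟩
  have hμ' := ball_subset_ball hδη.le hμ
  rw [Function.iterate_add_apply, sub_eq_zero.1 h0]
  exact (hT μ (hb μ hμ') _ (hXm ω μ hμ')).1

end Mand

open Complex Metric Set Filter Topology
open scoped NNReal ENNReal

namespace Mand

lemma lip_of_bound' {h : ℂ → ℂ} {c : ℂ} {R R1 ε : ℝ} (hR : R < R1) (hd : DifferentiableOn ℂ h (ball c R1))
    (hb : ∀ z ∈ ball c R1, ‖h z‖ ≤ ε) {z w : ℂ} (hz : z ∈ closedBall c R)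
    (hw : w ∈ closedBall c R) : ‖h z - h w‖ ≤ ε / ((R1 - R) / 2) * ‖z - w‖ := by
  have hm : ∀ x ∈ ball (0 : ℂ) R1, x + c ∈ ball c R1 := by
    intro x hx; rw [mem_ball, dist_eq_norm, add_sub_cancel_right]; simpa using hx
  have h1 : DifferentiableOn ℂ (fun x => h (x + c)) (ball 0 R1) := hd.comp (by fun_prop) hm
  have := lip_of_bound (z := z - c) (w := w - c) hR h1 (fun x hx => hb _ (hm x hx))
    (by rw [mem_closedBall_zero_iff, ← dist_eq_norm]; exact hz)
    (by rw [mem_closedBall_zero_iff, ← dist_eq_norm]; exact hw)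
  simpa using this

/-- difference quotient of iterates -/
noncomputable def QQ (μ : ℂ) : ℕ → ℂ → ℂ → ℂ
  | 0, _, _ => 1
  | n + 1, z, w => QQ μ n z w * (μ + (f μ)^[n] z + (f μ)^[n] w)

lemma QQ_spec (μ : ℂ) (n : ℕ) (z w : ℂ) : (f μ)^[n] z - (f μ)^[n] w = (z - w) * QQ μ n z w := by
  induction n with
  | zero => simp [QQ]
  | succ n ih =>
    simp only [Function.iterate_succ_apply', QQ]
    rw [← mul_assoc, ← ih]; simp only [f]; ring

lemma fit_cont (n : ℕ) : Continuous (fun p : ℂ × ℂ => (f p.1)^[n] p.2) := by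
  induction n with
  | zero => exact continuous_snd
  | succ n ih =>
    simp only [Function.iterate_succ_apply', f]; fun_prop

lemma QQ_cont (n : ℕ) : Continuous (fun p : ℂ × ℂ × ℂ => QQ p.1 n p.2.1 p.2.2) := by
  induction n with
  | zero => exact continuous_const
  | succ n ih =>
    simp only [QQ]
    have h1 : Continuous (fun p : ℂ × ℂ × ℂ => (f p.1)^[n] p.2.1) := (fit_cont n).comp (by fun_prop : Continuous fun p : ℂ × ℂ × ℂ => (p.1, p.2.1))
    have h2 : Continuous (fun p : ℂ × ℂ × ℂ => (f p.1)^[n] p.2.2) := (fit_cont n).comp (by fun_prop : Continuous fun p : ℂ × ℂ × ℂ => (p.1, p.2.2))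
    exact ih.mul ((continuous_fst.add h1).add h2)

section
variable {μs : ℂ} {K : ℕ} {n : Fin K → ℕ} {R R0 r d η : ℝ} {GG : Fin K → ℂ → ℂ → ℂ}

lemma QQ_ne (S : Sys μs K n R R0 r d η GG) {μ : ℂ} (hμ : μ ∈ ball μs η) (i : Fin K) {u : ℂ}
    (hu : u ∈ closedBall (0 : ℂ) R0) : QQ μ (n i) (GG i μ u) (GG i μ u) ≠ 0 := by
  have huR : ∀ᶠ u' in 𝓝[≠] u, u' ∈ closedBall (0 : ℂ) R := by
    refine nhdsWithin_le_nhds ?_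
    exact mem_of_superset (isOpen_ball.mem_nhds (closedBall_subset_ball S.R0_lt hu)) ball_subset_closedBall
  have hu' : u ∈ closedBall (0 : ℂ) R := closedBall_subset_closedBall S.R0_lt.le hu
  have hG : Tendsto (fun u' => GG i μ u') (𝓝[≠] u) (𝓝 (GG i μ u)) := by
    rw [tendsto_iff_norm_sub_tendsto_zero]
    have h2 : Tendsto (fun u' : ℂ => ‖u' - u‖ / 2) (𝓝[≠] u) (𝓝 0) := by
      have : Continuous (fun u' : ℂ => ‖u' - u‖ / 2) := by fun_prop
      have := this.tendsto u
      simp only [sub_self, norm_zero, zero_div] at this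
      exact this.mono_left nhdsWithin_le_nhds
    refine squeeze_zero' (Eventually.of_forall fun _ => norm_nonneg _) ?_ h2
    filter_upwards [huR] with u' h
    exact S.upp i μ hμ _ h _ hu'
  have h3 : Tendsto (fun u' => ‖QQ μ (n i) (GG i μ u) (GG i μ u')‖) (𝓝[≠] u) (𝓝 ‖QQ μ (n i) (GG i μ u) (GG i μ u)‖) := by
    have := ((QQ_cont (n i)).tendsto (μ, GG i μ u, GG i μ u)).comp
      (tendsto_const_nhds.prodMk_nhds (tendsto_const_nhds.prodMk_nhds hG))
    exact this.norm
  have h4 : 2 ≤ ‖QQ μ (n i) (GG i μ u) (GG i μ u)‖ := by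
    refine ge_of_tendsto h3 ?_
    filter_upwards [huR, self_mem_nhdsWithin] with u' h hne
    have e1 := QQ_spec μ (n i) (GG i μ u) (GG i μ u')
    rw [S.inv i μ hμ _ hu', S.inv i μ hμ _ h] at e1
    have e2 := S.upp i μ hμ _ hu' _ h
    have e3 := congrArg norm e1
    rw [norm_mul] at e3
    have e4 : 0 < ‖u - u'‖ := norm_pos_iff.2 (sub_ne_zero.2 (fun hh => hne hh.symm))
    have e5 := mul_le_mul_of_nonneg_right e2 (norm_nonneg (QQ μ (n i) (GG i μ u) (GG i μ u')))
    rw [← e3] at e5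
    by_contra! hlt
    nlinarith
  intro h0
  rw [h0, norm_zero] at h4; linarith

lemma NN_ge (hn : ∀ i, 1 ≤ n i) (j : ℕ) (ω : ℕ → Fin K) : j ≤ NN n j ω := by
  induction j with
  | zero => simp
  | succ j ih => simp only [NN]; have := hn (ω j); omega

lemma param_mem (S : Sys μs K n R R0 r d η GG) (hR : R ≤ 1 / 100) (hn : ∀ i, 1 ≤ n i) {J2 : ℕ}
    {ω : ℕ → Fin K} {μ : ℂ} (hμ : μ ∈ ball μs η) (h : (f μ)^[J2] (-μ / 2) = XX GG ω μ) :
    cc μ ∈ MM := by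
  rw [mem_MM (S.near μ hμ)]
  intro m
  by_contra! hm
  have h1 := escape_iter (S.near μ hμ) hm (NN n m ω + J2 - m)
  rw [← Function.iterate_add_apply] at h1
  have := NN_ge hn m ω
  rw [show NN n m ω + J2 - m + m = NN n m ω + J2 by omega, Function.iterate_add_apply, h, XX_iter S hμ] at h1
  have h2 := XX_mem' S hμ (sh m ω)
  rw [mem_closedBall_zero_iff] at h2
  have h3 : (1 : ℝ) ≤ 2 ^ (NN n m ω + J2 - m) := one_le_pow₀ (by norm_num)
  nlinarith

lemma param_not_interior (S : Sys μs K n R R0 r d η GG) (hR : R ≤ 1 / 100) {J2 : ℕ}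
    (hJ2 : (f μs)^[J2] (-μs / 2) = 1 - μs)
    {ω : ℕ → Fin K} {μ0 : ℂ} (hμ : μ0 ∈ ball μs η) (h : (f μ0)^[J2] (-μ0 / 2) = XX GG ω μ0) :
    cc μ0 ∉ interior MM := by
  intro hin
  have hcc : Continuous cc := by unfold cc; fun_prop
  have hmem : {μ | cc μ ∈ MM} ∩ ball μs η ∈ 𝓝 μ0 :=
    inter_mem (hcc.continuousAt (mem_interior_iff_mem_nhds.1 hin)) (isOpen_ball.mem_nhds hμ)
  obtain ⟨δ, hδ, hsub⟩ := Metric.mem_nhds_iff.1 hmem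
  have hbdd : ∀ μ ∈ ball μ0 δ, ∀ m, ‖(f μ)^[m] (-μ / 2)‖ ≤ 4 := fun μ hh =>
    (mem_MM (S.near μ (hsub hh).2)).1 (hsub hh).1
  set ψ : ℕ → ℂ → ℂ := fun j μ => (f μ)^[NN n j ω + J2] (-μ / 2) with hψ
  have hψd : ∀ j, Differentiable ℂ (ψ j) := fun j => diff_param _
  have hψ0 : ∀ j, ψ j μ0 = XX GG (sh j ω) μ0 := by
    intro j
    simp only [hψ]
    rw [Function.iterate_add_apply, h, XX_iter S hμ]
  set L := 4 / ((δ - δ / 2) / 2) with hL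
  have hL0 : 0 < L := by rw [hL]; apply div_pos <;> linarith
  have hlip : ∀ j, ∀ μ ∈ closedBall μ0 (δ / 2), ‖ψ j μ - ψ j μ0‖ ≤ L * ‖μ - μ0‖ := fun j μ hh =>
    lip_of_bound' (by linarith) (hψd j).differentiableOn (fun z hz => hbdd z hz _) hh
      (mem_closedBall_self (by linarith))
  set δ2 := min (δ / 2) ((R - R0) / L) with hδ2
  have hδ20 : 0 < δ2 := lt_min (by linarith) (div_pos (by linarith [S.R0_lt]) hL0)
  have hs2 : ball μ0 δ2 ⊆ ball μs η := fun μ hh =>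
    (hsub (ball_subset_ball ((min_le_left _ _).trans (by linarith)) hh)).2
  have hψR : ∀ j, ∀ μ ∈ ball μ0 δ2, ψ j μ ∈ closedBall (0 : ℂ) R := by
    intro j μ hh
    have h1 := hlip j μ (ball_subset_closedBall (ball_subset_ball (min_le_left _ _) hh))
    have h2 := XX_mem S hμ (sh j ω)
    rw [← hψ0] at h2
    rw [mem_closedBall_zero_iff] at h2 ⊢
    rw [mem_ball, dist_eq_norm] at hh
    have h3 : ‖μ - μ0‖ ≤ (R - R0) / L := hh.le.trans (min_le_right _ _)
    rw [le_div_iff₀ hL0] at h3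
    have h4 := norm_add_le (ψ j μ - ψ j μ0) (ψ j μ0)
    rw [sub_add_cancel] at h4
    linarith
  have key : ∀ j, ∀ μ ∈ ball μ0 δ2, ψ j μ = GG (ω j) μ (ψ (j + 1) μ) := by
    intro j
    have hB : DifferentiableOn ℂ (fun μ => GG (ω j) μ (ψ (j + 1) μ)) (ball μ0 δ2) :=
      S.diffX (ω j) hs2 (hψd _).differentiableOn (hψR (j + 1))
    have hA : DifferentiableOn ℂ (ψ j) (ball μ0 δ2) := (hψd j).differentiableOn
    have hc0 : μ0 ∈ ball μ0 δ2 := mem_ball_self hδ20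
    have h0 : ψ j μ0 = GG (ω j) μ0 (ψ (j + 1) μ0) := by
      rw [hψ0, hψ0, XX_eq S hμ, sh_sh]; simp [sh]
    have hev : ψ j =ᶠ[𝓝 μ0] (fun μ => GG (ω j) μ (ψ (j + 1) μ)) := by
      have c1 : ContinuousAt (fun μ => QQ μ (n (ω j)) (ψ j μ) (GG (ω j) μ (ψ (j + 1) μ))) μ0 := by
        have c2 : ContinuousAt (fun μ => (μ, ψ j μ, GG (ω j) μ (ψ (j + 1) μ))) μ0 :=
          continuousAt_id.prodMk ((hψd j).continuous.continuousAt.prodMk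
            (hB.continuousOn.continuousAt (isOpen_ball.mem_nhds hc0)))
        exact ContinuousAt.comp (f := fun μ => (μ, ψ j μ, GG (ω j) μ (ψ (j + 1) μ)))
          (g := fun p : ℂ × ℂ × ℂ => QQ p.1 (n (ω j)) p.2.1 p.2.2) (QQ_cont (n (ω j))).continuousAt c2
      have hne : QQ μ0 (n (ω j)) (ψ j μ0) (GG (ω j) μ0 (ψ (j + 1) μ0)) ≠ 0 := by
        rw [h0, hψ0]; exact QQ_ne S hμ _ (XX_mem S hμ _)
      filter_upwards [c1.eventually_ne hne, isOpen_ball.mem_nhds hc0] with μ h1 h2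
      have h3 := QQ_spec μ (n (ω j)) (ψ j μ) (GG (ω j) μ (ψ (j + 1) μ))
      rw [S.inv _ μ (hs2 h2) _ (hψR _ μ h2)] at h3
      have h4 : (f μ)^[n (ω j)] (ψ j μ) = ψ (j + 1) μ := by
        simp only [hψ]
        rw [← Function.iterate_add_apply]
        have : n (ω j) + (NN n j ω + J2) = NN n (j + 1) ω + J2 := by simp only [NN]; omega
        rw [this]
      rw [h4, sub_self] at h3
      rcases mul_eq_zero.1 h3.symm with h5 | h5
      · exact sub_eq_zero.1 h5
      · exact absurd h5 h1
    exact (hA.analyticOnNhd isOpen_ball).eqOn_of_preconnected_of_eventuallyEq (hB.analyticOnNhd isOpen_ball)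
      (convex_ball μ0 δ2).isPreconnected hc0 hev
  have hdist : ∀ μ ∈ ball μ0 δ2, ∀ j i, ‖ψ i μ - XX GG (sh i ω) μ‖ ≤ 2 * R / 2 ^ j := by
    intro μ hh j
    induction j with
    | zero =>
      intro i
      have h1 := hψR i μ hh
      have h2 := XX_mem' S (hs2 hh) (sh i ω)
      rw [mem_closedBall_zero_iff] at h1 h2
      refine (norm_sub_le _ _).trans ?_
      rw [pow_zero, div_one]; linarith
    | succ j ih =>
      intro i
      have e : XX GG (sh i ω) μ = GG (ω i) μ (XX GG (sh (i + 1) ω) μ) := by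
        rw [XX_eq S (hs2 hh), sh_sh]; simp [sh]
      rw [key i μ hh, e]
      have h1 := S.upp (ω i) μ (hs2 hh) _ (hψR (i + 1) μ hh) _ (XX_mem' S (hs2 hh) (sh (i + 1) ω))
      have h2 := ih (i + 1)
      have h8 : 2 * R / 2 ^ (j + 1) = (2 * R / 2 ^ j : ℝ) / 2 := by rw [pow_succ]; field_simp
      rw [h8]; linarith
  have heq : ∀ μ ∈ ball μ0 δ2, ψ 0 μ = XX GG ω μ := by
    intro μ hh
    have h1 : Tendsto (fun k : ℕ => 2 * R * (1 / 2) ^ k) atTop (𝓝 (2 * R * 0)) :=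
      (tendsto_pow_atTop_nhds_zero_of_lt_one (by norm_num) (by norm_num)).const_mul _
    rw [mul_zero] at h1
    have h2 : ‖ψ 0 μ - XX GG ω μ‖ ≤ 0 := by
      refine ge_of_tendsto h1 (Eventually.of_forall fun k => ?_)
      have := hdist μ hh k 0
      rw [one_div, inv_pow, ← div_eq_mul_inv]
      exact this
    exact sub_eq_zero.1 (norm_le_zero_iff.1 h2)
  have hall : EqOn (ψ 0) (XX GG ω) (ball μs η) := by
    refine ((hψd 0).differentiableOn.analyticOnNhd isOpen_ball).eqOn_of_preconnected_of_eventuallyEq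
      ((XX_diff S ω).analyticOnNhd isOpen_ball) (convex_ball μs η).isPreconnected hμ ?_
    exact mem_of_superset (isOpen_ball.mem_nhds (mem_ball_self hδ20)) heq
  have h1 := hall (mem_ball_self S.η_pos)
  simp only [hψ, NN, zero_add] at h1
  rw [hJ2] at h1
  have h2 := XX_mem' S (mem_ball_self S.η_pos) ω
  rw [← h1, mem_closedBall_zero_iff] at h2
  have h3 := re_le_norm (1 - μs)
  have h4 := abs_lt.1 (mu_bounds (S.near μs (mem_ball_self S.η_pos))).1
  rw [sub_re, one_re] at h3
  linarith

/-- **Theorem A.** -/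
theorem theoremA {ρ s : ℝ} {G : Fin K → ℂ → ℂ} {J : ℕ} (hK : 2 ≤ K)
    (hμ : ‖μs + 1‖ < 1 / 20) (hR : 0 < R) (hRρ : R < ρ) (hR0 : R0 < R) (hr : 0 < r) (hd : 0 < d)
    (hR100 : R ≤ 1 / 100) (hn : ∀ i, 1 ≤ n i) (hJ : (f μs)^[J] (-μs / 2) = 1 - μs)
    (hG : ∀ i, DifferentiableOn ℂ (G i) (ball 0 ρ))
    (hinv : ∀ i, ∀ z ∈ ball (0 : ℂ) ρ, (f μs)^[n i] (G i z) = z)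
    (hmaps : ∀ i, ∀ z ∈ closedBall (0 : ℂ) R, G i z ∈ closedBall (0 : ℂ) R0)
    (hlow : ∀ i, ∀ z ∈ closedBall (0 : ℂ) R, ∀ w ∈ closedBall (0 : ℂ) R,
      r * ‖z - w‖ ≤ ‖G i z - G i w‖)
    (hupp : ∀ i, ∀ z ∈ closedBall (0 : ℂ) R, ∀ w ∈ closedBall (0 : ℂ) R,
      ‖G i z - G i w‖ ≤ ‖z - w‖ / 4)
    (hsep : ∀ i j, i ≠ j → ∀ z ∈ closedBall (0 : ℂ) R, ∀ w ∈ closedBall (0 : ℂ) R,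
      d ≤ ‖G i z - G j w‖) (hs : 0 < s) (hKs : 1 ≤ K * (r / 2) ^ s) :
    ENNReal.ofReal s ≤ dimH (frontier MM) := by
  obtain ⟨η, GG, S⟩ := exists_sys hμ hR hRρ hR0 hr hd hG hinv hmaps hlow hupp hsep
  obtain ⟨δ, hδ, hδη, J2, hJ2, hω⟩ := exists_param S hR100 hJ
  choose m hmδ hm using hω
  have hmη : ∀ ω, m ω ∈ ball μs η := fun ω => ball_subset_ball hδη.le (hmδ ω)
  have hfr : range (fun ω => cc (m ω)) ⊆ frontier MM := by
    rintro _ ⟨ω, rfl⟩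
    exact ⟨subset_closure (param_mem S hR100 hn (hmη ω) (hm ω)), param_not_interior S hR100 hJ2 (hmη ω) (hm ω)⟩
  refine le_trans ?_ (dimH_mono hfr)
  set δ1 := (δ + η) / 2 with hδ1
  obtain ⟨C, hC⟩ := ((isCompact_closedBall μs δ1).exists_bound_of_continuousOn
    (diff_param J2).continuous.continuousOn)
  have hC' : 0 ≤ C := (norm_nonneg _).trans (hC μs (mem_closedBall_self (by linarith)))
  set L := (C + R) / ((δ1 - δ) / 2) with hL
  have hL0 : 0 < L := by rw [hL]; apply div_pos <;> linarith
  refine dim_lemma (A := d / 2 / L / 2) (r' := r / 2) (s := s.toNNReal) hK (by simpa using hs) (by positivity)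
    (by positivity) (by rw [Real.coe_toNNReal _ hs.le]; exact hKs) ?_
  intro k ω ω' h1 h2
  have e1 := XX_sep S (hmη ω) k ω ω' h1 h2
  have e2 := lip_of_bound' (h := fun μ => (f μ)^[J2] (-μ / 2) - XX GG ω' μ) (c := μs) (R := δ) (R1 := δ1)
    (ε := C + R) (by linarith)
    ((diff_param J2).differentiableOn.sub ((XX_diff S ω').mono (ball_subset_ball (by linarith))))
    (fun z hz => by
      refine (norm_sub_le _ _).trans (add_le_add (hC z (ball_subset_closedBall hz)) ?_)
      have := XX_mem' S (ball_subset_ball (by linarith) hz) ω'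
      simpa using this)
    (ball_subset_closedBall (hmδ ω)) (ball_subset_closedBall (hmδ ω'))
  simp only [hm] at e2
  rw [sub_self, sub_zero] at e2
  have e3 := cc_sep (S.near _ (hmη ω)) (S.near _ (hmη ω'))
  have e4 : d / 2 * (r / 2) ^ k ≤ L * ‖m ω - m ω'‖ := e1.trans e2
  have e5 : d / 2 / L * (r / 2) ^ k ≤ ‖m ω - m ω'‖ := by
    rw [div_mul_eq_mul_div, div_le_iff₀ hL0]; linarith
  have : d / 2 / L / 2 * (r / 2) ^ k = (d / 2 / L * (r / 2) ^ k) / 2 := by ring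
  rw [this]; linarith

end
end Mand

open Complex Metric Set Filter Topology
open scoped NNReal ENNReal

namespace Mand

/-- the parameter -/
noncomputable def mu (l0 : ℂ) (q : ℕ) (l : ℂ) : ℂ := l0 * exp (l / q)

/-- the return map -/
noncomputable def FF (l0 : ℂ) (q : ℕ) (l z : ℂ) : ℂ := (f (mu l0 q l))^[q] z

/-- Local expansion data. -/
structure Base (l0 : ℂ) (q N : ℕ) (B : ℂ) (C ε : ℝ) : Prop where
  q_pos : 0 < q
  q_le : q ≤ N
  l0_pow : l0 ^ q = 1
  l0_powN : l0 ^ N = 1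
  near : ‖l0 + 1‖ < 1 / 40
  B_ne : B ≠ 0
  C_pos : 0 < C
  ε_pos : 0 < ε
  ε_le : ε ≤ 1
  exp : ∀ l z, ‖l‖ ≤ ε → ‖z‖ ≤ ε →
    ‖FF l0 q l z - z * (exp l + B * z ^ N)‖ ≤ C * ‖z‖ * (‖z‖ ^ (N + 1) + ‖l‖ * ‖z‖)
  nrm : ‖l0‖ = 1

lemma mu_pow {l0 : ℂ} {q : ℕ} (hq : 0 < q) (h : l0 ^ q = 1) (l : ℂ) : mu l0 q l ^ q = exp l := by
  unfold mu
  rw [mul_pow, h, one_mul, ← exp_nat_mul, mul_div_cancel₀]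
  exact_mod_cast hq.ne'

lemma mu_zero (l0 : ℂ) (q : ℕ) : mu l0 q 0 = l0 := by simp [mu]

lemma mu_sub_le {l0 : ℂ} {q : ℕ} (hq : 0 < q) (h0 : ‖l0‖ = 1) {l : ℂ} (hl : ‖l‖ ≤ 1) :
    ‖mu l0 q l - l0‖ ≤ 2 * ‖l‖ := by
  have e : mu l0 q l - l0 = l0 * (exp (l / q) - 1) := by unfold mu; ring
  have h1 : ‖l / q‖ ≤ ‖l‖ := by
    rw [norm_div, norm_natCast]
    exact div_le_self (norm_nonneg _) (by exact_mod_cast hq)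
  rw [e, norm_mul, h0, one_mul]
  exact (norm_exp_sub_one_le (h1.trans hl)).trans (by linarith)

lemma perturb {l0 : ℂ} {q : ℕ} (hq : 0 < q) (h0 : ‖l0‖ = 1) (k : ℕ) : ∃ C > 0, ∀ l z : ℂ, ‖l‖ ≤ 1 → ‖z‖ ≤ 1 →
    ‖(f (mu l0 q l))^[k] z‖ ≤ C * ‖z‖ ∧ ‖(f l0)^[k] z - l0 ^ k * z‖ ≤ C * ‖z‖ ^ 2 ∧
    ‖(f (mu l0 q l))^[k] z - (f l0)^[k] z‖ ≤ C * ‖l‖ * ‖z‖ ∧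
    ‖((f (mu l0 q l))^[k] z - mu l0 q l ^ k * z) - ((f l0)^[k] z - l0 ^ k * z)‖ ≤ C * ‖l‖ * ‖z‖ ^ 2 := by
  induction k with
  | zero =>
    refine ⟨1, one_pos, fun l z hl hz => ?_⟩
    simp only [Function.iterate_zero, id, pow_zero, one_mul, sub_self, norm_zero]
    refine ⟨le_rfl, by positivity, by positivity, by positivity⟩
  | succ k ih =>
    obtain ⟨C, hC, ih⟩ := ih
    refine ⟨3 * C + 3 * C ^ 2 + 2 * C + 2 * C ^ 2 + 4 * C, by positivity, fun l z hl hz => ?_⟩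
    obtain ⟨i1, i2, i3, i4⟩ := ih l z hl hz
    obtain ⟨j1, -, -, -⟩ := ih 0 z (by simp) hz
    rw [mu_zero] at j1
    have hm := mu_sub_le hq h0 hl
    simp only [Function.iterate_succ_apply']
    set μ := mu l0 q l
    set a := (f μ)^[k] z
    set b := (f l0)^[k] z
    have hμ : ‖μ‖ ≤ 3 := by
      have := norm_add_le (μ - l0) l0
      rw [sub_add_cancel, h0] at this
      linarith
    have nz := norm_nonneg z
    have nl := norm_nonneg l
    have hz2 : ‖z‖ ^ 2 ≤ ‖z‖ := by nlinarith
    have ha2 : ‖a‖ ^ 2 ≤ C ^ 2 * ‖z‖ ^ 2 := by rw [← mul_pow]; gcongr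
    have hb2 : ‖b‖ ^ 2 ≤ C ^ 2 * ‖z‖ ^ 2 := by rw [← mul_pow]; gcongr
    have hC2 : 0 ≤ C ^ 2 := by positivity
    refine ⟨?_, ?_, ?_, ?_⟩
    · unfold f
      refine (norm_add_le _ _).trans ?_
      rw [norm_mul, norm_pow]
      have : ‖μ‖ * ‖a‖ ≤ 3 * (C * ‖z‖) := by gcongr
      have : C ^ 2 * ‖z‖ ^ 2 ≤ C ^ 2 * ‖z‖ := by gcongr
      nlinarith [mul_nonneg hC.le nz, mul_nonneg hC2 nz]
    · have e : f l0 b - l0 ^ (k + 1) * z = l0 * (b - l0 ^ k * z) + b ^ 2 := by unfold f; ring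
      rw [e]
      refine (norm_add_le _ _).trans ?_
      rw [norm_mul, norm_pow, h0, one_mul]
      nlinarith [mul_nonneg hC.le (sq_nonneg ‖z‖), mul_nonneg hC2 (sq_nonneg ‖z‖)]
    · have e : f μ a - f l0 b = μ * (a - b) + (μ - l0) * b + (a - b) * (a + b) := by unfold f; ring
      rw [e]
      refine (norm_add₃_le).trans ?_
      rw [norm_mul, norm_mul, norm_mul]
      have e1 : ‖μ‖ * ‖a - b‖ ≤ 3 * (C * ‖l‖ * ‖z‖) := by gcongr
      have e2 : ‖μ - l0‖ * ‖b‖ ≤ 2 * ‖l‖ * (C * ‖z‖) := by gcongr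
      have e3 : ‖a - b‖ * ‖a + b‖ ≤ (C * ‖l‖ * ‖z‖) * (C * 1 + C * 1) := by
        gcongr
        exact (norm_add_le _ _).trans (add_le_add (i1.trans (by gcongr)) (j1.trans (by gcongr)))
      have p1 : 0 ≤ C * ‖l‖ * ‖z‖ := by positivity
      have p2 : 0 ≤ C ^ 2 * ‖l‖ * ‖z‖ := by positivity
      nlinarith
    · have e : (f μ a - μ ^ (k + 1) * z) - (f l0 b - l0 ^ (k + 1) * z) =
        μ * ((a - μ ^ k * z) - (b - l0 ^ k * z)) + (μ - l0) * (b - l0 ^ k * z) + (a - b) * (a + b) := by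
        unfold f; ring
      rw [e]
      refine (norm_add₃_le).trans ?_
      rw [norm_mul, norm_mul, norm_mul]
      have e1 : ‖μ‖ * ‖(a - μ ^ k * z) - (b - l0 ^ k * z)‖ ≤ 3 * (C * ‖l‖ * ‖z‖ ^ 2) := by gcongr
      have e2 : ‖μ - l0‖ * ‖b - l0 ^ k * z‖ ≤ 2 * ‖l‖ * (C * ‖z‖ ^ 2) := by gcongr
      have e3 : ‖a - b‖ * ‖a + b‖ ≤ (C * ‖l‖ * ‖z‖) * (C * ‖z‖ + C * ‖z‖) := by
        gcongr
        exact (norm_add_le _ _).trans (add_le_add i1 j1)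
      have p1 : 0 ≤ C * ‖l‖ * ‖z‖ ^ 2 := by positivity
      have p2 : 0 ≤ C ^ 2 * ‖l‖ * ‖z‖ ^ 2 := by positivity
      nlinarith

lemma expand0 {l0 : ℂ} {q : ℕ} (hq : 0 < q) (h0 : ‖l0‖ = 1) (hl : l0 ^ q = 1) :
    ∃ (N : ℕ) (g : ℂ → ℂ), 1 ≤ N ∧ AnalyticAt ℂ g 0 ∧ g 0 ≠ 0 ∧ l0 ^ N = 1 ∧
      ∀ᶠ z in 𝓝 0, (f l0)^[q] z - z = z ^ (N + 1) * g z := by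
  have hl0 : l0 ≠ 0 := norm_pos_iff.1 (by rw [h0]; exact one_pos)
  set D : ℂ → ℂ := fun z => (f l0)^[q] z - z with hD
  have hDd : Differentiable ℂ D := (fit_diff l0 q).sub differentiable_id
  have hDa : AnalyticOnNhd ℂ D univ := hDd.differentiableOn.analyticOnNhd isOpen_univ
  have hf0 : ∀ n, (f l0)^[n] 0 = 0 := fun n => Function.iterate_fixed (by simp [f]) n
  have hDne : D (-l0) ≠ 0 := by
    have : (f l0)^[q] (-l0) = 0 := by
      obtain ⟨p, rfl⟩ := Nat.exists_eq_succ_of_ne_zero hq.ne'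
      rw [Function.iterate_succ_apply, show f l0 (-l0) = 0 by unfold f; ring, hf0]
    simp only [hD, this]; simpa using hl0
  have hnz : ¬ ∀ᶠ z in 𝓝 0, D z = 0 := fun h =>
    hDne (hDa.eqOn_zero_of_preconnected_of_eventuallyEq_zero isPreconnected_univ (mem_univ 0) h (mem_univ _))
  obtain ⟨n, g, hg, hg0, hDg⟩ := ((hDa 0 (mem_univ _)).exists_eventuallyEq_pow_smul_nonzero_iff).2 hnz
  simp only [sub_zero, smul_eq_mul] at hDg
  obtain ⟨C, hC, hp⟩ := perturb hq h0 q
  -- order at least two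
  have hn2 : 2 ≤ n := by
    by_contra! hlt
    have hb : ∀ᶠ z in 𝓝[≠] (0 : ℂ), ‖g z‖ ≤ C * ‖z‖ := by
      filter_upwards [nhdsWithin_le_nhds hDg, nhdsWithin_le_nhds (ball_mem_nhds (0 : ℂ) one_pos), self_mem_nhdsWithin] with z h1 h2 h3
      have hz1 : ‖z‖ ≤ 1 := by simpa using (mem_ball_zero_iff.1 h2).le
      have h4 := (hp 0 z (by simp) hz1).2.1
      rw [hl, one_mul] at h4
      have h5 : ‖z‖ ^ n * ‖g z‖ ≤ C * ‖z‖ ^ 2 := by rw [← norm_pow, ← norm_mul, ← h1]; exact h4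
      have hz0 : 0 < ‖z‖ := norm_pos_iff.2 h3
      have h6 : ‖z‖ ^ 1 ≤ ‖z‖ ^ n := pow_le_pow_of_le_one hz0.le hz1 (by omega)
      have h7 : ‖z‖ * ‖g z‖ ≤ ‖z‖ * (C * ‖z‖) := by
        rw [pow_one] at h6
        nlinarith [norm_nonneg (g z)]
      exact le_of_mul_le_mul_left h7 hz0
    have ht1 : Tendsto (fun z => ‖g z‖) (𝓝[≠] 0) (𝓝 ‖g 0‖) :=
      (hg.continuousAt.norm.tendsto).mono_left nhdsWithin_le_nhds
    have ht2 : Tendsto (fun z : ℂ => C * ‖z‖) (𝓝[≠] 0) (𝓝 0) := by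
      have : Continuous (fun z : ℂ => C * ‖z‖) := by fun_prop
      have := this.tendsto 0
      simp only [norm_zero, mul_zero] at this
      exact this.mono_left nhdsWithin_le_nhds
    have := le_of_tendsto_of_tendsto ht1 ht2 hb
    exact hg0 (norm_le_zero_iff.1 this)
  obtain ⟨N, rfl⟩ : ∃ N, n = N + 1 := ⟨n - 1, by omega⟩
  refine ⟨N, g, by omega, hg, hg0, ?_, hDg⟩
  have hcom : ∀ z, D (f l0 z) = D z * (l0 + 2 * z + D z) := by
    intro z
    simp only [hD]
    have : (f l0)^[q] (f l0 z) = f l0 ((f l0)^[q] z) := by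
      rw [← Function.iterate_succ_apply, Function.iterate_succ_apply']
    rw [this]; unfold f; ring
  have hfc : Continuous (f l0) := (f_diff l0).continuous
  have hf00 : f l0 0 = 0 := by simp [f]
  have hev : ∀ᶠ z in 𝓝[≠] (0 : ℂ), (l0 + z) ^ (N + 1) * g (f l0 z) = g z * (l0 + 2 * z + D z) := by
    have h1 : ∀ᶠ z in 𝓝 (0 : ℂ), D (f l0 z) = (f l0 z) ^ (N + 1) * g (f l0 z) := by
      have : Tendsto (f l0) (𝓝 0) (𝓝 0) := by have := hfc.tendsto 0; rwa [hf00] at this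
      exact this.eventually hDg
    filter_upwards [nhdsWithin_le_nhds h1, nhdsWithin_le_nhds hDg, self_mem_nhdsWithin] with z h1 h2 h3
    have h4 := hcom z
    rw [h1] at h4
    have hz : z ^ (N + 1) ≠ 0 := pow_ne_zero _ h3
    apply mul_left_cancel₀ hz
    calc z ^ (N + 1) * ((l0 + z) ^ (N + 1) * g (f l0 z)) = (f l0 z) ^ (N + 1) * g (f l0 z) := by
          rw [show f l0 z = z * (l0 + z) by unfold f; ring, mul_pow]; ring
      _ = _ := by rw [h4]; nth_rewrite 1 [h2]; ring
  have c1 : Tendsto (fun z => (l0 + z) ^ (N + 1) * g (f l0 z)) (𝓝[≠] 0) (𝓝 ((l0 + 0) ^ (N + 1) * g (f l0 0))) := by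
    have hgc : ContinuousAt (fun z => g (f l0 z)) 0 := by
      refine ContinuousAt.comp ?_ hfc.continuousAt
      rw [hf00]; exact hg.continuousAt
    have h1 : ContinuousAt (fun z => (l0 + z) ^ (N + 1)) 0 := by fun_prop
    exact (h1.mul hgc).tendsto.mono_left nhdsWithin_le_nhds
  have c2 : Tendsto (fun z => g z * (l0 + 2 * z + D z)) (𝓝[≠] 0) (𝓝 (g 0 * (l0 + 2 * 0 + D 0))) := by
    have h1 : ContinuousAt (fun z => l0 + 2 * z + D z) 0 := by
      have := hDd.continuous
      fun_prop
    exact (hg.continuousAt.mul h1).tendsto.mono_left nhdsWithin_le_nhds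
  have heq := tendsto_nhds_unique (c1.congr' hev) c2
  have hD0 : D 0 = 0 := by simp [hD, hf0]
  rw [hf00, hD0, add_zero, mul_zero, add_zero, add_zero, mul_comm (g 0)] at heq
  have h5 := mul_right_cancel₀ hg0 heq
  rw [pow_succ] at h5
  exact mul_right_cancel₀ hl0 (by rw [h5, one_mul])

lemma exists_base (q0 : ℕ) : ∃ (l0 : ℂ) (q N : ℕ) (B : ℂ) (C ε : ℝ), q0 ≤ q ∧ Base l0 q N B C ε := by
  set k := q0 + 200 with hk
  set q := 2 * k + 1 with hqd
  have hq : 0 < q := by omega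
  have hqC : (q : ℂ) ≠ 0 := by exact_mod_cast hq.ne'
  have hprim : IsPrimitiveRoot (exp (2 * Real.pi * I * (k / q))) q :=
    Complex.isPrimitiveRoot_exp_of_coprime k q hq.ne' (by
      rw [hqd]; simp [Nat.coprime_mul_left_add_right])
  set l0 := exp (2 * Real.pi * I * (k / q)) with hl0
  have hl : l0 ^ q = 1 := hprim.pow_eq_one
  have h0 : ‖l0‖ = 1 := hprim.norm'_eq_one hq.ne'
  have hnear : ‖l0 + 1‖ < 1 / 40 := by
    have e : l0 = - exp (-(Real.pi * I / q)) := by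
      have : (2 * Real.pi * I * (k / q) : ℂ) = Real.pi * I + -(Real.pi * I / q) := by
        have : (2 * k + 1 : ℂ) = q := by rw [hqd]; push_cast; ring
        field_simp
        linear_combination this
      rw [hl0, this, exp_add, exp_pi_mul_I]; ring
    have h1 : ‖-(Real.pi * I / q)‖ ≤ 1 / 100 := by
      rw [norm_neg, norm_div, norm_mul, norm_I, mul_one, norm_natCast, Complex.norm_real, Real.norm_eq_abs, abs_of_pos Real.pi_pos]
      have : (401 : ℝ) ≤ q := by exact_mod_cast (by omega : 401 ≤ q)
      rw [div_le_iff₀ (by linarith)]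
      have := Real.pi_lt_four
      linarith
    have h2 := norm_exp_sub_one_le (h1.trans (by norm_num))
    rw [e, show -exp (-(Real.pi * I / q)) + 1 = -(exp (-(Real.pi * I / q)) - 1) by ring, norm_neg]
    linarith
  obtain ⟨N, g, hN1, hga, hg0, hlN, hD⟩ := expand0 hq h0 hl
  have hqN : q ≤ N := Nat.le_of_dvd (by omega) (hprim.dvd_of_pow_eq_one N hlN)
  obtain ⟨C1, hC1, hp⟩ := perturb hq h0 q
  obtain ⟨C2, hC2⟩ := (hga.differentiableAt.isBigO_sub).bound
  obtain ⟨ε1, hε1, hε⟩ := Metric.eventually_nhds_iff.1 (hC2.and hD)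
  refine ⟨l0, q, N, g 0, C1 + |C2| , min (ε1 / 2) 1, by omega, ⟨hq, hqN, hl, hlN, hnear, hg0, by positivity,
    by positivity, min_le_right _ _, ?_, h0⟩⟩
  intro l z hlε hzε
  have hz1 : ‖z‖ ≤ 1 := hzε.trans (min_le_right _ _)
  have hl1 : ‖l‖ ≤ 1 := hlε.trans (min_le_right _ _)
  have h1 := (hp l z hl1 hz1).2.2.2
  rw [hl, one_mul, mu_pow hq hl] at h1
  obtain ⟨h2, h3⟩ := hε (show dist z 0 < ε1 by
    rw [dist_zero_right]; have := hzε.trans (min_le_left _ _); linarith)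
  rw [sub_zero] at h2
  have e : FF l0 q l z - z * (exp l + g 0 * z ^ N) =
      ((f (mu l0 q l))^[q] z - exp l * z - ((f l0)^[q] z - z)) + z ^ (N + 1) * (g z - g 0) := by
    rw [h3]; unfold FF; ring
  rw [e]
  refine (norm_add_le _ _).trans ?_
  rw [norm_mul, norm_pow]
  have h4 : ‖z‖ ^ (N + 1) * ‖g z - g 0‖ ≤ ‖z‖ ^ (N + 1) * (|C2| * ‖z‖) := by
    gcongr
    exact h2.trans (by gcongr; exact le_abs_self _)
  have p1 : 0 ≤ C1 * ‖z‖ * ‖z‖ ^ (N + 1) := by positivity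
  have p2 : 0 ≤ |C2| * ‖z‖ * (‖l‖ * ‖z‖) := by positivity
  have hfin : (C1 + |C2|) * ‖z‖ * (‖z‖ ^ (N + 1) + ‖l‖ * ‖z‖) =
      (C1 * ‖l‖ * ‖z‖ ^ 2 + ‖z‖ ^ (N + 1) * (|C2| * ‖z‖)) + C1 * ‖z‖ * ‖z‖ ^ (N + 1) +
        |C2| * ‖z‖ * (‖l‖ * ‖z‖) := by
    generalize ‖z‖ ^ (N + 1) = y
    ring
  rw [hfin]
  exact (add_le_add h1 h4).trans (by rw [add_assoc]; exact le_add_of_nonneg_right (add_nonneg p1 p2))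

end Mand

open Complex Metric Set Filter Topology
open scoped NNReal ENNReal

namespace Mand

/-- the approximate Fatou coordinate -/
noncomputable def ZZ (N : ℕ) (B z : ℂ) : ℂ := -1 / (N * B * z ^ N)

/-- inverse branch of the approximate Fatou coordinate -/
noncomputable def zh (κ : ℂ) (N : ℕ) (Z : ℂ) : ℂ := κ * exp (-log (I * Z) / N)

lemma exists_kappa {N : ℕ} (hN : 0 < N) (B : ℂ) : ∃ κ : ℂ, κ ^ N = -I / (N * B) :=
  IsAlgClosed.exists_pow_nat_eq _ hN

lemma kappa_ne {N : ℕ} (hN : 0 < N) {B κ : ℂ} (hB : B ≠ 0) (hκ : κ ^ N = -I / (N * B)) : κ ≠ 0 := by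
  rintro rfl
  have hNC : (N : ℂ) ≠ 0 := by exact_mod_cast hN.ne'
  rw [zero_pow hN.ne'] at hκ
  have : -I / (N * B) ≠ 0 := div_ne_zero (neg_ne_zero.2 I_ne_zero) (mul_ne_zero hNC hB)
  exact this hκ.symm

lemma zh_ne {N : ℕ} (hN : 0 < N) {B κ : ℂ} (hB : B ≠ 0) (hκ : κ ^ N = -I / (N * B)) (Z : ℂ) : zh κ N Z ≠ 0 :=
  mul_ne_zero (kappa_ne hN hB hκ) (exp_ne_zero _)

lemma ZZ_ne {N : ℕ} (hN : 0 < N) {B z : ℂ} (hB : B ≠ 0) (hz : z ≠ 0) : ZZ N B z ≠ 0 := by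
  have hNC : (N : ℂ) ≠ 0 := by exact_mod_cast hN.ne'
  exact div_ne_zero (by simp) (mul_ne_zero (mul_ne_zero hNC hB) (pow_ne_zero _ hz))

lemma zh_ZZ {N : ℕ} (hN : 0 < N) {B κ : ℂ} (hB : B ≠ 0) (hκ : κ ^ N = -I / (N * B)) {Z : ℂ} (hZ : Z ≠ 0) :
    ZZ N B (zh κ N Z) = Z := by
  have hNC : (N : ℂ) ≠ 0 := by exact_mod_cast hN.ne'
  unfold ZZ zh
  rw [mul_pow, hκ, ← exp_nat_mul, mul_div_cancel₀ _ hNC, exp_neg, exp_log (mul_ne_zero I_ne_zero hZ)]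
  field_simp
  

lemma ZZ_mul {N : ℕ} {B z a : ℂ} : ZZ N B (z * a) = ZZ N B z * (a ^ N)⁻¹ := by
  unfold ZZ
  rw [mul_pow, ← mul_assoc, div_mul_eq_div_div, div_eq_mul_inv]

lemma ZZ_norm {N : ℕ} (hN : 0 < N) {B z : ℂ} (hB : B ≠ 0) (hz : z ≠ 0) :
    ‖z‖ ^ N * ‖ZZ N B z‖ = 1 / (N * ‖B‖) := by
  have hNC : (N : ℝ) ≠ 0 := by exact_mod_cast hN.ne'
  have h1 : ‖B‖ ≠ 0 := norm_ne_zero_iff.2 hB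
  have h2 : ‖z‖ ≠ 0 := norm_ne_zero_iff.2 hz
  unfold ZZ
  rw [norm_div, norm_mul, norm_mul, norm_pow, norm_neg, norm_one, norm_natCast]
  field_simp

/-- first order bound -/
lemma inv_pow_sub_one {N : ℕ} (hN : 0 < N) {s : ℂ} (hs : ‖s‖ ≤ 1 / (4 * N)) :
    ‖((1 + s) ^ N)⁻¹ - 1‖ ≤ 3 * N * ‖s‖ ∧ 1 + s ≠ 0 ∧ ‖log (1 + s)‖ ≤ 3 / 2 * ‖s‖ := by
  have hN1 : (1 : ℝ) ≤ N := by exact_mod_cast hN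
  have hs4 : ‖s‖ * (4 * N) ≤ 1 := by rwa [le_div_iff₀ (by positivity)] at hs
  have hs' : ‖s‖ ≤ 1 / 4 := by nlinarith [norm_nonneg s]
  have hne : 1 + s ≠ 0 := by
    intro h
    have : s = -1 := by linear_combination h
    rw [this] at hs'; norm_num at hs'
  have hL := norm_log_one_add_half_le_self (z := s) (by linarith)
  refine ⟨?_, hne, hL⟩
  have e : ((1 + s) ^ N)⁻¹ = exp (-(N * log (1 + s))) := by
    rw [exp_neg, exp_nat_mul, exp_log hne]
  rw [e]
  have h1 : ‖-(N * log (1 + s))‖ ≤ 3 / 2 * N * ‖s‖ := by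
    rw [norm_neg, norm_mul, norm_natCast]
    calc (N : ℝ) * ‖log (1 + s)‖ ≤ N * (3 / 2 * ‖s‖) := by gcongr
      _ = _ := by ring
  refine (norm_exp_sub_one_le (h1.trans (by nlinarith))).trans (by linarith)

lemma sheet {N : ℕ} (hN : 0 < N) {B κ : ℂ} (hB : B ≠ 0) (hκ : κ ^ N = -I / (N * B)) {Z s : ℂ} (hZ : Z ≠ 0)
    (him : Z.im ≤ 3 / 10 * ‖Z‖) (hs : ‖s‖ ≤ 1 / (4 * N)) :
    zh κ N Z * (1 + s) = zh κ N (ZZ N B (zh κ N Z * (1 + s))) := by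
  have hNC : (N : ℂ) ≠ 0 := by exact_mod_cast hN.ne'
  have hN1 : (1 : ℝ) ≤ N := by exact_mod_cast hN
  have hs4 : ‖s‖ * (4 * N) ≤ 1 := by rwa [le_div_iff₀ (by positivity)] at hs
  obtain ⟨-, hne, hL⟩ := inv_pow_sub_one hN hs
  rw [ZZ_mul, zh_ZZ hN hB hκ hZ]
  have hIZ : I * Z ≠ 0 := mul_ne_zero I_ne_zero hZ
  have hIZn : ‖I * Z‖ = ‖Z‖ := by rw [norm_mul, norm_I, one_mul]
  have e : I * (Z * ((1 + s) ^ N)⁻¹) = exp (log (I * Z) - N * log (1 + s)) := by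
    rw [exp_sub, exp_log hIZ, exp_nat_mul, exp_log hne]
    ring
  have harg : |arg (I * Z)| < Real.pi - 1 / 2 := by
    by_contra! h
    have h1 : Real.cos (arg (I * Z)) ≤ Real.cos (Real.pi - 1 / 2) := by
      rw [← Real.cos_abs (arg (I * Z))]
      exact Real.cos_le_cos_of_nonneg_of_le_pi (by linarith [Real.pi_gt_three]) (abs_arg_le_pi _) h
    rw [cos_arg hIZ, Real.cos_pi_sub, hIZn, div_le_iff₀ (norm_pos_iff.2 hZ)] at h1
    have h2 := Real.one_sub_sq_div_two_le_cos (x := 1 / 2)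
    have h3 : (I * Z).re = -Z.im := by simp
    rw [h3] at h1
    have h4 := norm_pos_iff.2 hZ
    nlinarith
  have hNl : |(N * log (1 + s)).im| ≤ 3 / 8 := by
    refine (abs_im_le_norm _).trans ?_
    rw [norm_mul, norm_natCast]
    nlinarith
  have hlog : log (I * (Z * ((1 + s) ^ N)⁻¹)) = log (I * Z) - N * log (1 + s) := by
    rw [e]
    rw [abs_lt] at harg
    rw [abs_le] at hNl
    apply log_exp
    · rw [sub_im, log_im]; linarith
    · rw [sub_im, log_im]; linarith
  unfold zh
  rw [hlog, show -(log (I * Z) - N * log (1 + s)) / N = -log (I * Z) / N + log (1 + s) by field_simp; ring,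
    exp_add, exp_log hne, mul_assoc]

/-- second order bound -/
lemma inv_pow_second (N : ℕ) : ∃ C > 0, ∀ x : ℂ, ‖x‖ ≤ 1 / 2 → ‖((1 + x) ^ N)⁻¹ - 1 + N * x‖ ≤ C * ‖x‖ ^ 2 := by
  induction N with
  | zero => exact ⟨1, one_pos, fun x _ => by simp⟩
  | succ N ih =>
    obtain ⟨C, hC, ih⟩ := ih
    refine ⟨2 * C + 2 + 2 * N, by positivity, fun x hx => ?_⟩
    have h1 := ih x hx
    have hge : 1 / 2 ≤ ‖1 + x‖ := by
      have := norm_sub_le (1 + x) x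
      rw [add_sub_cancel_right, norm_one] at this
      linarith
    have hne : 1 + x ≠ 0 := norm_pos_iff.1 (by linarith)
    set y := (1 + x)⁻¹ with hy
    have hy2 : ‖y‖ ≤ 2 := by
      rw [hy, norm_inv]
      exact inv_le_of_inv_le₀ (by norm_num) (by linarith)
    have hyx : y * (1 + x) = 1 := inv_mul_cancel₀ hne
    have e : ((1 + x) ^ (N + 1))⁻¹ - 1 + (N + 1 : ℕ) * x =
        y * (((1 + x) ^ N)⁻¹ - 1 + N * x) + y * x ^ 2 + N * (y * x ^ 2) := by
      rw [pow_succ, mul_inv, ← hy]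
      push_cast
      linear_combination (1 - x - N * x) * hyx
    rw [e]
    refine norm_add₃_le.trans ?_
    rw [norm_mul, norm_mul, norm_mul (N : ℂ), norm_mul y, Complex.norm_natCast, norm_pow]
    have a1 : ‖y‖ * ‖((1 + x) ^ N)⁻¹ - 1 + N * x‖ ≤ 2 * (C * ‖x‖ ^ 2) := by gcongr
    have a2 : ‖y‖ * ‖x‖ ^ 2 ≤ 2 * ‖x‖ ^ 2 := by gcongr
    have a3 : (N : ℝ) * (‖y‖ * ‖x‖ ^ 2) ≤ N * (2 * ‖x‖ ^ 2) := by gcongr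
    linarith


set_option maxHeartbeats 1000000 in
lemma zstep {l0 : ℂ} {q N : ℕ} {B : ℂ} {C ε : ℝ} (hb : Base l0 q N B C ε) {δ C1 : ℝ} (hδ : 0 < δ) (hC1 : 0 < C1) :
    ∃ ε2 > 0, ε2 ≤ ε ∧ ∀ l z : ℂ, z ≠ 0 → ‖z‖ ≤ ε2 → ‖l‖ ≤ ε2 → ‖l‖ * ‖ZZ N B z‖ ≤ C1 →
      ∃ s, FF l0 q l z = z * (1 + s) ∧ ‖s‖ ≤ δ ∧
        ‖ZZ N B (FF l0 q l z) - (exp (-(N * l)) * ZZ N B z + 1)‖ ≤ δ := by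
  have hN : 0 < N := hb.q_pos.trans_le hb.q_le
  have hN1 : (1 : ℝ) ≤ N := by exact_mod_cast hN
  have hNC : (N : ℂ) ≠ 0 := by exact_mod_cast hN.ne'
  have hB := hb.B_ne
  have hC := hb.C_pos
  obtain ⟨CN, hCN, h2⟩ := inv_pow_second N
  set b := ‖B‖ with hbd
  have hb0 : 0 < b := norm_pos_iff.2 hB
  obtain ⟨K2, hK2⟩ : ∃ K2, K2 = C * (1 / b + C1) := ⟨_, rfl⟩
  have hK2p : 0 < K2 := by rw [hK2]; positivity
  obtain ⟨K3, hK3⟩ : ∃ K3, K3 = b + 2 * C := ⟨_, rfl⟩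
  have hK3p : 0 < K3 := by rw [hK3]; positivity
  obtain ⟨K, hK⟩ : ∃ K, K = 27 * CN * (1 + K2) * K3 + 2 * (N + 1) + 3 * N * K2 + 2 + 3 * K3 := ⟨_, rfl⟩
  have hKp : 0 < K := by rw [hK]; positivity
  refine ⟨min ε (min (1 / (N + 1)) (min δ 1 / (2 * K))), by have := hb.ε_pos; positivity, min_le_left _ _, ?_⟩
  intro l z hz0 hz hl hlZ
  have hzε := hz.trans (min_le_left _ _)
  have hlε := hl.trans (min_le_left _ _)
  have hlN := hl.trans ((min_le_right _ _).trans (min_le_left _ _))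
  have hzK := hz.trans ((min_le_right _ _).trans (min_le_right _ _))
  have hlK := hl.trans ((min_le_right _ _).trans (min_le_right _ _))
  rw [le_div_iff₀ (by positivity)] at hzK hlK hlN
  have hm1 : min δ 1 ≤ δ := min_le_left _ _
  have hm2 : min δ 1 ≤ 1 := min_le_right _ _
  have hexp := hb.exp l z hlε hzε
  have nz := norm_nonneg z
  have nl := norm_nonneg l
  have hz1 : ‖z‖ ≤ 1 := hzε.trans hb.ε_le
  have hl1 : ‖l‖ ≤ 1 := hlε.trans hb.ε_le
  have zpos : 0 < ‖z‖ := norm_pos_iff.2 hz0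
  set Z := ZZ N B z with hZ
  have hZn : ‖z‖ ^ N * ‖Z‖ = 1 / (N * b) := ZZ_norm hN hB hz0
  have hZe : N * Z * (B * z ^ N) = -1 := by
    rw [hZ]; unfold ZZ
    have := pow_ne_zero N hz0
    field_simp
  set e := FF l0 q l z / z - exp l - B * z ^ N with he
  have hFe : FF l0 q l z = z * (exp l + B * z ^ N + e) := by
    rw [he]; field_simp; ring
  have heb : ‖e‖ ≤ C * (‖z‖ ^ (N + 1) + ‖l‖ * ‖z‖) := by
    rw [hFe, show z * (exp l + B * z ^ N + e) - z * (exp l + B * z ^ N) = z * e by ring, norm_mul] at hexp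
    refine le_of_mul_le_mul_left (hexp.trans (le_of_eq ?_)) zpos
    ring
  have hZe2 : ‖Z‖ * ‖e‖ ≤ K2 * ‖z‖ := by
    have t1 : ‖Z‖ * (C * (‖z‖ ^ (N + 1) + ‖l‖ * ‖z‖)) = C * ((‖z‖ ^ N * ‖Z‖) + ‖l‖ * ‖Z‖) * ‖z‖ := by
      rw [pow_succ]; ring
    have t2 : 1 / (N * b) ≤ 1 / b := by
      apply one_div_le_one_div_of_le hb0; nlinarith
    calc ‖Z‖ * ‖e‖ ≤ ‖Z‖ * (C * (‖z‖ ^ (N + 1) + ‖l‖ * ‖z‖)) := by gcongr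
      _ = _ := t1
      _ ≤ C * (1 / b + C1) * ‖z‖ := by rw [hZn]; gcongr
      _ = _ := by rw [hK2]
  set w := B * z ^ N + e with hw
  have hzN : ‖z‖ ^ N ≤ ‖z‖ := by simpa using pow_le_pow_of_le_one nz hz1 hN
  have hzN1 : ‖z‖ ^ (N + 1) ≤ ‖z‖ := by simpa using pow_le_pow_of_le_one nz hz1 (show 1 ≤ N + 1 by omega)
  have hwb : ‖w‖ ≤ K3 * ‖z‖ := by
    refine (norm_add_le _ _).trans ?_
    rw [norm_mul, norm_pow, hK3]
    have : ‖l‖ * ‖z‖ ≤ 1 * ‖z‖ := by gcongr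
    have t1 : b * ‖z‖ ^ N ≤ b * ‖z‖ := by gcongr
    have t2 : ‖e‖ ≤ C * (‖z‖ + 1 * ‖z‖) := heb.trans (by gcongr)
    linarith
  have hZw : ‖Z‖ * ‖w‖ ≤ 1 + K2 := by
    have : ‖w‖ ≤ b * ‖z‖ ^ N + ‖e‖ := by
      refine (norm_add_le _ _).trans ?_
      rw [norm_mul, norm_pow]
    have t1 : ‖Z‖ * (b * ‖z‖ ^ N + ‖e‖) = b * (‖z‖ ^ N * ‖Z‖) + ‖Z‖ * ‖e‖ := by ring
    have t2 : b * (1 / (N * b)) ≤ 1 := by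
      rw [show b * (1 / (N * b)) = 1 / N by field_simp]
      rw [div_le_one (by positivity)]; exact hN1
    have t3 : K2 * ‖z‖ ≤ K2 * 1 := by gcongr
    calc ‖Z‖ * ‖w‖ ≤ ‖Z‖ * (b * ‖z‖ ^ N + ‖e‖) := by gcongr
      _ = _ := t1
      _ ≤ _ := by rw [hZn]; linarith
  have hexp3 : ∀ k : ℂ, ‖k‖ ≤ 1 → ‖exp k‖ ≤ 3 := fun k hk => by
    have h1 := norm_exp_sub_one_le hk
    have h2 := norm_add_le (exp k - 1) 1
    rw [sub_add_cancel, norm_one] at h2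
    linarith
  have hNl1 : ‖-((N + 1 : ℂ) * l)‖ ≤ 1 := by
    rw [norm_neg, norm_mul, show (N + 1 : ℂ) = ((N + 1 : ℕ) : ℂ) by push_cast; rfl, Complex.norm_natCast]
    push_cast; linarith
  have hNl0 : ‖-((N : ℂ) * l)‖ ≤ 1 := by
    rw [norm_neg, norm_mul, Complex.norm_natCast]
    nlinarith
  set x := exp (-l) * w with hx
  have hxb : ‖x‖ ≤ 3 * ‖w‖ := by
    rw [hx, norm_mul]
    gcongr
    exact hexp3 _ (by rwa [norm_neg])
  have hK3K : 3 * K3 ≤ K := by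
    rw [hK]; have : 0 ≤ 27 * CN * (1 + K2) * K3 + 2 * (N + 1) + 3 * N * K2 + 2 := by positivity
    linarith
  have hx2 : ‖x‖ ≤ 1 / 2 := by
    have : 3 * (K3 * ‖z‖) ≤ K * ‖z‖ := by nlinarith
    linarith
  have hr := h2 x hx2
  have hfac : exp l + B * z ^ N + e = exp l * (1 + x) := by
    rw [hx, mul_add, mul_one, ← mul_assoc, ← exp_add, add_neg_cancel, exp_zero, one_mul, hw]; ring
  refine ⟨exp l - 1 + w, by rw [hFe, hw]; ring, ?_, ?_⟩
  · have h1 := norm_exp_sub_one_le hl1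
    have h3 := norm_add_le (exp l - 1) w
    have t0 : 0 ≤ 27 * CN * (1 + K2) * K3 + 2 * (N + 1) + 3 * N * K2 + 2 * K3 := by positivity
    have t1 : (2 + K3) * (‖z‖ + ‖l‖) ≤ K * (‖z‖ + ‖l‖) := by
      gcongr; rw [hK]; linarith
    have t2 : 0 ≤ K3 * ‖l‖ := by positivity
    have t3 : (2 + K3) * (‖z‖ + ‖l‖) = 2 * ‖l‖ + K3 * ‖z‖ + (2 * ‖z‖ + K3 * ‖l‖) := by ring
    have t4 : K * (‖z‖ + ‖l‖) = (‖z‖ * (2 * K) + ‖l‖ * (2 * K)) / 2 := by ring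
    linarith
  · have e1 : ZZ N B (FF l0 q l z) = Z * (exp (-(N * l)) * ((1 + x) ^ N)⁻¹) := by
      rw [hFe, hfac, ZZ_mul, mul_pow, mul_inv, ← exp_nat_mul, ← exp_neg]
    have e2 : exp (-((N + 1) * l)) = exp (-(N * l)) * exp (-l) := by rw [← exp_add]; ring_nf
    have e3 : ZZ N B (FF l0 q l z) - (exp (-(N * l)) * Z + 1) =
        Z * (exp (-(N * l)) * (((1 + x) ^ N)⁻¹ - 1 + N * x)) + (exp (-((N + 1) * l)) - 1) +
          -(N * (Z * (exp (-((N + 1) * l)) * e))) := by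
      rw [e1, e2, hx, hw]
      linear_combination (-exp (-(N * l)) * exp (-l)) * hZe
    rw [e3]
    refine norm_add₃_le.trans ?_
    rw [norm_neg, norm_mul, norm_mul, norm_mul (N : ℂ), norm_mul Z, norm_mul (exp (-((N + 1) * l))), Complex.norm_natCast]
    have a1 : ‖Z‖ * (‖exp (-(N * l))‖ * ‖((1 + x) ^ N)⁻¹ - 1 + N * x‖) ≤ 27 * CN * (1 + K2) * K3 * ‖z‖ := by
      calc _ ≤ ‖Z‖ * (3 * (CN * (3 * ‖w‖) ^ 2)) := by
            gcongr
            · exact hexp3 _ hNl0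
            · exact hr.trans (by gcongr)
        _ = 27 * CN * (‖Z‖ * ‖w‖) * ‖w‖ := by ring
        _ ≤ 27 * CN * (1 + K2) * (K3 * ‖z‖) := by gcongr
        _ = _ := by ring
    have a2 : ‖exp (-((N + 1) * l)) - 1‖ ≤ 2 * (N + 1) * ‖l‖ := by
      refine (norm_exp_sub_one_le hNl1).trans (le_of_eq ?_)
      rw [norm_neg, norm_mul, show (N + 1 : ℂ) = ((N + 1 : ℕ) : ℂ) by push_cast; rfl, Complex.norm_natCast]
      push_cast; ring
    have a3 : (N : ℝ) * (‖Z‖ * (‖exp (-((N + 1) * l))‖ * ‖e‖)) ≤ 3 * N * K2 * ‖z‖ := by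
      calc _ ≤ (N : ℝ) * (‖Z‖ * (3 * ‖e‖)) := by gcongr; exact hexp3 _ hNl1
        _ = 3 * N * (‖Z‖ * ‖e‖) := by ring
        _ ≤ 3 * N * (K2 * ‖z‖) := by gcongr
        _ = _ := by ring
    obtain ⟨A, hA⟩ : ∃ A, A = 27 * CN * (1 + K2) * K3 := ⟨_, rfl⟩
    obtain ⟨D, hD⟩ : ∃ D, D = 3 * N * K2 := ⟨_, rfl⟩
    obtain ⟨E, hE⟩ : ∃ E : ℝ, E = 2 * (N + 1) := ⟨_, rfl⟩
    have hAp : 0 < A := by rw [hA]; positivity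
    have hDp : 0 < D := by rw [hD]; positivity
    have hEp : 0 < E := by rw [hE]; positivity
    rw [← hA] at a1 hK
    rw [← hD] at a3 hK
    rw [← hE] at a2 hK
    have s1 : (A + D) * ‖z‖ ≤ K * ‖z‖ := by gcongr; linarith
    have s2 : E * ‖l‖ ≤ K * ‖l‖ := by gcongr; linarith
    linarith

end Mand

open Complex Metric Set Filter Topology
open scoped NNReal ENNReal

namespace Mand

/-- local inverse of f fixing 0 -/
noncomputable def g0 (μ y : ℂ) : ℂ := (-μ + μ * (1 + 4 * y / μ ^ 2) ^ (1 / 2 : ℂ)) / 2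

/-- local inverse of the return map -/
noncomputable def hh (l0 : ℂ) (q : ℕ) (l y : ℂ) : ℂ := (g0 (mu l0 q l))^[q] y

lemma mu_ne {μ : ℂ} (hμ : ‖μ + 1‖ < 1 / 20) : μ ≠ 0 :=
  norm_pos_iff.1 (by have := (mu_bounds hμ).2.2.1; linarith)

lemma f_g0 {μ : ℂ} (hμ : μ ≠ 0) (y : ℂ) : f μ (g0 μ y) = y := by
  have h := sqrt_sq (1 + 4 * y / μ ^ 2)
  set S := (1 + 4 * y / μ ^ 2) ^ (1 / 2 : ℂ) with hS
  unfold f g0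
  rw [← hS]
  have h2 : μ ^ 2 * (1 + 4 * y / μ ^ 2) = μ ^ 2 + 4 * y := by field_simp
  linear_combination (μ ^ 2 / 4) * h + h2 / 4

lemma g0_norm {μ : ℂ} (hμ : ‖μ + 1‖ < 1 / 20) (y : ℂ) : ‖g0 μ y‖ ≤ 3 * ‖y‖ := by
  have h1 := f_g0 (mu_ne hμ) y
  have hb := (mu_bounds hμ).2.2.1
  set S := (1 + 4 * y / μ ^ 2) ^ (1 / 2 : ℂ) with hS
  have hre : 0 ≤ S.re := sqrt_re_nonneg _
  have e : μ + g0 μ y = μ / 2 * (1 + S) := by unfold g0; rw [← hS]; ring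
  have h3 : 1 ≤ ‖1 + S‖ := by
    have := re_le_norm (1 + S)
    rw [add_re, one_re] at this; linarith
  have h4 : 19 / 40 ≤ ‖μ + g0 μ y‖ := by
    rw [e, norm_mul, norm_div, show ‖(2 : ℂ)‖ = 2 by simp]; nlinarith
  have h5 : ‖g0 μ y‖ * ‖μ + g0 μ y‖ = ‖y‖ := by
    rw [← norm_mul]; conv_rhs => rw [← h1]
    unfold f; ring_nf
  nlinarith [norm_nonneg (g0 μ y)]

lemma g0_iter_norm {μ : ℂ} (hμ : ‖μ + 1‖ < 1 / 20) (k : ℕ) (y : ℂ) : ‖(g0 μ)^[k] y‖ ≤ 3 ^ k * ‖y‖ := by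
  induction k with
  | zero => simp
  | succ k ih =>
    rw [Function.iterate_succ_apply', pow_succ]
    have := g0_norm hμ ((g0 μ)^[k] y)
    linarith

lemma f_g0_iter {μ : ℂ} (hμ : μ ≠ 0) (k : ℕ) (y : ℂ) : (f μ)^[k] ((g0 μ)^[k] y) = y := by
  induction k generalizing y with
  | zero => rfl
  | succ k ih =>
    rw [Function.iterate_succ_apply' (g0 μ), Function.iterate_succ_apply, f_g0 hμ, ih]

lemma norm_div_mu {μ z : ℂ} (hμ : ‖μ + 1‖ < 1 / 20) : ‖z / μ‖ ≤ 11 / 10 * ‖z‖ := by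
  have hb := (mu_bounds hμ).2.2.1
  rw [norm_div, div_le_iff₀ (by linarith)]
  nlinarith [norm_nonneg z]

lemma g0_f {μ z : ℂ} (hμ : ‖μ + 1‖ < 1 / 20) (hz : ‖z‖ ≤ 1 / 4) : g0 μ (f μ z) = z := by
  have hm := mu_ne hμ
  have h := sqrt_sq (1 + 4 * f μ z / μ ^ 2)
  set S := (1 + 4 * f μ z / μ ^ 2) ^ (1 / 2 : ℂ) with hS
  have hre : 0 ≤ S.re := sqrt_re_nonneg _
  have e : S ^ 2 = (1 + 2 * (z / μ)) ^ 2 := by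
    rw [h]; unfold f; field_simp; ring
  have hn := norm_div_mu (z := z) hμ
  have hn2 := neg_le_of_abs_le (abs_re_le_norm (z / μ))
  have hre2 : 0 < (1 + 2 * (z / μ)).re := by
    simp only [add_re, one_re, mul_re, re_ofNat, im_ofNat, zero_mul, sub_zero]; linarith
  have hSe : S = 1 + 2 * (z / μ) := by
    rcases sq_eq_sq_iff_eq_or_eq_neg.1 e with h | h
    · exact h
    · rw [h, neg_re] at hre; linarith
  unfold g0
  rw [← hS, hSe]; field_simp; ring

lemma g0_diff {m y : ℂ → ℂ} {u : ℂ} (hm : DifferentiableAt ℂ m u) (hy : DifferentiableAt ℂ y u)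
    (hμ : ‖m u + 1‖ < 1 / 20) (hyu : ‖y u‖ ≤ 1 / 10) : DifferentiableAt ℂ (fun v => g0 (m v) (y v)) u := by
  have h0 := mu_ne hμ
  unfold g0
  have h1 : DifferentiableAt ℂ (fun v => 1 + 4 * y v / m v ^ 2) u :=
    (differentiableAt_const _).add ((hy.const_mul 4).div (hm.pow 2) (pow_ne_zero _ h0))
  have h2 : 1 + 4 * y u / m u ^ 2 ∈ slitPlane := by
    left
    have e : 4 * y u / m u ^ 2 = 4 * ((y u / m u) / m u) := by field_simp
    have n1 := norm_div_mu (z := y u) hμ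
    have n2 := norm_div_mu (z := y u / m u) hμ
    have n3 := neg_le_of_abs_le (abs_re_le_norm (y u / m u / m u))
    rw [e]
    simp only [add_re, one_re, mul_re, re_ofNat, im_ofNat, zero_mul, sub_zero]; linarith
  have h3 := h1.cpow (differentiableAt_const (1 / 2 : ℂ)) h2
  exact ((hm.neg).add (hm.mul h3)).div_const _

lemma g0_iter_diff {m y : ℂ → ℂ} {u : ℂ} (hm : DifferentiableAt ℂ m u) (hy : DifferentiableAt ℂ y u)
    (hμ : ‖m u + 1‖ < 1 / 20) (k : ℕ) (hyu : 3 ^ k * ‖y u‖ ≤ 1 / 10) :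
    DifferentiableAt ℂ (fun v => (g0 (m v))^[k] (y v)) u := by
  induction k with
  | zero => simpa using hy
  | succ k ih =>
    have h3 : (3 : ℝ) ^ k * ‖y u‖ ≤ 1 / 10 := by
      rw [pow_succ] at hyu
      nlinarith [mul_nonneg (pow_nonneg (show (0:ℝ) ≤ 3 by norm_num) k) (norm_nonneg (y u))]
    simp only [Function.iterate_succ_apply']
    exact g0_diff hm (ih h3) hμ ((g0_iter_norm hμ k _).trans h3)

lemma mu_diff (l0 : ℂ) (q : ℕ) : Differentiable ℂ (mu l0 q) := by unfold mu; fun_prop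

lemma mu_near {l0 : ℂ} {q N : ℕ} {B : ℂ} {C ε : ℝ} (hb : Base l0 q N B C ε) {l : ℂ} (hl : ‖l‖ ≤ 1 / 100) :
    ‖mu l0 q l + 1‖ < 1 / 20 := by
  have h1 := mu_sub_le hb.q_pos hb.nrm (hl.trans (by norm_num))
  have h2 := hb.near
  have h3 := norm_add_le (mu l0 q l - l0) (l0 + 1)
  rw [show mu l0 q l - l0 + (l0 + 1) = mu l0 q l + 1 by ring] at h3
  linarith

lemma f_norm {μ z : ℂ} (hμ : ‖μ + 1‖ < 1 / 20) (hz : ‖z‖ ≤ 1) : ‖f μ z‖ ≤ 3 * ‖z‖ := by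
  have hb := (mu_bounds hμ).2.2.2
  unfold f
  refine (norm_add_le _ _).trans ?_
  rw [norm_mul, norm_pow]
  nlinarith [norm_nonneg z]

lemma f_iter_norm {μ z : ℂ} (hμ : ‖μ + 1‖ < 1 / 20) (k : ℕ) (hz : 3 ^ k * ‖z‖ ≤ 1) :
    ‖(f μ)^[k] z‖ ≤ 3 ^ k * ‖z‖ := by
  induction k with
  | zero => simp
  | succ k ih =>
    have h3 : (3 : ℝ) ^ k * ‖z‖ ≤ 1 := by
      rw [pow_succ] at hz
      nlinarith [mul_nonneg (pow_nonneg (show (0:ℝ) ≤ 3 by norm_num) k) (norm_nonneg z)]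
    rw [Function.iterate_succ_apply', pow_succ]
    have := f_norm hμ ((ih h3).trans h3)
    have := ih h3
    linarith

lemma g0_f_iter {μ z : ℂ} (hμ : ‖μ + 1‖ < 1 / 20) (k : ℕ) (hz : 3 ^ k * ‖z‖ ≤ 1 / 4) :
    (g0 μ)^[k] ((f μ)^[k] z) = z := by
  induction k with
  | zero => rfl
  | succ k ih =>
    have h3 : (3 : ℝ) ^ k * ‖z‖ ≤ 1 / 4 := by
      rw [pow_succ] at hz
      nlinarith [mul_nonneg (pow_nonneg (show (0:ℝ) ≤ 3 by norm_num) k) (norm_nonneg z)]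
    rw [Function.iterate_succ_apply' (f μ), Function.iterate_succ_apply, g0_f hμ, ih h3]
    exact (f_iter_norm hμ k (h3.trans (by norm_num))).trans h3

set_option maxHeartbeats 1000000 in
lemma zstep_inv {l0 : ℂ} {q N : ℕ} {B : ℂ} {C ε : ℝ} (hb : Base l0 q N B C ε) {δ C1 : ℝ} (hδ : 0 < δ) (hC1 : 0 < C1) :
    ∃ ε2 > 0, ε2 ≤ ε ∧ ∀ l z : ℂ, z ≠ 0 → ‖z‖ ≤ ε2 → ‖l‖ ≤ ε2 → ‖l‖ * ‖ZZ N B z‖ ≤ C1 →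
      ∃ s, hh l0 q l z = z * (1 + s) ∧ ‖s‖ ≤ δ ∧
        ‖-ZZ N B (hh l0 q l z) - (exp (N * l) * -ZZ N B z + 1)‖ ≤ δ := by
  have hN : 0 < N := hb.q_pos.trans_le hb.q_le
  have hN1 : (1 : ℝ) ≤ N := by exact_mod_cast hN
  obtain ⟨δ', hδ', hδ1, hδ2⟩ : ∃ δ' > 0, δ' ≤ δ / 6 ∧ δ' ≤ 1 / 4 := ⟨min (δ / 6) (1 / 4), by positivity, min_le_left _ _, min_le_right _ _⟩
  obtain ⟨ε1, hε1, hε1ε, H⟩ := zstep hb hδ' (show 0 < C1 * (3 ^ q) ^ N by positivity)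
  refine ⟨min (ε1 / 3 ^ q) (min (1 / (4 * 9 ^ q)) (min (1 / 100) (min (1 / N) (δ / (4 * N))))), by positivity,
    (min_le_left _ _).trans ((div_le_self hε1.le (one_le_pow₀ (by norm_num))).trans hε1ε), ?_⟩
  intro l z hz0 hz hl hlZ
  have hz1 := hz.trans (min_le_left _ _)
  have hl1 := (hl.trans (min_le_left _ _)).trans (div_le_self hε1.le (one_le_pow₀ (by norm_num)))
  have hz2 := hz.trans ((min_le_right _ _).trans (min_le_left _ _))
  have hl3 := hl.trans ((min_le_right _ _).trans ((min_le_right _ _).trans (min_le_left _ _)))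
  have hl4 := hl.trans ((min_le_right _ _).trans ((min_le_right _ _).trans ((min_le_right _ _).trans (min_le_left _ _))))
  have hl5 := hl.trans ((min_le_right _ _).trans ((min_le_right _ _).trans ((min_le_right _ _).trans (min_le_right _ _))))
  rw [le_div_iff₀ (by positivity)] at hz1 hz2 hl4 hl5
  have hμ := mu_near hb hl3
  have hm := mu_ne hμ
  set w := hh l0 q l z with hw
  have hFw : FF l0 q l w = z := f_g0_iter hm q z
  have hwn : ‖w‖ ≤ 3 ^ q * ‖z‖ := g0_iter_norm hμ q z
  have hw0 : w ≠ 0 := by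
    intro h
    rw [h] at hFw
    have : FF l0 q l 0 = 0 := Function.iterate_fixed (by simp [f]) q
    exact hz0 (by rw [← hFw, this])
  have h9 : (9 : ℝ) ^ q = 3 ^ q * 3 ^ q := by rw [← mul_pow]; norm_num
  have hzw : ‖z‖ ≤ 3 ^ q * ‖w‖ := by
    conv_lhs => rw [← hFw]
    apply f_iter_norm hμ
    have : (3 : ℝ) ^ q * ‖w‖ ≤ 3 ^ q * (3 ^ q * ‖z‖) := by gcongr
    nlinarith
  have hZw : ‖ZZ N B w‖ ≤ (3 ^ q) ^ N * ‖ZZ N B z‖ := by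
    have h1 := ZZ_norm hN hb.B_ne hz0
    have h2 := ZZ_norm hN hb.B_ne hw0
    have h3 : ‖z‖ ^ N ≤ (3 ^ q) ^ N * ‖w‖ ^ N := by rw [← mul_pow]; gcongr
    have h4 : 0 < ‖w‖ ^ N := pow_pos (norm_pos_iff.2 hw0) N
    refine le_of_mul_le_mul_left ?_ h4
    rw [h2, ← h1]
    nlinarith [norm_nonneg (ZZ N B z)]
  obtain ⟨s, hs1, hs2, hs3⟩ := H l w hw0 (hwn.trans (by linarith)) hl1 (by
    calc ‖l‖ * ‖ZZ N B w‖ ≤ ‖l‖ * ((3 ^ q) ^ N * ‖ZZ N B z‖) := by gcongr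
      _ = (‖l‖ * ‖ZZ N B z‖) * (3 ^ q) ^ N := by ring
      _ ≤ _ := by gcongr)
  rw [hFw] at hs1 hs3
  have hge : 3 / 4 ≤ ‖1 + s‖ := by
    have := norm_sub_le (1 + s) s
    rw [add_sub_cancel_right, norm_one] at this
    linarith
  have hne : 1 + s ≠ 0 := norm_pos_iff.1 (by linarith)
  refine ⟨-s / (1 + s), ?_, ?_, ?_⟩
  · rw [hs1]; field_simp; ring
  · rw [norm_div, norm_neg, div_le_iff₀ (by linarith)]
    nlinarith
  · have hNl : ‖(N * l : ℂ)‖ ≤ 1 := by rw [norm_mul, Complex.norm_natCast]; linarith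
    have h1 := norm_exp_sub_one_le hNl
    have h3 : ‖exp (N * l)‖ ≤ 3 := by
      have := norm_add_le (exp (N * l) - 1) 1
      rw [sub_add_cancel, norm_one] at this
      linarith
    have hee : exp (N * l) * exp (-(N * l)) = 1 := by rw [← exp_add, add_neg_cancel, exp_zero]
    have e : -ZZ N B w - (exp (N * l) * -ZZ N B z + 1) = (exp (N * l) - 1) +
        exp (N * l) * (ZZ N B z - (exp (-(N * l)) * ZZ N B w + 1)) := by
      linear_combination (ZZ N B w) * hee
    rw [e]
    refine (norm_add_le _ _).trans ?_
    rw [norm_mul]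
    have h4 : ‖exp (N * l)‖ * ‖ZZ N B z - (exp (-(N * l)) * ZZ N B w + 1)‖ ≤ 3 * δ' := by gcongr
    rw [norm_mul, Complex.norm_natCast] at h1
    nlinarith

end Mand

open Complex Metric Set Filter Topology
open scoped NNReal ENNReal

namespace Mand

lemma QQ_ne_of_inv {μ : ℂ} {n : ℕ} {H : ℂ → ℂ} {z1 : ℂ} (hH : DifferentiableAt ℂ H z1)
    (hi : ∀ᶠ z in 𝓝 z1, (f μ)^[n] (H z) = z) : QQ μ n (H z1) (H z1) ≠ 0 := by
  intro h0
  have h1 : Tendsto (slope H z1) (𝓝[≠] z1) (𝓝 (deriv H z1)) := hasDerivAt_iff_tendsto_slope.1 hH.hasDerivAt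
  have h2 : Tendsto (fun z => QQ μ n (H z) (H z1)) (𝓝[≠] z1) (𝓝 (QQ μ n (H z1) (H z1))) := by
    have hc : ContinuousAt (fun z => (μ, H z, H z1)) z1 :=
      continuousAt_const.prodMk (hH.continuousAt.prodMk continuousAt_const)
    have := ((QQ_cont n).continuousAt.comp hc).tendsto
    exact this.mono_left nhdsWithin_le_nhds
  have h3 := h1.mul h2
  rw [h0, mul_zero] at h3
  have h4 : ∀ᶠ z in 𝓝[≠] z1, slope H z1 z * QQ μ n (H z) (H z1) = 1 := by
    filter_upwards [nhdsWithin_le_nhds hi, self_mem_nhdsWithin] with z hz hne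
    have h5 := QQ_spec μ n (H z) (H z1)
    rw [hz, hi.self_of_nhds] at h5
    rw [slope_def_field]
    have : z - z1 ≠ 0 := sub_ne_zero.2 hne
    rw [div_mul_eq_mul_div, ← h5, div_self this]
  have h5 := tendsto_nhds_unique (h3.congr' h4) tendsto_const_nhds
  exact zero_ne_one h5

lemma lift_unique {μ : ℂ} {n : ℕ} {U : Set ℂ} {x0 : ℂ} {A A' : ℂ → ℂ} (ho : IsOpen U) (hc : IsPreconnected U)
    (hA : DifferentiableOn ℂ A U) (hA' : DifferentiableOn ℂ A' U)
    (heq : ∀ x ∈ U, (f μ)^[n] (A x) = (f μ)^[n] (A' x)) (hx0 : x0 ∈ U) (h0 : A x0 = A' x0)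
    (hne : QQ μ n (A x0) (A x0) ≠ 0) : EqOn A A' U := by
  refine (hA.analyticOnNhd ho).eqOn_of_preconnected_of_eventuallyEq (hA'.analyticOnNhd ho) hc hx0 ?_
  have c1 := (hA.differentiableAt (ho.mem_nhds hx0)).continuousAt
  have c2 := (hA'.differentiableAt (ho.mem_nhds hx0)).continuousAt
  have hcc : ContinuousAt (fun z => QQ μ n (A z) (A' z)) x0 := by
    have hc : ContinuousAt (fun z => (μ, A z, A' z)) x0 := continuousAt_const.prodMk (c1.prodMk c2)
    exact (QQ_cont n).continuousAt.comp hc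
  have hne' : QQ μ n (A x0) (A' x0) ≠ 0 := by rwa [← h0]
  filter_upwards [hcc.eventually_ne hne', ho.mem_nhds hx0] with z h1 h2
  have h3 := QQ_spec μ n (A z) (A' z)
  rw [heq z h2, sub_self] at h3
  rcases mul_eq_zero.1 h3.symm with h | h
  · exact sub_eq_zero.1 h
  · exact absurd h h1

lemma zh_near {N : ℕ} (hN : 0 < N) {B κ : ℂ} (hB : B ≠ 0) (hκ : κ ^ N = -I / (N * B)) {Y x : ℂ} (hY : Y ≠ 0)
    (him : Y.im ≤ 3 / 10 * ‖Y‖) (hx : ‖x‖ ≤ 1 / 12) :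
    ∃ s, zh κ N (Y * (1 + x)) = zh κ N Y * (1 + s) ∧ ‖s‖ ≤ 3 * ‖x‖ / N := by
  have hNC : (N : ℂ) ≠ 0 := by exact_mod_cast hN.ne'
  have hN1 : (1 : ℝ) ≤ N := by exact_mod_cast hN
  have hL := norm_log_one_add_half_le_self (z := x) (by linarith)
  have hne : 1 + x ≠ 0 := by
    intro h
    have : x = -1 := by linear_combination h
    rw [this] at hx; norm_num at hx
  set s := exp (-log (1 + x) / N) - 1 with hs
  have h1 : ‖-log (1 + x) / N‖ ≤ 3 / 2 * ‖x‖ / N := by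
    rw [norm_div, norm_neg, Complex.norm_natCast]; gcongr
  have h2 : 3 / 2 * ‖x‖ / N ≤ 1 := by
    rw [div_le_one (by positivity)]; linarith
  have hsb : ‖s‖ ≤ 3 * ‖x‖ / N := by
    refine (norm_exp_sub_one_le (h1.trans h2)).trans ?_
    calc 2 * ‖-log (1 + x) / N‖ ≤ 2 * (3 / 2 * ‖x‖ / N) := by gcongr
      _ = _ := by ring
  refine ⟨s, ?_, hsb⟩
  have hs4 : ‖s‖ ≤ 1 / (4 * N) := by
    refine hsb.trans ?_
    rw [div_le_div_iff₀ (by positivity) (by positivity)]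
    nlinarith
  have := sheet hN hB hκ hY him hs4
  rw [this, ZZ_mul, zh_ZZ hN hB hκ hY, hs, add_sub_cancel, ← exp_nat_mul, mul_div_cancel₀ _ hNC, exp_neg,
    exp_log hne, inv_inv]

lemma norm_le_of_ZZ {N : ℕ} (hN : 0 < N) {B z : ℂ} {e : ℝ} (hB : B ≠ 0) (he : 0 < e)
    (h : 1 / (N * ‖B‖ * e ^ N) ≤ ‖ZZ N B z‖) : ‖z‖ ≤ e := by
  by_cases hz : z = 0
  · subst hz; simpa using he.le
  have h1 := ZZ_norm hN hB hz
  have hN1 : (0 : ℝ) < N := by exact_mod_cast hN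
  have hb0 : 0 < ‖B‖ := norm_pos_iff.2 hB
  have hz0 : 0 < ‖z‖ := norm_pos_iff.2 hz
  by_contra! hlt
  have h2 : e ^ N < ‖z‖ ^ N := pow_lt_pow_left₀ hlt he.le hN.ne'
  have h3 : 0 < ‖ZZ N B z‖ := norm_pos_iff.2 (ZZ_ne hN hB hz)
  rw [div_le_iff₀ (by positivity)] at h
  have h4 : ‖z‖ ^ N * ‖ZZ N B z‖ * (N * ‖B‖) = 1 := by rw [h1]; field_simp
  have h5 : e ^ N * ‖ZZ N B z‖ * (N * ‖B‖) < ‖z‖ ^ N * ‖ZZ N B z‖ * (N * ‖B‖) := by gcongr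
  nlinarith

lemma track {N : ℕ} (hN : 0 < N) {B κ : ℂ} (hB : B ≠ 0) (hκ : κ ^ N = -I / (N * B)) {G : ℂ → ℂ} {σ a : ℂ}
    (hσ : σ = 1 ∨ σ = -1) {δ X D0 R0 α : ℝ} {n : ℕ} {T : ℕ → ℂ} (hTs : ∀ k, T (k + 1) = a * T k + 1)
    (hT : ∀ k ≤ n, (X + k) / 4 ≤ ‖T k‖ ∧ ‖T k‖ ≤ 2 * (X + k) ∧ (σ * T k).im ≤ (X + k) / 50)
    (hR0 : 0 < R0) (hX : 5 * R0 ≤ X) (hδ : 0 ≤ δ) (hδ' : δ ≤ 1 / 200) (hD : D0 ≤ X / 200) (hα1 : 1 ≤ α)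
    (hα : ‖a‖ ≤ α) (hαn : α ^ n ≤ 2)
    (step : ∀ z, z ≠ 0 → R0 ≤ ‖ZZ N B z‖ → ‖ZZ N B z‖ ≤ 3 * (X + n) → ∃ s, G z = z * (1 + s) ∧ ‖s‖ ≤ 1 / (4 * N) ∧
      ‖σ * ZZ N B (G z) - (a * (σ * ZZ N B z) + 1)‖ ≤ δ)
    {z0 : ℂ} (hz0 : z0 ≠ 0) (h0 : z0 = zh κ N (ZZ N B z0)) (hD0 : ‖σ * ZZ N B z0 - T 0‖ ≤ D0) :
    ∀ k ≤ n, G^[k] z0 ≠ 0 ∧ G^[k] z0 = zh κ N (ZZ N B (G^[k] z0)) ∧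
      ‖σ * ZZ N B (G^[k] z0) - T k‖ ≤ α ^ k * (D0 + δ * k) ∧ (X + k) / 5 ≤ ‖ZZ N B (G^[k] z0)‖ ∧
      ‖ZZ N B (G^[k] z0)‖ ≤ 3 * (X + k) ∧ (ZZ N B (G^[k] z0)).im ≤ 1 / 5 * ‖ZZ N B (G^[k] z0)‖ := by
  have hσn : ‖σ‖ = 1 := by rcases hσ with rfl | rfl <;> simp
  have hσ2 : σ * σ = 1 := by rcases hσ with rfl | rfl <;> simp
  have hD00 : 0 ≤ D0 := (norm_nonneg _).trans hD0
  -- consequences of the main estimate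
  have key : ∀ k ≤ n, ∀ Z : ℂ, ‖σ * Z - T k‖ ≤ α ^ k * (D0 + δ * k) →
      (X + k) / 5 ≤ ‖Z‖ ∧ ‖Z‖ ≤ 3 * (X + k) ∧ Z.im ≤ 1 / 5 * ‖Z‖ := by
    intro k hk Z hZ
    obtain ⟨t1, t2, t3⟩ := hT k hk
    have hk0 : (0 : ℝ) ≤ k := Nat.cast_nonneg k
    have hαk : α ^ k ≤ 2 := (pow_le_pow_right₀ hα1 hk).trans hαn
    have hb : ‖σ * Z - T k‖ ≤ (X + k) / 100 := by
      refine hZ.trans ?_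
      calc α ^ k * (D0 + δ * k) ≤ 2 * (X / 200 + 1 / 200 * k) := by gcongr
        _ = _ := by ring
    have hZn : ‖σ * Z‖ = ‖Z‖ := by rw [norm_mul, hσn, one_mul]
    have n1 := norm_sub_norm_le (T k) (T k - σ * Z)
    rw [sub_sub_cancel, norm_sub_rev (T k) (σ * Z), hZn] at n1
    have n2 := norm_add_le (σ * Z - T k) (T k)
    rw [sub_add_cancel, hZn] at n2
    have n3 : Z = σ * T k + σ * (σ * Z - T k) := by linear_combination (-Z) * hσ2
    have n4 := (abs_le.1 (abs_im_le_norm (σ * (σ * Z - T k)))).2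
    rw [norm_mul, hσn, one_mul] at n4
    have n5 := congrArg im n3
    rw [add_im] at n5
    refine ⟨by linarith, by linarith, by linarith⟩
  have main : ∀ k ≤ n, G^[k] z0 ≠ 0 ∧ G^[k] z0 = zh κ N (ZZ N B (G^[k] z0)) ∧
      ‖σ * ZZ N B (G^[k] z0) - T k‖ ≤ α ^ k * (D0 + δ * k) := by
    intro k
    induction k with
    | zero => intro _; refine ⟨hz0, h0, by simpa using hD0⟩
    | succ k ih =>
      intro hk
      obtain ⟨i1, i2, i3⟩ := ih (by omega)
      obtain ⟨k1, k2, k3⟩ := key k (by omega) _ i3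
      rw [Function.iterate_succ_apply']
      set z := G^[k] z0
      have hk0 : (0 : ℝ) ≤ k := Nat.cast_nonneg k
      have hkn : (k : ℝ) ≤ n := by exact_mod_cast (by omega : k ≤ n)
      obtain ⟨s, s1, s2, s3⟩ := step z i1 (by linarith) (by linarith)
      obtain ⟨-, hne, -⟩ := inv_pow_sub_one hN s2
      refine ⟨by rw [s1]; exact mul_ne_zero i1 hne, ?_, ?_⟩
      · have := sheet hN hB hκ (ZZ_ne hN hB i1) (by nlinarith [norm_nonneg (ZZ N B z)]) s2
        rw [← i2] at this
        rw [s1]; exact this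
      · have e : σ * ZZ N B (G z) - T (k + 1) = (σ * ZZ N B (G z) - (a * (σ * ZZ N B z) + 1)) +
            a * (σ * ZZ N B z - T k) := by rw [hTs]; ring
        rw [e]
        refine (norm_add_le _ _).trans ?_
        rw [norm_mul]
        have h1 : ‖a‖ * ‖σ * ZZ N B z - T k‖ ≤ α * (α ^ k * (D0 + δ * k)) := by gcongr
        have h2 : 1 ≤ α ^ (k + 1) := one_le_pow₀ hα1
        push_cast
        calc _ ≤ δ + α * (α ^ k * (D0 + δ * k)) := add_le_add s3 h1
          _ = δ + α ^ (k + 1) * (D0 + δ * k) := by ring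
          _ ≤ α ^ (k + 1) * δ + α ^ (k + 1) * (D0 + δ * k) := by gcongr; nlinarith
          _ = _ := by ring
  intro k hk
  obtain ⟨i1, i2, i3⟩ := main k hk
  exact ⟨i1, i2, i3, key k hk _ i3⟩

end Mand

open Complex Metric Set Filter Topology
open scoped NNReal ENNReal

namespace Mand

lemma zstep_both {l0 : ℂ} {q N : ℕ} {B : ℂ} {C ε : ℝ} (hb : Base l0 q N B C ε) {δ C1 e : ℝ} (hδ : 0 < δ)
    (hC1 : 0 < C1) (he : 0 < e) :
    ∃ R0 > 0, ∃ ε2 > 0, ε2 ≤ 1 / 100 ∧ ∀ l z : ℂ, z ≠ 0 → R0 ≤ ‖ZZ N B z‖ → ‖l‖ ≤ ε2 → ‖l‖ * ‖ZZ N B z‖ ≤ C1 →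
      ‖z‖ ≤ e ∧ (∃ s, FF l0 q l z = z * (1 + s) ∧ ‖s‖ ≤ δ ∧
        ‖ZZ N B (FF l0 q l z) - (exp (-(N * l)) * ZZ N B z + 1)‖ ≤ δ) ∧
      (∃ s, hh l0 q l z = z * (1 + s) ∧ ‖s‖ ≤ δ ∧
        ‖-ZZ N B (hh l0 q l z) - (exp (N * l) * -ZZ N B z + 1)‖ ≤ δ) := by
  have hN : 0 < N := hb.q_pos.trans_le hb.q_le
  have hN0 : (0 : ℝ) < N := by exact_mod_cast hN
  have hB0 : 0 < ‖B‖ := norm_pos_iff.2 hb.B_ne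
  obtain ⟨a1, h1, -, H1⟩ := zstep hb hδ hC1
  obtain ⟨a2, h2, -, H2⟩ := zstep_inv hb hδ hC1
  have hm : 0 < min e (min a1 a2) := by positivity
  refine ⟨1 / (N * ‖B‖ * (min e (min a1 a2)) ^ N), by positivity, min (1 / 100) (min a1 a2), by positivity,
    min_le_left _ _, ?_⟩
  intro l z hz hZ hl hlZ
  have hz1 := norm_le_of_ZZ hN hb.B_ne hm hZ
  refine ⟨hz1.trans (min_le_left _ _), ?_, ?_⟩
  · exact H1 l z hz (hz1.trans ((min_le_right _ _).trans (min_le_left _ _))) (hl.trans ((min_le_right _ _).trans (min_le_left _ _))) hlZ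
  · exact H2 l z hz (hz1.trans ((min_le_right _ _).trans (min_le_right _ _))) (hl.trans ((min_le_right _ _).trans (min_le_right _ _))) hlZ

lemma near_sheet {N : ℕ} (hN : 0 < N) {B κ : ℂ} (hB : B ≠ 0) (hκ : κ ^ N = -I / (N * B)) {y w : ℂ} {c : ℝ}
    (hy0 : y ≠ 0) (hy : y = zh κ N (ZZ N B y)) (him : (ZZ N B y).im ≤ 3 / 10 * ‖ZZ N B y‖)
    (hw : ‖w - y‖ ≤ c * ‖y‖) (hc : c ≤ 1 / (4 * N)) :
    w ≠ 0 ∧ w = zh κ N (ZZ N B w) ∧ ‖ZZ N B w - ZZ N B y‖ ≤ 3 * N * c * ‖ZZ N B y‖ := by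
  have hyp : 0 < ‖y‖ := norm_pos_iff.2 hy0
  set s := (w - y) / y with hs
  have hsn : ‖s‖ ≤ c := by rw [hs, norm_div, div_le_iff₀ hyp]; exact hw
  have hws : w = y * (1 + s) := by rw [hs]; field_simp; ring
  obtain ⟨h1, h2, -⟩ := inv_pow_sub_one hN (hsn.trans hc)
  have h3 := sheet hN hB hκ (ZZ_ne hN hB hy0) him (hsn.trans hc)
  rw [← hy, ← hws] at h3
  refine ⟨by rw [hws]; exact mul_ne_zero hy0 h2, h3, ?_⟩
  rw [hws, ZZ_mul, show ZZ N B y * ((1 + s) ^ N)⁻¹ - ZZ N B y = (((1 + s) ^ N)⁻¹ - 1) * ZZ N B y by ring, norm_mul]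
  gcongr
  exact h1.trans (by gcongr)

lemma near_inv {N : ℕ} (hN : 0 < N) {B κ : ℂ} (hB : B ≠ 0) (hκ : κ ^ N = -I / (N * B)) {y w : ℂ} {c : ℝ}
    (hy0 : y ≠ 0) (hy : y = zh κ N (ZZ N B y)) (him : (ZZ N B y).im ≤ 3 / 10 * ‖ZZ N B y‖)
    (hw : w = zh κ N (ZZ N B w)) (hwy : ‖ZZ N B w - ZZ N B y‖ ≤ c * ‖ZZ N B y‖) (hc : c ≤ 1 / 12) :
    ‖w - y‖ ≤ 3 * c / N * ‖y‖ := by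
  have hY := ZZ_ne hN hB hy0
  have hYp : 0 < ‖ZZ N B y‖ := norm_pos_iff.2 hY
  set x := (ZZ N B w - ZZ N B y) / ZZ N B y with hx
  have hxn : ‖x‖ ≤ c := by rw [hx, norm_div, div_le_iff₀ hYp]; exact hwy
  have hxw : ZZ N B y * (1 + x) = ZZ N B w := by rw [hx]; field_simp; ring
  obtain ⟨s, h1, h2⟩ := zh_near hN hB hκ hY him (hxn.trans hc)
  rw [hxw, ← hw, ← hy] at h1
  rw [h1, show y * (1 + s) - y = s * y by ring, norm_mul]
  gcongr
  exact h2.trans (by gcongr)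

lemma iter_bound {μ : ℂ} (hμ : ‖μ + 1‖ < 1 / 20) {n : ℕ} {z : ℂ} (h : ‖(f μ)^[n] z‖ ≤ 4) : ‖z‖ ≤ 4 := by
  by_contra! hz
  have h1 := escape_iter hμ hz n
  have h2 : (1 : ℝ) ≤ 2 ^ n := one_le_pow₀ (by norm_num)
  nlinarith

lemma FF_iter (l0 : ℂ) (q : ℕ) (l : ℂ) (n : ℕ) (z : ℂ) : (FF l0 q l)^[n] z = (f (mu l0 q l))^[q * n] z := by
  rw [Function.iterate_mul]; rfl

lemma ball_simply (c : ℂ) {r : ℝ} (hr : 0 < r) : IsSimplyConnected (ball c r) :=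
  simplyConn_of_star ((convex_ball c r).starConvex (mem_ball_self hr)) (mem_ball_self hr)

/-- real sheet points -/
lemma zh_real {N : ℕ} (hN : 0 < N) {B κ : ℂ} (hB : B ≠ 0) (hκ : κ ^ N = -I / (N * B)) {R : ℝ} (hR : R ≠ 0) :
    zh κ N R ≠ 0 ∧ ZZ N B (zh κ N R) = R ∧ zh κ N R = zh κ N (ZZ N B (zh κ N R)) := by
  have h := zh_ZZ hN hB hκ (Z := (R : ℂ)) (by exact_mod_cast hR)
  exact ⟨zh_ne hN hB hκ _, h, by rw [h]⟩

set_option maxHeartbeats 1000000 in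
lemma B3a {l0 : ℂ} {q N : ℕ} {B κ : ℂ} {C ε : ℝ} (hb : Base l0 q N B C ε) (hκ : κ ^ N = -I / (N * B))
    {δ : ℝ} (hδ : 0 < δ) (hδ1 : δ ≤ 1 / 100) :
    ∃ R0 : ℝ, ∀ R ≥ R0, ∃ n1 : ℕ, ∀ n ≥ n1, ∃ i, (f l0)^[i] (-l0 ^ 2 / 4) ≠ 0 ∧
      (f l0)^[i] (-l0 ^ 2 / 4) = zh κ N (ZZ N B ((f l0)^[i] (-l0 ^ 2 / 4))) ∧
      ‖ZZ N B ((f l0)^[i] (-l0 ^ 2 / 4)) - (R + n : ℝ)‖ ≤ δ * (R + n) := by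
  have hN : 0 < N := hb.q_pos.trans_le hb.q_le
  have hN1 : (1 : ℝ) ≤ N := by exact_mod_cast hN
  have hB := hb.B_ne
  have hl0 : ‖l0 + 1‖ < 1 / 20 := hb.near.trans (by norm_num)
  obtain ⟨d, hd⟩ : ∃ d, d = δ / 100 := ⟨_, rfl⟩
  have hdp : 0 < d := by rw [hd]; positivity
  have hd1 : d ≤ 1 / 10000 := by rw [hd]; linarith
  obtain ⟨d2, hd2⟩ : ∃ d2, d2 = d / (6 * N) := ⟨_, rfl⟩
  have hd2p : 0 < d2 := by rw [hd2]; positivity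
  have hd2e : d2 * N = d / 6 := by rw [hd2]; field_simp
  have hd2d : d2 ≤ d := by nlinarith
  have hd24 : 2 * d2 ≤ 1 / (4 * N) := by rw [le_div_iff₀ (by positivity)]; nlinarith
  obtain ⟨R0, hR0, ε2, hε2, -, hst⟩ := zstep_both hb hd2p one_pos one_pos
  refine ⟨5 * R0 + 1, fun R hR => ?_⟩
  have hRp : 0 < R := by linarith
  set F := FF l0 q 0 with hF
  have hFi : ∀ n z, F^[n] z = (f l0)^[q * n] z := fun n z => by rw [hF, FF_iter, mu_zero]
  have step : ∀ z, z ≠ 0 → R0 ≤ ‖ZZ N B z‖ → ∃ s, F z = z * (1 + s) ∧ ‖s‖ ≤ d2 ∧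
      ‖ZZ N B (F z) - (ZZ N B z + 1)‖ ≤ d2 := by
    intro z hz hZ
    obtain ⟨-, ⟨s, s1, s2, s3⟩, -⟩ := hst 0 z hz hZ (by simpa using hε2.le) (by simp)
    exact ⟨s, s1, s2, by simpa using s3⟩
  have trk : ∀ z0, z0 ≠ 0 → z0 = zh κ N (ZZ N B z0) → ‖ZZ N B z0 - R‖ ≤ d * R → ∀ k : ℕ,
      F^[k] z0 ≠ 0 ∧ F^[k] z0 = zh κ N (ZZ N B (F^[k] z0)) ∧ ‖ZZ N B (F^[k] z0) - (R + k)‖ ≤ d * (R + k) ∧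
      (R + k) / 5 ≤ ‖ZZ N B (F^[k] z0)‖ ∧ ‖ZZ N B (F^[k] z0)‖ ≤ 3 * (R + k) ∧
      (ZZ N B (F^[k] z0)).im ≤ 1 / 5 * ‖ZZ N B (F^[k] z0)‖ := by
    intro z0 hz0 h0 hD k
    have := track hN hB hκ (G := F) (σ := 1) (a := 1) (Or.inl rfl) (δ := d) (X := R) (D0 := d * R) (R0 := R0) (α := 1)
      (n := k) (T := fun k => ((R + k : ℝ) : ℂ)) (fun k => by push_cast; ring) (fun j _ => by
        have hj : (0 : ℝ) ≤ j := Nat.cast_nonneg j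
        rw [one_mul, ofReal_im, Complex.norm_real, Real.norm_eq_abs, abs_of_nonneg (by positivity)]
        refine ⟨by linarith, by linarith, by positivity⟩) hR0 (by linarith) hdp.le (by linarith) (by nlinarith)
      le_rfl (by simp) (by simp) (fun z hz hZ _ => by
        obtain ⟨s, s1, s2, s3⟩ := step z hz hZ
        refine ⟨s, s1, by linarith, by simpa using s3.trans hd2d⟩) hz0 h0 (by simpa using hD) k le_rfl
    obtain ⟨t1, t2, t3, t4⟩ := this
    refine ⟨t1, t2, ?_, t4⟩
    rw [one_mul, one_pow, one_mul] at t3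
    push_cast at t3
    exact t3.trans (le_of_eq (by ring))
  set y0 := zh κ N R with hy0
  obtain ⟨y0ne, y0Z, y0s⟩ := zh_real hN hB hκ hRp.ne'
  have y0p : 0 < ‖y0‖ := norm_pos_iff.2 y0ne
  have y0im : (ZZ N B y0).im ≤ 3 / 10 * ‖ZZ N B y0‖ := by rw [y0Z, ofReal_im]; positivity
  have ytrk := trk y0 y0ne y0s (by rw [y0Z, sub_self, norm_zero]; positivity)
  obtain ⟨c, hc⟩ : ∃ c, c = 13 * d / N := ⟨_, rfl⟩
  have hcN : c * N = 13 * d := by rw [hc]; field_simp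
  have hcp : 0 < c := by rw [hc]; positivity
  have hc4 : c ≤ 1 / (4 * N) := by rw [le_div_iff₀ (by positivity)]; nlinarith
  have hy10 : F y0 ≠ y0 := by
    intro h
    obtain ⟨s, s1, s2, s3⟩ := step y0 y0ne (by rw [y0Z, Complex.norm_real, Real.norm_eq_abs, abs_of_pos hRp]; linarith)
    rw [h, show ZZ N B y0 - (ZZ N B y0 + 1) = -1 by ring, norm_neg, norm_one] at s3
    linarith
  obtain ⟨d3, hd3⟩ : ∃ d3, d3 = c * ‖F y0 - y0‖ / 32 := ⟨_, rfl⟩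
  have hFy : 0 < ‖F y0 - y0‖ := norm_pos_iff.2 (sub_ne_zero.2 hy10)
  have hd3p : 0 < d3 := by rw [hd3]; positivity
  obtain ⟨R3, hR3, ε3, hε3, -, hst3⟩ := zstep_both hb (lt_min hd3p (half_pos hcp)) one_pos one_pos
  obtain ⟨n1, hn1⟩ := exists_nat_ge (5 * R3)
  refine ⟨n1, fun n hn => ?_⟩
  have hnn : (5 * R3 : ℝ) ≤ n := hn1.trans (by exact_mod_cast hn)
  have hn0 : (0 : ℝ) ≤ n := Nat.cast_nonneg n
  set yn := F^[n] y0 with hyn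
  obtain ⟨t1, t2, t3, t4, t5, t6⟩ := ytrk n
  rw [← hyn] at t1 t2 t3 t4 t5 t6
  have ynp : 0 < ‖yn‖ := norm_pos_iff.2 t1
  have t6' : (ZZ N B yn).im ≤ 3 / 10 * ‖ZZ N B yn‖ := by linarith [norm_nonneg (ZZ N B yn)]
  have hYle : ‖ZZ N B yn‖ ≤ (1 + d) * (R + n) := by
    have := norm_add_le (ZZ N B yn - (R + n)) (R + n)
    rw [sub_add_cancel, show (R + n : ℂ) = ((R + n : ℝ) : ℂ) by push_cast; rfl, Complex.norm_real, Real.norm_eq_abs,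
      abs_of_nonneg (by positivity)] at this
    push_cast at this
    linarith
  have hYge : (1 - d) * (R + n) ≤ ‖ZZ N B yn‖ := by
    have := norm_sub_le (ZZ N B yn) (ZZ N B yn - (R + n))
    rw [sub_sub_cancel, show (R + n : ℂ) = ((R + n : ℝ) : ℂ) by push_cast; rfl, Complex.norm_real, Real.norm_eq_abs,
      abs_of_nonneg (by positivity)] at this
    push_cast at this
    linarith
  have hcard : ∃ i < q * n, (f l0)^[i] (-l0 ^ 2 / 4) ∈ ball yn (c * ‖yn‖) := by
    by_contra! hno
    obtain ⟨H, Hd, Hi, H1⟩ := inv_branch (ball_simply yn (by positivity)) isOpen_ball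
      (mem_ball_self (by positivity : 0 < c * ‖yn‖)) (q * n) hno y0 (by rw [← hFi])
    obtain ⟨e1, ⟨s, s1, s2, -⟩, -⟩ := hst3 0 yn t1 (by linarith) (by simpa using hε3.le) (by simp)
    have Hb : ∀ z ∈ ball yn (c * ‖yn‖), ‖H z‖ ≤ 4 := by
      intro z hz
      refine iter_bound hl0 (n := q * n) ?_
      rw [Hi z hz]
      have hz' : ‖z - yn‖ < c * ‖yn‖ := by rwa [mem_ball, dist_eq_norm] at hz
      have hz2 := norm_add_le (z - yn) yn
      rw [sub_add_cancel] at hz2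
      have : c ≤ 1 := hc4.trans (by rw [div_le_one (by positivity)]; linarith)
      nlinarith
    -- the lift is the identity on the small disc
    set D := ball y0 (2 * d2 * ‖y0‖) with hD
    have hmap : ∀ z ∈ D, (f l0)^[q * n] z ∈ ball yn (c * ‖yn‖) := by
      intro z hz
      rw [hD, mem_ball, dist_eq_norm] at hz
      obtain ⟨a1, a2, a3⟩ := near_sheet hN hB hκ y0ne y0s y0im hz.le hd24
      rw [y0Z, Complex.norm_real, Real.norm_eq_abs, abs_of_pos hRp] at a3
      obtain ⟨b1, b2, b3, b4, b5, b6⟩ := trk z a1 a2 (a3.trans (by nlinarith)) n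
      rw [← hFi]
      have b7 : ‖ZZ N B (F^[n] z) - ZZ N B yn‖ ≤ 4 * d * ‖ZZ N B yn‖ := by
        have := norm_sub_le (ZZ N B (F^[n] z) - (R + n)) (ZZ N B yn - (R + n))
        rw [sub_sub_sub_cancel_right] at this
        nlinarith
      have b8 := near_inv hN hB hκ t1 t2 t6' b2 b7 (by linarith)
      rw [mem_ball, dist_eq_norm]
      refine b8.trans_lt ?_
      rw [hc]
      have h13 : 3 * (4 * d) / N < 13 * d / N := by
        apply div_lt_div_of_pos_right _ (by positivity); linarith
      refine lt_of_le_of_lt (le_of_eq ?_) (mul_lt_mul_of_pos_right h13 ynp)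
      ring
    have hDo : (0 : ℝ) < 2 * d2 * ‖y0‖ := by positivity
    have hQ : QQ l0 (q * n) (H yn) (H yn) ≠ 0 := by
      refine QQ_ne_of_inv (Hd.differentiableAt (ball_mem_nhds _ (by positivity))) ?_
      filter_upwards [ball_mem_nhds yn (by positivity : 0 < c * ‖yn‖)] with z hz using Hi z hz
    have heq : EqOn (fun z => z) (fun z => H ((f l0)^[q * n] z)) D := by
      refine lift_unique isOpen_ball (convex_ball _ _).isPreconnected differentiableOn_id
        (Hd.comp (fit_diff _ _).differentiableOn hmap) (fun z hz => (Hi _ (hmap z hz)).symm) (mem_ball_self hDo) ?_ ?_ (n := q * n) (μ := l0)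
      · rw [← hFi, ← hyn, H1]
      · rw [H1] at hQ; exact hQ
    have hFy0 : F y0 ∈ D := by
      obtain ⟨s, s1, s2, s3⟩ := step y0 y0ne (by rw [y0Z, Complex.norm_real, Real.norm_eq_abs, abs_of_pos hRp]; linarith)
      rw [hD, mem_ball, dist_eq_norm, s1, show y0 * (1 + s) - y0 = s * y0 by ring, norm_mul]
      gcongr; linarith
    have h2 : H (F yn) = F y0 := by
      have := heq hFy0
      simp only at this
      rw [this, ← hFi, hyn, ← Function.iterate_succ_apply, Function.iterate_succ_apply']
    have hss : ‖F yn - yn‖ ≤ min d3 (c / 2) * ‖yn‖ := by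
      rw [show F yn = yn * (1 + s) from s1, show yn * (1 + s) - yn = s * yn by ring, norm_mul]
      gcongr
    have h3 := lip_of_bound' (R := c * ‖yn‖ / 2) (by nlinarith [mul_pos hcp ynp]) Hd Hb (z := F yn) (w := yn)
      (by rw [mem_closedBall, dist_eq_norm]; refine hss.trans ?_
          have : min d3 (c / 2) * ‖yn‖ ≤ c / 2 * ‖yn‖ := by gcongr; exact min_le_right _ _
          linarith) (mem_closedBall_self (by positivity))
    rw [h2, H1] at h3
    have h4 : 4 / ((c * ‖yn‖ - c * ‖yn‖ / 2) / 2) * ‖F yn - yn‖ ≤ 4 / ((c * ‖yn‖ - c * ‖yn‖ / 2) / 2) * (d3 * ‖yn‖) := by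
      have : 0 < c * ‖yn‖ - c * ‖yn‖ / 2 := by nlinarith [mul_pos hcp ynp]
      gcongr
      refine hss.trans ?_
      gcongr; exact min_le_left _ _
    have h5 : 4 / ((c * ‖yn‖ - c * ‖yn‖ / 2) / 2) * (d3 * ‖yn‖) = 16 * d3 / c := by
      rw [show (c * ‖yn‖ - c * ‖yn‖ / 2) / 2 = c * ‖yn‖ / 4 by ring]; field_simp; norm_num
    have h6 : 16 * d3 / c = ‖F y0 - y0‖ / 2 := by rw [hd3]; field_simp; norm_num
    linarith
  obtain ⟨i, -, hi⟩ := hcard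
  rw [mem_ball, dist_eq_norm] at hi
  obtain ⟨a1, a2, a3⟩ := near_sheet hN hB hκ t1 t2 t6' hi.le hc4
  refine ⟨i, a1, a2, ?_⟩
  have := norm_add_le (ZZ N B ((f l0)^[i] (-l0 ^ 2 / 4)) - ZZ N B yn) (ZZ N B yn - (R + n))
  rw [sub_add_sub_cancel] at this
  push_cast
  have h7 : 3 * N * c * ‖ZZ N B yn‖ ≤ 39 * d * ((1 + d) * (R + n)) := by
    rw [show 3 * N * c = 3 * (c * N) by ring, hcN, show 3 * (13 * d) = 39 * d by ring]
    gcongr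
  have h8 : 0 < d * (R + n) := by positivity
  have h9 : δ = 100 * d := by rw [hd]; ring
  rw [h9]
  nlinarith

end Mand

open Complex Metric Set Filter Topology
open scoped NNReal ENNReal

namespace Mand

lemma FF_hh {l0 : ℂ} {q : ℕ} {l : ℂ} (hμ : mu l0 q l ≠ 0) (y : ℂ) : FF l0 q l (hh l0 q l y) = y :=
  f_g0_iter hμ q y

lemma FF_hh_iter {l0 : ℂ} {q : ℕ} {l : ℂ} (hμ : mu l0 q l ≠ 0) (n : ℕ) (y : ℂ) :
    (FF l0 q l)^[n] ((hh l0 q l)^[n] y) = y := by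
  induction n generalizing y with
  | zero => rfl
  | succ n ih =>
    rw [Function.iterate_succ_apply' (hh l0 q l), Function.iterate_succ_apply, FF_hh hμ, ih]

set_option maxHeartbeats 1000000 in
lemma B3b {l0 : ℂ} {q N : ℕ} {B κ : ℂ} {C ε : ℝ} (hb : Base l0 q N B C ε) (hκ : κ ^ N = -I / (N * B))
    {δ : ℝ} (hδ : 0 < δ) (hδ1 : δ ≤ 1 / 100) :
    ∃ R0 : ℝ, ∀ R ≥ R0, ∃ n1 : ℕ, ∀ n ≥ n1, ∃ (b : ℂ) (i : ℕ), b ≠ 0 ∧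
      b = zh κ N (ZZ N B b) ∧ (f l0)^[i] b = 1 - l0 ∧ 
      ‖-ZZ N B b - (R + n : ℝ)‖ ≤ δ * (R + n) := by
  have hN : 0 < N := hb.q_pos.trans_le hb.q_le
  have hN1 : (1 : ℝ) ≤ N := by exact_mod_cast hN
  have hB := hb.B_ne
  have hl0 : ‖l0 + 1‖ < 1 / 20 := hb.near.trans (by norm_num)
  have hl0n : mu l0 q 0 ≠ 0 := by rw [mu_zero]; exact mu_ne hl0
  obtain ⟨d, hd⟩ : ∃ d, d = δ / 100 := ⟨_, rfl⟩
  have hdp : 0 < d := by rw [hd]; positivity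
  have hd1 : d ≤ 1 / 10000 := by rw [hd]; linarith
  obtain ⟨d2, hd2⟩ : ∃ d2, d2 = d / (6 * N) := ⟨_, rfl⟩
  have hd2p : 0 < d2 := by rw [hd2]; positivity
  have hd2e : d2 * N = d / 6 := by rw [hd2]; field_simp
  have hd2d : d2 ≤ d := by nlinarith
  have hd24 : 2 * d2 ≤ 1 / (4 * N) := by rw [le_div_iff₀ (by positivity)]; nlinarith
  obtain ⟨R0, hR0, ε2, hε2, -, hst⟩ := zstep_both hb hd2p one_pos (show (0 : ℝ) < 1 / 2 by norm_num)
  refine ⟨5 * R0 + 1, fun R hR => ?_⟩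
  have hRp : 0 < R := by linarith
  set F := FF l0 q 0 with hF
  set h := hh l0 q 0 with hh0
  have hFi : ∀ n z, F^[n] z = (f l0)^[q * n] z := fun n z => by rw [hF, FF_iter, mu_zero]
  have step : ∀ z, z ≠ 0 → R0 ≤ ‖ZZ N B z‖ → ‖z‖ ≤ 1 / 2 ∧ (∃ s, F z = z * (1 + s) ∧ ‖s‖ ≤ d2 ∧
      ‖ZZ N B (F z) - (ZZ N B z + 1)‖ ≤ d2) ∧ ∃ s, h z = z * (1 + s) ∧ ‖s‖ ≤ d2 ∧
      ‖-ZZ N B (h z) - (-ZZ N B z + 1)‖ ≤ d2 := by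
    intro z hz hZ
    obtain ⟨e, ⟨s, s1, s2, s3⟩, ⟨s', s1', s2', s3'⟩⟩ := hst 0 z hz hZ (by simpa using hε2.le) (by simp)
    exact ⟨e, ⟨s, s1, s2, by simpa using s3⟩, s', s1', s2', by simpa using s3'⟩
  have trk : ∀ z0, z0 ≠ 0 → z0 = zh κ N (ZZ N B z0) → ‖-ZZ N B z0 - R‖ ≤ d * R → ∀ k : ℕ,
      h^[k] z0 ≠ 0 ∧ h^[k] z0 = zh κ N (ZZ N B (h^[k] z0)) ∧ ‖-ZZ N B (h^[k] z0) - (R + k)‖ ≤ d * (R + k) ∧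
      (R + k) / 5 ≤ ‖ZZ N B (h^[k] z0)‖ ∧ ‖ZZ N B (h^[k] z0)‖ ≤ 3 * (R + k) ∧
      (ZZ N B (h^[k] z0)).im ≤ 1 / 5 * ‖ZZ N B (h^[k] z0)‖ := by
    intro z0 hz0 h0 hD k
    have := track hN hB hκ (G := h) (σ := -1) (a := 1) (Or.inr rfl) (δ := d) (X := R) (D0 := d * R) (R0 := R0) (α := 1)
      (n := k) (T := fun k => ((R + k : ℝ) : ℂ)) (fun k => by push_cast; ring) (fun j _ => by
        have hj : (0 : ℝ) ≤ j := Nat.cast_nonneg j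
        rw [neg_one_mul, neg_im, ofReal_im, Complex.norm_real, Real.norm_eq_abs, abs_of_nonneg (by positivity)]
        refine ⟨by linarith, by linarith, by rw [neg_zero]; positivity⟩) hR0 (by linarith) hdp.le (by linarith) (by nlinarith)
      le_rfl (by simp) (by simp) (fun z hz hZ _ => by
        obtain ⟨-, -, s, s1, s2, s3⟩ := step z hz hZ
        refine ⟨s, s1, by linarith, by simpa using s3.trans hd2d⟩) hz0 h0 (by simpa using hD) k le_rfl
    obtain ⟨t1, t2, t3, t4⟩ := this
    refine ⟨t1, t2, ?_, t4⟩
    rw [neg_one_mul, one_pow, one_mul] at t3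
    push_cast at t3
    exact t3.trans (le_of_eq (by ring))
  set y0 := zh κ N (-R : ℝ) with hy0
  obtain ⟨y0ne, y0Z, y0s⟩ := zh_real hN hB hκ (neg_ne_zero.2 hRp.ne')
  rw [← hy0] at y0ne y0Z y0s
  have y0p : 0 < ‖y0‖ := norm_pos_iff.2 y0ne
  have ytrk := trk y0 y0ne y0s (by rw [y0Z]; push_cast; rw [neg_neg, sub_self, norm_zero]; positivity)
  have y0R : R0 ≤ ‖ZZ N B y0‖ := by
    rw [y0Z, Complex.norm_real, Real.norm_eq_abs, abs_neg, abs_of_pos hRp]; linarith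
  obtain ⟨y0h, ⟨s0, s01, s02, s03⟩, -⟩ := step y0 y0ne y0R
  have hy10 : F y0 ≠ y0 := by
    intro h
    rw [h, show ZZ N B y0 - (ZZ N B y0 + 1) = -1 by ring, norm_neg, norm_one] at s03
    linarith
  obtain ⟨c, hc⟩ : ∃ c, c = 13 * d / N := ⟨_, rfl⟩
  have hcN : c * N = 13 * d := by rw [hc]; field_simp
  have hcp : 0 < c := by rw [hc]; positivity
  have hc4 : c ≤ 1 / (4 * N) := by rw [le_div_iff₀ (by positivity)]; nlinarith
  -- normalisation
  have hβ : (39 / 20 : ℝ) ≤ ‖1 - l0‖ := by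
    have := norm_sub_le (1 - l0) (-(l0 + 1))
    rw [norm_neg, show 1 - l0 - -(l0 + 1) = 2 by ring] at this
    norm_num at this
    linarith
  have hβ2 : (-1 - (1 - l0) : ℂ) ≠ 0 := by
    intro h
    rw [show (-1 - (1 - l0) : ℂ) = l0 - 2 by ring] at h
    rw [show l0 = 2 from sub_eq_zero.1 h] at hl0
    norm_num at hl0
  have h0a : (y0 - (1 - l0)) / (-1 - (1 - l0)) ≠ 0 := by
    refine div_ne_zero (sub_ne_zero.2 fun h => ?_) hβ2
    rw [← h] at hβ; linarith
  have h0b : (y0 - (1 - l0)) / (-1 - (1 - l0)) ≠ 1 := by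
    intro h
    rw [div_eq_one_iff_eq hβ2] at h
    have : y0 = -1 := by linear_combination h
    rw [this] at y0h; norm_num at y0h
  obtain ⟨Cs, hCs, hsch⟩ := schottky _ h0a h0b
  obtain ⟨d3, hd3⟩ : ∃ d3, d3 = c * ‖(F y0 - y0) / (-1 - (1 - l0))‖ / (16 * Cs) := ⟨_, rfl⟩
  have hFy : 0 < ‖(F y0 - y0) / (-1 - (1 - l0))‖ := norm_pos_iff.2 (div_ne_zero (sub_ne_zero.2 hy10) hβ2)
  have hd3p : 0 < d3 := by rw [hd3]; positivity
  obtain ⟨R3, hR3, ε3, hε3, -, hst3⟩ := zstep_both hb (lt_min hd3p (show 0 < c / 4 by positivity)) one_pos one_pos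
  obtain ⟨n1, hn1⟩ := exists_nat_ge (5 * R3)
  refine ⟨n1, fun n hn => ?_⟩
  have hnn : (5 * R3 : ℝ) ≤ n := hn1.trans (by exact_mod_cast hn)
  have hn0 : (0 : ℝ) ≤ n := Nat.cast_nonneg n
  set yn := h^[n] y0 with hyn
  obtain ⟨t1, t2, t3, t4, t5, t6⟩ := ytrk n
  rw [← hyn] at t1 t2 t3 t4 t5 t6
  have ynp : 0 < ‖yn‖ := norm_pos_iff.2 t1
  have t6' : (ZZ N B yn).im ≤ 3 / 10 * ‖ZZ N B yn‖ := by linarith [norm_nonneg (ZZ N B yn)]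
  have hYle : ‖ZZ N B yn‖ ≤ (1 + d) * (R + n) := by
    have := norm_add_le (-ZZ N B yn - (R + n)) (R + n)
    rw [sub_add_cancel, norm_neg, show (R + n : ℂ) = ((R + n : ℝ) : ℂ) by push_cast; rfl, Complex.norm_real, Real.norm_eq_abs,
      abs_of_nonneg (by positivity)] at this
    push_cast at this
    linarith
  have hFn : F^[n] yn = y0 := FF_hh_iter hl0n n y0
  have hcp' : 0 < c * ‖yn‖ := by positivity
  have hex : ∃ b ∈ ball yn (c * ‖yn‖), (f l0)^[q * n] b = 1 - l0 ∨ (f l0)^[q * n] b = -1 := by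
    by_contra! hno
    obtain ⟨e1, ⟨s, s1, s2, -⟩, -⟩ := hst3 0 yn t1 (by linarith) (by simpa using hε3.le) (by simp)
    set g : ℂ → ℂ := fun z => ((f l0)^[q * n] z - (1 - l0)) / (-1 - (1 - l0)) with hg
    have gd : Differentiable ℂ g := ((fit_diff _ _).sub_const _).div_const _
    have gb := hsch g yn (c * ‖yn‖) hcp' gd.differentiableOn (fun z hz => by
      obtain ⟨a1, a2⟩ := hno z hz
      refine ⟨div_ne_zero (sub_ne_zero.2 a1) hβ2, fun h => a2 ?_⟩
      rw [div_eq_one_iff_eq hβ2] at h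
      linear_combination h) (by rw [hg]; simp only; rw [← hFi, hFn])
    have hss : ‖F yn - yn‖ ≤ min d3 (c / 4) * ‖yn‖ := by
      rw [show F yn = yn * (1 + s) from s1, show yn * (1 + s) - yn = s * yn by ring, norm_mul]
      gcongr
    have h3 := lip_of_bound' (R := c * ‖yn‖ / 4) (R1 := c * ‖yn‖ / 2) (by linarith) gd.differentiableOn gb (z := F yn) (w := yn)
      (by rw [mem_closedBall, dist_eq_norm]; refine hss.trans ?_
          have : min d3 (c / 4) * ‖yn‖ ≤ c / 4 * ‖yn‖ := by gcongr; exact min_le_right _ _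
          linarith) (mem_closedBall_self (by positivity))
    have h2 : g (F yn) - g yn = (F y0 - y0) / (-1 - (1 - l0)) := by
      rw [hg]; simp only
      rw [← hFi, ← hFi, hFn, ← Function.iterate_succ_apply, Function.iterate_succ_apply', hFn]; ring
    rw [h2] at h3
    have h4 : Cs / ((c * ‖yn‖ / 2 - c * ‖yn‖ / 4) / 2) * ‖F yn - yn‖ ≤ Cs / ((c * ‖yn‖ / 2 - c * ‖yn‖ / 4) / 2) * (d3 * ‖yn‖) := by
      have : 0 < c * ‖yn‖ / 2 - c * ‖yn‖ / 4 := by linarith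
      gcongr
      refine hss.trans ?_
      gcongr; exact min_le_left _ _
    have h5 : Cs / ((c * ‖yn‖ / 2 - c * ‖yn‖ / 4) / 2) * (d3 * ‖yn‖) = 8 * Cs * d3 / c := by
      rw [show (c * ‖yn‖ / 2 - c * ‖yn‖ / 4) / 2 = c * ‖yn‖ / 8 by ring]; field_simp
    have h6 : 8 * Cs * d3 / c = ‖(F y0 - y0) / (-1 - (1 - l0))‖ / 2 := by rw [hd3]; field_simp; norm_num
    linarith
  obtain ⟨b, hbm, hbv⟩ := hex
  rw [mem_ball, dist_eq_norm] at hbm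
  obtain ⟨a1, a2, a3⟩ := near_sheet hN hB hκ t1 t2 t6' hbm.le hc4
  have hfin : ‖-ZZ N B b - (R + n : ℝ)‖ ≤ δ * (R + n) := by
    have := norm_sub_le (-ZZ N B yn - (R + n)) (ZZ N B b - ZZ N B yn)
    rw [show -ZZ N B yn - (R + n) - (ZZ N B b - ZZ N B yn) = -ZZ N B b - (R + n) by ring] at this
    push_cast
    have h7 : 3 * N * c * ‖ZZ N B yn‖ ≤ 39 * d * ((1 + d) * (R + n)) := by
      rw [show 3 * N * c = 3 * (c * N) by ring, hcN, show 3 * (13 * d) = 39 * d by ring]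
      gcongr
    have h8 : 0 < d * (R + n) := by positivity
    have h9 : δ = 100 * d := by rw [hd]; ring
    rw [h9]
    nlinarith
  rcases hbv with hv | hv
  · exact ⟨b, q * n, a1, a2, hv, hfin⟩
  · refine ⟨b, q * n + 1, a1, a2, ?_, hfin⟩
    rw [Function.iterate_succ_apply', hv]; unfold f; ring

end Mand

open Complex Metric Set Filter Topology
open scoped NNReal ENNReal

namespace Mand

noncomputable def TT (a : ℂ) (X : ℝ) (k : ℕ) : ℂ := X * a ^ k + ∑ j ∈ Finset.range k, a ^ j

lemma TT_succ (a : ℂ) (X : ℝ) (k : ℕ) : TT a X (k + 1) = a * TT a X k + 1 := by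
  unfold TT; rw [geom_sum_succ]; ring

lemma sum_quad (k : ℕ) (c s : ℝ) : ∑ j ∈ Finset.range k, (1 - (s * (c - j)) ^ 2 / 2) =
    k - s ^ 2 / 2 * (k * c ^ 2 - c * (k * (k - 1)) + (k - 1) * k * (2 * k - 1) / 6) := by
  induction k with
  | zero => simp
  | succ k ih => rw [Finset.sum_range_succ, ih]; push_cast; ring

lemma exp_mul_I_pow (θ : ℝ) (j : ℕ) : exp (-(θ * I)) ^ j = exp (((-(j * θ) : ℝ) : ℂ) * I) := by
  rw [← Complex.exp_nat_mul]; congr 1; push_cast; ring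

lemma model0 {X : ℝ} (hX : 0 < X) {n k : ℕ} (hn : 100 ≤ n) (hnX : 10 * X ≤ n) (hk : k ≤ n) :
    (TT (exp (-((Real.pi / n : ℝ) * I))) X k).im ≤ 0 ∧ 7 / 25 * (X + k) ≤ ‖TT (exp (-((Real.pi / n : ℝ) * I))) X k‖ := by
  obtain ⟨θ, hθ⟩ : ∃ θ, θ = Real.pi / n := ⟨_, rfl⟩
  have hn' : (100 : ℝ) ≤ n := by exact_mod_cast hn
  have hn0 : (0 : ℝ) < n := by linarith
  have hk' : (k : ℝ) ≤ n := by exact_mod_cast hk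
  have hk0 : (0 : ℝ) ≤ k := Nat.cast_nonneg k
  have hnθ : n * θ = Real.pi := by rw [hθ]; field_simp
  have hpi := Real.pi_lt_d4
  have hpi0 := Real.pi_pos
  have hθ0 : 0 < θ := by rw [hθ]; positivity
  have hkθ : k * θ ≤ Real.pi := by rw [← hnθ]; gcongr
  have hkθ0 : 0 ≤ k * θ := by positivity
  have hθ1 : θ ≤ 1 / 20 := by nlinarith
  rw [← hθ]
  have hpow := exp_mul_I_pow θ
  constructor
  · unfold TT
    rw [Complex.add_im, Complex.im_ofReal_mul, Complex.im_sum, hpow, exp_ofReal_mul_I_im, Real.sin_neg]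
    have h1 : 0 ≤ Real.sin (k * θ) := Real.sin_nonneg_of_nonneg_of_le_pi hkθ0 hkθ
    have h2 : ∑ j ∈ Finset.range k, (exp (-(θ * I)) ^ j).im ≤ 0 := by
      refine Finset.sum_nonpos fun j hj => ?_
      have hjk : (j : ℝ) ≤ k := by exact_mod_cast (Finset.mem_range.1 hj).le
      rw [hpow, exp_ofReal_mul_I_im, Real.sin_neg, neg_nonpos]
      refine Real.sin_nonneg_of_nonneg_of_le_pi (by positivity) (le_trans ?_ hkθ)
      gcongr
    nlinarith
  · have hw : ‖exp (((k * θ / 2 : ℝ) : ℂ) * I)‖ = 1 := norm_exp_ofReal_mul_I _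
    have hT : ‖TT (exp (-(θ * I))) X k‖ = ‖exp (((k * θ / 2 : ℝ) : ℂ) * I) * TT (exp (-(θ * I))) X k‖ := by
      rw [norm_mul, hw, one_mul]
    rw [hT]
    refine le_trans ?_ (Complex.re_le_norm _)
    have hre : (exp (((k * θ / 2 : ℝ) : ℂ) * I) * TT (exp (-(θ * I))) X k).re =
        X * Real.cos (k * θ / 2) + ∑ j ∈ Finset.range k, Real.cos (θ * (k / 2 - j)) := by
      unfold TT
      rw [mul_add, Finset.mul_sum, Complex.add_re, Complex.re_sum, hpow,
        show exp (((k * θ / 2 : ℝ) : ℂ) * I) * (X * exp (((-(k * θ) : ℝ) : ℂ) * I)) =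
          X * (exp (((k * θ / 2 : ℝ) : ℂ) * I) * exp (((-(k * θ) : ℝ) : ℂ) * I)) by ring, ← Complex.exp_add,
        show ((k * θ / 2 : ℝ) : ℂ) * I + ((-(k * θ) : ℝ) : ℂ) * I = ((-(k * θ / 2) : ℝ) : ℂ) * I by push_cast; ring,
        Complex.re_ofReal_mul, exp_ofReal_mul_I_re, Real.cos_neg]
      congr 1
      refine Finset.sum_congr rfl fun j _ => ?_
      rw [hpow, ← Complex.exp_add,
        show ((k * θ / 2 : ℝ) : ℂ) * I + ((-(j * θ) : ℝ) : ℂ) * I = ((θ * (k / 2 - j) : ℝ) : ℂ) * I by push_cast; ring,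
        exp_ofReal_mul_I_re]
    rw [hre]
    have hs : ∑ j ∈ Finset.range k, (1 - (θ * (k / 2 - j)) ^ 2 / 2) ≤ ∑ j ∈ Finset.range k, Real.cos (θ * (k / 2 - j)) :=
      Finset.sum_le_sum fun j _ => Real.one_sub_sq_div_two_le_cos
    rw [sum_quad] at hs
    have hsq : (k * θ) ^ 2 ≤ 9.871 := by
      calc (k * θ) ^ 2 ≤ 3.1416 ^ 2 := by gcongr; linarith
        _ ≤ _ := by norm_num
    have hid : (k : ℝ) - θ ^ 2 / 2 * (k * (k / 2) ^ 2 - k / 2 * (k * (k - 1)) + (k - 1) * k * (2 * k - 1) / 6) =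
      k * (1 - (k * θ) ^ 2 / 24 - θ ^ 2 / 12) := by ring
    rw [hid] at hs
    have hs2 : 29 / 50 * (k : ℝ) ≤ k * (1 - (k * θ) ^ 2 / 24 - θ ^ 2 / 12) := by
      rw [mul_comm]; gcongr; nlinarith
    have hc0 : 0 ≤ Real.cos (k * θ / 2) := Real.cos_nonneg_of_neg_pi_div_two_le_of_le (by linarith) (by linarith)
    by_cases h : (k : ℝ) ≤ n / 2
    · have hc := @Real.one_sub_sq_div_two_le_cos (k * θ / 2)
      have h1 : k * θ / 2 ≤ 1 := by nlinarith
      have h2 : (k * θ / 2) ^ 2 ≤ 1 := by apply pow_le_one₀ (by positivity) h1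
      have : X * (1 / 2) ≤ X * Real.cos (k * θ / 2) := by gcongr; linarith
      linarith
    · have : 0 ≤ X * Real.cos (k * θ / 2) := by positivity
      linarith

lemma exp_sub_one_le {x : ℂ} (h : ‖x‖ ≤ 1) : ‖exp x - 1‖ ≤ 2 * ‖x‖ := norm_exp_sub_one_le h

lemma TT_conj (a : ℂ) (X : ℝ) (k : ℕ) : TT ((starRingEnd ℂ) a) X k = (starRingEnd ℂ) (TT a X k) := by
  simp [TT]

lemma TT_pert {a x : ℂ} {X r : ℝ} (hX : 0 ≤ X) {n k : ℕ} (ha : ‖a‖ = 1) (hk : k ≤ n) (hx : n * ‖x‖ ≤ r) (hr : r ≤ 1) :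
    ‖TT (a * exp x) X k - TT a X k‖ ≤ 2 * r * (X + k) := by
  have h1 : ∀ j ≤ n, ‖(a * exp x) ^ j - a ^ j‖ ≤ 2 * r := by
    intro j hj
    rw [mul_pow, ← Complex.exp_nat_mul, show a ^ j * exp (j * x) - a ^ j = a ^ j * (exp (j * x) - 1) by ring, norm_mul,
      norm_pow, ha, one_pow, one_mul]
    have h2 : ‖(j : ℂ) * x‖ ≤ r := by
      rw [norm_mul, Complex.norm_natCast]
      refine le_trans ?_ hx
      gcongr
    exact (exp_sub_one_le (h2.trans hr)).trans (by linarith)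
  unfold TT
  rw [show X * (a * exp x) ^ k + ∑ j ∈ Finset.range k, (a * exp x) ^ j - (X * a ^ k + ∑ j ∈ Finset.range k, a ^ j) =
    X * ((a * exp x) ^ k - a ^ k) + ∑ j ∈ Finset.range k, ((a * exp x) ^ j - a ^ j) by rw [Finset.sum_sub_distrib]; ring]
  refine (norm_add_le _ _).trans ?_
  have h3 : ‖∑ j ∈ Finset.range k, ((a * exp x) ^ j - a ^ j)‖ ≤ ∑ j ∈ Finset.range k, 2 * r :=
    norm_sum_le_of_le _ fun j hj => h1 j ((Finset.mem_range.1 hj).le.trans hk)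
  rw [Finset.sum_const, Finset.card_range, nsmul_eq_mul] at h3
  have h4 : ‖X * ((a * exp x) ^ k - a ^ k)‖ ≤ X * (2 * r) := by
    rw [norm_mul, Complex.norm_real, Real.norm_eq_abs, abs_of_nonneg hX]
    gcongr
    exact h1 k hk
  linarith

/-- the model orbit -/
lemma model {X : ℝ} (hX : 0 < X) {n : ℕ} (hn : 100 ≤ n) (hnX : 10 * X ≤ n) {u : ℂ} (hu : ‖u‖ ≤ 1 / 400) {σ : ℂ}
    (hσ : σ = 1 ∨ σ = -1) {k : ℕ} (hk : k ≤ n) :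
    (X + k) / 4 ≤ ‖TT (exp (-(σ * (Real.pi / n * I * (1 + u))))) X k‖ ∧
    ‖TT (exp (-(σ * (Real.pi / n * I * (1 + u))))) X k‖ ≤ 2 * (X + k) ∧
    (σ * TT (exp (-(σ * (Real.pi / n * I * (1 + u))))) X k).im ≤ (X + k) / 50 := by
  have hn' : (100 : ℝ) ≤ n := by exact_mod_cast hn
  have hn0 : (0 : ℝ) < n := by linarith
  have hpi := Real.pi_lt_d4
  have hpi0 := Real.pi_pos
  have hk0 : (0 : ℝ) ≤ k := Nat.cast_nonneg k
  have hσn : ‖σ‖ = 1 := by rcases hσ with rfl | rfl <;> simp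
  obtain ⟨a, ha⟩ : ∃ a, a = exp (-(σ * (Real.pi / n * I))) := ⟨_, rfl⟩
  have hsplit : exp (-(σ * (Real.pi / n * I * (1 + u)))) = a * exp (-(σ * (Real.pi / n * I * u))) := by
    rw [ha, ← Complex.exp_add]; congr 1; ring
  have ha0 : (σ * TT a X k).im ≤ 0 ∧ 7 / 25 * (X + k) ≤ ‖TT a X k‖ ∧ ‖a‖ = 1 := by
    obtain ⟨m1, m2⟩ := model0 hX hn hnX hk
    have e : ∀ t : ℝ, ‖exp (t * I)‖ = 1 := norm_exp_ofReal_mul_I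
    rcases hσ with rfl | rfl
    · have : a = exp (-((Real.pi / n : ℝ) * I)) := by rw [ha]; push_cast; ring_nf
      rw [this, one_mul]
      refine ⟨m1, m2, ?_⟩
      rw [← neg_mul]; exact_mod_cast e (-(Real.pi / n))
    · have : a = (starRingEnd ℂ) (exp (-((Real.pi / n : ℝ) * I))) := by
        rw [← Complex.exp_conj, ha]; congr 1; simp
      rw [this, TT_conj]
      refine ⟨by simpa using m1, by rw [Complex.norm_conj]; exact m2, ?_⟩
      rw [Complex.norm_conj, ← neg_mul]; exact_mod_cast e (-(Real.pi / n))
  obtain ⟨a1, a2, a3⟩ := ha0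
  have hp := TT_pert (x := -(σ * (Real.pi / n * I * u))) (r := 1 / 100) hX.le a3 hk (by
    rw [norm_neg, norm_mul, hσn, one_mul, norm_mul, norm_mul, norm_div, Complex.norm_I, Complex.norm_natCast, Complex.norm_real,
      Real.norm_eq_abs, abs_of_pos hpi0, show n * (Real.pi / n * 1 * ‖u‖) = Real.pi * ‖u‖ by field_simp]
    nlinarith [norm_nonneg u]) (by norm_num)
  rw [← hsplit] at hp
  set t := TT (exp (-(σ * (Real.pi / n * I * (1 + u))))) X k
  have a4 : ‖TT a X k‖ ≤ X + k := by
    unfold TT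
    refine (norm_add_le _ _).trans ?_
    have h3 : ‖∑ j ∈ Finset.range k, a ^ j‖ ≤ ∑ j ∈ Finset.range k, (1 : ℝ) :=
      norm_sum_le_of_le _ fun j hj => by rw [norm_pow, a3, one_pow]
    rw [Finset.sum_const, Finset.card_range, nsmul_eq_mul, mul_one] at h3
    rw [norm_mul, Complex.norm_real, norm_pow, a3, one_pow, mul_one, Real.norm_eq_abs, abs_of_pos hX]
    linarith
  have h5 := norm_sub_norm_le (TT a X k) t
  have h6 := norm_sub_norm_le t (TT a X k)
  rw [norm_sub_rev] at h5
  refine ⟨by linarith, by linarith, ?_⟩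
  have h7 : (σ * t).im - (σ * TT a X k).im ≤ ‖t - TT a X k‖ := by
    rw [← Complex.sub_im, ← mul_sub]
    refine (Complex.im_le_norm _).trans ?_
    rw [norm_mul, hσn, one_mul]
  linarith

lemma model_alpha {n : ℕ} (hn : 0 < n) {u σ : ℂ} (hu : ‖u‖ ≤ 1 / 400) (hσ : σ = 1 ∨ σ = -1) :
    ‖exp (-(σ * (Real.pi / n * I * (1 + u))))‖ ≤ Real.exp (1 / 100 / n) ∧ 1 ≤ Real.exp (1 / 100 / n) ∧
      Real.exp (1 / 100 / n) ^ n ≤ 2 := by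
  have hn0 : (0 : ℝ) < n := by exact_mod_cast hn
  have hpi := Real.pi_lt_d4
  have hpi0 := Real.pi_pos
  refine ⟨?_, Real.one_le_exp (by positivity), ?_⟩
  · rw [Complex.norm_exp]
    refine Real.exp_le_exp.2 ?_
    have : (-(σ * (Real.pi / n * I * (1 + u)))).re = (-(σ * (Real.pi / n * I * u))).re := by
      rcases hσ with rfl | rfl
      · rw [show -(1 * (Real.pi / n * I * (1 + u))) = -(1 * (Real.pi / n * I * u)) - ((Real.pi / n : ℝ) : ℂ) * I by push_cast; ring, Complex.sub_re,
          Complex.re_ofReal_mul, I_re]; ring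
      · rw [show -(-1 * (Real.pi / n * I * (1 + u))) = -(-1 * (Real.pi / n * I * u)) + ((Real.pi / n : ℝ) : ℂ) * I by push_cast; ring, Complex.add_re,
          Complex.re_ofReal_mul, I_re]; ring
    rw [this]
    have hσn : ‖σ‖ = 1 := by rcases hσ with rfl | rfl <;> simp
    refine (Complex.re_le_norm _).trans ?_
    rw [norm_neg, norm_mul, hσn, one_mul, norm_mul, norm_mul, norm_div, Complex.norm_I, Complex.norm_natCast, Complex.norm_real,
      Real.norm_eq_abs, abs_of_pos hpi0, mul_one, div_mul_eq_mul_div]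
    gcongr
    nlinarith [norm_nonneg u]
  · rw [← Real.exp_nat_mul, mul_div_cancel₀ _ hn0.ne']
    have := Real.exp_bound_div_one_sub_of_interval (x := 1 / 100) (by norm_num) (by norm_num)
    refine this.trans (by norm_num)

/-- the defect S(u) -/
lemma model_defect {X : ℝ} (hX : 10 ≤ X) {n : ℕ} (hn : 1000 ≤ n) :
    (‖TT (exp (-(1 * (Real.pi / n * I * (1 + 0))))) X n + TT (exp (-(-1 * (Real.pi / n * I * (1 + 0))))) X n‖ ≤ 3 * X) ∧
    ∀ u : ℂ, ‖u‖ = 1 / 400 → 1 / 250 * n - 3 * X ≤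
      ‖TT (exp (-(1 * (Real.pi / n * I * (1 + u))))) X n + TT (exp (-(-1 * (Real.pi / n * I * (1 + u))))) X n‖ := by
  have hn' : (1000 : ℝ) ≤ n := by exact_mod_cast hn
  have hn0 : (0 : ℝ) < n := by linarith
  have hnc : (n : ℂ) ≠ 0 := by exact_mod_cast hn0.ne'
  have hpi := Real.pi_lt_d4
  have hpi3 := Real.pi_gt_three
  have hpi0 := Real.pi_pos
  have hpin : ‖(Real.pi : ℂ)‖ = Real.pi := by rw [Complex.norm_real, Real.norm_eq_abs, abs_of_pos hpi0]
  have key : ∀ u : ℂ, ‖u‖ ≤ 1 / 400 → ∃ w : ℂ, w = Real.pi / n * I * (1 + u) ∧ exp (-w) ≠ 1 ∧ ‖1 - exp (-w)‖ ≤ 33 / 10 / n ∧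
      TT (exp (-(1 * (Real.pi / n * I * (1 + u))))) X n + TT (exp (-(-1 * (Real.pi / n * I * (1 + u))))) X n =
      -(X * (exp (-(Real.pi * I * u)) + exp (Real.pi * I * u))) + (1 + exp (Real.pi * I * u)) +
        (exp (-(Real.pi * I * u)) - exp (Real.pi * I * u)) / (1 - exp (-w)) := by
    intro u hu
    refine ⟨_, rfl, ?_⟩
    set w := Real.pi / n * I * (1 + u) with hw
    have hun : ‖1 + u‖ ≤ 401 / 400 := (norm_add_le _ _).trans (by rw [norm_one]; linarith)
    have hun2 : 399 / 400 ≤ ‖1 + u‖ := by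
      have := norm_sub_le (1 + u) u
      rw [add_sub_cancel_right, norm_one] at this; linarith
    have hwn : ‖w‖ = Real.pi / n * ‖1 + u‖ := by
      rw [hw, norm_mul, norm_mul, norm_div, Complex.norm_I, Complex.norm_natCast, hpin, mul_one]
    have hpn : Real.pi / n ≤ 1 / 300 := by rw [div_le_iff₀ hn0]; linarith
    have hpn0 : 0 < Real.pi / n := by positivity
    have hw1 : ‖w‖ ≤ 1 / 200 := by rw [hwn]; nlinarith
    have hw0 : 0 < ‖w‖ := by rw [hwn]; positivity
    have hq := norm_exp_sub_one_sub_id_le (x := -w) (by rw [norm_neg]; linarith)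
    rw [norm_neg] at hq
    have e1 : ‖1 - exp (-w)‖ ≤ ‖w‖ + ‖w‖ ^ 2 := by
      have := norm_sub_le w (exp (-w) - 1 - -w)
      rw [show w - (exp (-w) - 1 - -w) = 1 - exp (-w) by ring] at this
      linarith
    have e2 : exp (-w) ≠ 1 := by
      intro h
      rw [h, show (1 : ℂ) - 1 - -w = w by ring] at hq
      nlinarith
    have e3 : exp (w * n) = -exp (Real.pi * I * u) := by
      rw [hw, show Real.pi / n * I * (1 + u) * n = Real.pi * I + Real.pi * I * u by field_simp, Complex.exp_add, exp_pi_mul_I]; ring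
    refine ⟨e2, ?_, ?_⟩
    · have : ‖w‖ + ‖w‖ ^ 2 ≤ ‖w‖ * (201 / 200) := by nlinarith
      refine e1.trans (this.trans ?_)
      rw [hwn, div_mul_eq_mul_div, div_mul_eq_mul_div]
      gcongr
      nlinarith
    · have e4 : exp w ≠ 1 := by
        intro h; apply e2; rw [Complex.exp_neg, h, inv_one]
      unfold TT
      rw [one_mul, neg_one_mul, neg_neg, geom_sum_eq e2, geom_sum_eq e4, ← Complex.exp_nat_mul, ← Complex.exp_nat_mul,
        mul_comm (n : ℂ) w, e3, show (n : ℂ) * -w = -(w * n) by ring, Complex.exp_neg (w * n), e3]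
      have ew : exp (-w) = (exp w)⁻¹ := Complex.exp_neg w
      have eu : exp (-(Real.pi * I * u)) = (exp (Real.pi * I * u))⁻¹ := Complex.exp_neg _
      rw [ew, eu]
      have z1 := Complex.exp_ne_zero w
      have z2 := Complex.exp_ne_zero (Real.pi * I * u)
      set E := exp w
      set U := exp (Real.pi * I * u)
      have z3 : E - 1 ≠ 0 := sub_ne_zero.2 e4
      have i1 : E⁻¹ - 1 = -(E - 1) / E := by field_simp; ring
      have i2 : 1 - E⁻¹ = (E - 1) / E := by field_simp
      rw [i1, i2]
      field_simp
      ring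
  constructor
  · obtain ⟨w, -, -, -, h⟩ := key 0 (by norm_num)
    rw [h]
    simp only [mul_zero, neg_zero, Complex.exp_zero, sub_self, zero_div, add_zero]
    rw [show -((X : ℂ) * (1 + 1)) + (1 + 1) = ((-(2 * X) + 2 : ℝ) : ℂ) by push_cast; ring, Complex.norm_real, Real.norm_eq_abs, abs_le]
    constructor <;> linarith
  · intro u hu
    obtain ⟨w, -, hw1, hw2, h⟩ := key u hu.le
    rw [h]
    set U := Real.pi * I * u with hU
    have hUn : ‖U‖ = Real.pi / 400 := by rw [hU, norm_mul, norm_mul, hpin, Complex.norm_I, hu]; ring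
    have hU1 : ‖U‖ ≤ 1 / 100 := by rw [hUn]; linarith
    have q1 := norm_exp_sub_one_sub_id_le (x := U) (by linarith)
    have q2 := norm_exp_sub_one_sub_id_le (x := -U) (by rw [norm_neg]; linarith)
    rw [norm_neg] at q2
    have d1 : 7 / 500 ≤ ‖exp (-U) - exp U‖ := by
      have := norm_sub_le (exp (-U) - exp U) ((exp (-U) - 1 - -U) - (exp U - 1 - U))
      have h2 := norm_sub_le (exp (-U) - 1 - -U) (exp U - 1 - U)
      rw [show exp (-U) - exp U - ((exp (-U) - 1 - -U) - (exp U - 1 - U)) = -(2 * U) by ring, norm_neg, norm_mul, show ‖(2 : ℂ)‖ = 2 by simp] at this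
      have : ‖U‖ ^ 2 ≤ 1 / 100 * ‖U‖ := by nlinarith [norm_nonneg U]
      linarith
    have b1 : ‖exp U‖ ≤ 102 / 100 := by
      have := norm_add_le (exp U - 1) 1
      rw [sub_add_cancel, norm_one] at this
      have h2 := exp_sub_one_le (x := U) (by linarith)
      linarith
    have b2 : ‖exp (-U)‖ ≤ 102 / 100 := by
      have := norm_add_le (exp (-U) - 1) 1
      rw [sub_add_cancel, norm_one] at this
      have h2 := exp_sub_one_le (x := -U) (by rw [norm_neg]; linarith)
      rw [norm_neg] at h2
      linarith
    have hw0 : 0 < ‖1 - exp (-w)‖ := norm_pos_iff.2 (sub_ne_zero.2 hw1.symm)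
    have d2 : 1 / 250 * n ≤ ‖(exp (-U) - exp U) / (1 - exp (-w))‖ := by
      rw [norm_div, le_div_iff₀ hw0]
      calc 1 / 250 * n * ‖1 - exp (-w)‖ ≤ 1 / 250 * n * (33 / 10 / n) := by gcongr
        _ = 1 / 250 * (33 / 10) := by field_simp
        _ ≤ _ := by linarith
    have d3 : ‖-(X * (exp (-U) + exp U)) + (1 + exp U)‖ ≤ 3 * X := by
      refine (norm_add_le _ _).trans ?_
      rw [norm_neg, norm_mul, Complex.norm_real, Real.norm_eq_abs, abs_of_pos (by linarith)]
      have h1 := norm_add_le (exp (-U)) (exp U)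
      have h2 := norm_add_le 1 (exp U)
      rw [norm_one] at h2
      nlinarith
    have := norm_sub_le (-(X * (exp (-U) + exp U)) + (1 + exp U) + (exp (-U) - exp U) / (1 - exp (-w))) (-(X * (exp (-U) + exp U)) + (1 + exp U))
    rw [add_sub_cancel_left] at this
    linarith

end Mand

open Complex Metric Set Filter Topology
open scoped NNReal ENNReal

namespace Mand

lemma fit_diff2 {m y : ℂ → ℂ} {u : ℂ} (hm : DifferentiableAt ℂ m u) (hy : DifferentiableAt ℂ y u) (n : ℕ) :
    DifferentiableAt ℂ (fun v => (f (m v))^[n] (y v)) u := by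
  induction n with
  | zero => exact hy
  | succ n ih =>
    simp only [Function.iterate_succ_apply']
    unfold f at ih ⊢
    exact (hm.mul ih).add (ih.pow 2)

/-- the critical value orbit as function of the parameter -/
noncomputable def vv (l0 : ℂ) (q i : ℕ) (l : ℂ) : ℂ := (f (mu l0 q l))^[i] (-(mu l0 q l) ^ 2 / 4)

lemma vv_diff (l0 : ℂ) (q i : ℕ) : Differentiable ℂ (vv l0 q i) := fun u => by
  unfold vv
  exact fit_diff2 (mu_diff l0 q u) (((mu_diff l0 q u).pow 2).neg.div_const 4) i

lemma sheet_stable {N : ℕ} (hN : 0 < N) {B κ : ℂ} (hB : B ≠ 0) (hκ : κ ^ N = -I / (N * B)) {σ : ℂ}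
    (hσ : σ = 1 ∨ σ = -1) {X : ℝ} (hX : 0 < X) {y w : ℂ} (hy0 : y ≠ 0) (hy : y = zh κ N (ZZ N B y))
    (hyX : ‖σ * ZZ N B y - X‖ ≤ 1 / 8000 * X) (hw : ‖w - y‖ ≤ 1 / (80000 * N) * ‖y‖) :
    w ≠ 0 ∧ w = zh κ N (ZZ N B w) ∧ ‖σ * ZZ N B w - X‖ ≤ 1 / 4000 * X := by
  have hN1 : (1 : ℝ) ≤ N := by exact_mod_cast hN
  have hσn : ‖σ‖ = 1 := by rcases hσ with rfl | rfl <;> simp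
  have hXn : ‖(X : ℂ)‖ = X := by rw [Complex.norm_real, Real.norm_eq_abs, abs_of_pos hX]
  have h1 : ‖ZZ N B y‖ ≤ 2 * X := by
    have := norm_add_le (σ * ZZ N B y - X) X
    rw [sub_add_cancel, norm_mul, hσn, one_mul, hXn] at this
    linarith
  have h1' : 9 / 10 * X ≤ ‖ZZ N B y‖ := by
    have := norm_sub_le (σ * ZZ N B y) (σ * ZZ N B y - X)
    rw [sub_sub_cancel, norm_mul, hσn, one_mul, hXn] at this
    linarith
  have him : |(ZZ N B y).im| ≤ 1 / 8000 * X := by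
    have := (Complex.abs_im_le_norm (σ * ZZ N B y - X)).trans hyX
    rw [Complex.sub_im, ofReal_im, sub_zero] at this
    rcases hσ with rfl | rfl
    · simpa using this
    · simpa using this
  obtain ⟨a1, a2, a3⟩ := near_sheet hN hB hκ hy0 hy (by linarith [(abs_le.1 him).2]) hw (by gcongr; norm_num)
  refine ⟨a1, a2, ?_⟩
  have h2 := norm_add_le (σ * (ZZ N B w - ZZ N B y)) (σ * ZZ N B y - X)
  rw [show σ * (ZZ N B w - ZZ N B y) + (σ * ZZ N B y - X) = σ * ZZ N B w - X by ring, norm_mul, hσn, one_mul] at h2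
  have h3 : 3 * N * (1 / (80000 * N)) * ‖ZZ N B y‖ ≤ 3 / 80000 * (2 * X) := by
    rw [show 3 * (N : ℝ) * (1 / (80000 * N)) = 3 / 80000 by field_simp]
    gcongr
  linarith

/-- the critical orbit at the parabolic parameter never hits beta -/
lemma vv_ne_beta {l0 : ℂ} {q N : ℕ} {B κ : ℂ} {C ε : ℝ} (hb : Base l0 q N B C ε) (hκ : κ ^ N = -I / (N * B)) (i : ℕ) :
    (f l0)^[i] (-l0 ^ 2 / 4) ≠ 1 - l0 := by
  intro hi
  obtain ⟨R0, h⟩ := B3a hb hκ (δ := 1 / 100) (by norm_num) le_rfl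
  obtain ⟨n1, h⟩ := h (max R0 1) (le_max_left _ _)
  have hfix : ∀ j, (f l0)^[j] (1 - l0) = 1 - l0 := fun j => Function.iterate_fixed (by unfold f; ring) j
  have hfin : (Set.range fun j => (f l0)^[j] (-l0 ^ 2 / 4)).Finite := by
    refine ((Finset.range (i + 1)).finite_toSet.image (fun j => (f l0)^[j] (-l0 ^ 2 / 4))).subset ?_
    rintro _ ⟨j, rfl⟩
    by_cases hj : j < i + 1
    · exact ⟨j, by simpa using hj, rfl⟩
    · refine ⟨i, by simp, ?_⟩
      obtain ⟨k, rfl⟩ : ∃ k, j = k + i := ⟨j - i, by omega⟩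
      simp only
      rw [Function.iterate_add_apply, hi, hfix]
  obtain ⟨M, hM⟩ := (hfin.image fun z => ‖ZZ N B z‖).bddAbove
  obtain ⟨n2, hn2⟩ := exists_nat_gt (2 * M)
  obtain ⟨j, -, -, h3⟩ := h (max n1 n2) (le_max_left _ _)
  have h4 : ‖ZZ N B ((f l0)^[j] (-l0 ^ 2 / 4))‖ ≤ M := hM ⟨_, ⟨j, rfl⟩, rfl⟩
  have h5 := norm_sub_le (ZZ N B ((f l0)^[j] (-l0 ^ 2 / 4))) (ZZ N B ((f l0)^[j] (-l0 ^ 2 / 4)) - (max R0 1 + (max n1 n2 : ℕ) : ℝ))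
  have h6 : (n2 : ℝ) ≤ (max n1 n2 : ℕ) := by exact_mod_cast le_max_right _ _
  have h7 : (1 : ℝ) ≤ max R0 1 := le_max_right _ _
  have h8 : (0 : ℝ) ≤ n2 := Nat.cast_nonneg _
  rw [sub_sub_cancel, Complex.norm_real, Real.norm_eq_abs, abs_of_nonneg (by linarith)] at h5
  linarith

lemma mu_cont (l0 : ℂ) (q : ℕ) : Continuous (mu l0 q) := (mu_diff l0 q).continuous

set_option maxHeartbeats 1000000 in
lemma start {l0 : ℂ} {q N : ℕ} {B κ : ℂ} {C ε : ℝ} (hb : Base l0 q N B C ε) (hκ : κ ^ N = -I / (N * B)) (X1 : ℝ) :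
    ∃ X : ℝ, X1 ≤ X ∧ 10 ≤ X ∧ ∃ (i0 i1 : ℕ) (b0 : ℂ → ℂ), ∃ η > 0, ∀ l, ‖l‖ < η → DifferentiableAt ℂ b0 l ∧
      (f (mu l0 q l))^[i1] (b0 l) = 1 - mu l0 q l ∧
      (vv l0 q i0 l ≠ 0 ∧ vv l0 q i0 l = zh κ N (ZZ N B (vv l0 q i0 l)) ∧ ‖1 * ZZ N B (vv l0 q i0 l) - X‖ ≤ 1 / 4000 * X) ∧
      (b0 l ≠ 0 ∧ b0 l = zh κ N (ZZ N B (b0 l)) ∧ ‖-1 * ZZ N B (b0 l) - X‖ ≤ 1 / 4000 * X) := by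
  have hN : 0 < N := hb.q_pos.trans_le hb.q_le
  have hN1 : (1 : ℝ) ≤ N := by exact_mod_cast hN
  have hB := hb.B_ne
  have hl0 : ‖l0 + 1‖ < 1 / 20 := hb.near.trans (by norm_num)
  obtain ⟨Ra, ha⟩ := B3a hb hκ (δ := 1 / 8000) (by norm_num) (by norm_num)
  obtain ⟨Rb, hbb⟩ := B3b hb hκ (δ := 1 / 8000) (by norm_num) (by norm_num)
  obtain ⟨R, hR⟩ : ∃ R, R = max (max Ra Rb) (max X1 10) := ⟨_, rfl⟩
  obtain ⟨na, ha⟩ := ha R (by rw [hR]; exact (le_max_left _ _).trans (le_max_left _ _))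
  obtain ⟨nb, hbb⟩ := hbb R (by rw [hR]; exact (le_max_right _ _).trans (le_max_left _ _))
  obtain ⟨i0, v1, v2, v3⟩ := ha (max na nb) (le_max_left _ _)
  obtain ⟨b, i1, b1, b2, b3, b4⟩ := hbb (max na nb) (le_max_right _ _)
  have hR1 : X1 ≤ R := by rw [hR]; exact (le_max_left _ _).trans (le_max_right _ _)
  have hR10 : 10 ≤ R := by rw [hR]; exact (le_max_right _ _).trans (le_max_right _ _)
  obtain ⟨X, hX⟩ : ∃ X : ℝ, X = R + (max na nb : ℕ) := ⟨_, rfl⟩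
  rw [← hX] at v3 b4
  have hXR : R ≤ X := by rw [hX]; exact le_add_of_nonneg_right (Nat.cast_nonneg _)
  have hX0 : 0 < X := by linarith
  -- the branch
  obtain ⟨ρ, hρ, hρv⟩ : ∃ ρ > 0, ∀ i < i1, (f l0)^[i] (-l0 ^ 2 / 4) ∉ ball (1 - l0) ρ := by
    have hfin := ((Finset.range i1).finite_toSet.image (fun j => (f l0)^[j] (-l0 ^ 2 / 4)))
    have hop : IsOpen ((fun j => (f l0)^[j] (-l0 ^ 2 / 4)) '' (Finset.range i1 : Set ℕ))ᶜ := hfin.isClosed.isOpen_compl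
    obtain ⟨ρ, hρ, h⟩ := Metric.isOpen_iff.1 hop (1 - l0) (by
      rintro ⟨j, -, hj⟩; exact vv_ne_beta hb hκ j hj)
    refine ⟨ρ, hρ, fun i hi hm => h hm ⟨i, by simpa using hi, rfl⟩⟩
  obtain ⟨G, Gd, Gi, G1⟩ := inv_branch (ball_simply (1 - l0) hρ) isOpen_ball (mem_ball_self hρ) i1 hρv b b3
  have hcb : 0 < 1 / (80000 * N) * ‖b‖ := by have := norm_pos_iff.2 b1; positivity
  have hcv : 0 < 1 / (80000 * N) * ‖vv l0 q i0 0‖ := by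
    have : vv l0 q i0 0 ≠ 0 := by unfold vv; rw [mu_zero]; exact v1
    have := norm_pos_iff.2 this; positivity
  obtain ⟨η, hη, GG, GGd, GGs⟩ := lift_branch l0 (1 - l0) i1 (ρ / 2) ρ (by linarith) G Gd Gi _ (half_pos hcb)
  -- neighbourhoods
  have hopen : IsOpen (ball l0 η ×ˢ ball (1 - l0) (ρ / 2)) := isOpen_ball.prod isOpen_ball
  set b0 : ℂ → ℂ := fun l => GG (mu l0 q l) (1 - mu l0 q l) with hb0
  have hpair : Continuous (fun l => (mu l0 q l, 1 - mu l0 q l)) := by have := mu_cont l0 q; fun_prop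
  have hmem0 : ((mu l0 q 0, 1 - mu l0 q 0) : ℂ × ℂ) ∈ ball l0 η ×ˢ ball (1 - l0) (ρ / 2) := by
    rw [mu_zero]; exact ⟨mem_ball_self hη, mem_ball_self (by positivity)⟩
  have hdiff : ∀ l, (mu l0 q l, 1 - mu l0 q l) ∈ ball l0 η ×ˢ ball (1 - l0) (ρ / 2) → DifferentiableAt ℂ b0 l := by
    intro l hl
    have h1 := (GGd _ hl).differentiableAt (hopen.mem_nhds hl)
    have h2 : DifferentiableAt ℂ (fun l => (mu l0 q l, 1 - mu l0 q l)) l :=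
      (mu_diff l0 q l).prodMk ((mu_diff l0 q l).const_sub 1)
    exact h1.comp l h2
  have hb00 : ‖b0 0 - b‖ < 1 / (80000 * N) * ‖b‖ := by
    have := (GGs (mu l0 q 0) hmem0.1 (1 - mu l0 q 0) hmem0.2).2
    rw [mu_zero, G1] at this
    rw [hb0]; simp only; rw [mu_zero]; linarith
  have ev1 : ∀ᶠ l in 𝓝 (0 : ℂ), (mu l0 q l, 1 - mu l0 q l) ∈ ball l0 η ×ˢ ball (1 - l0) (ρ / 2) :=
    hpair.continuousAt.eventually_mem (hopen.mem_nhds hmem0)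
  have ev2 : ∀ᶠ l in 𝓝 (0 : ℂ), ‖b0 l - b‖ < 1 / (80000 * N) * ‖b‖ := by
    have hc : ContinuousAt (fun l => ‖b0 l - b‖) 0 := ((hdiff 0 hmem0).continuousAt.sub continuousAt_const).norm
    exact hc.eventually (gt_mem_nhds hb00)
  have ev3 : ∀ᶠ l in 𝓝 (0 : ℂ), ‖vv l0 q i0 l - vv l0 q i0 0‖ < 1 / (80000 * N) * ‖vv l0 q i0 0‖ := by
    have hc : ContinuousAt (fun l => ‖vv l0 q i0 l - vv l0 q i0 0‖) 0 :=
      ((vv_diff l0 q i0 0).continuousAt.sub continuousAt_const).norm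
    exact hc.eventually (gt_mem_nhds (by simpa using hcv))
  obtain ⟨η', hη', hev⟩ := Metric.eventually_nhds_iff.1 (ev1.and (ev2.and ev3))
  have hv0 : vv l0 q i0 0 = (f l0)^[i0] (-l0 ^ 2 / 4) := by unfold vv; rw [mu_zero]
  refine ⟨X, by linarith, by linarith, i0, i1, b0, η', hη', fun l hl => ?_⟩
  obtain ⟨e1, e2, e3⟩ := hev (by rwa [dist_zero_right] : dist l 0 < η')
  refine ⟨hdiff l e1, (GGs _ e1.1 _ e1.2).1, ?_, ?_⟩
  · exact sheet_stable hN hB hκ (Or.inl rfl) hX0 (y := vv l0 q i0 0) (by rw [hv0]; exact v1) (by rw [hv0]; exact v2)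
      (by rw [hv0, one_mul]; exact v3) e3.le
  · exact sheet_stable hN hB hκ (Or.inr rfl) hX0 b1 b2 (by rw [neg_one_mul]; exact b4) e2.le

end Mand

open Complex Metric Set Filter Topology
open scoped NNReal ENNReal

namespace Mand

/-- a point at time k of a half pass -/
structure Good (N : ℕ) (B : ℂ) (X : ℝ) (k : ℕ) (z : ℂ) : Prop where
  ne : z ≠ 0
  lo : (X + k) / 5 ≤ ‖ZZ N B z‖
  hi : ‖ZZ N B z‖ ≤ 3 * (X + k)
  im : (ZZ N B z).im ≤ 1 / 5 * ‖ZZ N B z‖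

lemma half_pass {N : ℕ} (hN : 0 < N) {B κ : ℂ} (hB : B ≠ 0) (hκ : κ ^ N = -I / (N * B)) {G : ℂ → ℂ} {σ : ℂ}
    (hσ : σ = 1 ∨ σ = -1) {X R0 : ℝ} (hX : 0 < X) {n : ℕ} (hn : 1000 ≤ n) (hnX : 10 * X ≤ n) {u : ℂ} (hu : ‖u‖ ≤ 1 / 400)
    (hR0 : 0 < R0) (hXR : 5 * R0 ≤ X)
    (step : ∀ z, z ≠ 0 → R0 ≤ ‖ZZ N B z‖ → ‖ZZ N B z‖ ≤ 3 * (X + n) → ∃ s, G z = z * (1 + s) ∧ ‖s‖ ≤ 1 / (4 * N) ∧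
      ‖σ * ZZ N B (G z) - (exp (-(σ * (Real.pi / n * I * (1 + u)))) * (σ * ZZ N B z) + 1)‖ ≤ 1 / 4000)
    {z0 : ℂ} (hz0 : z0 ≠ 0) (h0 : z0 = zh κ N (ZZ N B z0)) (hD0 : ‖σ * ZZ N B z0 - X‖ ≤ 1 / 4000 * X) :
    ∀ k ≤ n, Good N B X k (G^[k] z0) ∧ G^[k] z0 = zh κ N (ZZ N B (G^[k] z0)) ∧
      ‖σ * ZZ N B (G^[k] z0) - TT (exp (-(σ * (Real.pi / n * I * (1 + u))))) X k‖ ≤ (X + k) / 2000 := by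
  intro k hk
  obtain ⟨a1, a2, a3⟩ := model_alpha (by omega : 0 < n) hu hσ
  obtain ⟨t1, t2, t3, t4, t5, t6⟩ := track hN hB hκ hσ (TT_succ _ X) (fun k hk => model hX (by omega) hnX hu hσ hk) hR0 hXR
    (δ := 1 / 4000) (D0 := 1 / 4000 * X) (by norm_num) (by norm_num) (by linarith) a2 a1 a3 step hz0 h0 (by simpa [TT] using hD0) k hk
  refine ⟨⟨t1, t4, t5, t6⟩, t2, t3.trans ?_⟩
  have : Real.exp (1 / 100 / n) ^ k ≤ 2 := (pow_le_pow_right₀ a2 hk).trans a3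
  calc _ ≤ 2 * (1 / 4000 * X + 1 / 4000 * k) := by gcongr
    _ = _ := by ring

lemma par_pass {N : ℕ} (hN : 0 < N) {B κ : ℂ} (hB : B ≠ 0) (hκ : κ ^ N = -I / (N * B)) {G : ℂ → ℂ} {σ : ℂ}
    (hσ : σ = 1 ∨ σ = -1) {X R0 : ℝ} (hR0 : 0 < R0) (hXR : 5 * R0 ≤ X)
    (step : ∀ z, z ≠ 0 → R0 ≤ ‖ZZ N B z‖ → ∃ s, G z = z * (1 + s) ∧ ‖s‖ ≤ 1 / (4 * N) ∧
      ‖σ * ZZ N B (G z) - (σ * ZZ N B z + 1)‖ ≤ 1 / 4000)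
    {z0 : ℂ} (hz0 : z0 ≠ 0) (h0 : z0 = zh κ N (ZZ N B z0)) (hD0 : ‖σ * ZZ N B z0 - X‖ ≤ 1 / 4000 * X) (k : ℕ) :
    G^[k] z0 ≠ 0 ∧ R0 ≤ ‖ZZ N B (G^[k] z0)‖ := by
  have hX : 0 < X := by linarith
  have := track hN hB hκ (G := G) (σ := σ) (a := 1) hσ (δ := 1 / 4000) (X := X) (D0 := 1 / 4000 * X) (R0 := R0) (α := 1)
      (n := k) (T := fun k => ((X + k : ℝ) : ℂ)) (fun k => by push_cast; ring) (fun j _ => by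
        have hj : (0 : ℝ) ≤ j := Nat.cast_nonneg j
        rw [Complex.norm_real, Real.norm_eq_abs, abs_of_nonneg (by positivity)]
        refine ⟨by linarith, by linarith, ?_⟩
        have : (σ * ((X + j : ℝ) : ℂ)).im = 0 := by
          rcases hσ with rfl | rfl
          · rw [one_mul, ofReal_im]
          · rw [neg_one_mul, neg_im, ofReal_im, neg_zero]
        rw [this]; positivity) hR0 hXR (by norm_num) (by norm_num) (by linarith)
      le_rfl (by simp) (by simp) (fun z hz hZ _ => by
        obtain ⟨s, s1, s2, s3⟩ := step z hz hZ
        refine ⟨s, s1, s2, by rw [one_mul]; exact s3⟩) hz0 h0 (by simpa using hD0) k le_rfl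
  refine ⟨this.1, le_trans ?_ this.2.2.2.1⟩
  have hj : (0 : ℝ) ≤ k := Nat.cast_nonneg k
  linarith

lemma ZZ_diff {N : ℕ} (hN : 0 < N) {B : ℂ} (hB : B ≠ 0) {y : ℂ → ℂ} {u : ℂ} (hy : DifferentiableAt ℂ y u) (h0 : y u ≠ 0) :
    DifferentiableAt ℂ (fun v => ZZ N B (y v)) u := by
  unfold ZZ
  have hN' : (N : ℂ) ≠ 0 := by exact_mod_cast hN.ne'
  exact (differentiableAt_const _).div ((hy.pow N).const_mul _) (mul_ne_zero (mul_ne_zero hN' hB) (pow_ne_zero _ h0))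

set_option maxHeartbeats 1000000 in
lemma passage {l0 : ℂ} {q N : ℕ} {B : ℂ} {C ε : ℝ} (hb : Base l0 q N B C ε) (X1 : ℝ) :
    ∃ X : ℝ, X1 ≤ X ∧ 10 ≤ X ∧ ∃ (i0 i1 : ℕ) (b0 : ℂ → ℂ), ∃ η > 0, (∀ l, ‖l‖ < η → DifferentiableAt ℂ b0 l ∧
      (f (mu l0 q l))^[i1] (b0 l) = 1 - mu l0 q l ∧ vv l0 q i0 l ≠ 0 ∧ b0 l ≠ 0) ∧
      (∀ k, 3 ^ q * ‖(hh l0 q 0)^[k] (b0 0)‖ ≤ 1 / 10) ∧ (∀ k, (FF l0 q 0)^[k] (vv l0 q i0 0) ≠ 0) ∧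
      ∀ ε' > 0, ∃ (l : ℂ) (n : ℕ), 0 < ‖l‖ ∧ ‖l‖ < ε' ∧ ‖l‖ < η ∧ 1 ≤ n ∧ X ≤ n ∧ ‖l‖ * n ≤ 4 ∧
      (∀ k ≤ n, Good N B X k ((FF l0 q l)^[k] (vv l0 q i0 l)) ∧ Good N B X k ((hh l0 q l)^[k] (b0 l))) ∧
      (FF l0 q l)^[n] (vv l0 q i0 l) = (hh l0 q l)^[n] (b0 l) := by
  have hN : 0 < N := hb.q_pos.trans_le hb.q_le
  have hN1 : (1 : ℝ) ≤ N := by exact_mod_cast hN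
  have hN' : (N : ℂ) ≠ 0 := by exact_mod_cast hN.ne'
  have hB := hb.B_ne
  obtain ⟨κ, hκ⟩ := exists_kappa hN B
  obtain ⟨R0, hR0, ε2, hε2, hε2', hst⟩ := zstep_both hb (δ := min (1 / 4000) (1 / (4 * N))) (C1 := 30) (e := 1 / 10 / 3 ^ q)
    (by positivity) (by norm_num) (by positivity)
  obtain ⟨X, hX1, hX10, i0, i1, b0, η, hη, hs⟩ := start hb hκ (max X1 (5 * R0))
  have hX0 : 0 < X := by linarith
  have hXR : 5 * R0 ≤ X := (le_max_right _ _).trans hX1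
  refine ⟨X, (le_max_left _ _).trans hX1, hX10, i0, i1, b0, η, hη, fun l hl => ?_, fun k => ?_, fun k => ?_, fun ε' hε' => ?_⟩
  · obtain ⟨h1, h2, h3, h4⟩ := hs l hl
    exact ⟨h1, h2, h3.1, h4.1⟩
  · have := par_pass hN hB hκ (G := hh l0 q 0) (σ := -1) (Or.inr rfl) hR0 hXR (fun z hz hZ => by
      obtain ⟨-, -, s, s1, s2, s3⟩ := hst 0 z hz hZ (by simpa using hε2.le) (by simp)
      refine ⟨s, s1, s2.trans (min_le_right _ _), ?_⟩
      simpa using s3.trans (min_le_left _ _)) (hs 0 (by simpa using hη)).2.2.2.1 (hs 0 (by simpa using hη)).2.2.2.2.1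
      (hs 0 (by simpa using hη)).2.2.2.2.2 k
    obtain ⟨e1, -⟩ := hst 0 _ this.1 this.2 (by simpa using hε2.le) (by simp)
    rw [le_div_iff₀ (by positivity)] at e1
    linarith
  · exact (par_pass hN hB hκ (G := FF l0 q 0) (σ := 1) (Or.inl rfl) hR0 hXR (fun z hz hZ => by
      obtain ⟨-, ⟨s, s1, s2, s3⟩, -⟩ := hst 0 z hz hZ (by simpa using hε2.le) (by simp)
      refine ⟨s, s1, s2.trans (min_le_right _ _), ?_⟩
      simpa using s3.trans (min_le_left _ _)) (hs 0 (by simpa using hη)).2.2.1.1 (hs 0 (by simpa using hη)).2.2.1.2.1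
      (hs 0 (by simpa using hη)).2.2.1.2.2 k).1
  obtain ⟨n, hn⟩ := exists_nat_gt (max (1000 + 4000 * X) (4 / min ε' (min η ε2)))
  have hn1 : 1000 + 4000 * X < n := (le_max_left _ _).trans_lt hn
  have hm : 0 < min ε' (min η ε2) := by positivity
  have hn2 : 4 / n < min ε' (min η ε2) := by
    have := (le_max_right _ _).trans_lt hn
    rw [div_lt_iff₀ hm] at this
    rw [div_lt_iff₀ (by linarith)]; linarith
  have hn1000 : 1000 ≤ n := by
    have : (1000 : ℝ) < n := by linarith
    exact_mod_cast this.le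
  have hn0 : (0 : ℝ) < n := by linarith
  have hnc : (n : ℂ) ≠ 0 := by exact_mod_cast hn0.ne'
  have hpi := Real.pi_lt_d4
  have hpi0 := Real.pi_pos
  set L : ℂ → ℂ := fun u => Real.pi / n * I * (1 + u) / N with hL
  have hLd : Differentiable ℂ L := by rw [hL]; fun_prop
  have hLN : ∀ u, N * L u = Real.pi / n * I * (1 + u) := fun u => by rw [hL]; simp only; field_simp
  have hLn : ∀ u, ‖L u‖ = Real.pi / n * ‖1 + u‖ / N := fun u => by
    rw [hL]; simp only
    rw [norm_div, norm_mul, norm_mul, norm_div, Complex.norm_I, Complex.norm_natCast, Complex.norm_natCast, Complex.norm_real,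
      Real.norm_eq_abs, abs_of_pos hpi0, mul_one]
  have hLle : ∀ u, ‖u‖ ≤ 1 / 400 → ‖L u‖ * n ≤ 4 := fun u hu => by
    have hun : ‖1 + u‖ ≤ 401 / 400 := (norm_add_le _ _).trans (by rw [norm_one]; linarith)
    rw [hLn, show Real.pi / n * ‖1 + u‖ / N * n = Real.pi * ‖1 + u‖ / N by field_simp, div_le_iff₀ (by linarith)]
    nlinarith
  have hLpos : ∀ u, ‖u‖ ≤ 1 / 400 → 0 < ‖L u‖ := fun u hu => by
    have hun2 : 399 / 400 ≤ ‖1 + u‖ := by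
      have := norm_sub_le (1 + u) u
      rw [add_sub_cancel_right, norm_one] at this; linarith
    rw [hLn]; positivity
  have hLsm : ∀ u, ‖u‖ ≤ 1 / 400 → ‖L u‖ < ε' ∧ ‖L u‖ < η ∧ ‖L u‖ < ε2 := fun u hu => by
    have h1 : ‖L u‖ ≤ 4 / n := by rw [le_div_iff₀ hn0]; exact hLle u hu
    have h2 := h1.trans_lt hn2
    rw [lt_min_iff, lt_min_iff] at h2
    exact h2
  -- the two half passes
  have stp : ∀ u, ‖u‖ ≤ 1 / 400 → ∀ z, z ≠ 0 → R0 ≤ ‖ZZ N B z‖ → ‖ZZ N B z‖ ≤ 3 * (X + n) →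
      ‖z‖ ≤ 1 / 10 / 3 ^ q ∧ (∃ s, FF l0 q (L u) z = z * (1 + s) ∧ ‖s‖ ≤ 1 / (4 * N) ∧
      ‖1 * ZZ N B (FF l0 q (L u) z) - (exp (-(1 * (Real.pi / n * I * (1 + u)))) * (1 * ZZ N B z) + 1)‖ ≤ 1 / 4000) ∧
      (∃ s, hh l0 q (L u) z = z * (1 + s) ∧ ‖s‖ ≤ 1 / (4 * N) ∧
      ‖-1 * ZZ N B (hh l0 q (L u) z) - (exp (-(-1 * (Real.pi / n * I * (1 + u)))) * (-1 * ZZ N B z) + 1)‖ ≤ 1 / 4000) := by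
    intro u hu z hz hZ hZ2
    have hlz : ‖L u‖ * ‖ZZ N B z‖ ≤ 30 := by
      have : ‖L u‖ * ‖ZZ N B z‖ ≤ ‖L u‖ * (3 * (2 * n)) := by gcongr; linarith
      nlinarith [hLle u hu]
    obtain ⟨e1, ⟨s, s1, s2, s3⟩, ⟨s', s1', s2', s3'⟩⟩ := hst (L u) z hz hZ (hLsm u hu).2.2.le hlz
    rw [hLN] at s3 s3'
    refine ⟨e1, ⟨s, s1, s2.trans (min_le_right _ _), ?_⟩, s', s1', s2'.trans (min_le_right _ _), ?_⟩
    · rw [one_mul, one_mul, one_mul]; exact s3.trans (min_le_left _ _)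
    · rw [neg_one_mul, neg_one_mul, neg_one_mul, neg_neg]; exact s3'.trans (min_le_left _ _)
  have P1 : ∀ u, ‖u‖ ≤ 1 / 400 → _ := fun u hu =>
    half_pass hN hB hκ (G := FF l0 q (L u)) (σ := 1) (Or.inl rfl) hX0 hn1000 (by linarith) hu hR0 hXR
      (fun z a1 a2 a3 => (stp u hu z a1 a2 a3).2.1) (hs (L u) (hLsm u hu).2.1).2.2.1.1 (hs (L u) (hLsm u hu).2.1).2.2.1.2.1
      (hs (L u) (hLsm u hu).2.1).2.2.1.2.2
  have P2 : ∀ u, ‖u‖ ≤ 1 / 400 → _ := fun u hu =>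
    half_pass hN hB hκ (G := hh l0 q (L u)) (σ := -1) (Or.inr rfl) hX0 hn1000 (by linarith) hu hR0 hXR
      (fun z a1 a2 a3 => (stp u hu z a1 a2 a3).2.2) (hs (L u) (hLsm u hu).2.1).2.2.2.1 (hs (L u) (hLsm u hu).2.1).2.2.2.2.1
      (hs (L u) (hLsm u hu).2.1).2.2.2.2.2
  -- differentiability
  have D1 : ∀ u, DifferentiableAt ℂ (fun u => (FF l0 q (L u))^[n] (vv l0 q i0 (L u))) u := by
    intro u
    simp only [FF_iter]
    exact fit_diff2 ((mu_diff l0 q _).comp u (hLd u)) ((vv_diff l0 q i0 _).comp u (hLd u)) _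
  have D2 : ∀ u, ‖u‖ ≤ 1 / 400 → ∀ k ≤ n, DifferentiableAt ℂ (fun u => (hh l0 q (L u))^[k] (b0 (L u))) u := by
    intro u hu k
    induction k with
    | zero => intro _; exact (hs (L u) (hLsm u hu).2.1).1.comp u (hLd u)
    | succ k ih =>
      intro hk
      have ih := ih (by omega)
      simp only [Function.iterate_succ_apply']
      have hg := (P2 u hu k (by omega)).1
      have hk' : (k : ℝ) ≤ n := by exact_mod_cast (by omega : k ≤ n)
      have hk0 : (0 : ℝ) ≤ k := Nat.cast_nonneg k
      obtain ⟨e1, -, -⟩ := stp u hu _ hg.ne (le_trans (by linarith) hg.lo) (hg.hi.trans (by linarith))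
      refine g0_iter_diff ((mu_diff l0 q _).comp u (hLd u)) ih (mu_near hb ((hLsm u hu).2.2.le.trans hε2')) q ?_
      rw [le_div_iff₀ (by positivity)] at e1
      linarith
  set H : ℂ → ℂ := fun u => ZZ N B ((FF l0 q (L u))^[n] (vv l0 q i0 (L u))) - ZZ N B ((hh l0 q (L u))^[n] (b0 (L u))) with hH
  have HD : ∀ u, ‖u‖ ≤ 1 / 400 → DifferentiableAt ℂ H u := fun u hu =>
    (ZZ_diff hN hB (D1 u) (P1 u hu n le_rfl).1.ne).sub (ZZ_diff hN hB (D2 u hu n le_rfl) (P2 u hu n le_rfl).1.ne)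
  have HS : ∀ u, ‖u‖ ≤ 1 / 400 → ‖H u - (TT (exp (-(1 * (Real.pi / n * I * (1 + u))))) X n +
      TT (exp (-(-1 * (Real.pi / n * I * (1 + u))))) X n)‖ ≤ (X + n) / 1000 := by
    intro u hu
    have a := (P1 u hu n le_rfl).2.2
    have b := (P2 u hu n le_rfl).2.2
    have := norm_add_le_of_le a b
    refine le_trans (le_of_eq ?_) (this.trans (le_of_eq (by ring)))
    congr 1
    rw [hH]; ring
  obtain ⟨m1, m2⟩ := model_defect hX10 hn1000
  have hz0 : ∃ u ∈ ball (0 : ℂ) (1 / 400), H u = 0 := by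
    refine exists_zero (by norm_num) ?_ ?_
    · refine DifferentiableOn.diffContOnCl fun u hu => (HD u ?_).differentiableWithinAt
      rw [closure_ball _ (by norm_num)] at hu
      simpa using hu
    · intro u hu
      have hu' : ‖u‖ = 1 / 400 := by simpa using hu
      have c1 := HS 0 (by norm_num)
      have c2 := HS u hu'.le
      have c3 := m2 u hu'
      generalize TT (exp (-(1 * (Real.pi / n * I * (1 + 0))))) X n +
        TT (exp (-(-1 * (Real.pi / n * I * (1 + 0))))) X n = S0 at c1 m1
      generalize TT (exp (-(1 * (Real.pi / n * I * (1 + u))))) X n +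
        TT (exp (-(-1 * (Real.pi / n * I * (1 + u))))) X n = S1 at c2 c3
      have c4 := norm_sub_norm_le (H 0) S0
      have c5 := norm_sub_norm_le S1 (H u)
      rw [norm_sub_rev S1 (H u)] at c5
      generalize ‖H 0‖ = x1 at *
      generalize ‖H u‖ = x2 at *
      linarith only [c1, c2, c3, c4, c5, m1, hn1, hX10]
  obtain ⟨u, hu, hu0⟩ := hz0
  have hu : ‖u‖ ≤ 1 / 400 := by rw [mem_ball_zero_iff] at hu; exact hu.le
  refine ⟨L u, n, hLpos u hu, (hLsm u hu).1, (hLsm u hu).2.1, by omega, by linarith, hLle u hu,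
    fun k hk => ⟨(P1 u hu k hk).1, (P2 u hu k hk).1⟩, ?_⟩
  rw [(P1 u hu n le_rfl).2.1, (P2 u hu n le_rfl).2.1, sub_eq_zero.1 hu0]

end Mand

open Complex Metric Set Filter Topology
open scoped NNReal ENNReal

namespace Mand

lemma shift1 {l0 : ℂ} {q N : ℕ} {B : ℂ} {C ε : ℝ} (hb : Base l0 q N B C ε) (j : ℕ) :
    ∃ e3 > 0, ∀ e ≤ e3, ∀ l z : ℂ, z ≠ 0 → ‖z‖ ≤ e → ‖l‖ ≤ e → (f (mu l0 q l))^[j] z ≠ 0 ∧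
      ‖(f (mu l0 q l))^[j] z‖ ≤ 2 * ‖z‖ ∧
      ‖ZZ N B ((f (mu l0 q l))^[j] z) - ZZ N B z‖ ≤ 1 / 20 * ‖ZZ N B z‖ := by
  obtain ⟨C, hC, h⟩ := perturb hb.q_pos hb.nrm j
  have hN : 0 < N := hb.q_pos.trans_le hb.q_le
  have hN1 : (1 : ℝ) ≤ N := by exact_mod_cast hN
  refine ⟨min 1 (1 / (120 * C * N)), lt_min one_pos (by positivity), fun e he l z hz hze hle => ?_⟩
  have e1 : e ≤ 1 := he.trans (min_le_left _ _)
  have e2 : e * (120 * C * N) ≤ 1 := by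
    have := he.trans (min_le_right _ _)
    rwa [le_div_iff₀ (by positivity)] at this
  obtain ⟨-, h1, h2, -⟩ := h l z (hle.trans e1) (hze.trans e1)
  obtain ⟨w, hw⟩ : ∃ w, w = (f (mu l0 q l))^[j] z := ⟨_, rfl⟩
  rw [← hw] at h2 ⊢
  have hzn : 0 < ‖z‖ := norm_pos_iff.2 hz
  have hl0 : l0 ≠ 0 := norm_pos_iff.1 (by rw [hb.nrm]; exact one_pos)
  obtain ⟨s, hs⟩ : ∃ s, s = w / (l0 ^ j * z) - 1 := ⟨_, rfl⟩
  have hws : w = z * (l0 ^ j * (1 + s)) := by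
    rw [hs]; field_simp; ring
  have h3 : ‖w - l0 ^ j * z‖ ≤ 2 * C * e * ‖z‖ := by
    have : w - l0 ^ j * z = (w - (f l0)^[j] z) + ((f l0)^[j] z - l0 ^ j * z) := by ring
    rw [this]
    refine (norm_add_le _ _).trans ?_
    have a1 : C * ‖l‖ * ‖z‖ ≤ C * e * ‖z‖ := by gcongr
    have a2 : C * ‖z‖ ^ 2 ≤ C * e * ‖z‖ := by
      rw [pow_two, ← mul_assoc]; gcongr
    linarith
  have hsn : ‖s‖ ≤ 2 * C * e := by
    have : w - l0 ^ j * z = l0 ^ j * z * s := by rw [hws]; ring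
    rw [this, norm_mul, norm_mul, norm_pow, hb.nrm, one_pow, one_mul, mul_comm] at h3
    exact le_of_mul_le_mul_right h3 hzn
  have hs60 : ‖s‖ * (60 * N) ≤ 1 := by
    refine le_trans ?_ e2
    calc ‖s‖ * (60 * N) ≤ (2 * C * e) * (60 * N) := by gcongr
      _ = _ := by ring
  have hs4 : ‖s‖ ≤ 1 / (4 * N) := by
    rw [le_div_iff₀ (by positivity)]
    nlinarith [norm_nonneg s]
  obtain ⟨i1, i2, -⟩ := inv_pow_sub_one hN hs4
  refine ⟨?_, ?_, ?_⟩
  · rw [hws]; exact mul_ne_zero hz (mul_ne_zero (pow_ne_zero _ hl0) i2)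
  · rw [hws, norm_mul, norm_mul, norm_pow, hb.nrm, one_pow, one_mul, mul_comm]
    gcongr
    refine (norm_add_le _ _).trans ?_
    rw [norm_one]
    nlinarith [norm_nonneg s]
  · have : ZZ N B w - ZZ N B z = ZZ N B z * (((1 + s) ^ N)⁻¹ - 1) := by
      rw [hws, ZZ_mul, mul_pow, ← pow_mul, mul_comm j N, pow_mul, hb.l0_powN]; simp; ring
    rw [this, norm_mul, mul_comm]
    gcongr
    refine i1.trans ?_
    linarith

lemma shift {l0 : ℂ} {q N : ℕ} {B : ℂ} {C ε : ℝ} (hb : Base l0 q N B C ε) (J : ℕ) :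
    ∃ e3 > 0, ∀ j < J, ∀ l z : ℂ, z ≠ 0 → ‖z‖ ≤ e3 → ‖l‖ ≤ e3 → (f (mu l0 q l))^[j] z ≠ 0 ∧
      ‖(f (mu l0 q l))^[j] z‖ ≤ 2 * ‖z‖ ∧
      ‖ZZ N B ((f (mu l0 q l))^[j] z) - ZZ N B z‖ ≤ 1 / 20 * ‖ZZ N B z‖ := by
  choose e he h using shift1 hb
  induction J with
  | zero => exact ⟨1, one_pos, fun j hj => absurd hj (by omega)⟩
  | succ J ih =>
    obtain ⟨e3, h3, ih⟩ := ih
    refine ⟨min e3 (e J), lt_min h3 (he J), fun j hj l z hz h1 h2 => ?_⟩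
    rcases Nat.lt_succ_iff_lt_or_eq.1 hj with hj | rfl
    · exact ih j hj l z hz (h1.trans (min_le_left _ _)) (h2.trans (min_le_left _ _))
    · exact h j _ (min_le_right _ _) l z hz h1 h2

lemma fin_away {ι : Type*} (s : Finset ι) (E : ι → ℂ → ℂ) (hc : ∀ i ∈ s, ContinuousAt (E i) 0) {S : Set ℂ}
    (hS : IsClosed S) (hne : S.Nonempty) (h0 : ∀ i ∈ s, E i 0 ∉ S) :
    ∃ κ > 0, ∀ᶠ l in 𝓝 (0 : ℂ), ∀ i ∈ s, κ ≤ infDist (E i l) S := by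
  classical
  induction s using Finset.induction_on with
  | empty => exact ⟨1, one_pos, by simp⟩
  | insert a s ha ih =>
    obtain ⟨κ, hκ, h⟩ := ih (fun i hi => hc i (Finset.mem_insert_of_mem hi)) fun i hi => h0 i (Finset.mem_insert_of_mem hi)
    have hp : 0 < infDist (E a 0) S := (hS.notMem_iff_infDist_pos hne).1 (h0 a (Finset.mem_insert_self _ _))
    have hcont : ContinuousAt (fun l => infDist (E a l) S) 0 :=
      ContinuousAt.comp (f := E a) (g := fun x => infDist x S) (continuous_infDist_pt S).continuousAt
        (hc a (Finset.mem_insert_self _ _))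
    have h1 := hcont.eventually (lt_mem_nhds (half_lt_self hp))
    refine ⟨min κ (infDist (E a 0) S / 2), lt_min hκ (half_pos hp), ?_⟩
    filter_upwards [h, h1] with l hl hl1 i hi
    rcases Finset.mem_insert.1 hi with rfl | hi
    · exact (min_le_right _ _).trans hl1.le
    · exact (min_le_left _ _).trans (hl i hi)

lemma pick_zt {p z0 : ℂ} (hz : z0 ≠ p) {A : Set ℂ} (hA : A.Countable) (hp : p ∉ A) {δ : ℝ} (hδ : 0 < δ) :
    ∃ zt, ‖zt - z0‖ < δ ∧ ∀ x ∈ A, x ∉ segment ℝ zt p := by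
  obtain ⟨w, hw⟩ : ∃ w, w = z0 - p := ⟨_, rfl⟩
  have hw0 : w ≠ 0 := by rw [hw]; exact sub_ne_zero.2 hz
  have hwn : 0 < ‖w‖ := norm_pos_iff.2 hw0
  have hc : ((fun x => ((x - p) / w).im / ((x - p) / w).re) '' A).Countable := hA.image _
  obtain ⟨s, hs, hs1, hs2⟩ := (hc.dense_compl ℝ).exists_between (show (0 : ℝ) < δ / ‖w‖ by positivity)
  refine ⟨p + w * (1 + s * I), ?_, fun x hx hseg => hs ⟨x, hx, ?_⟩⟩
  · have : p + w * (1 + s * I) - z0 = w * (s * I) := by rw [hw]; ring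
    rw [this, norm_mul, norm_mul, norm_I, mul_one, norm_real, Real.norm_eq_abs, abs_of_pos hs1]
    rw [lt_div_iff₀ hwn] at hs2
    linarith
  · obtain ⟨a, b, ha, hb, hab, rfl⟩ := hseg
    have ha0 : a ≠ 0 := by
      rintro rfl
      apply hp
      have : b = 1 := by linarith
      subst this
      simpa using hx
    have hb' : (b : ℂ) = 1 - a := by rw [eq_sub_iff_add_eq, add_comm]; exact_mod_cast hab
    have : (a • (p + w * (1 + s * I)) + b • p - p) / w = a * (1 + s * I) := by
      rw [real_smul, real_smul, hb']; field_simp; ring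
    simp only [this]
    simp
    field_simp

lemma hh_iter_diff {l0 : ℂ} {q N : ℕ} {B : ℂ} {C ε : ℝ} (hb : Base l0 q N B C ε) {b0 : ℂ → ℂ} (hd : DifferentiableAt ℂ b0 0)
    (h : ∀ k, 3 ^ q * ‖(hh l0 q 0)^[k] (b0 0)‖ ≤ 1 / 10) (k : ℕ) :
    DifferentiableAt ℂ (fun l => (hh l0 q l)^[k] (b0 l)) 0 := by
  induction k with
  | zero => exact hd
  | succ k ih =>
    simp only [Function.iterate_succ_apply']
    have := g0_iter_diff (m := mu l0 q) (u := 0) (mu_diff l0 q 0) ih (mu_near hb (by simp)) q (h k)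
    exact this

lemma f_beta (μ : ℂ) : f μ (1 - μ) = 1 - μ := by unfold f; ring
lemma f_beta_iter (μ : ℂ) (n : ℕ) : (f μ)^[n] (1 - μ) = 1 - μ := Function.iterate_fixed (f_beta μ) n
lemma f_zero (μ : ℂ) : f μ 0 = 0 := by unfold f; ring
lemma f_zero_iter (μ : ℂ) (n : ℕ) : (f μ)^[n] 0 = 0 := Function.iterate_fixed (f_zero μ) n
lemma f_pp (μ : ℂ) : f μ (-μ) = 0 := by unfold f; ring

lemma ne_of_beta {μ x : ℂ} (hμ : ‖μ + 1‖ < 1 / 20) {m : ℕ} (h : (f μ)^[m] x = 1 - μ) : x ≠ 0 ∧ x ≠ -μ := by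
  have h1 : (1 : ℂ) - μ ≠ 0 := by
    intro h
    have : μ = 1 := by linear_combination -h
    rw [this] at hμ
    norm_num at hμ
  constructor
  · rintro rfl; rw [f_zero_iter] at h; exact h1 h.symm
  · rintro rfl
    have h2 : (f μ)^[m + 1] (-μ) = 1 - μ := by rw [Function.iterate_succ_apply', h, f_beta]
    rw [Function.iterate_succ_apply, f_pp, f_zero_iter] at h2
    exact h1 h2.symm

lemma vv_add (l0 : ℂ) (q i m : ℕ) (l : ℂ) : vv l0 q (i + m) l = (f (mu l0 q l))^[m] (vv l0 q i l) := by
  unfold vv; rw [← Function.iterate_add_apply, add_comm]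

lemma classify {l0 : ℂ} {q : ℕ} (hq : 0 < q) {l b : ℂ} {i0 i1 n : ℕ} (hμ : mu l0 q l ≠ 0)
    (hend : (f (mu l0 q l))^[i1] b = 1 - mu l0 q l) (heq : (FF l0 q l)^[n] (vv l0 q i0 l) = (hh l0 q l)^[n] b) (i : ℕ) :
    i < i0 ∨ (∃ k ≤ n, ∃ j < q, i = i0 + (q * k + j) ∧ vv l0 q i l = (f (mu l0 q l))^[j] ((FF l0 q l)^[k] (vv l0 q i0 l))) ∨
    (∃ k ≤ n, ∃ j < q, vv l0 q i l = (f (mu l0 q l))^[j] ((hh l0 q l)^[k] b)) ∨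
    ∃ j ≤ i1, vv l0 q i l = (f (mu l0 q l))^[j] b := by
  by_cases h1 : i < i0
  · exact Or.inl h1
  obtain ⟨m, rfl⟩ := Nat.exists_eq_add_of_le (not_lt.1 h1)
  right
  have key : ∀ k j, (f (mu l0 q l))^[q * k + j] (vv l0 q i0 l) = (f (mu l0 q l))^[j] ((FF l0 q l)^[k] (vv l0 q i0 l)) := by
    intro k j
    rw [FF_iter, ← Function.iterate_add_apply, add_comm]
  by_cases h2 : m < q * n
  · left
    refine ⟨m / q, (Nat.div_lt_of_lt_mul h2).le, m % q, Nat.mod_lt _ hq, by rw [Nat.div_add_mod], ?_⟩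
    rw [vv_add, ← key, Nat.div_add_mod]
  right
  obtain ⟨m', rfl⟩ := Nat.exists_eq_add_of_le (not_lt.1 h2)
  rw [vv_add, key, heq]
  have key2 : ∀ k ≤ n, ∀ j, (f (mu l0 q l))^[q * k + j] ((hh l0 q l)^[n] b) = (f (mu l0 q l))^[j] ((hh l0 q l)^[n - k] b) := by
    intro k hk j
    have e1 : (hh l0 q l)^[n] b = (hh l0 q l)^[k] ((hh l0 q l)^[n - k] b) := by
      rw [← Function.iterate_add_apply, Nat.add_sub_cancel' hk]
    rw [e1, add_comm (q * k) j, Function.iterate_add_apply, ← FF_iter, FF_hh_iter hμ]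
  by_cases h3 : m' < q * n
  · left
    refine ⟨n - m' / q, Nat.sub_le _ _, m' % q, Nat.mod_lt _ hq, ?_⟩
    rw [← key2 (m' / q) (Nat.div_lt_of_lt_mul h3).le, Nat.div_add_mod]
  right
  obtain ⟨m, rfl⟩ := Nat.exists_eq_add_of_le (not_lt.1 h3)
  rw [key2 n le_rfl, Nat.sub_self]
  by_cases h4 : m ≤ i1
  · exact ⟨m, h4, rfl⟩
  · refine ⟨i1, le_rfl, ?_⟩
    obtain ⟨m, rfl⟩ := Nat.exists_eq_add_of_le (not_le.1 h4).le
    rw [add_comm, Function.iterate_add_apply, Function.iterate_zero, id, hend, f_beta_iter]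

lemma reach_beta {l0 : ℂ} {q : ℕ} {l b : ℂ} {i0 i1 n : ℕ} (hμ : mu l0 q l ≠ 0)
    (hend : (f (mu l0 q l))^[i1] b = 1 - mu l0 q l) (heq : (FF l0 q l)^[n] (vv l0 q i0 l) = (hh l0 q l)^[n] b) :
    ∃ J, (f (mu l0 q l))^[J] (-(mu l0 q l) / 2) = 1 - mu l0 q l := by
  refine ⟨i1 + q * n + q * n + i0 + 1, ?_⟩
  have h0 : f (mu l0 q l) (-(mu l0 q l) / 2) = -(mu l0 q l) ^ 2 / 4 := by unfold f; ring
  rw [Function.iterate_succ_apply, h0, Function.iterate_add_apply]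
  change (f (mu l0 q l))^[i1 + q * n + q * n] (vv l0 q i0 l) = _
  rw [Function.iterate_add_apply, ← FF_iter, heq, Function.iterate_add_apply, ← FF_iter, FF_hh_iter hμ, hend]

end Mand

open Complex Metric Set Filter Topology
open scoped NNReal ENNReal

namespace Mand

lemma gate_near {N : ℕ} {B x z : ℂ} {X : ℝ} {k n : ℕ} {t : ℝ} (hN : 0 < N) (hB : B ≠ 0) (hX : 10 ≤ X) (hXn : X ≤ n) (hk : k ≤ n)
    (hg : Good N B X k z) (hx0 : x ≠ 0) (hx : ‖ZZ N B x - ZZ N B z‖ ≤ 1 / 20 * ‖ZZ N B z‖) (ht : t * n ≤ 4) :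
    1 / (28 * N * ‖B‖) * t ≤ ‖x‖ ^ N ∧ ¬ (1 / 2 * ‖ZZ N B x‖ < (ZZ N B x).im) := by
  have hBn : 0 < ‖B‖ := norm_pos_iff.2 hB
  have hNp : (0 : ℝ) < N := by exact_mod_cast hN
  have hkn : (k : ℝ) ≤ n := by exact_mod_cast hk
  have h1 := hg.hi
  have h2 := hg.im
  have hZp : 0 < ‖ZZ N B x‖ := norm_pos_iff.2 (ZZ_ne hN hB hx0)
  have h3 : ‖ZZ N B x‖ ≤ ‖ZZ N B z‖ + 1 / 20 * ‖ZZ N B z‖ := by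
    have := norm_le_norm_add_norm_sub' (ZZ N B x) (ZZ N B z); linarith
  have h4 : ‖ZZ N B z‖ ≤ ‖ZZ N B x‖ + 1 / 20 * ‖ZZ N B z‖ := by
    have := norm_le_norm_add_norm_sub (ZZ N B x) (ZZ N B z); linarith
  have h5 : (ZZ N B x).im ≤ (ZZ N B z).im + 1 / 20 * ‖ZZ N B z‖ := by
    have := (abs_le.1 (abs_im_le_norm (ZZ N B x - ZZ N B z))).2
    rw [sub_im] at this; linarith
  have h6 := ZZ_norm hN hB hx0
  constructor
  · have h7 : ‖ZZ N B x‖ ≤ 7 * n := by linarith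
    have hnp : (0 : ℝ) < n := by linarith
    have h8 : 1 / (N * ‖B‖) ≤ ‖x‖ ^ N * (7 * n) := by
      rw [← h6]; gcongr
    rw [← mul_le_mul_iff_left₀ (show 0 < 7 * (n : ℝ) by positivity)]
    refine le_trans ?_ h8
    calc 1 / (28 * N * ‖B‖) * t * (7 * n) = 1 / (N * ‖B‖) * (t * n / 4) := by field_simp; ring
      _ ≤ 1 / (N * ‖B‖) * 1 := by gcongr; linarith
      _ = _ := mul_one _
  · intro h
    linarith [norm_nonneg (ZZ N B z)]

lemma good_small {N : ℕ} {B z : ℂ} {X e : ℝ} {k : ℕ} (hN : 0 < N) (hB : B ≠ 0) (he : 0 < e) (hg : Good N B X k z)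
    (h : 5 / (N * ‖B‖ * e ^ N) ≤ X + k) : ‖z‖ ≤ e := by
  refine norm_le_of_ZZ hN hB he (le_trans ?_ hg.lo)
  rw [le_div_iff₀ (by norm_num)]
  refine le_trans (le_of_eq ?_) h
  ring

set_option maxHeartbeats 1000000 in
lemma gate {l0 : ℂ} {q N : ℕ} {B : ℂ} {C ε : ℝ} (hb : Base l0 q N B C ε) :
    ∃ ε1 > 0, ∃ c1 > 0, ∀ e > 0, ∃ (zt : ℂ) (κ' : ℝ), 0 < κ' ∧ zt ≠ 0 ∧ ‖zt‖ ≤ e ∧ 9 / 10 * ‖ZZ N B zt‖ ≤ (ZZ N B zt).im ∧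
      κ' ≤ infDist 0 (segment ℝ zt (-l0)) ∧ ∀ ε' > 0, ∃ l : ℂ, 0 < ‖l‖ ∧ ‖l‖ < ε' ∧
      (∃ J, (f (mu l0 q l))^[J] (-(mu l0 q l) / 2) = 1 - mu l0 q l) ∧ ∀ i, c1 * ‖l‖ ≤ ‖vv l0 q i l‖ ^ N ∧
      ¬ (‖vv l0 q i l‖ < ε1 ∧ 1 / 2 * ‖ZZ N B (vv l0 q i l)‖ < (ZZ N B (vv l0 q i l)).im) ∧
      κ' ≤ infDist (vv l0 q i l) (segment ℝ zt (-l0)) := by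
  have hN : 0 < N := hb.q_pos.trans_le hb.q_le
  have hB := hb.B_ne
  have hBn : 0 < ‖B‖ := norm_pos_iff.2 hB
  have hNp : (0 : ℝ) < N := by exact_mod_cast hN
  obtain ⟨e3, he3, hsh⟩ := shift hb q
  obtain ⟨X, hX1, hX10, i0, i1, b0, η, hη, hbb, h3q, hFne, hpass⟩ := passage hb (5 / (N * ‖B‖ * e3 ^ N))
  have hμ0 : ‖mu l0 q 0 + 1‖ < 1 / 20 := mu_near hb (by simp)
  have hμne := mu_ne hμ0
  obtain ⟨hbd, hbend, -, -⟩ := hbb 0 (by simpa using hη)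
  -- limit points
  have hE1 : ∀ i, vv l0 q i 0 ≠ 0 := by
    intro i hi
    apply hFne i
    rw [FF_iter, ← vv_add]
    have : i ≤ i0 + q * i := by nlinarith [hb.q_pos]
    obtain ⟨m, hm⟩ := Nat.exists_eq_add_of_le this
    rw [hm, vv_add, hi, f_zero_iter]
  have hE1p : ∀ i, vv l0 q i 0 ≠ -l0 := by
    intro i hi
    apply hE1 (i + 1)
    rw [vv_add, hi, mu_zero]; exact f_pp _
  have hE2 : ∀ i k, (f (mu l0 q 0))^[i] ((hh l0 q 0)^[k] (b0 0)) ≠ 0 ∧ (f (mu l0 q 0))^[i] ((hh l0 q 0)^[k] (b0 0)) ≠ -l0 := by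
    intro i k
    have : (f (mu l0 q 0))^[i1 + q * k] ((f (mu l0 q 0))^[i] ((hh l0 q 0)^[k] (b0 0))) = 1 - mu l0 q 0 := by
      rw [← Function.iterate_add_apply, add_comm, Function.iterate_add_apply, Function.iterate_add_apply (f (mu l0 q 0)) i1,
        ← FF_iter, FF_hh_iter hμne, hbend, f_beta_iter]
    have h := ne_of_beta hμ0 this
    exact ⟨h.1, fun h' => h.2 (by rw [h', mu_zero])⟩
  have hc1 : ∀ i, ContinuousAt (vv l0 q i) 0 := fun i => (vv_diff l0 q i).continuous.continuousAt
  have hc2 : ∀ i k, ContinuousAt (fun l => (f (mu l0 q l))^[i] ((hh l0 q l)^[k] (b0 l))) 0 := fun i k =>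
    (fit_diff2 (mu_diff l0 q 0) (hh_iter_diff hb hbd h3q k) i).continuousAt
  obtain ⟨ka, hka, hA⟩ := fin_away (Finset.range i0) (fun i => vv l0 q i) (fun i _ => hc1 i) isClosed_singleton
    (singleton_nonempty (0 : ℂ)) (fun i _ => hE1 i)
  obtain ⟨kb, hkb, hBv⟩ := fin_away (Finset.range (i1 + 1)) (fun i l => (f (mu l0 q l))^[i] ((hh l0 q l)^[0] (b0 l)))
    (fun i _ => hc2 i 0) isClosed_singleton (singleton_nonempty (0 : ℂ)) (fun i _ => (hE2 i 0).1)
  simp only [infDist_singleton, dist_zero_right] at hA hBv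
  obtain ⟨ε1, hε1⟩ : ∃ ε1, ε1 = min ka kb := ⟨_, rfl⟩
  have hε1p : 0 < ε1 := by rw [hε1]; exact lt_min hka hkb
  refine ⟨ε1, hε1p, min (ε1 ^ N) (1 / (28 * N * ‖B‖)), lt_min (by positivity) (by positivity), fun e he => ?_⟩
  -- choice of zt
  obtain ⟨κ, hκ⟩ := exists_kappa hN B
  obtain ⟨e', he'⟩ : ∃ e', e' = min (e / 2) (1 / 2) := ⟨_, rfl⟩
  have he'p : 0 < e' := by rw [he']; exact lt_min (by linarith) (by norm_num)
  have he'1 : e' ≤ 1 / 2 := by rw [he']; exact min_le_right _ _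
  have he'2 : e' ≤ e / 2 := by rw [he']; exact min_le_left _ _
  obtain ⟨Y, hY⟩ : ∃ Y, Y = 1 / (N * ‖B‖ * e' ^ N) := ⟨_, rfl⟩
  have hYp : 0 < Y := by rw [hY]; positivity
  have hIY : I * (Y : ℂ) ≠ 0 := mul_ne_zero I_ne_zero (by exact_mod_cast hYp.ne')
  obtain ⟨z0, hz0⟩ : ∃ z0, z0 = zh κ N (I * Y) := ⟨_, rfl⟩
  have hZ0 : ZZ N B z0 = I * Y := by rw [hz0, zh_ZZ hN hB hκ hIY]
  have hz0ne : z0 ≠ 0 := by rw [hz0]; exact zh_ne hN hB hκ _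
  have hz0n : ‖z0‖ ≤ e' := by
    refine norm_le_of_ZZ hN hB he'p ?_
    rw [hZ0, norm_mul, norm_I, one_mul, norm_real, Real.norm_eq_abs, abs_of_pos hYp, hY]
  have hev : ∀ᶠ z in 𝓝 z0, z ≠ 0 ∧ 9 / 10 * ‖ZZ N B z‖ < (ZZ N B z).im := by
    have hcz : ContinuousAt (ZZ N B) z0 := (ZZ_diff hN hB (y := fun z => z) differentiableAt_id hz0ne).continuousAt
    have c1 : ContinuousAt (fun z => 9 / 10 * ‖ZZ N B z‖) z0 := continuousAt_const.mul hcz.norm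
    have c2 : ContinuousAt (fun z => (ZZ N B z).im) z0 := continuous_im.continuousAt.comp hcz
    refine (continuousAt_id.eventually_ne hz0ne).and (c1.eventually_lt c2 ?_)
    rw [hZ0, norm_mul, norm_I, one_mul, norm_real, Real.norm_eq_abs, abs_of_pos hYp]
    simp
    linarith
  obtain ⟨δ, hδ, hδ2⟩ := Metric.eventually_nhds_iff.1 hev
  obtain ⟨A, hAA⟩ : ∃ A : Set ℂ, A = (range (fun i => vv l0 q i 0) ∪
    range (fun x : ℕ × ℕ => (f (mu l0 q 0))^[x.1] ((hh l0 q 0)^[x.2] (b0 0)))) ∪ {0} := ⟨_, rfl⟩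
  have hAc : A.Countable := by
    rw [hAA]; exact ((countable_range _).union (countable_range _)).union (countable_singleton _)
  have hl0n : -l0 ≠ 0 := by
    intro h; have := hb.nrm; rw [neg_eq_zero.1 h] at this; simp at this
  have hpA : -l0 ∉ A := by
    rw [hAA]
    rintro ((⟨i, hi⟩ | ⟨x, hx⟩) | h)
    · exact hE1p i hi
    · exact (hE2 _ _).2 hx
    · exact hl0n h
  have hz0p : z0 ≠ -l0 := by
    intro h
    have := hb.nrm
    rw [← norm_neg, ← h] at this
    linarith
  obtain ⟨zt, hzt, hztA⟩ := pick_zt hz0p hAc hpA (lt_min hδ he'p)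
  obtain ⟨hzt0, hztc⟩ := hδ2 (y := zt) (by rw [dist_eq_norm]; exact hzt.trans_le (min_le_left _ _))
  have hztn : ‖zt‖ ≤ e := by
    have := norm_le_norm_add_norm_sub' zt z0
    have := hzt.le.trans (min_le_right _ _)
    linarith
  obtain ⟨S, hS⟩ : ∃ S, S = segment ℝ zt (-l0) := ⟨_, rfl⟩
  rw [← hS] at hztA
  have hSc : IsClosed S := by
    rw [hS, ← convexHull_pair]
    exact ((Set.toFinite {zt, -l0}).isCompact_convexHull (𝕜 := ℝ)).isClosed
  have hSn : S.Nonempty := ⟨zt, by rw [hS]; exact left_mem_segment _ _ _⟩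
  obtain ⟨d0, hd0⟩ : ∃ d0, d0 = infDist 0 S := ⟨_, rfl⟩
  have hd0p : 0 < d0 := by
    rw [hd0]; exact (hSc.notMem_iff_infDist_pos hSn).1 (hztA 0 (by rw [hAA]; exact Or.inr rfl))
  have hfar : ∀ x : ℂ, ‖x‖ ≤ d0 / 2 → d0 / 2 ≤ infDist x S := by
    intro x hx
    have := infDist_le_infDist_add_dist (x := (0 : ℂ)) (y := x) (s := S)
    rw [← hd0, dist_zero_left] at this
    linarith
  obtain ⟨K0, hK0⟩ := exists_nat_ge (5 / (N * ‖B‖ * (d0 / 4) ^ N))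
  obtain ⟨k1, hk1, hD1⟩ := fin_away (Finset.range (i0 + q * K0 + q)) (fun i => vv l0 q i) (fun i _ => hc1 i) hSc hSn
    (fun i _ => hztA _ (by rw [hAA]; exact Or.inl (Or.inl ⟨i, rfl⟩)))
  obtain ⟨k2, hk2, hD2⟩ := fin_away (Finset.range q ×ˢ Finset.range K0)
    (fun (x : ℕ × ℕ) l => (f (mu l0 q l))^[x.1] ((hh l0 q l)^[x.2] (b0 l))) (fun i _ => hc2 i.1 i.2) hSc hSn
    (fun i _ => hztA _ (by rw [hAA]; exact Or.inl (Or.inr ⟨i, rfl⟩)))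
  obtain ⟨k3, hk3, hD3⟩ := fin_away (Finset.range (i1 + 1))
    (fun i l => (f (mu l0 q l))^[i] ((hh l0 q l)^[0] (b0 l))) (fun i _ => hc2 i 0) hSc hSn
    (fun i _ => hztA _ (by rw [hAA]; exact Or.inl (Or.inr ⟨(i, 0), rfl⟩)))
  refine ⟨zt, ?_⟩
  rw [← hS]
  refine ⟨min (d0 / 2) (min k1 (min k2 k3)), by positivity, hzt0, hztn, hztc.le, ?_, fun ε' hε' => ?_⟩
  · rw [← hd0]; exact (min_le_left _ _).trans (by linarith)
  obtain ⟨ε2, hε2, hE⟩ := Metric.eventually_nhds_iff.1 (hA.and (hBv.and (hD1.and (hD2.and hD3))))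
  obtain ⟨l, n, hl0, hl1, hl2, hn1, hnX, hln, hgood, heq⟩ := hpass (min ε' (min ε2 (min e3 (1 / 100)))) (by positivity)
  have hla : ‖l‖ < ε' := hl1.trans_le (min_le_left _ _)
  have hl1 := hl1.trans_le (min_le_right _ _)
  have hlb : ‖l‖ < ε2 := hl1.trans_le (min_le_left _ _)
  have hl1 := hl1.trans_le (min_le_right _ _)
  have hlc : ‖l‖ < e3 := hl1.trans_le (min_le_left _ _)
  have hld : ‖l‖ < 1 / 100 := hl1.trans_le (min_le_right _ _)
  obtain ⟨hA, hBv, hD1, hD2, hD3⟩ := hE (y := l) (by rwa [dist_zero_right])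
  obtain ⟨-, hend, -, -⟩ := hbb l hl2
  have hμ := mu_ne (mu_near hb hld.le)
  refine ⟨l, hl0, hla, reach_beta hμ hend heq, fun i => ?_⟩
  have hfin : ∀ x : ℂ, ε1 ≤ ‖x‖ → min (ε1 ^ N) (1 / (28 * N * ‖B‖)) * ‖l‖ ≤ ‖x‖ ^ N ∧
      ¬ (‖x‖ < ε1 ∧ 1 / 2 * ‖ZZ N B x‖ < (ZZ N B x).im) := by
    intro x hx
    refine ⟨?_, fun h => absurd h.1 (not_lt.2 hx)⟩
    calc min (ε1 ^ N) (1 / (28 * N * ‖B‖)) * ‖l‖ ≤ ε1 ^ N * 1 := by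
          gcongr
          · exact min_le_left _ _
          · linarith
      _ ≤ ‖x‖ ^ N := by rw [mul_one]; gcongr
  have hnear : ∀ k ≤ n, ∀ j < q, ∀ z, Good N B X k z → (min (ε1 ^ N) (1 / (28 * N * ‖B‖)) * ‖l‖ ≤ ‖(f (mu l0 q l))^[j] z‖ ^ N ∧
      ¬ (‖(f (mu l0 q l))^[j] z‖ < ε1 ∧ 1 / 2 * ‖ZZ N B ((f (mu l0 q l))^[j] z)‖ < (ZZ N B ((f (mu l0 q l))^[j] z)).im)) ∧
      (K0 ≤ k → d0 / 2 ≤ infDist ((f (mu l0 q l))^[j] z) S) := by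
    intro k hk j hj z hg
    have hz3 : ‖z‖ ≤ e3 := by
      refine good_small hN hB he3 hg ?_
      have : (0 : ℝ) ≤ k := Nat.cast_nonneg k
      linarith
    obtain ⟨s1, s2, s3⟩ := hsh j hj l z hg.ne hz3 hlc.le
    obtain ⟨g1, g2⟩ := gate_near hN hB hX10 hnX hk hg s1 s3 hln
    refine ⟨⟨le_trans ?_ g1, fun h => g2 h.2⟩, fun hkK => hfar _ (s2.trans ?_)⟩
    · gcongr; exact min_le_right _ _
    · have := good_small (e := d0 / 4) hN hB (by positivity) hg (by
        have : (K0 : ℝ) ≤ k := by exact_mod_cast hkK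
        linarith)
      linarith
  have m0 : min (d0 / 2) (min k1 (min k2 k3)) ≤ d0 / 2 := min_le_left _ _
  have m1 : min (d0 / 2) (min k1 (min k2 k3)) ≤ k1 := (min_le_right _ _).trans (min_le_left _ _)
  have m2 : min (d0 / 2) (min k1 (min k2 k3)) ≤ k2 := (min_le_right _ _).trans ((min_le_right _ _).trans (min_le_left _ _))
  have m3 : min (d0 / 2) (min k1 (min k2 k3)) ≤ k3 := (min_le_right _ _).trans ((min_le_right _ _).trans (min_le_right _ _))
  rcases classify hb.q_pos hμ hend heq i with h | ⟨k, hk, j, hj, hi, h⟩ | ⟨k, hk, j, hj, h⟩ | ⟨j, hj, h⟩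
  · have a := hfin (vv l0 q i l) ((by rw [hε1]; exact min_le_left _ _ : ε1 ≤ ka).trans (hA i (Finset.mem_range.2 h)))
    exact ⟨a.1, a.2, m1.trans (hD1 i (Finset.mem_range.2 (by omega)))⟩
  · obtain ⟨⟨a1, a2⟩, a3⟩ := hnear k hk j hj _ (hgood k hk).1
    rw [← h] at a1 a2 a3
    refine ⟨a1, a2, ?_⟩
    by_cases hkK : K0 ≤ k
    · exact m0.trans (a3 hkK)
    · refine m1.trans (hD1 i (Finset.mem_range.2 ?_))
      have : q * k ≤ q * K0 := Nat.mul_le_mul_left _ (not_le.1 hkK).le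
      omega
  · obtain ⟨⟨a1, a2⟩, a3⟩ := hnear k hk j hj _ (hgood k hk).2
    rw [h]
    refine ⟨a1, a2, ?_⟩
    by_cases hkK : K0 ≤ k
    · exact m0.trans (a3 hkK)
    · exact m2.trans (hD2 (j, k) (Finset.mem_product.2 ⟨Finset.mem_range.2 hj, Finset.mem_range.2 (not_le.1 hkK)⟩))
  · rw [h]
    have hj' := Finset.mem_range.2 (Nat.lt_succ_of_le hj)
    have a := hfin _ ((by rw [hε1]; exact min_le_right _ _ : ε1 ≤ kb).trans (hBv j hj'))
    exact ⟨a.1, a.2, m3.trans (hD3 j hj')⟩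

end Mand

open Complex Metric Set Filter Topology
open scoped NNReal ENNReal

namespace Mand

lemma avg {F : ℂ → ℂ} (hF : Differentiable ℂ F) {e : ℂ} (he : F e = e) (hd : deriv F e = 1) {r A : ℝ} (hr : 0 < r)
    (hb : ∀ n, ∀ z ∈ ball e r, ‖F^[n] z - e‖ ≤ A) : ∀ᶠ z in 𝓝 e, F z = z := by
  have hA : 0 ≤ A := (norm_nonneg _).trans (hb 0 e (mem_ball_self hr))
  obtain ⟨φ, hφ⟩ : ∃ φ : ℕ → ℂ → ℂ, φ = fun n z => (∑ k ∈ Finset.range n, (F^[k] z)) / n := ⟨_, rfl⟩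
  have hit : ∀ k, Differentiable ℂ (F^[k]) := fun k => hF.iterate k
  have hφd : ∀ n, Differentiable ℂ (φ n) := by
    intro n; rw [hφ]
    exact (Differentiable.fun_sum fun k _ => hit k).div_const _
  have hφe : ∀ n, 0 < n → HasDerivAt (φ n) 1 e := by
    intro n hn
    have h1 : HasDerivAt (fun z => ∑ k ∈ Finset.range n, (F^[k] z)) (∑ k ∈ Finset.range n, (1 : ℂ)) e := by
      refine HasDerivAt.fun_sum fun k _ => ?_
      have := HasDerivAt.iterate e (hF e).hasDerivAt he k
      rwa [hd, one_pow] at this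
    have h2 := h1.div_const (n : ℂ)
    rw [hφ]
    have : (n : ℂ) ≠ 0 := by exact_mod_cast hn.ne'
    rw [Finset.sum_const, Finset.card_range, nsmul_eq_mul, mul_one, div_self this] at h2
    exact h2
  have hφb : ∀ n, 0 < n → ∀ z ∈ ball e r, ‖φ n z - e‖ ≤ A := by
    intro n hn z hz
    have hn' : (n : ℂ) ≠ 0 := by exact_mod_cast hn.ne'
    have hn'' : (0 : ℝ) < n := by exact_mod_cast hn
    have : φ n z - e = (∑ k ∈ Finset.range n, (F^[k] z - e)) / n := by
      rw [hφ, Finset.sum_sub_distrib, Finset.sum_const, Finset.card_range, nsmul_eq_mul]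
      field_simp
    rw [this, norm_div, Complex.norm_natCast, div_le_iff₀ hn'']
    refine (norm_sum_le _ _).trans ((Finset.sum_le_sum fun k _ => hb k z hz).trans ?_)
    rw [Finset.sum_const, Finset.card_range, nsmul_eq_mul, mul_comm]
  obtain ⟨D, hD⟩ : ∃ D, D = (A + r) / (r / 4) := ⟨_, rfl⟩
  have hDp : 0 < D := by rw [hD]; positivity
  obtain ⟨r3, hr3⟩ : ∃ r3, r3 = min (r / 4) (r / (16 * D)) := ⟨_, rfl⟩
  have hr3p : 0 < r3 := by rw [hr3]; positivity
  have hr3a : r3 ≤ r / 4 := by rw [hr3]; exact min_le_left _ _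
  have hr3b : r3 * (16 * D) ≤ r := by
    rw [← le_div_iff₀ (by positivity), hr3]; exact min_le_right _ _
  have key : ∀ n, 0 < n → ∀ x ∈ ball e r3, ∀ y ∈ ball e r3, ‖x - y‖ ≤ 2 * ‖φ n x - φ n y‖ := by
    intro n hn x hx y hy
    obtain ⟨h, hh⟩ : ∃ h : ℂ → ℂ, h = fun z => φ n z - z := ⟨_, rfl⟩
    have hhd : Differentiable ℂ h := by rw [hh]; exact (hφd n).sub differentiable_id
    have hhe : deriv h e = 0 := by
      rw [hh]
      have := ((hφe n hn).sub (hasDerivAt_id e)).deriv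
      simp only [sub_self] at this
      exact this
    have hhb : ∀ z ∈ ball e r, ‖h z‖ ≤ A + r := by
      intro z hz
      have : h z = (φ n z - e) - (z - e) := by rw [hh]; ring
      rw [this]
      refine (norm_sub_le _ _).trans (add_le_add (hφb n hn z hz) ?_)
      rw [← dist_eq_norm]; exact (mem_ball.1 hz).le
    have h1 : ∀ z ∈ ball e (r / 2), ‖deriv h z‖ ≤ D := by
      intro z hz
      rw [hD]
      refine norm_deriv_le_of_forall_mem_sphere_norm_le (by positivity) hhd.diffContOnCl fun w hw => hhb w ?_
      have := dist_triangle w z e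
      rw [mem_ball] at hz ⊢
      rw [mem_sphere] at hw
      linarith
    have hdd : Differentiable ℂ (deriv h) := hhd.deriv
    have h2 : ∀ z ∈ ball e r3, ‖deriv h z‖ ≤ 1 / 2 := by
      intro z hz
      have := lip_of_bound' (c := e) (R := r / 4) (R1 := r / 2) (by linarith) hdd.differentiableOn h1 (z := z) (w := e)
        (ball_subset_closedBall (ball_subset_ball hr3a hz)) (mem_closedBall_self (by positivity))
      rw [hhe, sub_zero] at this
      refine this.trans ?_
      have hz' : ‖z - e‖ ≤ r3 := by rw [← dist_eq_norm]; exact (mem_ball.1 hz).le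
      have e1 : (r / 2 - r / 4) / 2 = r / 8 := by ring
      rw [e1]
      calc D / (r / 8) * ‖z - e‖ ≤ D / (r / 8) * r3 := by gcongr
        _ = (r3 * (16 * D)) / (2 * r) := by field_simp; ring
        _ ≤ r / (2 * r) := by gcongr
        _ = 1 / 2 := by field_simp
    have h3 := (convex_ball e r3).norm_image_sub_le_of_norm_deriv_le (f := h) (fun z _ => hhd z) h2 hy hx
    have h4 : x - y = (φ n x - φ n y) - (h x - h y) := by rw [hh]; ring
    have h5 := norm_sub_le (φ n x - φ n y) (h x - h y)
    rw [← h4] at h5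
    linarith
  have hev : ∀ᶠ z in 𝓝 e, z ∈ ball e r3 ∧ F z ∈ ball e r3 := by
    refine Filter.Eventually.and (ball_mem_nhds e hr3p) ?_
    have : ContinuousAt F e := hF.continuous.continuousAt
    refine this.eventually ?_
    rw [he]
    exact ball_mem_nhds e hr3p
  filter_upwards [hev] with z hz
  have hn : ∀ n : ℕ, 0 < n → ‖F z - z‖ ≤ 2 * (A + r) / n := by
    intro n hn
    have hn'' : (0 : ℝ) < n := by exact_mod_cast hn
    have h1 := key n hn (F z) hz.2 z hz.1
    have h2 : φ n (F z) - φ n z = (F^[n] z - z) / n := by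
      rw [hφ]
      simp only []
      rw [← sub_div, ← Finset.sum_sub_distrib]
      have := Finset.sum_range_sub (fun k => F^[k] z) n
      simp only [Function.iterate_succ_apply, Function.iterate_zero, id] at this
      rw [this]
    have h3 : ‖F^[n] z - z‖ ≤ A + r := by
      have : F^[n] z - z = (F^[n] z - e) - (z - e) := by ring
      rw [this]
      refine (norm_sub_le _ _).trans (add_le_add (hb n z (ball_subset_ball (by linarith) hz.1)) ?_)
      rw [← dist_eq_norm]
      have := mem_ball.1 hz.1
      linarith
    rw [h2, norm_div, Complex.norm_natCast] at h1
    refine h1.trans ?_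
    rw [mul_div_assoc]
    gcongr
  have : ‖F z - z‖ ≤ 0 := by
    have ht : Tendsto (fun n : ℕ => 2 * (A + r) / n) atTop (𝓝 0) := tendsto_const_div_atTop_nhds_zero_nat _
    exact ge_of_tendsto ht (eventually_atTop.2 ⟨1, fun n h => hn n h⟩)
  exact sub_eq_zero.1 (norm_le_zero_iff.1 this)

/-- iterates as polynomials -/
noncomputable def FP (μ : ℂ) (q : ℕ) : Polynomial ℂ :=
  (fun p : Polynomial ℂ => Polynomial.C μ * p + p ^ 2)^[q] Polynomial.X

lemma FP_eval (μ : ℂ) (q : ℕ) (z : ℂ) : (FP μ q).eval z = (f μ)^[q] z := by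
  induction q with
  | zero => simp [FP]
  | succ q ih =>
    unfold FP at ih ⊢
    rw [Function.iterate_succ_apply', Function.iterate_succ_apply', ← ih]
    simp [f]

lemma FP_monic (μ : ℂ) (q : ℕ) : (FP μ q).Monic ∧ (FP μ q).natDegree = 2 ^ q := by
  induction q with
  | zero => exact ⟨Polynomial.monic_X, Polynomial.natDegree_X⟩
  | succ q ih =>
    obtain ⟨h1, h2⟩ := ih
    have e : FP μ (q + 1) = Polynomial.C μ * FP μ q + FP μ q ^ 2 := by
      unfold FP; rw [Function.iterate_succ_apply']
    have h3 : (FP μ q ^ 2).natDegree = 2 ^ (q + 1) := by rw [h1.natDegree_pow, h2]; ring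
    have h4 : (Polynomial.C μ * FP μ q).natDegree < (FP μ q ^ 2).natDegree := by
      refine (Polynomial.natDegree_C_mul_le _ _).trans_lt ?_
      rw [h2, h3]
      exact Nat.pow_lt_pow_right (by norm_num) (by omega)
    rw [e]
    exact ⟨(h1.pow 2).add_of_right (Polynomial.degree_lt_degree h4),
      by rw [Polynomial.natDegree_add_eq_right_of_natDegree_lt h4, h3]⟩

/-- index formula -/
lemma index_sum {P : Polynomial ℂ} (hm : P.Monic) (hd : 2 ≤ P.natDegree) (hs : ∀ e, P.eval e = 0 → P.derivative.eval e ≠ 0) :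
    ∃ s : Finset ℂ, s.card = P.natDegree ∧ (∀ e, e ∈ s ↔ P.eval e = 0) ∧ ∑ e ∈ s, (P.derivative.eval e)⁻¹ = 0 := by
  classical
  have hsp : P.Splits := IsAlgClosed.splits P
  have hnd : P.roots.Nodup := by
    rw [Polynomial.nodup_roots_iff_of_splits hm.ne_zero hsp, Polynomial.separable_def]
    refine (Polynomial.isCoprime_iff_aeval_ne_zero_of_isAlgClosed ℂ ℂ P P.derivative).2 fun a => ?_
    by_cases h : P.eval a = 0
    · exact Or.inr (by simpa using hs a h)
    · exact Or.inl (by simpa using h)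
  have hP : P = Lagrange.nodal P.roots.toFinset id := by
    conv_lhs => rw [hsp.eq_prod_roots_of_monic hm]
    rw [Lagrange.nodal, Finset.prod, Multiset.toFinset_val, hnd.dedup]
    rfl
  have hcard : P.roots.toFinset.card = P.natDegree := by
    rw [Multiset.toFinset_card_of_nodup hnd, hsp.natDegree_eq_card_roots]
  have hmem : ∀ e, e ∈ P.roots.toFinset ↔ P.eval e = 0 := fun e => by
    rw [Multiset.mem_toFinset, Polynomial.mem_roots hm.ne_zero, Polynomial.IsRoot]
  refine ⟨P.roots.toFinset, hcard, hmem, ?_⟩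
  have h1 := Lagrange.coeff_eq_sum (s := P.roots.toFinset) (v := (id : ℂ → ℂ)) Function.injective_id.injOn (P := 1)
    (by rw [Polynomial.degree_one, hcard]; exact_mod_cast (by omega : 0 < P.natDegree))
  rw [hcard, Polynomial.coeff_one, if_neg (by omega)] at h1
  rw [h1]
  refine Finset.sum_congr rfl fun e he => ?_
  have h2 := Lagrange.nodalWeight_eq_eval_derivative_nodal (v := (id : ℂ → ℂ)) he
  rw [← hP, Lagrange.nodalWeight, Finset.prod_inv_distrib] at h2
  rw [id] at h2
  rw [← h2]
  simp

end Mand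

open Complex Metric Set Filter Topology
open scoped NNReal ENNReal

namespace Mand

lemma FF_it (μ : ℂ) (q n : ℕ) (z : ℂ) : ((f μ)^[q])^[n] z = (f μ)^[q * n] z := by
  rw [Function.iterate_mul]

lemma P_finite {μ : ℂ} {J : ℕ} (hJ : (f μ)^[J] (-μ ^ 2 / 4) = 1 - μ) : (range fun i => (f μ)^[i] (-μ ^ 2 / 4)).Finite := by
  refine ((Finset.range (J + 1)).finite_toSet.image fun i => (f μ)^[i] (-μ ^ 2 / 4)).subset ?_
  rintro _ ⟨i, rfl⟩
  by_cases h : i ≤ J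
  · exact ⟨i, by simpa using Nat.lt_succ_of_le h, rfl⟩
  · refine ⟨J, by simp, ?_⟩
    obtain ⟨m, rfl⟩ := Nat.exists_eq_add_of_le (not_le.1 h).le
    simp only []
    rw [add_comm, Function.iterate_add_apply, hJ, f_beta_iter]

lemma bound5 {μ : ℂ} (hμ : ‖μ + 1‖ < 1 / 20) {n : ℕ} {z : ℂ} (h : ‖(f μ)^[n] z‖ ≤ 5) : ‖z‖ ≤ 5 := by
  by_contra! hz
  have h1 := escape_iter hμ (by linarith : 4 < ‖z‖) n
  have h2 : (1 : ℝ) ≤ 2 ^ n := one_le_pow₀ (by norm_num)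
  nlinarith

lemma fix_bound {μ : ℂ} (hμ : ‖μ + 1‖ < 1 / 20) {q : ℕ} (hq : 0 < q) {e : ℂ} (he : (f μ)^[q] e = e) : ‖e‖ ≤ 4 := by
  by_contra! hz
  have h1 := escape_iter hμ hz q
  rw [he] at h1
  have h2 : (2 : ℝ) ≤ 2 ^ q := le_self_pow₀ (by norm_num) hq.ne'
  nlinarith

lemma fp_mult {μ : ℂ} (hμ : ‖μ + 1‖ < 1 / 20) {q : ℕ} (hq : 0 < q) {J : ℕ} (hJ : (f μ)^[J] (-μ ^ 2 / 4) = 1 - μ) {e : ℂ}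
    (he : (f μ)^[q] e = e) (heP : ∀ i, (f μ)^[i] (-μ ^ 2 / 4) ≠ e) :
    1 ≤ ‖deriv ((f μ)^[q]) e‖ ∧ deriv ((f μ)^[q]) e ≠ 1 := by
  have hcl := (P_finite hJ).isClosed
  have hen : e ∈ (range fun i => (f μ)^[i] (-μ ^ 2 / 4))ᶜ := by
    rintro ⟨i, hi⟩; exact heP i hi
  obtain ⟨r0, hr0, hrP⟩ := Metric.isOpen_iff.1 hcl.isOpen_compl e hen
  obtain ⟨r, hr⟩ : ∃ r, r = min r0 1 := ⟨_, rfl⟩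
  have hrp : 0 < r := by rw [hr]; exact lt_min hr0 one_pos
  have hr1 : r ≤ 1 := by rw [hr]; exact min_le_right _ _
  have hr2 : r ≤ r0 := by rw [hr]; exact min_le_left _ _
  have hPr : ∀ i, (f μ)^[i] (-μ ^ 2 / 4) ∉ ball e r := fun i hi => hrP (ball_subset_ball hr2 hi) ⟨i, rfl⟩
  have he4 := fix_bound hμ hq he
  have hiter : ∀ n, (f μ)^[q * n] e = e := fun n => by
    rw [← FF_it]; exact Function.iterate_fixed he n
  have hH : ∀ n, ∃ H : ℂ → ℂ, DifferentiableOn ℂ H (ball e r) ∧ (∀ z ∈ ball e r, (f μ)^[q * n] (H z) = z) ∧ H e = e :=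
    fun n => inv_branch (ball_simply e hrp) isOpen_ball (mem_ball_self hrp) (q * n) (fun i _ => hPr i) e (hiter n)
  choose H Hd Hi He using hH
  obtain ⟨ν, hν⟩ : ∃ ν, ν = deriv ((f μ)^[q]) e := ⟨_, rfl⟩
  rw [← hν]
  have hder : ∀ n, ν ^ n * deriv (H n) e = 1 := by
    intro n
    have h1 : HasDerivAt ((f μ)^[q * n]) (ν ^ n) e := by
      have := HasDerivAt.iterate e ((fit_diff μ q) e).hasDerivAt he n
      rw [← hν, ← Function.iterate_mul] at this
      exact this
    have h2 : HasDerivAt (H n) (deriv (H n) e) e :=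
      ((Hd n).differentiableAt (ball_mem_nhds e hrp)).hasDerivAt
    rw [← He n] at h1
    have h3 := h1.comp e h2
    have h4 : (f μ)^[q * n] ∘ H n =ᶠ[𝓝 e] id := by
      filter_upwards [ball_mem_nhds e hrp] with z hz using Hi n z hz
    have h5 := (hasDerivAt_id e).congr_of_eventuallyEq h4
    rw [← h3.unique h5]
  constructor
  · by_contra! hlt
    have hb : ∀ n, ‖deriv (H n) e‖ ≤ 5 / (r / 2) := by
      intro n
      have hsub : closedBall e (r / 2) ⊆ ball e r := closedBall_subset_ball (by linarith)
      refine norm_deriv_le_of_forall_mem_sphere_norm_le (by positivity) (((Hd n).mono ?_).diffContOnCl) fun z hz => ?_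
      · rw [closure_ball _ (by positivity)]; exact hsub
      · have hz' := hsub (sphere_subset_closedBall hz)
        refine bound5 hμ (n := q * n) ?_
        rw [Hi n z hz']
        have := norm_le_norm_add_norm_sub' z e
        rw [← dist_eq_norm] at this
        have := mem_ball.1 hz'
        linarith
    have ht : Tendsto (fun n : ℕ => ‖ν‖ ^ n * (5 / (r / 2))) atTop (𝓝 (0 * (5 / (r / 2)))) :=
      (tendsto_pow_atTop_nhds_zero_of_lt_one (norm_nonneg _) hlt).mul_const _
    rw [zero_mul] at ht
    have : (1 : ℝ) ≤ 0 := ge_of_tendsto' ht fun n => by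
      have := congrArg norm (hder n)
      rw [norm_mul, norm_pow, norm_one] at this
      rw [← this]
      gcongr
      exact hb n
    linarith
  · intro h1
    obtain ⟨M, hM, hK⟩ := koebe
    have hM0 : 0 < M := by linarith
    have hev := avg (F := (f μ)^[q]) (fit_diff μ q) he (by rw [← hν, h1]) (r := r / M) (A := r) (by positivity) (by
      intro n z hz
      have huni : Uni (H n) (ball e r) := uni_of_leftInv isOpen_ball (fit_diff μ (q * n)) (Hd n) (Hi n)
      have h2 := (hK (H n) e r hrp huni).2
      have h3 := hder n
      rw [h1, one_pow, one_mul] at h3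
      rw [h3, norm_one, mul_one, He n] at h2
      obtain ⟨w, hw, hwz⟩ := h2 hz
      rw [FF_it, ← hwz, Hi n w hw, ← dist_eq_norm]
      exact (mem_ball.1 hw).le)
    have hid : (f μ)^[q] = id := by
      refine AnalyticOnNhd.eq_of_eventuallyEq (z₀ := e) (𝕜 := ℂ) ?_ ?_ hev
      · exact fun x _ => (fit_diff μ q).analyticAt x
      · exact fun x _ => differentiable_id.analyticAt x
    have h2 : (f μ)^[q] (-μ) = -μ := by rw [hid]; rfl
    obtain ⟨q', rfl⟩ : ∃ q', q = q' + 1 := ⟨q - 1, by omega⟩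
    rw [Function.iterate_succ_apply, f_pp, f_zero_iter] at h2
    exact mu_ne hμ (neg_eq_zero.1 h2.symm)

lemma re_inv {ν : ℂ} (h : ν ≠ 1) : ((ν - 1)⁻¹).re = -1 / 2 + (‖ν‖ ^ 2 - 1) / (2 * ‖ν - 1‖ ^ 2) := by
  have h0 : ν - 1 ≠ 0 := sub_ne_zero.2 h
  have h1 : normSq (ν - 1) ≠ 0 := (normSq_pos.2 h0).ne'
  rw [inv_re, Complex.sq_norm, Complex.sq_norm]
  field_simp
  rw [normSq_apply, normSq_apply]
  simp
  ring

lemma index_bound {μ : ℂ} (hμ : ‖μ + 1‖ < 1 / 20) {q : ℕ} (hq : 0 < q) {J : ℕ} (hJ : (f μ)^[J] (-μ ^ 2 / 4) = 1 - μ)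
    (h0 : ∀ i, (f μ)^[i] (-μ ^ 2 / 4) ≠ 0) : 1 ≤ ‖μ ^ q‖ ∧ ‖μ ^ q‖ ^ 2 - 1 ≤ 2 ^ q * ‖μ ^ q - 1‖ ^ 2 := by
  have hm : ∀ e, (f μ)^[q] e = e → 1 ≤ ‖deriv ((f μ)^[q]) e‖ ∧ deriv ((f μ)^[q]) e ≠ 1 := by
    intro e he
    by_cases heβ : e = 1 - μ
    · have h1 : HasDerivAt (f μ) (2 - μ) (1 - μ) := by
        have := ((hasDerivAt_id (1 - μ)).const_mul μ).add (hasDerivAt_pow 2 (1 - μ))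
        have h' := this.congr_deriv (g' := 2 - μ) (by norm_num; ring)
        exact h'
      have h2 := (HasDerivAt.iterate _ h1 (f_beta μ) q).deriv
      rw [heβ, h2]
      have h3 : 2 ≤ ‖2 - μ‖ := by
        have := norm_sub_norm_le (3 : ℂ) (μ + 1)
        have h4 : (3 : ℂ) - (μ + 1) = 2 - μ := by ring
        rw [h4, show ‖(3 : ℂ)‖ = 3 by simp] at this
        linarith
      have h4 : 2 ≤ ‖(2 - μ) ^ q‖ := by
        rw [norm_pow]
        exact h3.trans (le_self_pow₀ (by linarith) hq.ne')
      refine ⟨by linarith, fun h => ?_⟩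
      rw [h, norm_one] at h4
      linarith
    · refine fp_mult hμ hq hJ he fun i hi => heβ ?_
      have h1 : (f μ)^[q * J] e = e := by rw [← FF_it]; exact Function.iterate_fixed he J
      have h2 : J ≤ q * J := Nat.le_mul_of_pos_left _ hq
      rw [← h1, ← hi, ← Function.iterate_add_apply]
      obtain ⟨m, hm⟩ := Nat.exists_eq_add_of_le (h2.trans (Nat.le_add_right _ i))
      rw [hm, add_comm, Function.iterate_add_apply, hJ, f_beta_iter]
  have hd0 : deriv ((f μ)^[q]) 0 = μ ^ q := by
    have h1 : HasDerivAt (f μ) μ 0 := by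
      have := ((hasDerivAt_id (0 : ℂ)).const_mul μ).add (hasDerivAt_pow 2 (0 : ℂ))
      have h' := this.congr_deriv (g' := μ) (by norm_num)
      exact h'
    exact (HasDerivAt.iterate _ h1 (f_zero μ) q).deriv
  have hm0 := hm 0 (f_zero_iter μ q)
  rw [hd0] at hm0
  refine ⟨hm0.1, ?_⟩
  obtain ⟨P, hP⟩ : ∃ P, P = FP μ q - Polynomial.X := ⟨_, rfl⟩
  obtain ⟨hF1, hF2⟩ := FP_monic μ q
  have hq2 : 2 ≤ 2 ^ q := Nat.le_self_pow hq.ne' 2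
  have hlt : Polynomial.degree (Polynomial.X : Polynomial ℂ) < (FP μ q).degree := by
    refine Polynomial.degree_lt_degree ?_
    rw [Polynomial.natDegree_X, hF2]; omega
  have hPm : P.Monic := by rw [hP]; exact hF1.sub_of_left hlt
  have hPd : P.natDegree = 2 ^ q := by
    rw [hP, Polynomial.natDegree_sub_eq_left_of_natDegree_lt (by rw [Polynomial.natDegree_X, hF2]; omega), hF2]
  have hPe : ∀ e, P.eval e = 0 ↔ (f μ)^[q] e = e := fun e => by
    rw [hP, Polynomial.eval_sub, FP_eval, Polynomial.eval_X, sub_eq_zero]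
  have hPder : ∀ e, P.derivative.eval e = deriv ((f μ)^[q]) e - 1 := fun e => by
    rw [hP, Polynomial.derivative_sub, Polynomial.derivative_X, Polynomial.eval_sub, Polynomial.eval_one, ← Polynomial.deriv]
    congr 2
    ext z
    exact FP_eval μ q z
  obtain ⟨s, hs1, hs2, hs3⟩ := index_sum hPm (by rw [hPd]; exact hq2) fun e he => by
    rw [hPder]; exact sub_ne_zero.2 (hm e ((hPe e).1 he)).2
  have h3 := congrArg re hs3
  rw [re_sum, zero_re] at h3
  have h4 : ∑ e ∈ s, ((P.derivative.eval e)⁻¹).re = ∑ e ∈ s, (-1 / 2 + (‖deriv ((f μ)^[q]) e‖ ^ 2 - 1) / (2 * ‖deriv ((f μ)^[q]) e - 1‖ ^ 2)) :=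
    Finset.sum_congr rfl fun e he => by
      rw [hPder, re_inv (hm e ((hPe e).1 ((hs2 e).1 he))).2]
  rw [h4, Finset.sum_add_distrib, Finset.sum_const, hs1, hPd, nsmul_eq_mul] at h3
  have h5 := Finset.single_le_sum (f := fun e => (‖deriv ((f μ)^[q]) e‖ ^ 2 - 1) / (2 * ‖deriv ((f μ)^[q]) e - 1‖ ^ 2)) (s := s)
    (fun e he => div_nonneg (by nlinarith [(hm e ((hPe e).1 ((hs2 e).1 he))).1]) (by positivity))
    ((hs2 0).2 ((hPe 0).2 (f_zero_iter μ q)))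
  simp only [hd0] at h5
  have h6 : 0 < ‖μ ^ q - 1‖ := norm_pos_iff.2 (sub_ne_zero.2 hm0.2)
  have h7 : (‖μ ^ q‖ ^ 2 - 1) / (2 * ‖μ ^ q - 1‖ ^ 2) ≤ 2 ^ q / 2 := by
    push_cast at h3
    linarith
  rw [div_le_iff₀ (by positivity)] at h7
  linarith

end Mand

open Complex Metric Set Filter Topology
open scoped NNReal ENNReal
namespace Mand

/-- Geometric data around the parabolic gate. -/
structure Geo (μ : ℂ) (q : ℕ) (S S' V : Set ℂ) (zt : ℂ) (ρ r0 κ : ℝ) : Prop where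
  near : ‖μ + 1‖ < 1 / 20
  q_pos : 0 < q
  oS : IsOpen S
  starS : StarConvex ℝ 0 S
  ρ_pos : 0 < ρ
  ballS : ball 0 ρ ⊆ S
  avS : ∀ i, (f μ)^[i] (-μ ^ 2 / 4) ∉ S
  oS' : IsOpen S'
  starS' : StarConvex ℝ 0 S'
  zS' : (0 : ℂ) ∈ S'
  subS' : S' ⊆ S
  mapS' : ∀ z ∈ S', (f μ)^[q] z ∈ S
  ztS' : zt ∈ S'
  r0_pos : 0 < r0
  ballzt : ball zt r0 ⊆ S
  oV : IsOpen V
  convV : Convex ℝ V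
  ztV : zt ∈ V
  κ_pos : 0 < κ
  κ_le : κ ≤ 1 / 2
  ballp : ball (-μ) κ ⊆ V
  avV : ∀ i, (f μ)^[i] (-μ ^ 2 / 4) ∉ V

lemma geo_branches {μ : ℂ} {q : ℕ} {S S' V : Set ℂ} {zt : ℂ} {ρ r0 κ : ℝ} (g : Geo μ q S S' V zt ρ r0 κ) :
    ∃ H T : ℕ → ℂ → ℂ, (∀ n, Uni (H n) S) ∧ (∀ n, H n 0 = 0) ∧ (∀ n, ∀ z ∈ S, (f μ)^[q * n] (H n z) = z) ∧
      (∀ n, ∀ z ∈ S, (f μ)^[q] (H (n + 1) z) = H n z) ∧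
      (∀ n, ∀ z ∈ S', H n ((f μ)^[q] z) = (f μ)^[q] (H n z)) ∧
      (∀ n, Uni (T n) V) ∧ (∀ n, ∀ z ∈ V, (f μ)^[q * n] (T n z) = z) ∧ (∀ n, T n zt = H n zt) ∧
      (∀ n, deriv (T n) zt = deriv (H n) zt) ∧ (∀ n, (μ ^ q) ^ n * deriv (H n) 0 = 1) := by
  have h0S : (0 : ℂ) ∈ S := g.ballS (mem_ball_self g.ρ_pos)
  have hzt : zt ∈ S := g.ballzt (mem_ball_self g.r0_pos)
  have hztV : zt ∈ V := g.ztV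
  have hH : ∀ n, ∃ H : ℂ → ℂ, DifferentiableOn ℂ H S ∧ (∀ z ∈ S, (f μ)^[q * n] (H z) = z) ∧ H 0 = 0 :=
    fun n => inv_branch (simplyConn_of_star g.starS h0S) g.oS h0S (q * n) (fun i _ => g.avS i) 0 (f_zero_iter μ _)
  choose H Hd Hi H0 using hH
  have hT : ∀ n, ∃ T : ℂ → ℂ, DifferentiableOn ℂ T V ∧ (∀ z ∈ V, (f μ)^[q * n] (T z) = z) ∧ T zt = H n zt :=
    fun n => inv_branch (simplyConn_of_star (g.convV.starConvex hztV) hztV) g.oV hztV (q * n) (fun i _ => g.avV i)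
      (H n zt) (Hi n zt hzt)
  choose T Td Ti T0 using hT
  have hQ : ∀ n, ∀ z ∈ S, QQ μ (q * n) (H n z) (H n z) ≠ 0 := fun n z hz =>
    QQ_ne_of_inv ((Hd n).differentiableAt (g.oS.mem_nhds hz))
      (by filter_upwards [g.oS.mem_nhds hz] with w hw using Hi n w hw)
  have hpre : IsPreconnected S := (g.starS.isPathConnected h0S).isConnected.isPreconnected
  have hpre' : IsPreconnected S' := (g.starS'.isPathConnected g.zS').isConnected.isPreconnected
  refine ⟨H, T, fun n => uni_of_leftInv g.oS (fit_diff μ (q * n)) (Hd n) (Hi n), H0, Hi, ?_, ?_,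
    fun n => uni_of_leftInv g.oV (fit_diff μ (q * n)) (Td n) (Ti n), Ti, T0, ?_, ?_⟩
  · intro n
    refine lift_unique (A := fun z => (f μ)^[q] (H (n + 1) z)) (A' := H n) (n := q * n) (μ := μ) (x0 := 0) g.oS hpre
      ((fit_diff μ q).comp_differentiableOn (Hd (n + 1))) (Hd n) ?_ h0S ?_ ?_
    · intro x hx
      rw [Hi n x hx, ← Function.iterate_add_apply]
      exact Hi (n + 1) x hx
    · rw [H0, H0, f_zero_iter]
    · have := hQ n 0 h0S
      simp only [H0, f_zero_iter] at this ⊢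
      exact this
  · intro n
    refine lift_unique (A := fun z => H n ((f μ)^[q] z)) (A' := fun z => (f μ)^[q] (H n z)) (n := q * n) (μ := μ) (x0 := 0)
      g.oS' hpre' ((Hd n).comp (fit_diff μ q).differentiableOn g.mapS')
      ((fit_diff μ q).comp_differentiableOn ((Hd n).mono g.subS')) ?_ g.zS' ?_ ?_
    · intro x hx
      rw [Hi n _ (g.mapS' x hx), ← Function.iterate_add_apply, add_comm, Function.iterate_add_apply, Hi n x (g.subS' hx)]
    · simp only [H0, f_zero_iter]
    · have := hQ n 0 h0S
      simp only [H0, f_zero_iter] at this ⊢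
      exact this
  · intro n
    obtain ⟨r, hr, hrV⟩ := Metric.isOpen_iff.1 (g.oS.inter g.oV) zt ⟨hzt, hztV⟩
    have h1 : EqOn (T n) (H n) (ball zt r) := by
      refine lift_unique (n := q * n) (μ := μ) (x0 := zt) isOpen_ball (convex_ball zt r).isPreconnected
        ((Td n).mono fun y hy => (hrV hy).2) ((Hd n).mono fun y hy => (hrV hy).1) ?_ (mem_ball_self hr) (T0 n) ?_
      · intro x hx
        rw [Ti n x (hrV hx).2, Hi n x (hrV hx).1]
      · rw [T0]; exact hQ n zt hzt
    exact (h1.eventuallyEq_of_mem (ball_mem_nhds zt hr)).deriv_eq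
  · intro n
    have hd0 : HasDerivAt (f μ) μ 0 := by
      have := ((hasDerivAt_id (0 : ℂ)).const_mul μ).add (hasDerivAt_pow 2 (0 : ℂ))
      have h' := this.congr_deriv (g' := μ) (by norm_num)
      exact h'
    have h1 : HasDerivAt ((f μ)^[q * n]) ((μ ^ q) ^ n) 0 := by
      have := HasDerivAt.iterate _ hd0 (f_zero μ) (q * n)
      rwa [pow_mul] at this
    have h2 : HasDerivAt (H n) (deriv (H n) 0) 0 :=
      ((Hd n).differentiableAt (g.oS.mem_nhds h0S)).hasDerivAt
    rw [← H0 n] at h1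
    have h3 := h1.comp 0 h2
    have h4 : (f μ)^[q * n] ∘ H n =ᶠ[𝓝 0] id := by
      filter_upwards [g.oS.mem_nhds h0S] with z hz using Hi n z hz
    exact h3.unique ((hasDerivAt_id (0 : ℂ)).congr_of_eventuallyEq h4)

end Mand

open Complex Metric Set Filter Topology
open scoped NNReal ENNReal
namespace Mand

/-- Koebe constant. -/
def KC (M : ℝ) : Prop := 1 ≤ M ∧ ∀ (H : ℂ → ℂ) (a : ℂ) (r : ℝ), 0 < r → Uni H (ball a r) →
  (∀ z ∈ ball a (r / 16), ‖deriv H z‖ ≤ M * ‖deriv H a‖ ∧ ‖deriv H a‖ ≤ M * ‖deriv H z‖ ∧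
    ‖H z - H a - deriv H a * (z - a)‖ ≤ M / r * ‖deriv H a‖ * ‖z - a‖ ^ 2 ∧
    ‖H z - H a‖ ≤ M * ‖deriv H a‖ * ‖z - a‖) ∧
  ball (H a) (r * ‖deriv H a‖ / M) ⊆ H '' ball a r

lemma exists_KC : ∃ M, KC M := koebe

/-- Koebe lower bound via injectivity. -/
lemma KC.low {M : ℝ} (hM : KC M) {H : ℂ → ℂ} {a b : ℂ} {U : Set ℂ} {r : ℝ} (hU : Uni H U) (hr : 0 < r)
    (hs : ball a r ⊆ U) (hb : b ∉ ball a r) (hbU : b ∈ U) : r * ‖deriv H a‖ / M ≤ ‖H b - H a‖ := by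
  by_contra! h
  have h1 := (hM.2 H a r hr (hU.mono hs)).2
  have h2 : H b ∈ ball (H a) (r * ‖deriv H a‖ / M) := by rw [mem_ball, dist_eq_norm]; exact h
  obtain ⟨w, hw, hwb⟩ := h1 h2
  exact hb (hU.inj (hs hw) hbU hwb ▸ hw)

/-- The inverse branches. -/
structure Br (μ : ℂ) (q : ℕ) (S S' V : Set ℂ) (zt : ℂ) (H T : ℕ → ℂ → ℂ) : Prop where
  uH : ∀ n, Uni (H n) S
  H0 : ∀ n, H n 0 = 0
  iH : ∀ n, ∀ z ∈ S, (f μ)^[q * n] (H n z) = z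
  sH : ∀ n, ∀ z ∈ S, (f μ)^[q] (H (n + 1) z) = H n z
  cH : ∀ n, ∀ z ∈ S', H n ((f μ)^[q] z) = (f μ)^[q] (H n z)
  uT : ∀ n, Uni (T n) V
  iT : ∀ n, ∀ z ∈ V, (f μ)^[q * n] (T n z) = z
  Tzt : ∀ n, T n zt = H n zt
  dT : ∀ n, deriv (T n) zt = deriv (H n) zt
  d0 : ∀ n, (μ ^ q) ^ n * deriv (H n) 0 = 1

section
variable {μ : ℂ} {q : ℕ} {S S' V : Set ℂ} {zt : ℂ} {ρ r0 κ : ℝ} {H T : ℕ → ℂ → ℂ} {M : ℝ}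

lemma exists_Br (g : Geo μ q S S' V zt ρ r0 κ) : ∃ H T, Br μ q S S' V zt H T := by
  obtain ⟨H, T, h1, h2, h3, h4, h5, h6, h7, h8, h9, h10⟩ := geo_branches g
  exact ⟨H, T, h1, h2, h3, h4, h5, h6, h7, h8, h9, h10⟩

lemma p_bound (hμ : ‖μ + 1‖ < 1 / 20) : 19 / 20 ≤ ‖-μ‖ ∧ ‖-μ‖ ≤ 21 / 20 := by
  have h1 := norm_sub_norm_le (1 : ℂ) (μ + 1)
  have h2 := norm_sub_le (1 : ℂ) (μ + 1)
  have e : (1 : ℂ) - (μ + 1) = -μ := by ring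
  rw [e, norm_one] at h1 h2
  constructor <;> linarith

lemma Br.low0 (g : Geo μ q S S' V zt ρ r0 κ) : (0 : ℂ) ∉ ball (-μ) κ := by
  intro h
  rw [mem_ball, dist_eq_norm, zero_sub, norm_neg] at h
  have := (p_bound g.near).1
  have := g.κ_le
  linarith

lemma Br.sep (hM : KC M) (g : Geo μ q S S' V zt ρ r0 κ) (b : Br μ q S S' V zt H T) {n m : ℕ} (hnm : n < m) :
    κ * ‖deriv (T m) (-μ)‖ / M ≤ ‖T n (-μ) - T m (-μ)‖ := by
  by_contra! h
  have hp : -μ ∈ V := g.ballp (mem_ball_self g.κ_pos)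
  have h1 := (hM.2 (T m) (-μ) κ g.κ_pos ((b.uT m).mono g.ballp)).2
  have h2 : T n (-μ) ∈ ball (T m (-μ)) (κ * ‖deriv (T m) (-μ)‖ / M) := by rw [mem_ball, dist_eq_norm]; exact h
  obtain ⟨w, hw, hwb⟩ := h1 h2
  have h3 := b.iT m w (g.ballp hw)
  rw [hwb] at h3
  obtain ⟨k, rfl⟩ : ∃ k, m = k + 1 + n := ⟨m - n - 1, by omega⟩
  rw [mul_add, Function.iterate_add_apply, b.iT n _ hp] at h3
  obtain ⟨j, hj⟩ : ∃ j, q * (k + 1) = j + 1 := ⟨q * (k + 1) - 1, by have := Nat.mul_pos g.q_pos (Nat.succ_pos k); simp only [Nat.succ_eq_add_one] at this; omega⟩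
  rw [hj, Function.iterate_succ_apply, f_pp, f_zero_iter] at h3
  exact Br.low0 g (h3 ▸ hw)

lemma Br.bdd (g : Geo μ q S S' V zt ρ r0 κ) (b : Br μ q S S' V zt H T) (n : ℕ) : ‖T n (-μ)‖ ≤ 4 := by
  refine iter_bound g.near (n := q * n) ?_
  rw [b.iT n _ (g.ballp (mem_ball_self g.κ_pos))]
  have := (p_bound g.near).2
  linarith

lemma Br.chS (g : Geo μ q S S' V zt ρ r0 κ) (b : Br μ q S S' V zt H T) :
    ∃ C, 1 ≤ C ∧ ∀ n, ‖deriv (H n) 0‖ ≤ C * ‖deriv (H n) zt‖ ∧ ‖H n zt‖ ≤ C * ‖deriv (H n) 0‖ := by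
  have h0S : (0 : ℂ) ∈ S := g.ballS (mem_ball_self g.ρ_pos)
  have hpre : IsPreconnected S := (g.starS.isPathConnected h0S).isConnected.isPreconnected
  obtain ⟨C, hC, h⟩ := chain g.oS hpre h0S (g.ballzt (mem_ball_self g.r0_pos))
  refine ⟨C, hC, fun n => ⟨(h _ (b.uH n)).2.1, ?_⟩⟩
  have := (h _ (b.uH n)).2.2
  rwa [b.H0, sub_zero] at this

lemma Br.strict (hM : KC M) (g : Geo μ q S S' V zt ρ r0 κ) (b : Br μ q S S' V zt H T) (h1 : 1 ≤ ‖μ ^ q‖) :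
    1 < ‖μ ^ q‖ := by
  refine lt_of_le_of_ne h1 fun he => ?_
  obtain ⟨C, hC, hCn⟩ := Br.chS g b
  obtain ⟨C', hC', hCn'⟩ := chain g.oV g.convV.isPreconnected g.ztV (g.ballp (mem_ball_self g.κ_pos))
  have hM0 : 0 < M := by linarith [hM.1]
  obtain ⟨δ, hδ⟩ : ∃ δ, δ = κ / M / (C * C') := ⟨_, rfl⟩
  have hδ0 : 0 < δ := by rw [hδ]; have := g.κ_pos; positivity
  have hs : ∀ n m, n < m → δ ≤ ‖T n (-μ) - T m (-μ)‖ := by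
    intro n m hnm
    refine le_trans ?_ (Br.sep hM g b hnm)
    have e1 := congrArg norm (b.d0 m)
    rw [norm_mul, norm_pow, ← he, one_pow, one_mul, norm_one] at e1
    have e2 := (hCn m).1
    rw [e1, ← b.dT] at e2
    have e3 := (hCn' _ (b.uT m)).2.1
    have e4 : 1 ≤ C * C' * ‖deriv (T m) (-μ)‖ := by
      rw [mul_assoc]
      exact e2.trans (by gcongr)
    rw [hδ, div_le_iff₀ (by positivity)]
    have : κ * ‖deriv (T m) (-μ)‖ / M * (C * C') = κ / M * (C * C' * ‖deriv (T m) (-μ)‖) := by ring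
    rw [this]
    exact le_mul_of_one_le_right (by have := g.κ_pos; positivity) e4
  obtain ⟨a, -, φ, hφ, hlim⟩ := tendsto_subseq_of_bounded (isBounded_closedBall (x := (0 : ℂ)) (r := 4))
    (x := fun n => T n (-μ)) (fun n => mem_closedBall_zero_iff.2 (Br.bdd g b n))
  have hc := hlim.cauchySeq
  rw [Metric.cauchySeq_iff'] at hc
  obtain ⟨n0, hn0⟩ := hc δ hδ0
  have := hn0 (n0 + 1) (by omega)
  rw [dist_comm, dist_eq_norm] at this
  have h2 := hs (φ n0) (φ (n0 + 1)) (hφ (Nat.lt_succ_self n0))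
  simp only [Function.comp] at this
  linarith

lemma Br.lim (hM : KC M) (g : Geo μ q S S' V zt ρ r0 κ) (b : Br μ q S S' V zt H T) (h1 : 1 ≤ ‖μ ^ q‖) :
    Tendsto (fun n => H n zt) atTop (𝓝 0) := by
  have h2 := Br.strict hM g b h1
  obtain ⟨C, hC, hCn⟩ := Br.chS g b
  have h3 : Tendsto (fun n : ℕ => C * (‖μ ^ q‖⁻¹) ^ n) atTop (𝓝 (C * 0)) :=
    (tendsto_pow_atTop_nhds_zero_of_lt_one (by positivity) (inv_lt_one_of_one_lt₀ h2)).const_mul C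
  rw [mul_zero] at h3
  refine squeeze_zero_norm (fun n => ?_) h3
  refine (hCn n).2.trans ?_
  have e1 := congrArg norm (b.d0 n)
  rw [norm_mul, norm_pow, norm_one] at e1
  have : ‖deriv (H n) 0‖ = (‖μ ^ q‖⁻¹) ^ n := by
    rw [inv_pow]; exact eq_inv_of_mul_eq_one_right e1
  rw [this]
end
end Mand

open Complex Metric Set Filter Topology
open scoped NNReal ENNReal
namespace Mand
section
variable {μ : ℂ} {q : ℕ} {S S' V : Set ℂ} {zt : ℂ} {ρ r0 κ : ℝ} {H T : ℕ → ℂ → ℂ} {M t σ : ℝ}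

lemma Br.d0_norm (b : Br μ q S S' V zt H T) (n : ℕ) : ‖μ ^ q‖ ^ n * ‖deriv (H n) 0‖ = 1 := by
  have e1 := congrArg norm (b.d0 n)
  rwa [norm_mul, norm_pow, norm_one] at e1

lemma window (hM : KC M) (g : Geo μ q S S' V zt ρ r0 κ) (b : Br μ q S S' V zt H T) (h1 : 1 ≤ ‖μ ^ q‖)
    (ht1 : t ≤ 1 / 2) (hσ : 0 < σ)
    (h5 : ∀ z, ‖z‖ ≤ σ → ‖(f μ)^[q] z - z‖ ≤ 2 * t * ‖z‖) (hzt : σ < ‖zt‖)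
    (hσρ : 32 * M * σ ≤ ρ) (h3 : 3 ^ q * (M * σ) ≤ 1 / 4) {K : ℕ} (hK : ‖μ ^ q‖ ^ K ≤ 3) :
    ∃ n1, ∀ k ≤ K, ‖H (n1 + k) zt‖ ≤ σ ∧ σ / 12 ≤ ‖H (n1 + k) zt‖ := by
  classical
  have hztS : zt ∈ S := g.ballzt (mem_ball_self g.r0_pos)
  have hM1 := hM.1
  have hex : ∃ n, ∀ k ≥ n, ‖H k zt‖ ≤ σ := by
    have := (Br.lim hM g b h1).norm
    rw [norm_zero] at this
    exact eventually_atTop.1 (this.eventually_le_const hσ)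
  obtain ⟨n1, hn1, hmin⟩ : ∃ n, (∀ k ≥ n, ‖H k zt‖ ≤ σ) ∧ ∀ m < n, ¬ (∀ k ≥ m, ‖H k zt‖ ≤ σ) :=
    ⟨Nat.find hex, Nat.find_spec hex, fun m hm => Nat.find_min hex hm⟩
  have hn0 : n1 ≠ 0 := by
    rintro rfl
    have e1 := hn1 0 le_rfl
    have e2 := b.iH 0 zt hztS
    rw [mul_zero, Function.iterate_zero, id] at e2
    rw [e2] at e1
    linarith
  obtain ⟨n2, rfl⟩ : ∃ n2, n1 = n2 + 1 := ⟨n1 - 1, by omega⟩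
  have hbig : σ < ‖H n2 zt‖ := by
    have := hmin n2 (by omega)
    push Not at this
    obtain ⟨k, hk, hk2⟩ := this
    rcases Nat.lt_or_ge n2 k with h | h
    · exact absurd (hn1 k h) (not_le.2 hk2)
    · rwa [le_antisymm h hk] at hk2
  have hlow : σ / 2 ≤ ‖H (n2 + 1) zt‖ := by
    have e1 := b.sH n2 zt hztS
    have e2 := h5 _ (hn1 (n2 + 1) le_rfl)
    rw [e1] at e2
    have e3 := norm_le_norm_add_norm_sub' (H n2 zt) (H (n2 + 1) zt)
    have e4 : 2 * t * ‖H (n2 + 1) zt‖ ≤ 1 * ‖H (n2 + 1) zt‖ := by gcongr; linarith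
    linarith
  refine ⟨n2 + 1, fun k hk => ⟨hn1 _ (by omega), ?_⟩⟩
  obtain ⟨a, ha⟩ : ∃ a, a = H (n2 + 1) zt := ⟨_, rfl⟩
  have haσ : ‖a‖ ≤ σ := ha ▸ hn1 _ le_rfl
  have haσ' : M * σ ≤ ρ / 32 := by linarith
  have hσM : σ ≤ M * σ := le_mul_of_one_le_left hσ.le hM1
  have hab : a ∈ ball (0 : ℂ) (ρ / 16) := by
    rw [mem_ball_zero_iff]
    have := g.ρ_pos
    linarith
  have haS : a ∈ S := g.ballS (ball_subset_ball (by have := g.ρ_pos; linarith) hab)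
  have hd1 : ∀ k, ‖deriv (H k) 0‖ ≤ 1 := by
    intro k
    have e1 := Br.d0_norm b k
    have e2 : 1 ≤ ‖μ ^ q‖ ^ k := one_le_pow₀ h1
    rw [← e1]
    exact le_mul_of_one_le_left (norm_nonneg _) e2
  have hkoe := fun k => (hM.2 (H k) 0 ρ g.ρ_pos ((b.uH k).mono g.ballS)).1 a hab
  have hsm : ∀ k, ‖H k a‖ ≤ M * σ := by
    intro k
    have e1 := (hkoe k).2.2.2
    rw [b.H0, sub_zero, sub_zero] at e1
    refine e1.trans ?_
    calc M * ‖deriv (H k) 0‖ * ‖a‖ ≤ M * 1 * σ := by gcongr; exact hd1 k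
      _ = M * σ := by ring
  have hka : ∀ k, H k a = H (n2 + 1 + k) zt := by
    intro k
    induction k with
    | zero =>
      have e2 := b.iH 0 a haS
      rw [mul_zero, Function.iterate_zero, id] at e2
      rw [e2, ha, add_zero]
    | succ k ih =>
      have e1 := b.sH k a haS
      have e2 := b.sH (n2 + 1 + k) zt hztS
      rw [ih, ← e2] at e1
      have e3 := g0_f_iter g.near q (z := H (k + 1) a) ((mul_le_mul_of_nonneg_left (hsm _) (by positivity)).trans h3)
      have e4 := g0_f_iter g.near q (z := H (n2 + 1 + k + 1) zt)
        ((mul_le_mul_of_nonneg_left ((hn1 _ (by omega)).trans hσM) (by positivity)).trans h3)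
      rw [← e3, e1, e4, add_assoc]
  rw [← hka]
  have e1 := (hkoe k).2.2.1
  rw [b.H0, sub_zero, sub_zero] at e1
  have e2 : M / ρ * ‖deriv (H k) 0‖ * ‖a‖ ^ 2 ≤ 1 / 32 * (‖deriv (H k) 0‖ * ‖a‖) := by
    have : M / ρ * ‖a‖ ≤ 1 / 32 := by
      rw [div_mul_eq_mul_div, div_le_iff₀ g.ρ_pos]
      have := mul_le_mul_of_nonneg_left haσ (by linarith : 0 ≤ M)
      linarith
    calc M / ρ * ‖deriv (H k) 0‖ * ‖a‖ ^ 2 = (M / ρ * ‖a‖) * (‖deriv (H k) 0‖ * ‖a‖) := by ring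
      _ ≤ _ := by gcongr
  have e3 := norm_sub_norm_le (deriv (H k) 0 * a) (deriv (H k) 0 * a - H k a)
  rw [sub_sub_cancel, norm_mul, norm_sub_rev (deriv (H k) 0 * a) (H k a)] at e3
  have e4 : 1 / 3 ≤ ‖deriv (H k) 0‖ := by
    have f1 := Br.d0_norm b k
    have f2 : ‖μ ^ q‖ ^ k ≤ 3 := (pow_le_pow_right₀ h1 hk).trans hK
    have f3 := mul_le_mul_of_nonneg_right f2 (norm_nonneg (deriv (H k) 0))
    linarith
  have e5 : 1 / 3 * (σ / 2) ≤ ‖deriv (H k) 0‖ * ‖a‖ := by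
    rw [ha]; gcongr
  linarith

lemma deriv_zt (hM : KC M) (g : Geo μ q S S' V zt ρ r0 κ) (b : Br μ q S S' V zt H T) (ht : 0 < t) {η : ℝ} (hη : 0 < η)
    (h5 : ∀ z, ‖z‖ ≤ σ → t / 2 * ‖z‖ ≤ ‖(f μ)^[q] z - z‖ ∧ ‖(f μ)^[q] z - z‖ ≤ 2 * t * ‖z‖)
    (hz1 : η ≤ ‖(f μ)^[q] zt - zt‖) (hz2 : ‖(f μ)^[q] zt - zt‖ < r0 / 16) {n : ℕ}
    (ha : ‖H n zt‖ ≤ σ) (ha2 : σ / 12 ≤ ‖H n zt‖) :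
    ‖deriv (T n) zt‖ ≤ 2 * M / η * (t * σ) ∧ 1 / (24 * M * r0) * (t * σ) ≤ ‖deriv (T n) zt‖ := by
  have hM1 := hM.1
  have hr0 := g.r0_pos
  have hc := b.cH n zt g.ztS'
  have h6 := h5 _ ha
  rw [← hc] at h6
  rw [b.dT]
  have hFS : (f μ)^[q] zt ∈ S := g.mapS' zt g.ztS'
  have hsub : ball zt ‖(f μ)^[q] zt - zt‖ ⊆ S := (ball_subset_ball (by linarith)).trans g.ballzt
  have hl := hM.low (b.uH n) (b := (f μ)^[q] zt) (by linarith) hsub (by rw [mem_ball, dist_eq_norm]; exact lt_irrefl _) hFS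
  have hu := ((hM.2 (H n) zt r0 hr0 ((b.uH n).mono g.ballzt)).1 ((f μ)^[q] zt)
    (by rw [mem_ball, dist_eq_norm]; exact hz2)).2.2.2
  constructor
  · have e1 : η * ‖deriv (H n) zt‖ / M ≤ 2 * t * σ := by
      refine le_trans ?_ (hl.trans (h6.2.trans (by gcongr)))
      gcongr
    rw [div_le_iff₀ (by linarith)] at e1
    rw [div_mul_eq_mul_div, le_div_iff₀ hη]
    linarith
  · have e1 : M * ‖deriv (H n) zt‖ * ‖(f μ)^[q] zt - zt‖ ≤ M * ‖deriv (H n) zt‖ * r0 := by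
      gcongr; linarith
    have e2 : t / 2 * (σ / 12) ≤ t / 2 * ‖H n zt‖ := by gcongr
    rw [div_mul_eq_mul_div, div_le_iff₀ (by positivity)]
    linarith
end
end Mand

open Complex Metric Set Filter Topology
open scoped NNReal ENNReal
namespace Mand
section
variable {μ : ℂ} {q : ℕ} {S S' V : Set ℂ} {zt : ℂ} {ρ r0 κ : ℝ} {H T : ℕ → ℂ → ℂ} {M σ : ℝ}

lemma gg_lip (hμ : ‖μ + 1‖ < 1 / 20) {z w : ℂ} (hz : ‖z‖ ≤ 1 / 100) (hw : ‖w‖ ≤ 1 / 100) :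
    1 / 2 * ‖z - w‖ ≤ ‖(-μ - g0 μ z) - (-μ - g0 μ w)‖ ∧ ‖(-μ - g0 μ z) - (-μ - g0 μ w)‖ ≤ 2 * ‖z - w‖ := by
  have hm := mu_ne hμ
  have h1 := f_g0 hm z
  have h2 := f_g0 hm w
  have h3 : z - w = (g0 μ z - g0 μ w) * (μ + (g0 μ z + g0 μ w)) := by
    rw [f] at h1 h2
    linear_combination h2 - h1
  have h4 := g0_norm hμ z
  have h5 := g0_norm hμ w
  have h6 : ‖g0 μ z + g0 μ w‖ ≤ 6 / 100 := (norm_add_le _ _).trans (by linarith)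
  have h7 := p_bound hμ
  rw [norm_neg] at h7
  have h8 := norm_add_le μ (g0 μ z + g0 μ w)
  have h9 := norm_sub_le_norm_add μ (g0 μ z + g0 μ w)
  have e : (-μ - g0 μ z) - (-μ - g0 μ w) = -(g0 μ z - g0 μ w) := by ring
  rw [e, norm_neg, h3, norm_mul]
  have h10 : ‖μ + (g0 μ z + g0 μ w)‖ ≤ 2 := by linarith
  have h11 : 1 / 2 ≤ ‖μ + (g0 μ z + g0 μ w)‖ := by linarith
  have h12 := mul_le_mul_of_nonneg_left h10 (norm_nonneg (g0 μ z - g0 μ w))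
  have h13 := mul_le_mul_of_nonneg_left h11 (norm_nonneg (g0 μ z - g0 μ w))
  constructor <;> linarith

lemma T_lip (hM : KC M) {Q : ℂ → ℂ} {p : ℂ} (hκ : 0 < κ) (hQ : Uni Q (ball p κ)) {z w : ℂ} (hz : ‖z - p‖ ≤ κ / 32)
    (hw : ‖w - p‖ ≤ κ / 32) : ‖Q z - Q w‖ ≤ M * ‖deriv Q p‖ * ‖z - w‖ ∧ ‖deriv Q p‖ / M ^ 2 * ‖z - w‖ ≤ ‖Q z - Q w‖ := by
  have hM1 := hM.1
  have hk := (hM.2 Q p κ hκ hQ).1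
  have hz' : z ∈ ball p (κ / 16) := by rw [mem_ball, dist_eq_norm]; linarith
  have hw' : w ∈ ball p (κ / 16) := by rw [mem_ball, dist_eq_norm]; linarith
  have hsub : ball p (κ / 16) ⊆ ball p κ := ball_subset_ball (by linarith)
  constructor
  · refine Convex.norm_image_sub_le_of_norm_deriv_le (𝕜 := ℂ) (s := ball p (κ / 16)) (fun x hx => ?_) (fun x hx => (hk x hx).1)
      (convex_ball _ _) hw' hz'
    exact hQ.d.differentiableAt (isOpen_ball.mem_nhds (hsub hx))
  · rcases eq_or_ne z w with rfl | hne
    · simp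
    have h0 : 0 < ‖w - z‖ := norm_pos_iff.2 (sub_ne_zero.2 hne.symm)
    have h1 := hM.low hQ (a := z) (b := w) (r := ‖w - z‖) h0 (fun x hx => by
      rw [mem_ball, dist_eq_norm] at hx ⊢
      have e1 : x - p = (x - z) + (z - p) := by ring
      have e2 : w - z = (w - p) - (z - p) := by ring
      have e3 := norm_add_le (x - z) (z - p)
      have e4 := norm_sub_le (w - p) (z - p)
      rw [← e1] at e3
      rw [← e2] at e4
      linarith) (by rw [mem_ball, dist_eq_norm]; exact lt_irrefl _) (hsub hw')
    rw [norm_sub_rev (Q z) (Q w), norm_sub_rev z w]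
    refine le_trans ?_ h1
    have h2 := (hk z hz').2.1
    have h3 : ‖deriv Q p‖ / M ^ 2 * ‖w - z‖ = ‖w - z‖ * (‖deriv Q p‖ / M) / M := by field_simp
    rw [h3]
    gcongr
    rw [div_le_iff₀ (by linarith)]
    linarith

set_option maxHeartbeats 1000000 in
lemma final_l (hM : KC M) (g : Geo μ q S S' V zt ρ r0 κ) (b : Br μ q S S' V zt H T) {C A a R x s : ℝ} {n1 K J : ℕ}
    (hJ : (f μ)^[J] (-μ / 2) = 1 - μ) (hC1 : 1 ≤ C)
    (hC : ∀ Q, Uni Q V → ‖deriv Q (-μ)‖ ≤ C * ‖deriv Q zt‖ ∧ ‖deriv Q zt‖ ≤ C * ‖deriv Q (-μ)‖ ∧ ‖Q (-μ) - Q zt‖ ≤ C * ‖deriv Q zt‖)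
    (hA : 0 < A) (ha : 0 < a) (hx : 0 < x)
    (hder : ∀ i < K, ‖deriv (T (n1 + i)) zt‖ ≤ A * x ∧ a * x ≤ ‖deriv (T (n1 + i)) zt‖)
    (hσ : ∀ i < K, ‖H (n1 + i) zt‖ ≤ σ)
    (hR : 0 < R) (hR1 : R ≤ 1 / 200) (hR2 : 200 * R ≤ κ) (hR3 : 8 * M ^ 2 * A * C ^ 2 * R ≤ κ * a)
    (hx1 : 8 * M * A * C * x ≤ 1) (hx2 : σ + C * A * x ≤ R / 4) (hK : 2 ≤ K) (hs : 0 < s)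
    (hKs : 1 ≤ K * (a / (4 * M ^ 2 * C) * x) ^ s) : ENNReal.ofReal s ≤ dimH (frontier MM) := by
  have hM1 := hM.1
  have hκ := g.κ_pos
  have hg0 : g0 μ 0 = 0 := by
    have := g0_norm g.near 0
    rw [norm_zero, mul_zero] at this
    exact norm_le_zero_iff.1 this
  have hgp : ∀ y : ℂ, ‖(-μ - g0 μ y) - (-μ)‖ ≤ 3 * ‖y‖ := fun y => by
    have e : (-μ - g0 μ y) - (-μ) = -g0 μ y := by ring
    rw [e, norm_neg]
    exact g0_norm g.near y
  have hgV : ∀ y ∈ ball (0 : ℂ) (2 * R), -μ - g0 μ y ∈ ball (-μ) κ := fun y hy => by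
    rw [mem_ball_zero_iff] at hy
    rw [mem_ball, dist_eq_norm]
    have := hgp y
    linarith
  have hfg : ∀ y, f μ (-μ - g0 μ y) = y := fun y => by
    have e1 := f_g0 (mu_ne g.near) y
    rw [f] at e1 ⊢
    linear_combination e1
  have hD : ∀ i < K, ‖deriv (T (n1 + i)) (-μ)‖ ≤ C * A * x ∧ a * x / C ≤ ‖deriv (T (n1 + i)) (-μ)‖ := by
    intro i hi
    have e1 := hC _ (b.uT (n1 + i))
    have e2 := hder i hi
    constructor
    · refine e1.1.trans ?_
      rw [mul_assoc]
      gcongr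
      exact e2.1
    · rw [div_le_iff₀ (by linarith)]
      linarith
  have hlip : ∀ i < K, ∀ z ∈ closedBall (0 : ℂ) R, ∀ w ∈ closedBall (0 : ℂ) R,
      ‖T (n1 + i) (-μ - g0 μ z) - T (n1 + i) (-μ - g0 μ w)‖ ≤ 2 * M * C * A * x * ‖z - w‖ ∧
      a / (2 * M ^ 2 * C) * x * ‖z - w‖ ≤ ‖T (n1 + i) (-μ - g0 μ z) - T (n1 + i) (-μ - g0 μ w)‖ := by
    intro i hi z hz w hw
    rw [mem_closedBall_zero_iff] at hz hw
    have e1 := T_lip hM hκ ((b.uT (n1 + i)).mono g.ballp) (z := -μ - g0 μ z) (w := -μ - g0 μ w)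
      ((hgp z).trans (by linarith)) ((hgp w).trans (by linarith))
    have e2 := gg_lip g.near (z := z) (w := w) (by linarith) (by linarith)
    have e3 := hD i hi
    constructor
    · refine e1.1.trans ?_
      calc M * ‖deriv (T (n1 + i)) (-μ)‖ * ‖(-μ - g0 μ z) - (-μ - g0 μ w)‖ ≤ M * (C * A * x) * (2 * ‖z - w‖) := by
            gcongr
            · exact e3.1
            · exact e2.2
        _ = _ := by ring
    · refine le_trans ?_ e1.2
      calc a / (2 * M ^ 2 * C) * x * ‖z - w‖ = (a * x / C) / M ^ 2 * (1 / 2 * ‖z - w‖) := by field_simp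
        _ ≤ _ := by
            gcongr
            · exact e3.2
            · exact e2.1
  have hsmall : 2 * M * C * A * x ≤ 1 / 4 := by linarith
  have hp : -μ - g0 μ 0 = -μ := by rw [hg0, sub_zero]
  have h0R : (0 : ℂ) ∈ closedBall (0 : ℂ) R := mem_closedBall_self hR.le
  obtain ⟨d, hd⟩ : ∃ d, d = κ * a * x / (2 * C * M) := ⟨_, rfl⟩
  have hd0 : 0 < d := by rw [hd]; positivity
  have hsepw : ∀ i j : Fin K, i < j → ∀ z ∈ closedBall (0 : ℂ) R, ∀ w ∈ closedBall (0 : ℂ) R,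
      d ≤ ‖T (n1 + i) (-μ - g0 μ z) - T (n1 + j) (-μ - g0 μ w)‖ := by
    intro i j hij z hz w hw
    have e1 := Br.sep hM g b (n := n1 + i) (m := n1 + j) (Nat.add_lt_add_left hij _)
    have e2 := (hlip i i.2 z hz 0 h0R).1
    have e3 := (hlip j j.2 w hw 0 h0R).1
    rw [sub_zero, hp] at e2 e3
    rw [mem_closedBall_zero_iff] at hz hw
    have e4 := (hD j j.2).2
    have e5 : 2 * d ≤ κ * ‖deriv (T (n1 + j)) (-μ)‖ / M := by
      have : 2 * d = κ * (a * x / C) / M := by rw [hd]; field_simp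
      rw [this]
      gcongr
    have e6 : 2 * M * C * A * x * R ≤ d / 2 := by
      rw [hd, div_div, le_div_iff₀ (by positivity)]
      calc 2 * M * C * A * x * R * (2 * C * M * 2) = 8 * M ^ 2 * A * C ^ 2 * R * x := by ring
        _ ≤ κ * a * x := by gcongr
    have e7 : 2 * M * C * A * x * ‖z‖ ≤ d / 2 := le_trans (by gcongr) e6
    have e8 : 2 * M * C * A * x * ‖w‖ ≤ d / 2 := le_trans (by gcongr) e6
    have e9 : T (n1 + i) (-μ) - T (n1 + j) (-μ) = (T (n1 + i) (-μ - g0 μ z) - T (n1 + j) (-μ - g0 μ w))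
        - (T (n1 + i) (-μ - g0 μ z) - T (n1 + i) (-μ)) + (T (n1 + j) (-μ - g0 μ w) - T (n1 + j) (-μ)) := by ring
    have e10 := norm_add_le ((T (n1 + i) (-μ - g0 μ z) - T (n1 + j) (-μ - g0 μ w))
        - (T (n1 + i) (-μ - g0 μ z) - T (n1 + i) (-μ))) (T (n1 + j) (-μ - g0 μ w) - T (n1 + j) (-μ))
    have e11 := norm_sub_le (T (n1 + i) (-μ - g0 μ z) - T (n1 + j) (-μ - g0 μ w))
        (T (n1 + i) (-μ - g0 μ z) - T (n1 + i) (-μ))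
    rw [← e9] at e10
    linarith
  refine theoremA (μs := μ) (K := K) (n := fun i => q * (n1 + i) + 1) (R := R) (R0 := R / 2) (r := a / (2 * M ^ 2 * C) * x)
    (d := d) (ρ := 2 * R) (G := fun i y => T (n1 + i) (-μ - g0 μ y)) (J := J) hK g.near hR (by linarith) (by linarith)
    (by positivity) hd0 (by linarith) (fun i => by omega) hJ ?_ ?_ ?_ ?_ ?_ ?_ hs ?_
  · intro i y hy
    have hy' := mem_ball_zero_iff.1 hy
    have h1 : DifferentiableAt ℂ (fun y => -μ - g0 μ y) y :=
      (differentiableAt_const _).sub (g0_diff (m := fun _ => μ) (y := fun v => v) (differentiableAt_const _) differentiableAt_id g.near (by linarith))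
    have h2 : DifferentiableAt ℂ (T (n1 + i)) (-μ - g0 μ y) :=
      (b.uT (n1 + i)).d.differentiableAt (g.oV.mem_nhds (g.ballp (hgV y hy)))
    exact (h2.comp y h1).differentiableWithinAt
  · intro i y hy
    rw [Function.iterate_succ_apply', b.iT _ _ (g.ballp (hgV y hy)), hfg]
  · intro i z hz
    have e2 := (hlip i i.2 z hz 0 h0R).1
    rw [sub_zero, hp] at e2
    rw [mem_closedBall_zero_iff] at hz ⊢
    have e3 := (hC _ (b.uT (n1 + i))).2.2
    have e4 := hσ i i.2
    have e5 := (hder i i.2).1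
    rw [b.Tzt] at e3
    have e6 : C * ‖deriv (T (n1 + i)) zt‖ ≤ C * A * x := by rw [mul_assoc]; gcongr
    have e7 : 2 * M * C * A * x * ‖z‖ ≤ 1 / 4 * R := by gcongr
    have e8 := norm_le_norm_add_norm_sub' (T (n1 + i) (-μ - g0 μ z)) (T (n1 + i) (-μ))
    have e9 := norm_le_norm_add_norm_sub' (T (n1 + i) (-μ)) (H (n1 + i) zt)
    linarith
  · intro i z hz w hw
    exact (hlip i i.2 z hz w hw).2
  · intro i z hz w hw
    refine (hlip i i.2 z hz w hw).1.trans ?_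
    have := mul_le_mul_of_nonneg_right hsmall (norm_nonneg (z - w))
    linarith
  · intro i j hij z hz w hw
    rcases lt_or_gt_of_ne hij with h | h
    · exact hsepw i j h z hz w hw
    · rw [norm_sub_rev]
      exact hsepw j i h w hw z hz
  · have : a / (2 * M ^ 2 * C) * x / 2 = a / (4 * M ^ 2 * C) * x := by field_simp; norm_num
    rw [this]
    exact hKs
end
end Mand

open Complex Metric Set Filter Topology
open scoped NNReal ENNReal
namespace Mand
section
variable {l0 : ℂ} {q N : ℕ} {B : ℂ} {C ε : ℝ}

lemma expF (hb : Base l0 q N B C ε) {l z : ℂ} (hl : ‖l‖ ≤ ε) (hz : ‖z‖ ≤ ε) :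
    ‖FF l0 q l z - z - z * (l + B * z ^ N)‖ ≤ ‖z‖ * (‖l‖ ^ 2 + C * (‖z‖ ^ (N + 1) + ‖l‖ * ‖z‖)) := by
  have h1 := hb.exp l z hl hz
  have h2 := Complex.norm_exp_sub_one_sub_id_le (hl.trans hb.ε_le)
  have e : FF l0 q l z - z - z * (l + B * z ^ N) = (FF l0 q l z - z * (exp l + B * z ^ N)) + z * (exp l - 1 - l) := by ring
  rw [e]
  refine (norm_add_le _ _).trans ?_
  rw [norm_mul]
  have h3 := mul_le_mul_of_nonneg_left h2 (norm_nonneg z)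
  linarith

lemma slip (hb : Base l0 q N B C ε) {δ : ℝ} (hδ : 0 < δ) : ∃ e3 > 0, e3 ≤ ε ∧ ∀ l z : ℂ, ‖l‖ ≤ e3 → ‖z‖ ≤ e3 →
    ∃ s, FF l0 q l z = z * (1 + s) ∧ ‖s‖ ≤ δ := by
  have hC := hb.C_pos
  have hN : 0 < N := hb.q_pos.trans_le hb.q_le
  obtain ⟨D, hD⟩ : ∃ D, D = 2 + ‖B‖ + 2 * C := ⟨_, rfl⟩
  have hD0 : 0 < D := by rw [hD]; positivity
  have he3 : 0 < min ε (δ / D) := lt_min hb.ε_pos (by positivity)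
  refine ⟨min ε (δ / D), he3, min_le_left _ _, fun l z hl hz => ?_⟩
  have he1 : min ε (δ / D) ≤ ε := min_le_left _ _
  have he2 : min ε (δ / D) ≤ δ / D := min_le_right _ _
  generalize min ε (δ / D) = e3 at *
  rw [le_div_iff₀ hD0] at he2
  by_cases hz0 : z = 0
  · refine ⟨0, ?_, by simpa using hδ.le⟩
    rw [hz0, zero_mul, FF, f_zero_iter]
  have hzn : 0 < ‖z‖ := norm_pos_iff.2 hz0
  have h1 := expF hb (hl.trans he1) (hz.trans he1)
  have he4 : e3 ≤ 1 := he1.trans hb.ε_le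
  refine ⟨FF l0 q l z / z - 1, by field_simp; ring, ?_⟩
  have e1 : FF l0 q l z / z - 1 = (FF l0 q l z - z) / z := by field_simp
  rw [e1, norm_div, div_le_iff₀ hzn]
  have h2 := norm_le_norm_add_norm_sub' (FF l0 q l z - z) (z * (l + B * z ^ N))
  refine h2.trans ((add_le_add le_rfl h1).trans ?_)
  rw [norm_mul, ← mul_add, mul_comm]
  gcongr
  have hzN : ‖z‖ ^ N ≤ e3 := by
    calc ‖z‖ ^ N ≤ ‖z‖ ^ 1 := pow_le_pow_of_le_one (norm_nonneg _) (hz.trans he4) hN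
      _ = ‖z‖ := pow_one _
      _ ≤ e3 := hz
  have hzN1 : ‖z‖ ^ (N + 1) ≤ e3 := by
    calc ‖z‖ ^ (N + 1) ≤ ‖z‖ ^ 1 := pow_le_pow_of_le_one (norm_nonneg _) (hz.trans he4) (by omega)
      _ = ‖z‖ := pow_one _
      _ ≤ e3 := hz
  have a1 : ‖l + B * z ^ N‖ ≤ e3 + ‖B‖ * e3 := by
    refine (norm_add_le _ _).trans ?_
    rw [norm_mul, norm_pow]
    gcongr
  have a2 : ‖l‖ ^ 2 ≤ e3 := by
    calc ‖l‖ ^ 2 ≤ ‖l‖ ^ 1 := pow_le_pow_of_le_one (norm_nonneg _) (hl.trans he4) (by omega)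
      _ = ‖l‖ := pow_one _
      _ ≤ e3 := hl
  have a3 : ‖l‖ * ‖z‖ ≤ e3 := by
    calc ‖l‖ * ‖z‖ ≤ e3 * 1 := by gcongr; exact hz.trans he4
      _ = e3 := mul_one _
  have a4 : C * (‖z‖ ^ (N + 1) + ‖l‖ * ‖z‖) ≤ C * (e3 + e3) := by gcongr
  rw [hD] at he2
  linarith

/-- neighbourhood of zero together with a cone -/
def CS (N : ℕ) (B : ℂ) (ρ e θ : ℝ) : Set ℂ := ball 0 ρ ∪ {z | ‖z‖ < e ∧ θ * ‖ZZ N B z‖ < (ZZ N B z).im}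

lemma ZZ_zero (hN : 0 < N) : ZZ N B 0 = 0 := by
  simp [ZZ, hN.ne']

lemma CS_open (hN : 0 < N) (hB : B ≠ 0) (ρ e θ : ℝ) : IsOpen (CS N B ρ e θ) := by
  refine isOpen_ball.union ?_
  rw [isOpen_iff_mem_nhds]
  rintro z ⟨h1, h2⟩
  have hz : z ≠ 0 := by
    rintro rfl
    rw [ZZ_zero hN] at h2
    simp at h2
  have hc : ContinuousAt (ZZ N B) z := (ZZ_diff hN hB (y := fun u => u) differentiableAt_id hz).continuousAt
  have c1 : ContinuousAt (fun z => θ * ‖ZZ N B z‖) z := continuousAt_const.mul hc.norm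
  have c2 : ContinuousAt (fun z => (ZZ N B z).im) z := continuous_im.continuousAt.comp hc
  have c3 : ∀ᶠ w in 𝓝 z, ‖w‖ < e := continuousAt_id.norm.eventually_lt continuousAt_const h1
  filter_upwards [c3, c1.eventually_lt c2 h2] with w hw1 hw2 using ⟨hw1, hw2⟩

lemma CS_star {ρ e θ : ℝ} (hρ : 0 < ρ) : StarConvex ℝ 0 (CS N B ρ e θ) := by
  rw [starConvex_zero_iff]
  intro x hx a ha0 ha1
  rcases ha0.eq_or_lt with rfl | ha
  · rw [zero_smul]; exact Or.inl (mem_ball_self hρ)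
  have hn : ‖a • x‖ ≤ ‖x‖ := by
    rw [norm_smul, Real.norm_of_nonneg ha0]
    exact mul_le_of_le_one_left (norm_nonneg _) ha1
  rcases hx with hx | ⟨h1, h2⟩
  · left
    rw [mem_ball_zero_iff] at hx ⊢
    linarith
  · right
    refine ⟨by linarith, ?_⟩
    have e1 : a • x = x * (a : ℂ) := by rw [real_smul, mul_comm]
    have e2 : ZZ N B x * (((a : ℂ) ^ N)⁻¹) = ZZ N B x * (((a ^ N)⁻¹ : ℝ) : ℂ) := by push_cast; rfl
    have hp : 0 < (a ^ N)⁻¹ := by positivity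
    rw [e1, ZZ_mul, e2, norm_mul, Complex.norm_real, Real.norm_of_nonneg hp.le, im_mul_ofReal, ← mul_assoc]
    exact mul_lt_mul_of_pos_right h2 hp

lemma cone_move (hN : 0 < N) (hB : B ≠ 0) {z s : ℂ} (hz : z ≠ 0) (h : 4 / 5 * ‖ZZ N B z‖ ≤ (ZZ N B z).im)
    (hs : ‖s‖ ≤ 1 / (40 * N)) : 1 / 2 * ‖ZZ N B (z * (1 + s))‖ < (ZZ N B (z * (1 + s))).im := by
  have hN0 : (0 : ℝ) < N := by exact_mod_cast hN
  have h1 := (inv_pow_sub_one hN (hs.trans (by gcongr; norm_num))).1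
  have h2 : 3 * N * ‖s‖ ≤ 3 / 40 := by
    calc 3 * N * ‖s‖ ≤ 3 * N * (1 / (40 * N)) := by gcongr
      _ = 3 / 40 := by field_simp
  have hZ : 0 < ‖ZZ N B z‖ := norm_pos_iff.2 (ZZ_ne hN hB hz)
  rw [ZZ_mul]
  obtain ⟨W, hW⟩ : ∃ W, W = ZZ N B z * ((1 + s) ^ N)⁻¹ := ⟨_, rfl⟩
  rw [← hW]
  have h3 : ‖W - ZZ N B z‖ ≤ 3 / 40 * ‖ZZ N B z‖ := by
    have : W - ZZ N B z = ZZ N B z * (((1 + s) ^ N)⁻¹ - 1) := by rw [hW]; ring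
    rw [this, norm_mul, mul_comm]
    gcongr
    linarith
  have h4 := norm_le_norm_add_norm_sub' W (ZZ N B z)
  have h5 := (abs_le.1 (abs_im_le_norm (W - ZZ N B z))).1
  rw [sub_im] at h5
  linarith

lemma mk_geo (hb : Base l0 q N B C ε) {e1 e3 ρ κ : ℝ} {zt l : ℂ} (he3 : 0 < e3) (he31 : 2 * e3 ≤ e1)
    (hs : ∀ z, ‖z‖ ≤ e3 → ∃ s, FF l0 q l z = z * (1 + s) ∧ ‖s‖ ≤ 1 / (40 * N)) (hz : zt ≠ 0) (hze : ‖zt‖ < e3)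
    (hcone : 9 / 10 * ‖ZZ N B zt‖ ≤ (ZZ N B zt).im) (hρ : 0 < ρ) (hρe : ρ ≤ e3) (hl : ‖l‖ ≤ 1 / 100) (hκ : 0 < κ)
    (hlκ : 4 * ‖l‖ ≤ κ) (h1 : ∀ i, ρ ≤ ‖vv l0 q i l‖)
    (h2 : ∀ i, ¬(‖vv l0 q i l‖ < e1 ∧ 1 / 2 * ‖ZZ N B (vv l0 q i l)‖ < (ZZ N B (vv l0 q i l)).im))
    (h3 : ∀ i, κ ≤ infDist (vv l0 q i l) (segment ℝ zt (-l0))) :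
    Geo (mu l0 q l) q (CS N B ρ e1 (1 / 2)) (CS N B (ρ / 2) e3 (4 / 5)) (thickening κ (segment ℝ zt (-l0))) zt ρ
      (‖zt‖ / (40 * N)) (min (κ / 2) (1 / 2)) := by
  have hN : 0 < N := hb.q_pos.trans_le hb.q_le
  have hN0 : (1 : ℝ) ≤ N := by exact_mod_cast hN
  have hB := hb.B_ne
  have hzn : 0 < ‖zt‖ := norm_pos_iff.2 hz
  have hZ : 0 < ‖ZZ N B zt‖ := norm_pos_iff.2 (ZZ_ne hN hB hz)
  have hs2 : (1 : ℝ) / (40 * N) ≤ 1 := by rw [div_le_one (by positivity)]; linarith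
  have hsn : ∀ s : ℂ, ‖s‖ ≤ 1 / (40 * N) → ‖1 + s‖ ≤ 2 := fun s hs => by
    refine (norm_add_le _ _).trans ?_
    rw [norm_one]; linarith
  have hseg : (segment ℝ zt (-l0)).Nonempty := ⟨zt, left_mem_segment ℝ zt (-l0)⟩
  exact
  { near := mu_near hb hl
    q_pos := hb.q_pos
    oS := CS_open hN hB _ _ _
    starS := CS_star hρ
    ρ_pos := hρ
    ballS := subset_union_left
    avS := fun i hi => by
      rcases hi with hi | hi
      · rw [mem_ball_zero_iff] at hi
        exact absurd (h1 i) (not_le.2 hi)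
      · exact h2 i hi
    oS' := CS_open hN hB _ _ _
    starS' := CS_star (by linarith)
    zS' := Or.inl (mem_ball_self (by linarith))
    subS' := by
      rintro z (hz | ⟨ha, hb⟩)
      · exact Or.inl (ball_subset_ball (by linarith) hz)
      · refine Or.inr ⟨by linarith, lt_of_le_of_lt ?_ hb⟩
        exact mul_le_mul_of_nonneg_right (by norm_num) (norm_nonneg _)
    mapS' := by
      rintro z (hz | ⟨ha, hb⟩)
      · rw [mem_ball_zero_iff] at hz
        obtain ⟨s, h1, h2⟩ := hs z (by linarith)
        left
        rw [mem_ball_zero_iff]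
        change ‖FF l0 q l z‖ < ρ
        rw [h1, norm_mul]
        have := mul_le_mul_of_nonneg_left (hsn s h2) (norm_nonneg z)
        linarith
      · obtain ⟨s, h1, h2⟩ := hs z ha.le
        have hz0 : z ≠ 0 := by
          rintro rfl
          rw [ZZ_zero hN] at hb
          simp at hb
        right
        change ‖FF l0 q l z‖ < e1 ∧ 1 / 2 * ‖ZZ N B (FF l0 q l z)‖ < (ZZ N B (FF l0 q l z)).im
        rw [h1]
        refine ⟨?_, cone_move hN hB hz0 hb.le h2⟩
        rw [norm_mul]
        have := mul_le_mul_of_nonneg_left (hsn s h2) (norm_nonneg z)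
        linarith
    ztS' := Or.inr ⟨hze, by linarith⟩
    r0_pos := by positivity
    ballzt := by
      intro z hz'
      rw [mem_ball, dist_eq_norm] at hz'
      have e1 : z = zt * (1 + (z - zt) / zt) := by field_simp; ring
      have e2 : ‖(z - zt) / zt‖ ≤ 1 / (40 * N) := by
        rw [norm_div, div_le_iff₀ hzn]
        calc _ ≤ ‖zt‖ / (40 * N) := hz'.le
          _ = _ := by ring
      right
      rw [e1]
      refine ⟨?_, cone_move hN hB hz (by linarith) e2⟩
      rw [norm_mul]
      have := mul_le_mul_of_nonneg_left (hsn _ e2) (norm_nonneg zt)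
      linarith
    oV := isOpen_thickening
    convV := (convex_segment zt (-l0)).thickening κ
    ztV := self_subset_thickening hκ _ (left_mem_segment ℝ zt (-l0))
    κ_pos := lt_min (by linarith) (by norm_num)
    κ_le := min_le_right _ _
    ballp := by
      intro z hz'
      rw [mem_ball, dist_eq_norm] at hz'
      rw [mem_thickening_iff]
      refine ⟨-l0, right_mem_segment ℝ zt (-l0), ?_⟩
      have e1 := mu_sub_le hb.q_pos hb.nrm (l := l) (by linarith)
      have e2 : z - -l0 = (z - -mu l0 q l) - (mu l0 q l - l0) := by ring
      have e3 := norm_sub_le (z - -mu l0 q l) (mu l0 q l - l0)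
      rw [dist_eq_norm, e2]
      have := min_le_left (κ / 2) (1 / 2)
      linarith
    avV := fun i hi => by
      have h4 := (mem_thickening_iff_infDist_lt hseg).1 hi
      exact absurd (h3 i) (not_le.2 h4) }
end
end Mand

open Complex Metric Set Filter Topology
open scoped NNReal ENNReal
namespace Mand
section
variable {l0 : ℂ} {q N : ℕ} {B : ℂ} {C ε : ℝ}

/-- chain with a uniform constant up to the moving point -/
lemma chain_p (hb : Base l0 q N B C ε) {zt : ℂ} {κ M : ℝ} (hκ : 0 < κ) (hM : KC M) :
    ∃ D, 1 ≤ D ∧ ∀ l : ℂ, ‖l‖ ≤ 1 → 40 * ‖l‖ ≤ κ → ∀ Q, Uni Q (thickening κ (segment ℝ zt (-l0))) →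
      ‖deriv Q (-mu l0 q l)‖ ≤ D * ‖deriv Q zt‖ ∧ ‖deriv Q zt‖ ≤ D * ‖deriv Q (-mu l0 q l)‖ ∧
      ‖Q (-mu l0 q l) - Q zt‖ ≤ D * ‖deriv Q zt‖ := by
  have hM1 := hM.1
  obtain ⟨E, hE, h⟩ := chain (isOpen_thickening (δ := κ) (E := segment ℝ zt (-l0)))
    ((convex_segment zt (-l0)).thickening κ).isPreconnected
    (self_subset_thickening hκ _ (left_mem_segment ℝ zt (-l0))) (self_subset_thickening hκ _ (right_mem_segment ℝ zt (-l0)))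
  refine ⟨M * E * (2 + κ), ?_, fun l hl hlκ Q hQ => ?_⟩
  · have : 1 ≤ M * E := one_le_mul_of_one_le_of_one_le hM1 hE
    nlinarith
  have hsub : ball (-l0) κ ⊆ thickening κ (segment ℝ zt (-l0)) := by
    intro z hz
    rw [mem_thickening_iff]
    exact ⟨-l0, right_mem_segment ℝ zt (-l0), hz⟩
  have e1 := mu_sub_le hb.q_pos hb.nrm hl
  have e2 : -mu l0 q l - -l0 = -(mu l0 q l - l0) := by ring
  have e3 : ‖-mu l0 q l - -l0‖ ≤ 2 * ‖l‖ := by rw [e2, norm_neg]; exact e1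
  have hk := (hM.2 Q (-l0) κ hκ (hQ.mono hsub)).1 (-mu l0 q l) (by
    rw [mem_ball, dist_eq_norm]; linarith)
  obtain ⟨k1, k2, -, k4⟩ := hk
  obtain ⟨c1, c2, c3⟩ := h Q hQ
  generalize ‖deriv Q (-mu l0 q l)‖ = x at *
  have hy := norm_nonneg (deriv Q zt)
  generalize ‖deriv Q zt‖ = y at *
  have hw := norm_nonneg (deriv Q (-l0))
  generalize ‖deriv Q (-l0)‖ = w at *
  have hx : 0 ≤ x := by
    by_contra! hx
    have : M * x < 0 := mul_neg_of_pos_of_neg (by linarith) hx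
    linarith
  refine ⟨?_, ?_, ?_⟩
  · calc x ≤ M * (E * y) * 1 := by rw [mul_one]; exact k1.trans (by gcongr)
      _ ≤ M * (E * y) * (2 + κ) := by gcongr; linarith
      _ = _ := by ring
  · calc y ≤ E * (M * x) * 1 := by rw [mul_one]; exact c2.trans (by gcongr)
      _ ≤ E * (M * x) * (2 + κ) := by gcongr; linarith
      _ = _ := by ring
  · have e4 : Q (-mu l0 q l) - Q zt = (Q (-mu l0 q l) - Q (-l0)) + (Q (-l0) - Q zt) := by ring
    rw [e4]
    have e5 : M * w * ‖-mu l0 q l - -l0‖ ≤ M * (E * y) * κ := by gcongr; linarith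
    have e6 : E * y ≤ M * (E * y) := le_mul_of_one_le_left (by positivity) hM1
    have e7 : 0 ≤ M * (E * y) := by positivity
    have := norm_add_le (Q (-mu l0 q l) - Q (-l0)) (Q (-l0) - Q zt)
    have e8 : M * E * (2 + κ) * y = 2 * (M * (E * y)) + M * (E * y) * κ := by ring
    linarith

lemma near_zero (hb : Base l0 q N B C ε) {l z : ℂ} {σ c1 : ℝ} (hl : ‖l‖ ≤ ε) (hσ : σ ≤ ε) (hz : ‖z‖ ≤ σ) (ht : ‖l‖ ≤ 1 / 8)
    (hBσ : ‖B‖ * σ ^ N ≤ ‖l‖ / 8) (hσN : σ ^ N ≤ c1 * ‖l‖) (hCσ : C * σ * (c1 + 1) ≤ 1 / 8) :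
    ‖l‖ / 2 * ‖z‖ ≤ ‖FF l0 q l z - z‖ ∧ ‖FF l0 q l z - z‖ ≤ 2 * ‖l‖ * ‖z‖ := by
  have hC := hb.C_pos
  have h1 := expF hb hl (hz.trans hσ)
  have hσ0 : 0 ≤ σ := (norm_nonneg z).trans hz
  have hzN : ‖z‖ ^ N ≤ σ ^ N := by gcongr
  have a1 : ‖z * (B * z ^ N)‖ ≤ ‖z‖ * (‖l‖ / 8) := by
    rw [norm_mul, norm_mul, norm_pow]
    gcongr
    exact le_trans (by gcongr) hBσ
  have a2 : ‖l‖ ^ 2 ≤ ‖l‖ / 8 := by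
    have := mul_le_mul_of_nonneg_left ht (norm_nonneg l)
    linarith
  have a3 : C * (‖z‖ ^ (N + 1) + ‖l‖ * ‖z‖) ≤ ‖l‖ / 8 := by
    calc C * (‖z‖ ^ (N + 1) + ‖l‖ * ‖z‖) = C * ‖z‖ * (‖z‖ ^ N + ‖l‖) := by ring
      _ ≤ C * σ * (c1 * ‖l‖ + ‖l‖) := by gcongr; exact hzN.trans hσN
      _ = C * σ * (c1 + 1) * ‖l‖ := by ring
      _ ≤ 1 / 8 * ‖l‖ := by gcongr
      _ = _ := by ring
  have a4 : ‖z‖ * (‖l‖ ^ 2 + C * (‖z‖ ^ (N + 1) + ‖l‖ * ‖z‖)) ≤ ‖z‖ * (‖l‖ / 8 + ‖l‖ / 8) := by gcongr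
  have a5 : ‖(FF l0 q l z - z) - z * l‖ ≤ 3 / 8 * (‖l‖ * ‖z‖) := by
    have e : (FF l0 q l z - z) - z * l = (FF l0 q l z - z - z * (l + B * z ^ N)) + z * (B * z ^ N) := by ring
    rw [e]
    refine (norm_add_le _ _).trans ?_
    linarith
  have a6 := norm_le_norm_add_norm_sub' (FF l0 q l z - z) (z * l)
  have a7 := norm_le_norm_add_norm_sub' (z * l) (FF l0 q l z - z)
  rw [norm_sub_rev (z * l) (FF l0 q l z - z)] at a7
  rw [norm_mul] at a6 a7
  have a8 : 0 ≤ ‖l‖ * ‖z‖ := by positivity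
  constructor <;> linarith

lemma zt_move (hb : Base l0 q N B C ε) {l z : ℂ} (hl : ‖l‖ ≤ ε) (hz : ‖z‖ ≤ ε) (hCz : C * ‖z‖ ≤ ‖B‖ / 4)
    (hls : ‖l‖ * (2 + C) ≤ ‖B‖ / 4 * ‖z‖ ^ N) : ‖B‖ / 2 * ‖z‖ ^ (N + 1) ≤ ‖FF l0 q l z - z‖ := by
  have hC := hb.C_pos
  have h1 := expF hb hl hz
  have hz1 := hz.trans hb.ε_le
  have hl1 := hl.trans hb.ε_le
  have e : z * (B * z ^ N) = (FF l0 q l z - z) - (FF l0 q l z - z - z * (l + B * z ^ N)) - z * l := by ring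
  have e1 := norm_sub_le ((FF l0 q l z - z) - (FF l0 q l z - z - z * (l + B * z ^ N))) (z * l)
  have e2 := norm_sub_le (FF l0 q l z - z) (FF l0 q l z - z - z * (l + B * z ^ N))
  rw [← e, norm_mul, norm_mul, norm_mul, norm_pow] at e1
  have a2 : ‖l‖ ^ 2 ≤ ‖l‖ := by
    have := mul_le_mul_of_nonneg_left hl1 (norm_nonneg l)
    linarith
  have a3 : C * (‖z‖ ^ (N + 1) + ‖l‖ * ‖z‖) ≤ ‖B‖ / 4 * ‖z‖ ^ N + C * ‖l‖ := by
    have b1 : C * ‖z‖ * ‖z‖ ^ N ≤ ‖B‖ / 4 * ‖z‖ ^ N := by gcongr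
    have b2 : C * ‖l‖ * ‖z‖ ≤ C * ‖l‖ * 1 := by gcongr
    have : C * (‖z‖ ^ (N + 1) + ‖l‖ * ‖z‖) = C * ‖z‖ * ‖z‖ ^ N + C * ‖l‖ * ‖z‖ := by ring
    linarith
  have a4 : ‖z‖ * (‖l‖ ^ 2 + C * (‖z‖ ^ (N + 1) + ‖l‖ * ‖z‖)) ≤ ‖z‖ * (‖l‖ + (‖B‖ / 4 * ‖z‖ ^ N + C * ‖l‖)) := by gcongr
  have a5 := mul_le_mul_of_nonneg_left hls (norm_nonneg z)
  have a6 : ‖z‖ ^ (N + 1) = ‖z‖ * ‖z‖ ^ N := by ring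
  rw [a6]
  linarith
end
end Mand

open Complex Metric Set Filter Topology
open scoped NNReal ENNReal
namespace Mand

lemma num_ev {c c1 s : ℝ} {N : ℕ} (q : ℕ) (hc : 0 < c) (hc1 : 0 < c1) (hsN : s * (1 + (N : ℝ)⁻¹) < 2) :
    ∀ᶠ t : ℝ in 𝓝[>] 0, 2 ^ (q + 3) * t ^ 2 ≤ (c * (t * (c1 * t) ^ ((N : ℝ)⁻¹))) ^ s := by
  obtain ⟨u, hu⟩ : ∃ u, u = s * (1 + (N : ℝ)⁻¹) := ⟨_, rfl⟩
  rw [← hu] at hsN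
  have h1 : Tendsto (fun t : ℝ => 2 ^ (q + 3) * t ^ (2 - u)) (𝓝[>] 0) (𝓝 0) := by
    have : Tendsto (fun t : ℝ => 2 ^ (q + 3) * t ^ (2 - u)) (𝓝 0) (𝓝 (2 ^ (q + 3) * 0 ^ (2 - u))) :=
      ((Real.continuousAt_rpow_const 0 (2 - u) (Or.inr (by linarith))).tendsto).const_mul _
    rw [Real.zero_rpow (by linarith), mul_zero] at this
    exact this.mono_left nhdsWithin_le_nhds
  have h2 : 0 < (c * c1 ^ ((N : ℝ)⁻¹)) ^ s := by positivity
  filter_upwards [h1.eventually_le_const h2, self_mem_nhdsWithin] with t ht ht0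
  rw [Set.mem_Ioi] at ht0
  have e1 : c * (t * (c1 * t) ^ ((N : ℝ)⁻¹)) = (c * c1 ^ ((N : ℝ)⁻¹)) * t ^ (1 + (N : ℝ)⁻¹) := by
    rw [Real.mul_rpow hc1.le ht0.le, Real.rpow_add ht0, Real.rpow_one]; ring
  rw [e1, Real.mul_rpow (by positivity) (by positivity), ← Real.rpow_mul ht0.le, mul_comm _ s, ← hu]
  have e2 : t ^ 2 = t ^ (2 - u) * t ^ u := by
    rw [← Real.rpow_add ht0, sub_add_cancel, ← Real.rpow_natCast]; norm_num
  rw [e2, ← mul_assoc]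
  gcongr

lemma K_lem {E t : ℝ} {q : ℕ} (hE : 1 ≤ E) (h : E ^ 2 - 1 ≤ 2 ^ q * (2 * t) ^ 2) (ht : 0 < t)
    (hy : 2 ^ (q + 2) * t ^ 2 ≤ 1 / 2) : ∃ K : ℕ, 2 ≤ K ∧ E ^ K ≤ 3 ∧ 1 ≤ K * (2 ^ (q + 3) * t ^ 2) := by
  obtain ⟨y, hyd⟩ : ∃ y : ℝ, y = 2 ^ (q + 2) * t ^ 2 := ⟨_, rfl⟩
  have hy0 : 0 < y := by rw [hyd]; positivity
  have e1 : 2 ^ q * (2 * t) ^ 2 = y := by rw [hyd]; ring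
  have e2 : 2 ^ (q + 3) * t ^ 2 = 2 * y := by rw [hyd]; ring
  rw [e1] at h
  rw [← hyd] at hy
  rw [e2]
  have hEy : E ≤ 1 + y := by nlinarith
  have h2 : 2 ≤ 1 / y := by rw [le_div_iff₀ hy0]; linarith
  have hfl := Nat.floor_le (by positivity : 0 ≤ 1 / y)
  have hfl2 := Nat.lt_floor_add_one (1 / y)
  refine ⟨⌊1 / y⌋₊, Nat.le_floor (by exact_mod_cast h2), ?_, ?_⟩
  · have a1 : E ≤ Real.exp y := by have := Real.add_one_le_exp y; linarith
    calc E ^ ⌊1 / y⌋₊ ≤ Real.exp y ^ ⌊1 / y⌋₊ := by gcongr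
      _ = Real.exp (⌊1 / y⌋₊ * y) := by rw [← Real.exp_nat_mul]
      _ ≤ Real.exp 1 := by
        gcongr
        calc (⌊1 / y⌋₊ : ℝ) * y ≤ 1 / y * y := by gcongr
          _ = 1 := by field_simp
      _ ≤ 3 := by have := Real.exp_one_lt_d9; linarith
  · have a1 : 1 / y ≤ 2 * ⌊1 / y⌋₊ := by
      have : (2 : ℝ) ≤ ⌊1 / y⌋₊ := by exact_mod_cast Nat.le_floor (by exact_mod_cast h2)
      linarith
    rw [div_le_iff₀ hy0] at a1
    linarith

set_option maxHeartbeats 1000000 in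
theorem lower {l0 : ℂ} {q N : ℕ} {B : ℂ} {C ε : ℝ} (hb : Base l0 q N B C ε) {s : ℝ} (hs : 0 < s)
    (hsN : s * (1 + (N : ℝ)⁻¹) < 2) : ENNReal.ofReal s ≤ dimH (frontier MM) := by
  have hN : 0 < N := hb.q_pos.trans_le hb.q_le
  have hN0 : (1 : ℝ) ≤ N := by exact_mod_cast hN
  have hB := norm_pos_iff.2 hb.B_ne
  have hC := hb.C_pos
  have hε := hb.ε_pos
  obtain ⟨M, hM⟩ := exists_KC
  have hM1 := hM.1
  obtain ⟨e1, he1, c1, hc1, hgate⟩ := gate hb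
  obtain ⟨e2, he2, he2ε, hslip⟩ := slip hb (δ := 1 / (1000 * N)) (by positivity)
  obtain ⟨e3, he3, he32, he31⟩ : ∃ e3 > 0, e3 ≤ e2 ∧ 2 * e3 ≤ e1 :=
    ⟨min e2 (e1 / 2), lt_min he2 (by positivity), min_le_left _ _, by have := min_le_right e2 (e1 / 2); linarith⟩
  obtain ⟨zt, κ', hκ', hzt, hzte, hcone, -, hgate⟩ := hgate (min (e3 / 2) (‖B‖ / (4 * C))) (lt_min (by positivity) (by positivity))
  have hzn := norm_pos_iff.2 hzt
  have hzt1 : ‖zt‖ < e3 := by have := hzte.trans (min_le_left _ _); linarith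
  have hzt2 : C * ‖zt‖ ≤ ‖B‖ / 4 := by
    have := hzte.trans (min_le_right _ _)
    rw [le_div_iff₀ (by positivity)] at this
    linarith
  clear hzte
  obtain ⟨D, hD1, hD⟩ := chain_p hb (zt := zt) hκ' hM
  obtain ⟨η, hη⟩ : ∃ η, η = ‖B‖ / 2 * ‖zt‖ ^ (N + 1) := ⟨_, rfl⟩
  have hη0 : 0 < η := by rw [hη]; positivity
  obtain ⟨r0, hr0⟩ : ∃ r0, r0 = ‖zt‖ / (40 * N) := ⟨_, rfl⟩
  have hr00 : 0 < r0 := by rw [hr0]; positivity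
  obtain ⟨A, hA⟩ : ∃ A, A = 2 * M / η := ⟨_, rfl⟩
  have hA0 : 0 < A := by rw [hA]; positivity
  obtain ⟨a, ha⟩ : ∃ a, a = 1 / (24 * M * r0) := ⟨_, rfl⟩
  have ha0 : 0 < a := by rw [ha]; positivity
  obtain ⟨κ, hκ⟩ : ∃ κ, κ = min (κ' / 2) (1 / 2) := ⟨_, rfl⟩
  have hκ0 : 0 < κ := by rw [hκ]; exact lt_min (by positivity) (by norm_num)
  obtain ⟨R, hR0, hR1, hR2, hR3⟩ : ∃ R : ℝ, 0 < R ∧ R ≤ 1 / 200 ∧ 200 * R ≤ κ ∧ 8 * M ^ 2 * A * D ^ 2 * R ≤ κ * a := by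
    refine ⟨min (1 / 200) (min (κ / 200) (κ * a / (8 * M ^ 2 * A * D ^ 2))), lt_min (by norm_num) (lt_min (by positivity) (by positivity)),
      min_le_left _ _, ?_, ?_⟩
    · have := (min_le_right (1 / 200) (min (κ / 200) (κ * a / (8 * M ^ 2 * A * D ^ 2)))).trans (min_le_left _ _)
      linarith
    · have := (min_le_right (1 / 200) (min (κ / 200) (κ * a / (8 * M ^ 2 * A * D ^ 2)))).trans (min_le_right _ _)
      rw [le_div_iff₀ (by positivity)] at this
      linarith
  obtain ⟨θ, hθ0, hθ1, hθM, hθB⟩ : ∃ θ : ℝ, 0 < θ ∧ θ ≤ 1 ∧ 32 * M * θ ≤ 1 ∧ ‖B‖ * θ * c1 ≤ 1 / 8 := by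
    refine ⟨min (1 / (32 * M)) (1 / (8 * ‖B‖ * c1)), lt_min (by positivity) (by positivity), ?_, ?_, ?_⟩
    · refine (min_le_left _ _).trans ?_
      rw [div_le_one (by positivity)]; linarith
    · have := min_le_left (1 / (32 * M)) (1 / (8 * ‖B‖ * c1))
      rw [le_div_iff₀ (by positivity)] at this
      linarith
    · have := min_le_right (1 / (32 * M)) (1 / (8 * ‖B‖ * c1))
      rw [le_div_iff₀ (by positivity)] at this
      linarith
  -- asymptotic conditions
  have hid : Tendsto (fun t : ℝ => t) (𝓝[>] 0) (𝓝 0) := tendsto_id.mono_left nhdsWithin_le_nhds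
  have hρt : Tendsto (fun t : ℝ => (c1 * t) ^ ((N : ℝ)⁻¹)) (𝓝[>] 0) (𝓝 0) := by
    have h1 : Tendsto (fun t : ℝ => c1 * t) (𝓝[>] 0) (𝓝 0) := by simpa using hid.const_mul c1
    have h2 := ((Real.continuousAt_rpow_const 0 ((N : ℝ)⁻¹) (Or.inr (by positivity))).tendsto).comp h1
    rw [Real.zero_rpow (by positivity)] at h2
    exact h2
  have hev : ∀ᶠ t : ℝ in 𝓝[>] 0, (t ≤ e3 ∧ t ≤ 1 / 100 ∧ 40 * t ≤ κ' ∧ t * (2 + C) ≤ ‖B‖ / 4 * ‖zt‖ ^ N ∧ 2 ^ (q + 2) * t ^ 2 ≤ 1 / 2) ∧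
      ((c1 * t) ^ ((N : ℝ)⁻¹) ≤ e3 ∧ (c1 * t) ^ ((N : ℝ)⁻¹) < ‖zt‖ ∧ 3 ^ q * (M * (c1 * t) ^ ((N : ℝ)⁻¹)) ≤ 1 / 4 ∧
        C * (c1 * t) ^ ((N : ℝ)⁻¹) * (c1 + 1) ≤ 1 / 8 ∧ (c1 * t) ^ ((N : ℝ)⁻¹) + D * A * (t * (c1 * t) ^ ((N : ℝ)⁻¹)) ≤ R / 4 ∧
        8 * M * A * D * (t * (c1 * t) ^ ((N : ℝ)⁻¹)) ≤ 1) ∧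
      2 ^ (q + 3) * t ^ 2 ≤ (a / (4 * M ^ 2 * D) * θ * (t * (c1 * t) ^ ((N : ℝ)⁻¹))) ^ s := by
    have hx := hid.mul hρt
    rw [mul_zero] at hx
    refine Filter.Eventually.and ?_ (Filter.Eventually.and ?_ (num_ev q (by positivity) hc1 hsN))
    · have t1 : Tendsto (fun t : ℝ => 40 * t) (𝓝[>] 0) (𝓝 0) := by simpa using hid.const_mul 40
      have t2 : Tendsto (fun t : ℝ => t * (2 + C)) (𝓝[>] 0) (𝓝 0) := by simpa using hid.mul_const (2 + C)
      have t3 : Tendsto (fun t : ℝ => 2 ^ (q + 2) * t ^ 2) (𝓝[>] 0) (𝓝 0) := by simpa using (hid.pow 2).const_mul (2 ^ (q + 2) : ℝ)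
      exact (hid.eventually_le_const he3).and ((hid.eventually_le_const (by norm_num)).and ((t1.eventually_le_const hκ').and
        ((t2.eventually_le_const (by positivity)).and (t3.eventually_le_const (by norm_num)))))
    · have t1 : Tendsto (fun t : ℝ => 3 ^ q * (M * (c1 * t) ^ ((N : ℝ)⁻¹))) (𝓝[>] 0) (𝓝 0) := by
        simpa using (hρt.const_mul M).const_mul ((3 : ℝ) ^ q)
      have t2 : Tendsto (fun t : ℝ => C * (c1 * t) ^ ((N : ℝ)⁻¹) * (c1 + 1)) (𝓝[>] 0) (𝓝 0) := by
        simpa using (hρt.const_mul C).mul_const (c1 + 1)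
      have t3 : Tendsto (fun t : ℝ => (c1 * t) ^ ((N : ℝ)⁻¹) + D * A * (t * (c1 * t) ^ ((N : ℝ)⁻¹))) (𝓝[>] 0) (𝓝 0) := by
        simpa using hρt.add (hx.const_mul (D * A))
      have t4 : Tendsto (fun t : ℝ => 8 * M * A * D * (t * (c1 * t) ^ ((N : ℝ)⁻¹))) (𝓝[>] 0) (𝓝 0) := by
        simpa using hx.const_mul (8 * M * A * D)
      exact (hρt.eventually_le_const he3).and ((hρt.eventually_lt_const hzn).and ((t1.eventually_le_const (by norm_num)).and
        ((t2.eventually_le_const (by norm_num)).and ((t3.eventually_le_const (by positivity)).and (t4.eventually_le_const one_pos)))))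
  obtain ⟨ε', hε', hev⟩ := mem_nhdsGT_iff_exists_Ioo_subset.1 hev
  obtain ⟨l, hl0, hlε, ⟨J, hJ⟩, hP⟩ := hgate ε' hε'
  obtain ⟨⟨b1, b2, b3, b4, b5⟩, ⟨d1, d2, d3, d4, d5, d6⟩, hfin⟩ := hev ⟨hl0, hlε⟩
  obtain ⟨t, ht⟩ : ∃ t, t = ‖l‖ := ⟨_, rfl⟩
  obtain ⟨ρ, hρ⟩ : ∃ ρ, ρ = (c1 * t) ^ ((N : ℝ)⁻¹) := ⟨_, rfl⟩
  rw [← ht, ← hρ] at d1 d2 d3 d4 d5 d6 hfin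
  rw [← ht] at b1 b2 b3 b4 b5 hl0 hlε
  have hρ0 : 0 < ρ := by rw [hρ]; positivity
  have hρN : ρ ^ N = c1 * t := by
    rw [hρ]; exact Real.rpow_inv_natCast_pow (by positivity) hN.ne'
  have hslip' : ∀ z, ‖z‖ ≤ e3 → ∃ s, FF l0 q l z = z * (1 + s) ∧ ‖s‖ ≤ 1 / (1000 * N) := fun z hz =>
    hslip l z (by rw [← ht]; linarith) (by linarith)
  have g := mk_geo hb (e1 := e1) (e3 := e3) (ρ := ρ) (κ := κ') (zt := zt) (l := l) he3 he31
    (fun z hz => by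
      obtain ⟨s, h1, h2⟩ := hslip' z hz
      exact ⟨s, h1, h2.trans (by gcongr; norm_num)⟩) hzt hzt1 hcone hρ0 d1 (by rw [← ht]; linarith) hκ' (by rw [← ht]; linarith)
    (fun i => by
      have := (hP i).1
      rw [← ht, ← hρN] at this
      exact le_of_pow_le_pow_left₀ hN.ne' (norm_nonneg _) this) (fun i => (hP i).2.1) (fun i => (hP i).2.2)
  rw [← hr0, ← hκ] at g
  obtain ⟨μ, hμ⟩ : ∃ μ, μ = mu l0 q l := ⟨_, rfl⟩
  have hFF : ∀ z, FF l0 q l z = (f μ)^[q] z := fun z => by rw [hμ]; rfl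
  have hμq : μ ^ q = exp l := by rw [hμ]; exact mu_pow hb.q_pos hb.l0_pow l
  have hDl := hD l (by rw [← ht]; linarith) (by rw [← ht]; linarith)
  rw [← hμ] at g hJ hDl
  obtain ⟨H, T, b⟩ := exists_Br g
  -- the multiplier
  have hJ' : (f μ)^[J] (-μ ^ 2 / 4) = 1 - μ := by
    have h1 : f μ (-μ / 2) = -μ ^ 2 / 4 := by rw [f]; ring
    rw [← h1, ← Function.iterate_succ_apply, Function.iterate_succ_apply', hJ, f_beta]
  have hind := index_bound g.near hb.q_pos hJ' (fun i hi => g.avS i (by rw [hi]; exact g.subS' g.zS'))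
  have hexp : ‖μ ^ q - 1‖ ≤ 2 * t := by
    rw [hμq, ht]
    exact exp_sub_one_le (by rw [← ht]; linarith)
  obtain ⟨K, hK2, hK3, hKt⟩ := K_lem (t := t) hind.1 (hind.2.trans (by gcongr)) hl0 b5
  obtain ⟨σ, hσ⟩ : ∃ σ, σ = θ * ρ := ⟨_, rfl⟩
  have hσ0 : 0 < σ := by rw [hσ]; positivity
  have hσρ : σ ≤ ρ := by rw [hσ]; exact mul_le_of_le_one_left hρ0.le hθ1
  have hσN : σ ^ N ≤ θ * (c1 * t) := by
    rw [hσ, mul_pow, hρN]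
    gcongr
    exact pow_le_of_le_one hθ0.le hθ1 hN.ne'
  have h5 : ∀ z, ‖z‖ ≤ σ → t / 2 * ‖z‖ ≤ ‖(f μ)^[q] z - z‖ ∧ ‖(f μ)^[q] z - z‖ ≤ 2 * t * ‖z‖ := by
    intro z hz
    have := near_zero hb (l := l) (z := z) (σ := σ) (c1 := c1) (by rw [← ht]; linarith) (by linarith) hz (by rw [← ht]; linarith)
      (by
        rw [← ht]
        calc ‖B‖ * σ ^ N ≤ ‖B‖ * (θ * (c1 * t)) := by gcongr
          _ = (‖B‖ * θ * c1) * t := by ring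
          _ ≤ 1 / 8 * t := by gcongr
          _ = t / 8 := by ring)
      (by
        rw [← ht]
        refine hσN.trans (mul_le_of_le_one_left (by positivity) hθ1))
      (le_trans (by gcongr) d4)
    rw [← ht, hFF] at this
    exact this
  obtain ⟨n1, hn1⟩ := window hM g b hind.1 (t := t) (σ := σ) (K := K) (by linarith) hσ0 (fun z hz => (h5 z hz).2) (by linarith)
    (by
      rw [hσ]
      calc 32 * M * (θ * ρ) = 32 * M * θ * ρ := by ring
        _ ≤ 1 * ρ := by gcongr
        _ = ρ := one_mul _)
    (le_trans (by gcongr) d3) hK3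
  have hz1 : η ≤ ‖(f μ)^[q] zt - zt‖ := by
    rw [← hFF, hη]
    exact zt_move hb (by rw [← ht]; linarith) (by linarith) hzt2 (by rw [← ht]; exact b4)
  have hz2 : ‖(f μ)^[q] zt - zt‖ < r0 / 16 := by
    obtain ⟨s, h1, h2⟩ := hslip' zt hzt1.le
    have e : zt * (1 + s) - zt = zt * s := by ring
    rw [← hFF, h1, e, norm_mul, hr0]
    calc ‖zt‖ * ‖s‖ ≤ ‖zt‖ * (1 / (1000 * N)) := by gcongr
      _ < ‖zt‖ * (1 / (640 * N)) := by gcongr; norm_num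
      _ = ‖zt‖ / (40 * N) / 16 := by field_simp; norm_num
  have hx0 : 0 < t * σ := by positivity
  have hxρ : t * σ ≤ t * ρ := by gcongr
  refine final_l hM g b (C := D) (A := A) (a := a) (R := R) (x := t * σ) (s := s) (n1 := n1) (K := K) (J := J) (σ := σ) hJ hD1 hDl hA0 ha0 hx0
    (fun i hi => ?_) (fun i hi => (hn1 i hi.le).1) hR0 hR1 hR2 hR3 (le_trans (by gcongr) d6) (le_trans (by gcongr) d5) hK2 hs ?_
  · rw [hA, ha]
    exact deriv_zt hM g b hl0 hη0 h5 hz1 hz2 (hn1 i hi.le).1 (hn1 i hi.le).2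
  · have e : a / (4 * M ^ 2 * D) * (t * σ) = a / (4 * M ^ 2 * D) * θ * (t * ρ) := by rw [hσ]; ring
    rw [e]
    exact hKt.trans (by gcongr)

theorem lower_two : 2 ≤ dimH (frontier MM) := by
  refine le_of_forall_lt fun c hc => ?_
  obtain ⟨c', hc1, hc2⟩ := exists_between hc
  lift c' to ℝ≥0 using hc2.ne_top
  have hc3 : (c' : ℝ) < 2 := by exact_mod_cast hc2
  obtain ⟨s, hs1, hs2⟩ := exists_between (max_lt hc3 (by norm_num : (1 : ℝ) < 2))
  have hs0 : 1 < s := (le_max_right _ _).trans_lt hs1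
  have hcs : (c' : ℝ) < s := (le_max_left _ _).trans_lt hs1
  obtain ⟨q0, hq0⟩ := exists_nat_gt (s / (2 - s))
  obtain ⟨l0, q, N, B, C, ε, hq, hb⟩ := exists_base q0
  have h1 : s / (2 - s) < N := hq0.trans_le (by exact_mod_cast hq.trans hb.q_le)
  have hN : (0 : ℝ) < N := lt_trans (div_pos (by linarith) (by linarith)) h1
  refine hc1.trans_le (le_trans ?_ (lower hb (s := s) (by linarith) ?_))
  · rw [← ENNReal.ofReal_coe_nnreal]
    exact ENNReal.ofReal_le_ofReal hcs.le
  · rw [div_lt_iff₀ (by linarith)] at h1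
    have : s * (1 + (N : ℝ)⁻¹) = (s * N + s) / N := by field_simp
    rw [this, div_lt_iff₀ hN]
    linarith

end Mand

theorem hausdorff_dimension_boundary_mandelbrot :
    dimH (frontier {c : ℂ |
      Bornology.IsBounded (Set.range fun n : ℕ => (fun z : ℂ => z ^ 2 + c)^[n] 0)}) = 2 := by
  refine le_antisymm ?_ Mand.lower_two
  refine (dimH_mono (Set.subset_univ _)).trans ?_
  rw [Real.dimH_univ_eq_finrank, Complex.finrank_real_complex]
  norm_num
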